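/- Let V be a countable transitive model of ZFC, 𝔗 ∈ V a Π₂ TCI, and M a (ℙ(𝔗), V)-generic model of 𝔗. Then either M is almost finitely determined, or M is a (ℙ(𝔗)^⊤, V)-generic model of 𝔗. -/

import Mathlib

/-!
Common formalization layer for "Small extensions of set-theoretic universes".

We work with `ZFSet`, Mathlib's type of ZFC sets.  A "universe" `V` is a
`ZFSet` which is a (countable) transitive model of ZFC, where satisfaction
of ZFC is spelled out via an explicit first-order syntax `Fm` for languages
whose symbols are named by ZFC sets, together with a Tarskian satisfaction
predicate `Sat`.  TCIs (theories with constraints in interpretation), their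
models, the forcings `ℙ(𝔗)`, derivative forcings, generic filters, the
evaluation map `Eval^V`, local method definitions and the reducibility
relation `≤^M` are all defined below, following the paper.
-/

noncomputable section

namespace SmallExt

open Classical

attribute [local instance] Classical.propDecidable

instance : Nonempty ZFSet := ⟨∅⟩

/-! ### basic coding machinery -/

/-- Kuratowski ordered pair. -/
def opair (a b : ZFSet) : ZFSet := ZFSet.pair a b

/-- First projection of a Kuratowski pair. -/
def zfst (x : ZFSet) : ZFSet := ZFSet.sUnion (ZFSet.sInter x)

/-- Second projection of a Kuratowski pair. -/
def zsnd (x : ZFSet) : ZFSet :=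
  ZFSet.sUnion
    (ZFSet.sep (fun y => ZFSet.sUnion x ≠ ZFSet.sInter x → y ∉ ZFSet.sInter x) (ZFSet.sUnion x))

/-- The `n`-th von Neumann natural, as a ZFC set. -/
def natZ : ℕ → ZFSet
  | 0 => ∅
  | n + 1 => insert (natZ n) (natZ n)

/-- Internal coding of a finite list as an iterated pair (`[a] ↦ a`), so that
`ztuple` of a list of length `n` is a member of the `n`-th cartesian power. -/
def ztuple : List ZFSet → ZFSet
  | [] => ∅
  | [a] => a
  | a :: b :: l => opair a (ztuple (b :: l))

/-- Internal coding of a finite list as an iterated pair, with end marker `∅`. -/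
def zlist : List ZFSet → ZFSet
  | [] => ∅
  | a :: l => opair a (zlist l)

/-- `n`-th cartesian power of a ZFC set (with `z^1 = z`, as in the paper). -/
def ZPow (z : ZFSet) : ℕ → ZFSet
  | 0 => {∅}
  | 1 => z
  | n + 2 => ZFSet.prod z (ZPow z (n + 1))

/-- Decode an internal `n`-tuple into a list. -/
def decodeTuple : ℕ → ZFSet → List ZFSet
  | 0, _ => []
  | 1, t => [t]
  | n + 2, t => zfst t :: decodeTuple (n + 1) (zsnd t)

/-- Image of a ZFC set under an arbitrary (classically definable) function. -/
def zimage (f : ZFSet → ZFSet) (x : ZFSet) : ZFSet :=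
  @ZFSet.image f (Classical.allZFSetDefinable _) x

/-- The set of finite subsets of a ZFC set. -/
def finSubsets (A : ZFSet) : ZFSet :=
  ZFSet.sep (fun p => p.toSet.Finite) (ZFSet.powerset A)

/-- Application of a set-coded function (a set of ordered pairs) to an argument. -/
def iapp (I s : ZFSet) : ZFSet := Classical.epsilon fun v => opair s v ∈ I

/-- `f` is a set-coded function with domain `d`. -/
def IsZFunc (f d : ZFSet) : Prop :=
  (∀ q ∈ f, ∃ s v, q = opair s v ∧ s ∈ d) ∧ ∀ s ∈ d, ∃! v, opair s v ∈ f

/-- `j` is (the code of) an injective function from `a` into `b`. -/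
def ZInjFun (j a b : ZFSet) : Prop :=
  IsZFunc j a ∧ (∀ s ∈ a, iapp j s ∈ b) ∧
    ∀ s ∈ a, ∀ s' ∈ a, iapp j s = iapp j s' → s = s'

/-- Von Neumann ordinals: transitive sets of transitive sets. -/
def IsOrd (x : ZFSet) : Prop := x.IsTransitive ∧ ∀ y ∈ x, ZFSet.IsTransitive y

/-- `t` is the transitive closure of `a`. -/
def IsTrclOf (a t : ZFSet) : Prop :=
  a ⊆ t ∧ t.IsTransitive ∧ ∀ u, a ⊆ u → u.IsTransitive → t ⊆ u

/-! ### first-order syntax over set-named signatures -/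

/-- Terms: de Bruijn variables, set parameters, and applications of
function symbols (named by ZFC sets; constants are `0`-ary functions). -/
inductive Tm : Type 1
  | var : ℕ → Tm
  | param : ZFSet.{0} → Tm
  | func : ZFSet.{0} → (n : ℕ) → (Fin n → Tm) → Tm

/-- First-order formulas over set-named signatures (with equality). -/
inductive Fm : Type 1
  | rel : ZFSet.{0} → (n : ℕ) → (Fin n → Tm) → Fm
  | eq : Tm → Tm → Fm
  | not : Fm → Fm
  | imp : Fm → Fm → Fm
  | all : Fm → Fm
  | ex : Fm → Fm

/-- Derived conjunction. -/
def Fm.and (f g : Fm) : Fm := Fm.not (Fm.imp f (Fm.not g))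

/-- Derived disjunction. -/
def Fm.or (f g : Fm) : Fm := Fm.imp (Fm.not f) g

/-- Derived biconditional. -/
def Fm.iff (f g : Fm) : Fm := Fm.and (Fm.imp f g) (Fm.imp g f)

/-- Evaluation of terms. -/
def Tm.eval (fI : ZFSet → List ZFSet → ZFSet) (v : ℕ → ZFSet) : Tm → ZFSet
  | Tm.var n => v n
  | Tm.param a => a
  | Tm.func s n a => fI s (List.ofFn fun i => Tm.eval fI v (a i))

/-- Prepend a value to a valuation (for quantifiers). -/
def vcons (z : ZFSet) (v : ℕ → ZFSet) : ℕ → ZFSet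
  | 0 => z
  | n + 1 => v n

/-- Tarskian satisfaction, parametrized by a class domain `domP`, an
interpretation `rI` of the relation symbols and `fI` of the function symbols. -/
def Sat (domP : ZFSet → Prop) (rI : ZFSet → List ZFSet → Prop)
    (fI : ZFSet → List ZFSet → ZFSet) : Fm → (ℕ → ZFSet) → Prop
  | Fm.rel s n a, v => rI s (List.ofFn fun i => Tm.eval fI v (a i))
  | Fm.eq t u, v => Tm.eval fI v t = Tm.eval fI v u
  | Fm.not f, v => ¬ Sat domP rI fI f v
  | Fm.imp f g, v => Sat domP rI fI f v → Sat domP rI fI g v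
  | Fm.all f, v => ∀ z, domP z → Sat domP rI fI f (vcons z v)
  | Fm.ex f, v => ∃ z, domP z ∧ Sat domP rI fI f (vcons z v)

/-- Free variables of a term. -/
def Tm.free : Tm → Set ℕ
  | Tm.var n => {n}
  | Tm.param _ => ∅
  | Tm.func _ _ a => {m | ∃ i, m ∈ Tm.free (a i)}

/-- Free variables of a formula (de Bruijn). -/
def Fm.free : Fm → Set ℕ
  | Fm.rel _ _ a => {m | ∃ i, m ∈ Tm.free (a i)}
  | Fm.eq t u => Tm.free t ∪ Tm.free u
  | Fm.not f => Fm.free f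
  | Fm.imp f g => Fm.free f ∪ Fm.free g
  | Fm.all f => {m | m + 1 ∈ Fm.free f}
  | Fm.ex f => {m | m + 1 ∈ Fm.free f}

/-- Set parameters occurring in a term. -/
def Tm.paramSet : Tm → Set ZFSet
  | Tm.var _ => ∅
  | Tm.param a => {a}
  | Tm.func _ _ a => {b | ∃ i, b ∈ Tm.paramSet (a i)}

/-- Set parameters occurring in a formula. -/
def Fm.paramSet : Fm → Set ZFSet
  | Fm.rel _ _ a => {b | ∃ i, b ∈ Tm.paramSet (a i)}
  | Fm.eq t u => Tm.paramSet t ∪ Tm.paramSet u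
  | Fm.not f => Fm.paramSet f
  | Fm.imp f g => Fm.paramSet f ∪ Fm.paramSet g
  | Fm.all f => Fm.paramSet f
  | Fm.ex f => Fm.paramSet f

/-- Quantifier-free formulas. -/
def IsQF : Fm → Prop
  | Fm.rel _ _ _ => True
  | Fm.eq _ _ => True
  | Fm.not f => IsQF f
  | Fm.imp f g => IsQF f ∧ IsQF g
  | Fm.all _ => False
  | Fm.ex _ => False

mutual
  /-- `Π_n` formulas (prenex, with possibly empty quantifier blocks). -/
  inductive IsPi : ℕ → Fm → Prop where
    | qf {f} : IsQF f → IsPi 0 f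
    | ofSigma {n f} : IsSigma n f → IsPi (n + 1) f
    | all {n f} : IsPi (n + 1) f → IsPi (n + 1) (Fm.all f)

  /-- `Σ_n` formulas (prenex, with possibly empty quantifier blocks). -/
  inductive IsSigma : ℕ → Fm → Prop where
    | qf {f} : IsQF f → IsSigma 0 f
    | ofPi {n f} : IsPi n f → IsSigma (n + 1) f
    | ex {n f} : IsSigma (n + 1) f → IsSigma (n + 1) (Fm.ex f)
end

/-! ### the language of set theory and ZFC -/

/-- The name of the membership relation symbol. -/
def memSym : ZFSet := natZ 0

/-- The standard interpretation of `∈`. -/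
def memRel : ZFSet → List ZFSet → Prop :=
  fun s args => s = memSym ∧ ∃ a b, args = [a, b] ∧ a ∈ b

/-- Satisfaction in the ∈-structure with domain `M` (a ZFC set). -/
def SatV (M : ZFSet) (f : Fm) (v : ℕ → ZFSet) : Prop :=
  Sat (· ∈ M) memRel (fun _ _ => ∅) f v

/-- Satisfaction in the ambient (class-sized) ∈-structure. -/
def SatU (f : Fm) (v : ℕ → ZFSet) : Prop :=
  Sat (fun _ => True) memRel (fun _ _ => ∅) f v

/-- Atomic membership formula between de Bruijn variables. -/
def mem2 (i j : ℕ) : Fm := Fm.rel memSym 2 ![Tm.var i, Tm.var j]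

/-- Equality between de Bruijn variables. -/
def eq2 (i j : ℕ) : Fm := Fm.eq (Tm.var i) (Tm.var j)

/-- Terms that are plain variables or parameters. -/
def Tm.noFunc : Tm → Prop
  | Tm.var _ => True
  | Tm.param _ => True
  | Tm.func _ _ _ => False

/-- Formulas of the language of set theory (only `∈`, binary, no function
symbols; parameters allowed). -/
def Fm.memOnly : Fm → Prop
  | Fm.rel s n a => s = memSym ∧ n = 2 ∧ ∀ i, Tm.noFunc (a i)
  | Fm.eq t u => Tm.noFunc t ∧ Tm.noFunc u
  | Fm.not f => Fm.memOnly f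
  | Fm.imp f g => Fm.memOnly f ∧ Fm.memOnly g
  | Fm.all f => Fm.memOnly f
  | Fm.ex f => Fm.memOnly f

/-- Iterated universal closure. -/
def allClose : ℕ → Fm → Fm
  | 0, f => f
  | k + 1, f => allClose k (Fm.all f)

/-- Extensionality. -/
def extAx : Fm :=
  Fm.all (Fm.all (Fm.imp (Fm.all (Fm.iff (mem2 0 2) (mem2 0 1))) (eq2 1 0)))

/-- Pairing. -/
def pairAx : Fm := Fm.all (Fm.all (Fm.ex (Fm.and (mem2 2 0) (mem2 1 0))))

/-- Union. -/
def unionAx : Fm :=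
  Fm.all (Fm.ex (Fm.all (Fm.all (Fm.imp (Fm.and (mem2 1 0) (mem2 0 3)) (mem2 1 2)))))

/-- Power set. -/
def powAx : Fm :=
  Fm.all (Fm.ex (Fm.all (Fm.imp (Fm.all (Fm.imp (mem2 0 1) (mem2 0 3))) (mem2 0 1))))

/-- Infinity. -/
def infAx : Fm :=
  Fm.ex (Fm.and
    (Fm.ex (Fm.and (mem2 0 1) (Fm.all (Fm.not (mem2 0 1)))))
    (Fm.all (Fm.imp (mem2 0 1)
      (Fm.ex (Fm.and (mem2 0 2) (Fm.and (mem2 1 0)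
        (Fm.all (Fm.iff (mem2 0 1) (Fm.or (mem2 0 2) (eq2 0 2))))))))))

/-- Foundation. -/
def fundAx : Fm :=
  Fm.all (Fm.imp (Fm.ex (mem2 0 1))
    (Fm.ex (Fm.and (mem2 0 1) (Fm.all (Fm.imp (mem2 0 1) (Fm.not (mem2 0 2)))))))

/-- Choice (for families of nonempty pairwise disjoint sets). -/
def choiceAx : Fm :=
  Fm.all (Fm.imp
    (Fm.and
      (Fm.all (Fm.imp (mem2 0 1) (Fm.ex (mem2 0 1))))
      (Fm.all (Fm.all (Fm.imp
        (Fm.and (mem2 1 2) (Fm.and (mem2 0 2) (Fm.ex (Fm.and (mem2 0 2) (mem2 0 1)))))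
        (eq2 1 0)))))
    (Fm.ex (Fm.all (Fm.imp (mem2 0 2)
      (Fm.ex (Fm.and (mem2 0 1) (Fm.and (mem2 0 2)
        (Fm.all (Fm.imp (Fm.and (mem2 0 2) (mem2 0 3)) (eq2 0 1))))))))))

/-- Body of a separation instance: `∀x ∃s ∀z (z ∈ s ↔ z ∈ x ∧ φ)`,
where in `φ` the variable `0` is `z`, `2` is `x`, and `≥ 3` are parameters. -/
def sepBody (φ : Fm) : Fm :=
  Fm.all (Fm.ex (Fm.all (Fm.iff (mem2 0 1) (Fm.and (mem2 0 2) φ))))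

/-- Body of a collection instance: `∀a ∃b ∀x∈a (∃y φ → ∃y∈b φ)`,
where in `φ` the variable `0` is `y`, `1` is `x`, `3` is `a`, and `≥ 4` are parameters. -/
def repBody (φ : Fm) : Fm :=
  Fm.all (Fm.ex (Fm.all (Fm.imp (mem2 0 2)
    (Fm.imp (Fm.ex φ) (Fm.ex (Fm.and (mem2 0 2) φ))))))

/-- The ZFC axioms, as a set of sentences of the language of set theory. -/
def ZFCax : Set Fm :=
  {extAx, pairAx, unionAx, powAx, infAx, fundAx, choiceAx} ∪
    {f | ∃ k φ, Fm.memOnly φ ∧ Fm.paramSet φ = ∅ ∧ 1 ∉ Fm.free φ ∧ f = allClose k (sepBody φ)} ∪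
    {f | ∃ k φ, Fm.memOnly φ ∧ Fm.paramSet φ = ∅ ∧ 2 ∉ Fm.free φ ∧ f = allClose k (repBody φ)}

/-- `M` is an ∈-model of ZFC. -/
def SatZFC (M : ZFSet) : Prop := ∀ f ∈ ZFCax, SatV M f (fun _ => ∅)

/-- A transitive model of ZFC. -/
def IsTransModel (M : ZFSet) : Prop := M.IsTransitive ∧ SatZFC M

/-- A countable transitive model of ZFC. -/
def IsCTM (M : ZFSet) : Prop := IsTransModel M ∧ M.toSet.Countable

/-- `W` is an outer model of `U`: both are CTMs, `U ⊆ W`, and they have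
the same ordinals. -/
def OuterModel (U W : ZFSet) : Prop :=
  IsCTM U ∧ IsCTM W ∧ U ⊆ W ∧ ∀ y ∈ W, IsOrd y → y ∈ U

/-- `W = U[m]`: `W` is an outer model of `U` and the smallest CTM
containing `U` as a subset and `m` as an element. -/
def Generates (U m W : ZFSet) : Prop :=
  OuterModel U W ∧ m ∈ W ∧ ∀ W', IsCTM W' → U ⊆ W' → m ∈ W' → W ⊆ W'

/-- `W` is a small extension of `U`. -/
def IsSmallExt (U W : ZFSet) : Prop :=
  OuterModel U W ∧ ∃ m ∈ W, ∀ W', IsCTM W' → U ⊆ W' → m ∈ W' → W ⊆ W'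

/-- `k` is a cardinal from the point of view of the model `U`: an ordinal
with no `U`-internal injection into a smaller ordinal. -/
def IsCardinalIn (U k : ZFSet) : Prop :=
  k ∈ U ∧ IsOrd k ∧ ∀ b ∈ k, ¬ ∃ j ∈ U, ZInjFun j k b

end SmallExt
namespace SmallExt

attribute [local instance] Classical.propDecidable

/-! ### Theories with constraints in interpretation (TCIs) -/

/-- Coding of terms as ZFC sets. -/
def TmCode : Tm → ZFSet
  | Tm.var n => opair (natZ 0) (natZ n)
  | Tm.param a => opair (natZ 1) a
  | Tm.func s n a => opair (natZ 2) (opair s (zlist (List.ofFn fun i => TmCode (a i))))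

/-- Coding of formulas as ZFC sets (the code of `¬ f` is `⟨2, code f⟩`). -/
def FmCode : Fm → ZFSet
  | Fm.rel s n a => opair (natZ 0) (opair s (zlist (List.ofFn fun i => TmCode (a i))))
  | Fm.eq t u => opair (natZ 1) (opair (TmCode t) (TmCode u))
  | Fm.not f => opair (natZ 2) (FmCode f)
  | Fm.imp f g => opair (natZ 3) (opair (FmCode f) (FmCode g))
  | Fm.all f => opair (natZ 4) (FmCode f)
  | Fm.ex f => opair (natZ 5) (FmCode f)

/-- The first component of a TCI `⟨T, σ, U̇, ϑ⟩`: its theory. -/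
def tciT (x : ZFSet) : ZFSet := zfst x

/-- The signature `σ` of a TCI. -/
def tciSig (x : ZFSet) : ZFSet := zfst (zsnd x)

/-- The distinguished unary relation symbol `U̇` of a TCI. -/
def tciUdot (x : ZFSet) : ZFSet := zfst (zsnd (zsnd x))

/-- The interpretation constraint map `ϑ` of a TCI. -/
def tciTheta (x : ZFSet) : ZFSet := zsnd (zsnd (zsnd x))

/-- Symbols are coded as `⟨kind, ⟨arity, name⟩⟩` with kind `0` (relation),
`1` (function) or `2` (constant). -/
def symKind (s : ZFSet) : ZFSet := zfst s

/-- The (internal) arity of a symbol. -/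
def symArity (s : ZFSet) : ZFSet := zfst (zsnd s)

/-- A well-formed symbol. -/
def IsSymbol (s : ZFSet) : Prop :=
  ∃ k a nm, s = opair k (opair a nm) ∧ (k = natZ 0 ∨ k = natZ 1 ∨ k = natZ 2) ∧ ∃ n : ℕ, a = natZ n

/-- Decode an internal von Neumann natural. -/
def zToNat (a : ZFSet) : ℕ := if h : ∃ n, natZ n = a then h.choose else 0

/-- The arity of a symbol, as a natural number. -/
def arityOf (s : ZFSet) : ℕ := zToNat (symArity s)

/-- A term uses only symbols of the signature `σ` (with correct kinds and
arities) and no parameters. -/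
def Tm.usesSig (σ : ZFSet) : Tm → Prop
  | Tm.var _ => True
  | Tm.param _ => False
  | Tm.func s n a => s ∈ σ ∧
      ((symKind s = natZ 1 ∧ symArity s = natZ n) ∨ (symKind s = natZ 2 ∧ n = 0)) ∧
      ∀ i, Tm.usesSig σ (a i)

/-- A formula over the signature `σ` (no parameters). -/
def Fm.usesSig (σ : ZFSet) : Fm → Prop
  | Fm.rel s n a => s ∈ σ ∧ symKind s = natZ 0 ∧ symArity s = natZ n ∧ ∀ i, Tm.usesSig σ (a i)
  | Fm.eq t u => Tm.usesSig σ t ∧ Tm.usesSig σ u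
  | Fm.not f => Fm.usesSig σ f
  | Fm.imp f g => Fm.usesSig σ f ∧ Fm.usesSig σ g
  | Fm.all f => Fm.usesSig σ f
  | Fm.ex f => Fm.usesSig σ f

/-- Same as `Fm.usesSig` but allowing set parameters (used for literals
with parameters). -/
def Tm.usesSigP (σ : ZFSet) : Tm → Prop
  | Tm.var _ => True
  | Tm.param _ => True
  | Tm.func s n a => s ∈ σ ∧
      ((symKind s = natZ 1 ∧ symArity s = natZ n) ∨ (symKind s = natZ 2 ∧ n = 0)) ∧
      ∀ i, Tm.usesSigP σ (a i)

/-- A formula over the signature `σ`, allowing set parameters. -/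
def Fm.usesSigP (σ : ZFSet) : Fm → Prop
  | Fm.rel s n a => s ∈ σ ∧ symKind s = natZ 0 ∧ symArity s = natZ n ∧ ∀ i, Tm.usesSigP σ (a i)
  | Fm.eq t u => Tm.usesSigP σ t ∧ Tm.usesSigP σ u
  | Fm.not f => Fm.usesSigP σ f
  | Fm.imp f g => Fm.usesSigP σ f ∧ Fm.usesSigP σ g
  | Fm.all f => Fm.usesSigP σ f
  | Fm.ex f => Fm.usesSigP σ f

/-- Atomic formulas. -/
def Fm.isAtom : Fm → Prop
  | Fm.rel _ _ _ => True
  | Fm.eq _ _ => True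
  | _ => False

/-- `x` is (the code of) a theory with constraints in interpretation:
a tuple `⟨T, σ, U̇, ϑ⟩` where `T` is a set of (codes of) first-order
sentences over `σ`, `U̇` is a unary relation symbol not in `σ`, and `ϑ`
maps each symbol of `σ ∪ {U̇}` to a pair `(y, i)` with `i ∈ {0, 1}` and `y`
included in a finite cartesian power of the first component `z` of `ϑ(U̇)`,
with the disjointness conditions on the powers of `z` from the paper. -/
def IsTCI (x : ZFSet) : Prop :=
  x = opair (tciT x) (opair (tciSig x) (opair (tciUdot x) (tciTheta x))) ∧
  (∀ s ∈ tciSig x, IsSymbol s) ∧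
  IsSymbol (tciUdot x) ∧ symKind (tciUdot x) = natZ 0 ∧ symArity (tciUdot x) = natZ 1 ∧
  tciUdot x ∉ tciSig x ∧
  IsZFunc (tciTheta x) (insert (tciUdot x) (tciSig x)) ∧
  (∀ s ∈ insert (tciUdot x) (tciSig x),
    ∃ y i, iapp (tciTheta x) s = opair y i ∧ (i = natZ 0 ∨ i = natZ 1) ∧
      ∃ n : ℕ, y ⊆ ZPow (zfst (iapp (tciTheta x) (tciUdot x))) n) ∧
  (∀ n : ℕ, 1 < n →
    zfst (iapp (tciTheta x) (tciUdot x)) ∩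
      ZPow (zfst (iapp (tciTheta x) (tciUdot x))) n = ∅) ∧
  (∀ m n : ℕ, 1 < m → m < n →
    ZPow (zfst (iapp (tciTheta x) (tciUdot x))) m ∩
      ZPow (zfst (iapp (tciTheta x) (tciUdot x))) n = ∅) ∧
  (∀ c ∈ tciT x, ∃ f : Fm, FmCode f = c ∧ Fm.free f = ∅ ∧ Fm.usesSig (tciSig x) f)

/-- Satisfaction in a coded structure `M = ⟨U, I⟩`: relation symbols are
interpreted by `I` via internal tuples, function and constant symbols by the
(graph) values recorded in `I`. -/
def SatStr (M : ZFSet) (f : Fm) : Prop :=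
  Sat (· ∈ zfst M) (fun s args => ztuple args ∈ iapp (zsnd M) s)
    (fun s args => if args = [] then iapp (zsnd M) s
      else Classical.epsilon fun b => ztuple (args ++ [b]) ∈ iapp (zsnd M) s)
    f (fun _ => ∅)

/-- The modelling relation `M ⊨* 𝔗` between coded structures and TCIs. -/
def ModelsTCI (M x : ZFSet) : Prop :=
  IsTCI x ∧
  M = opair (zfst M) (zsnd M) ∧
  IsZFunc (zsnd M) (tciSig x) ∧
  -- the constraint on the universe
  (∀ y i, iapp (tciTheta x) (tciUdot x) = opair y i →
    (i = natZ 0 → zfst M ⊆ y) ∧ (i = natZ 1 → zfst M = y)) ∧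
  -- the constraints on the symbols of the signature
  (∀ s ∈ tciSig x, ∀ y i, iapp (tciTheta x) s = opair y i →
    (symKind s = natZ 0 →
      (i = natZ 0 → iapp (zsnd M) s ⊆ y ∩ ZPow (zfst M) (arityOf s)) ∧
      (i = natZ 1 → iapp (zsnd M) s = y ∩ ZPow (zfst M) (arityOf s))) ∧
    (symKind s = natZ 1 →
      (∀ args : List ZFSet, args.length = arityOf s → (∀ a ∈ args, a ∈ zfst M) →
        ∃! b, b ∈ zfst M ∧ ztuple (args ++ [b]) ∈ iapp (zsnd M) s) ∧
      (i = natZ 0 → iapp (zsnd M) s ⊆ y ∩ ZPow (zfst M) (arityOf s + 1)) ∧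
      (i = natZ 1 → iapp (zsnd M) s = y ∩ ZPow (zfst M) (arityOf s + 1))) ∧
    (symKind s = natZ 2 → iapp (zsnd M) s ∈ y ∧ iapp (zsnd M) s ∈ zfst M)) ∧
  -- `M` satisfies the theory
  (∀ c ∈ tciT x, ∀ f : Fm, FmCode f = c → SatStr M f)

/-- A `Π_n` TCI: one whose theory contains only `Π_n` sentences. -/
def IsPiTCI (n : ℕ) (x : ZFSet) : Prop :=
  IsTCI x ∧ ∀ c ∈ tciT x, ∃ f : Fm, FmCode f = c ∧ IsPi n f

/-- A `Σ_n` TCI: one whose theory contains only `Σ_n` sentences. -/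
def IsSigmaTCI (n : ℕ) (x : ZFSet) : Prop :=
  IsTCI x ∧ ∀ c ∈ tciT x, ∃ f : Fm, FmCode f = c ∧ IsSigma n f

/-- A TCI in `V` is consistent iff it has a model in some outer model of `V`. -/
def ConsistentTCI (V x : ZFSet) : Prop :=
  ∃ W M, OuterModel V W ∧ M ∈ W ∧ ModelsTCI M x

/-! ### the language fragment `𝓛_𝔗` and the diagram `Σ(𝔗, M)` -/

/-- The set of codes of atomic sentences (with parameters) associated to a
symbol `s` of a TCI `x`, as in the proof of Proposition 3.22 of the paper. -/
def codesFor (x s : ZFSet) : ZFSet :=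
  if symKind s = natZ 0 then
    zimage (fun t => FmCode (Fm.rel s (arityOf s)
      fun i => Tm.param ((decodeTuple (arityOf s) t).getD i ∅)))
      (zfst (iapp (tciTheta x) s))
  else if symKind s = natZ 1 then
    zimage (fun t => FmCode (Fm.eq
      (Tm.func s (arityOf s) fun i => Tm.param ((decodeTuple (arityOf s + 1) t).getD i ∅))
      (Tm.param ((decodeTuple (arityOf s + 1) t).getD (arityOf s) ∅))))
      (zfst (iapp (tciTheta x) s))
  else
    zimage (fun a => FmCode (Fm.eq (Tm.func s 0 Fin.elim0) (Tm.param a)))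
      (zfst (iapp (tciTheta x) s))

/-- The atomic sentences of `𝓛_𝔗`. -/
def LLbase (x : ZFSet) : ZFSet :=
  ZFSet.sUnion (zimage (fun s => codesFor x s) (insert (tciUdot x) (tciSig x)))

/-- The language fragment `𝓛_𝔗`: atomic sentences with parameters, closed
under negation. -/
def LL (x : ZFSet) : ZFSet :=
  LLbase x ∪ zimage (fun t => opair (natZ 2) t) (LLbase x)

/-- A literal of `𝓛_𝔗` true in the structure `M` (with `U̇` interpreted as
the domain of `M`). -/
def LitTrue (x M : ZFSet) (f : Fm) : Prop :=
  (∃ a, f = Fm.rel (tciUdot x) 1 (fun _ => Tm.param a) ∧ a ∈ zfst M) ∨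
  (∃ a, f = Fm.not (Fm.rel (tciUdot x) 1 (fun _ => Tm.param a)) ∧ a ∉ zfst M) ∨
  (∃ g, (f = g ∨ f = Fm.not g) ∧ Fm.isAtom g ∧ Fm.usesSigP (tciSig x) g ∧
    (∀ a ∈ Fm.paramSet g, a ∈ zfst M) ∧
    (f = g → SatStr M g) ∧ (f = Fm.not g → ¬ SatStr M g))

/-- The `𝔗`-specific atomic diagram `Σ(𝔗, M)` of a model `M` of `𝔗`. -/
def SigmaSet (x M : ZFSet) : ZFSet :=
  ZFSet.sep (fun c => ∃ f : Fm, FmCode f = c ∧ LitTrue x M f) (LL x)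

/-! ### forcing notions and generic filters -/

/-- A forcing notion coded as a pair `⟨P, ≤⟩` of a set of conditions and a
partial order (a set of Kuratowski pairs). -/
def IsForcing (P : ZFSet) : Prop :=
  P = opair (zfst P) (zsnd P) ∧
  (∀ q ∈ zsnd P, ∃ a ∈ zfst P, ∃ b ∈ zfst P, q = opair a b) ∧
  (∀ a ∈ zfst P, opair a a ∈ zsnd P) ∧
  (∀ a b c : ZFSet, opair a b ∈ zsnd P → opair b c ∈ zsnd P → opair a c ∈ zsnd P) ∧
  (∀ a b : ZFSet, opair a b ∈ zsnd P → opair b a ∈ zsnd P → a = b)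

/-- `a ≤ b` in the coded forcing `P` (`a` extends, i.e. is stronger than, `b`). -/
def ple (P a b : ZFSet) : Prop := opair a b ∈ zsnd P

/-- `g` is a filter on the coded forcing `P`. -/
def IsFilterOn (P g : ZFSet) : Prop :=
  g ⊆ zfst P ∧
  (∀ p ∈ g, ∀ q ∈ zfst P, ple P p q → q ∈ g) ∧
  (∀ p ∈ g, ∀ q ∈ g, ∃ r ∈ g, ple P r p ∧ ple P r q)

/-- `D` is a dense subset of the coded forcing `P`. -/
def IsDenseIn (P D : ZFSet) : Prop :=
  D ⊆ zfst P ∧ ∀ p ∈ zfst P, ∃ q ∈ D, ple P q p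

/-- `g` is a `P`-generic filter over `V`: a filter on `P` meeting all dense
subsets of `P` lying in `V`. -/
def GenericFilterOver (V P g : ZFSet) : Prop :=
  IsFilterOn P g ∧ ∀ D ∈ V, IsDenseIn P D → ∃ q ∈ g, q ∈ D

/-- `p` is an atom of the coded forcing `P`: any two extensions of `p`
are compatible. -/
def PAtom (P p : ZFSet) : Prop :=
  p ∈ zfst P ∧ ∀ q₁ ∈ zfst P, ∀ q₂ ∈ zfst P, ple P q₁ p → ple P q₂ p →
    ∃ r ∈ zfst P, ple P r q₁ ∧ ple P r q₂

/-- An atomless forcing notion. -/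
def Atomless (P : ZFSet) : Prop := ∀ p ∈ zfst P, ¬ PAtom P p

/-- `g_p(ℙ) = {q ∈ P : q` is compatible with `p}`. -/
def gpSet (P p : ZFSet) : ZFSet :=
  ZFSet.sep (fun q => ∃ r ∈ zfst P, ple P r q ∧ ple P r p) (zfst P)

/-- The reverse-inclusion order on a set `p` of conditions, as a set of pairs. -/
def supsetOrder (p : ZFSet) : ZFSet :=
  ZFSet.sep (fun q => ∃ a ∈ p, ∃ b ∈ p, q = opair a b ∧ b ⊆ a) (ZFSet.prod p p)

/-! ### the forcings `ℙ(𝔗)` and their derivatives -/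

/-- `P(𝔗)`: finite subsets of `𝓛_𝔗` included in `Σ(𝔗, M)` for some model
`M` of `𝔗` in some outer model of `V`. -/
def PT (V x : ZFSet) : ZFSet :=
  ZFSet.sep
    (fun p => ∃ W M, OuterModel V W ∧ M ∈ W ∧ ModelsTCI M x ∧ p ⊆ SigmaSet x M)
    (finSubsets (LL x))

/-- The forcing notion `ℙ(𝔗) = (P(𝔗), ⊇)`. -/
def Pforcing (V x : ZFSet) : ZFSet := opair (PT V x) (supsetOrder (PT V x))

/-- `q` is an atom of a `⊇`-ordered set `P` of conditions. -/
def SupAtomIn (P q : ZFSet) : Prop :=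
  q ∈ P ∧ ∀ q₁ ∈ P, ∀ q₂ ∈ P, q ⊆ q₁ → q ⊆ q₂ → ∃ r ∈ P, q₁ ⊆ r ∧ q₂ ⊆ r

/-- The derivative forcings `P(𝔗)^{(α)}`: conditions certified by the diagram
of a model of `𝔗` avoiding all atoms of all earlier stages (stage `0` is
`P(𝔗)` itself). -/
def PTa (V x : ZFSet) : Ordinal.{1} → ZFSet :=
  WellFounded.fix wellFounded_lt fun α rec =>
    ZFSet.sep
      (fun p => ∃ W M, OuterModel V W ∧ M ∈ W ∧ ModelsTCI M x ∧ p ⊆ SigmaSet x M ∧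
        ∀ β, ∀ h : β < α, ∀ q, SupAtomIn (rec β h) q → ¬ q ⊆ SigmaSet x M)
      (finSubsets (LL x))

/-- The ordinal `|[𝓛_𝔗]^{<ω}|⁺`, bounding the derivative process. -/
def cardBound (x : ZFSet) : Ordinal.{1} :=
  (Order.succ (Cardinal.mk (finSubsets (LL x)).toSet)).ord

/-- The fixed point `P(𝔗)^⊤` of the derivative process. -/
def PTtopSet (V x : ZFSet) : ZFSet :=
  PTa V x (sInf {α : Ordinal.{1} | PTa V x α = PTa V x (Order.succ α)})

/-- The forcing notion `ℙ(𝔗)^⊤`. -/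
def PtopForcing (V x : ZFSet) : ZFSet :=
  opair (PTtopSet V x) (supsetOrder (PTtopSet V x))

/-- `M` is an almost finitely determined model of `𝔗`: `p ⊆ Σ(𝔗, M)` for
some atom `p` of some derivative forcing `ℙ(𝔗)^{(α)}`, `α < |[𝓛_𝔗]^{<ω}|⁺`. -/
def AlmostFinDet (V x M : ZFSet) : Prop :=
  ModelsTCI M x ∧ ∃ α : Ordinal.{1}, α < cardBound x ∧
    ∃ p, SupAtomIn (PTa V x α) p ∧ p ⊆ SigmaSet x M

/-- All models of `𝔗` in outer models of `V` are almost finitely determined. -/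
def AllAFD (V x : ZFSet) : Prop :=
  ∀ W M, OuterModel V W → M ∈ W → ModelsTCI M x → AlmostFinDet V x M

/-! ### the TCI `𝔗(ℙ)` of a forcing notion -/

/-- The symbol `≤̇` (binary relation). -/
def leSym : ZFSet := opair (natZ 0) (opair (natZ 2) (natZ 0))

/-- The symbol `Ġ` (unary relation) for the generic filter. -/
def gSym : ZFSet := opair (natZ 0) (opair (natZ 1) (natZ 1))

/-- The symbol `Ḋ` (unary relation) associated to the dense set `D`. -/
def dSym (D : ZFSet) : ZFSet := opair (natZ 0) (opair (natZ 1) (opair (natZ 2) D))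

/-- The distinguished symbol `U̇` used for `𝔗(ℙ)` and `𝔗_s`. -/
def udSym : ZFSet := opair (natZ 0) (opair (natZ 1) (natZ 3))

/-- The set of dense subsets of a coded forcing notion `P`. -/
def denseSets (P : ZFSet) : ZFSet :=
  ZFSet.sep (fun D => ∀ p ∈ zfst P, ∃ q ∈ D, ple P q p) (ZFSet.powerset (zfst P))

/-- `Ġ(i)` as a formula. -/
def relG (i : ℕ) : Fm := Fm.rel gSym 1 (fun _ => Tm.var i)

/-- `i ≤̇ j` as a formula. -/
def relLe (i j : ℕ) : Fm := Fm.rel leSym 2 ![Tm.var i, Tm.var j]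

/-- The sentences of `𝔗(ℙ)`: `Ġ` is a filter meeting each dense set. -/
def TofPTheory (P : ZFSet) : ZFSet :=
  insert (FmCode (Fm.all (Fm.all (Fm.ex (Fm.imp (Fm.and (relG 2) (relG 1))
      (Fm.and (relG 0) (Fm.and (relLe 0 2) (relLe 0 1))))))))
    (insert (FmCode (Fm.all (Fm.all (Fm.imp (Fm.and (relLe 1 0) (relG 1)) (relG 0)))))
      (zimage (fun D => FmCode (Fm.ex (Fm.and (relG 0) (Fm.rel (dSym D) 1 (fun _ => Tm.var 0)))))
        (denseSets P)))

/-- The constraint map of `𝔗(ℙ)`. -/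
def TofPTheta (P : ZFSet) : ZFSet :=
  insert (opair udSym (opair (zfst P) (natZ 1)))
    (insert (opair leSym (opair (zsnd P) (natZ 1)))
      (insert (opair gSym (opair (zfst P) (natZ 0)))
        (zimage (fun D => opair (dSym D) (opair D (natZ 1))) (denseSets P))))

/-- The `Π₂` TCI `𝔗(ℙ)` whose models (in outer models of `V`) are exactly
the `ℙ`-generic filters over `V`. -/
def TofP (P : ZFSet) : ZFSet :=
  opair (TofPTheory P)
    (opair (insert leSym (insert gSym (zimage dSym (denseSets P))))
      (opair udSym (TofPTheta P)))

/-! ### evaluations, local method definitions and `≤^M` -/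

/-- `Eval^V(𝔗) = {V[M] : M ⊨* 𝔗` in some outer model of `V}`. -/
def EvalT (V x : ZFSet) : Set ZFSet :=
  {W' | ∃ W M, OuterModel V W ∧ M ∈ W ∧ ModelsTCI M x ∧ Generates V M W'}

/-- A valuation loading one set at variable `0`. -/
def vone (a : ZFSet) : ℕ → ZFSet := fun n => if n = 0 then a else ∅

/-- A valuation loading two sets at variables `0`, `1`. -/
def vtwo (a b : ZFSet) : ℕ → ZFSet := fun n => if n = 0 then a else if n = 1 then b else ∅

/-- A valuation loading three sets at variables `0`, `1`, `2`. -/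
def vthree (a b c : ZFSet) : ℕ → ZFSet :=
  fun n => if n = 0 then a else if n = 1 then b else if n = 2 then c else ∅

/-- The class function `F` (restricted to the class `X`) is definable in `V`
with parameters in `V`. -/
def DefFunIn (V : ZFSet) (X : ZFSet → Prop) (F : ZFSet → ZFSet) : Prop :=
  ∃ φ : Fm, Fm.memOnly φ ∧ (∀ a ∈ Fm.paramSet φ, a ∈ V) ∧
    ∀ x, x ∈ V → X x → ∀ y, y ∈ V → (SatV V φ (vtwo x y) ↔ y = F x)

/-- A local method definition over `V`: a nonempty class of TCIs in `V`,
definable in `V` with parameters in `V`. -/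
def LocalMethodDef (V : ZFSet) (X : ZFSet → Prop) : Prop :=
  (∃ t, X t) ∧ (∀ t, X t → t ∈ V ∧ IsTCI t) ∧
  ∃ φ : Fm, Fm.memOnly φ ∧ (∀ a ∈ Fm.paramSet φ, a ∈ V) ∧
    ∀ t, t ∈ V → (X t ↔ SatV V φ (vone t))

/-- The reducibility relation `X ≤^M Y` between local method definitions:
some `V`-definable `F : X → Y` satisfies
`∅ ≠ Eval^V(F(𝔗)) ⊆ Eval^V(𝔗)` for all consistent `𝔗 ∈ X`. -/
def LeqM (V : ZFSet) (X Y : ZFSet → Prop) : Prop :=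
  ∃ F : ZFSet → ZFSet, DefFunIn V X F ∧
    (∀ x, x ∈ V → X x → F x ∈ V ∧ Y (F x)) ∧
    ∀ x, x ∈ V → X x → ConsistentTCI V x →
      (EvalT V (F x)).Nonempty ∧ EvalT V (F x) ⊆ EvalT V x

/-- `X ≡^M Y`. -/
def EquivM (V : ZFSet) (X Y : ZFSet → Prop) : Prop := LeqM V X Y ∧ LeqM V Y X

/-- The local method definition `Π^M_n` of all `Π_n` TCIs. -/
def PiM (n : ℕ) : ZFSet → Prop := IsPiTCI n

/-- The local method definition `Σ^M_n` of all `Σ_n` TCIs. -/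
def SigmaM (n : ℕ) : ZFSet → Prop := IsSigmaTCI n

/-- The local method definition `Fg = {𝔗(ℙ) : ℙ` a forcing notion in `V}`. -/
def FgClass (V : ZFSet) : ZFSet → Prop :=
  fun t => ∃ P, P ∈ V ∧ IsForcing P ∧ t = TofP P

/-! ### H(κ), collapse forcing, and structure-genericity -/

/-- `H` is (the code of) `H(|trcl(t)|⁺)` as computed inside `V`:
the set of all `y ∈ V` whose transitive closure admits, in `V`,
an injection into the transitive closure of `t`. -/
def IsHIn (V t H : ZFSet) : Prop :=
  H ∈ V ∧ ∀ y, (y ∈ H ↔ (y ∈ V ∧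
    ∀ ty tt, IsTrclOf {y} ty → IsTrclOf t tt → ∃ j ∈ V, ZInjFun j ty tt))

/-- The conditions of the collapse `Col(ω, λ)`: finite partial functions
from `ω` to `λ`. -/
def ColSet (lam : ZFSet) : ZFSet :=
  ZFSet.sep
    (fun f => (∀ q ∈ f, ∃ a b, q = opair a b) ∧
      (∀ a b b' : ZFSet, opair a b ∈ f → opair a b' ∈ f → b = b') ∧ f.toSet.Finite)
    (ZFSet.powerset (ZFSet.prod ZFSet.omega lam))

/-- The collapse forcing `Col(ω, λ)`, ordered by reverse inclusion. -/
def ColForcing (lam : ZFSet) : ZFSet := opair (ColSet lam) (supsetOrder (ColSet lam))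

/-- `g` is a `P`-generic filter over the ∈-structure with domain `H`:
a filter on `P` meeting every dense subset of `P` definable over `(H; ∈)`
with parameters in `H`. -/
def GenericOverStruct (H P g : ZFSet) : Prop :=
  IsFilterOn P g ∧
  ∀ φ : Fm, Fm.memOnly φ → (∀ a ∈ Fm.paramSet φ, a ∈ H) →
    ((∀ p ∈ zfst P, ∃ q ∈ zfst P, SatV H φ (vone q) ∧ ple P q p) →
      ∃ q ∈ g, SatV H φ (vone q))

/-- The `Π₀` TCI `𝔗_s` whose models in any outer model are the subsets of `s`. -/
def Tsub (s : ZFSet) : ZFSet :=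
  opair ∅ (opair ∅ (opair udSym ({opair udSym (opair s (natZ 0))} : ZFSet)))

end SmallExt

namespace SmallExt

/-- `g_p` for a `⊇`-ordered set of conditions `P`:
the conditions compatible with `p`. -/
def gpSup (P p : ZFSet) : ZFSet :=
  ZFSet.sep (fun q => ∃ r ∈ P, q ⊆ r ∧ p ⊆ r) P

/-- Outer models among arbitrary (not necessarily countable) transitive
models of ZFC. -/
def OuterModelT (U W : ZFSet) : Prop :=
  IsTransModel U ∧ IsTransModel W ∧ U ⊆ W ∧ ∀ y ∈ W, IsOrd y → y ∈ U

/-- Consistency of a TCI relative to a transitive model `U` of ZFC. -/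
def ConsistentT (U x : ZFSet) : Prop :=
  ∃ W M, OuterModelT U W ∧ M ∈ W ∧ ModelsTCI M x

end SmallExt


namespace SmallExt

/-! ### Part 1: definability over a countable transitive model -/

abbrev Ctx := ℕ → ZFSet.{0}

def shift (w : Ctx) : Ctx := fun i => w (i + 1)

/-- simultaneous renaming of variables, and replacement of parameters by variables -/
def Tm.sub (ρ : ℕ → ℕ) (π : ZFSet → Option ℕ) : Tm → Tm
  | Tm.var n => Tm.var (ρ n)
  | Tm.param a => match π a with
    | none => Tm.param a
    | some k => Tm.var k
  | Tm.func s n a => Tm.func s n fun i => Tm.sub ρ π (a i)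

def liftR (ρ : ℕ → ℕ) : ℕ → ℕ
  | 0 => 0
  | n + 1 => ρ n + 1

def liftP (π : ZFSet.{0} → Option ℕ) : ZFSet.{0} → Option ℕ := fun a => (π a).map (· + 1)

def Fm.sub : (ℕ → ℕ) → (ZFSet → Option ℕ) → Fm → Fm
  | ρ, π, Fm.rel s n a => Fm.rel s n fun i => Tm.sub ρ π (a i)
  | ρ, π, Fm.eq t u => Fm.eq (Tm.sub ρ π t) (Tm.sub ρ π u)
  | ρ, π, Fm.not f => Fm.not (Fm.sub ρ π f)
  | ρ, π, Fm.imp f g => Fm.imp (Fm.sub ρ π f) (Fm.sub ρ π g)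
  | ρ, π, Fm.all f => Fm.all (Fm.sub (liftR ρ) (liftP π) f)
  | ρ, π, Fm.ex f => Fm.ex (Fm.sub (liftR ρ) (liftP π) f)

theorem Tm.eval_sub (fI : ZFSet → List ZFSet → ZFSet) (ρ π) (v w : Ctx) (hρ : ∀ n, w (ρ n) = v n)
    (hπ : ∀ a k, π a = some k → w k = a) (t : Tm) :
    (Tm.sub ρ π t).eval fI w = t.eval fI v := by
  induction t with
  | var n => simp [Tm.sub, Tm.eval, hρ]
  | param a =>
    simp only [Tm.sub]
    cases h : π a with
    | none => rfl
    | some k => simp [Tm.eval, hπ a k h]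
  | func s n a ih => simp [Tm.sub, Tm.eval, ih]

theorem sat_sub (domP : ZFSet → Prop) (rI fI) (f : Fm) : ∀ (ρ : ℕ → ℕ) (π) (v w : Ctx),
    (∀ n, w (ρ n) = v n) → (∀ a k, π a = some k → w k = a) →
    (Sat domP rI fI (Fm.sub ρ π f) w ↔ Sat domP rI fI f v) := by
  have hl : ∀ (ρ : ℕ → ℕ) (v w : Ctx) z, (∀ n, w (ρ n) = v n) →
      ∀ n, vcons z w (liftR ρ n) = vcons z v n := by
    intro ρ v w z h n
    cases n with
    | zero => rfl
    | succ n => exact h n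
  have hp : ∀ (π : ZFSet → Option ℕ) (w : Ctx) z, (∀ a k, π a = some k → w k = a) →
      ∀ a k, liftP π a = some k → vcons z w k = a := by
    intro π w z h a k hk
    simp only [liftP, Option.map_eq_some_iff] at hk
    obtain ⟨j, hj, rfl⟩ := hk
    exact h a j hj
  induction f with
  | rel s n a =>
    intro ρ π v w h1 h2
    simp only [Fm.sub, Sat, Tm.eval_sub fI ρ π v w h1 h2]
  | eq t u =>
    intro ρ π v w h1 h2
    simp only [Fm.sub, Sat, Tm.eval_sub fI ρ π v w h1 h2]
  | not f ih =>
    intro ρ π v w h1 h2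
    simp only [Fm.sub, Sat, ih ρ π v w h1 h2]
  | imp f g ihf ihg =>
    intro ρ π v w h1 h2
    simp only [Fm.sub, Sat, ihf ρ π v w h1 h2, ihg ρ π v w h1 h2]
  | all f ih =>
    intro ρ π v w h1 h2
    simp only [Fm.sub, Sat]
    exact forall_congr' fun z => imp_congr_right fun _ =>
      ih _ _ _ _ (hl ρ v w z h1) (hp π w z h2)
  | ex f ih =>
    intro ρ π v w h1 h2
    simp only [Fm.sub, Sat]
    exact exists_congr fun z => and_congr_right fun _ =>
      ih _ _ _ _ (hl ρ v w z h1) (hp π w z h2)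

theorem Tm.eval_agree (fI : ZFSet → List ZFSet → ZFSet) (v w : Ctx) (t : Tm)
    (h : ∀ n ∈ t.free, v n = w n) : t.eval fI v = t.eval fI w := by
  induction t with
  | var n => exact h n rfl
  | param a => rfl
  | func s n a ih =>
    simp only [Tm.eval]
    congr 2
    funext i
    exact ih i fun m hm => h m ⟨i, hm⟩

theorem sat_agree (domP : ZFSet → Prop) (rI fI) (f : Fm) : ∀ (v w : Ctx),
    (∀ n ∈ f.free, v n = w n) → (Sat domP rI fI f v ↔ Sat domP rI fI f w) := by
  induction f with
  | rel s n a =>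
    intro v w h
    have : (fun i => Tm.eval fI v (a i)) = fun i => Tm.eval fI w (a i) := by
      funext i
      exact Tm.eval_agree fI v w _ fun m hm => h m ⟨i, hm⟩
    simp only [Sat, this]
  | eq t u =>
    intro v w h
    simp only [Sat, Tm.eval_agree fI v w t fun m hm => h m (Or.inl hm),
      Tm.eval_agree fI v w u fun m hm => h m (Or.inr hm)]
  | not f ih => intro v w h; exact not_congr (ih v w h)
  | imp f g ihf ihg =>
    intro v w h
    exact imp_congr (ihf v w fun m hm => h m (Or.inl hm)) (ihg v w fun m hm => h m (Or.inr hm))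
  | all f ih =>
    intro v w h
    exact forall_congr' fun z => imp_congr_right fun _ => ih _ _ fun n hn => by
      cases n with
      | zero => rfl
      | succ n => exact h n hn
  | ex f ih =>
    intro v w h
    exact exists_congr fun z => and_congr_right fun _ => ih _ _ fun n hn => by
      cases n with
      | zero => rfl
      | succ n => exact h n hn

theorem Tm.free_bdd (t : Tm) : ∃ N, ∀ m ∈ t.free, m < N := by
  induction t with
  | var n => exact ⟨n + 1, fun m hm => by have : m = n := hm; omega⟩
  | param a => exact ⟨0, fun m hm => hm.elim⟩
  | func s n a ih =>
    choose N hN using ih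
    refine ⟨Finset.univ.sup N, ?_⟩
    rintro m ⟨i, hm⟩
    exact lt_of_lt_of_le (hN i m hm) (Finset.le_sup (f := N) (Finset.mem_univ i))

theorem Fm.free_bdd (f : Fm) : ∃ N, ∀ m ∈ f.free, m < N := by
  induction f with
  | rel s n a =>
    choose N hN using fun i => Tm.free_bdd (a i)
    refine ⟨Finset.univ.sup N, ?_⟩
    rintro m ⟨i, hm⟩
    exact lt_of_lt_of_le (hN i m hm) (Finset.le_sup (f := N) (Finset.mem_univ i))
  | eq t u =>
    obtain ⟨N, hN⟩ := Tm.free_bdd t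
    obtain ⟨K, hK⟩ := Tm.free_bdd u
    refine ⟨max N K, ?_⟩
    rintro m (h | h)
    · exact lt_of_lt_of_le (hN m h) (le_max_left _ _)
    · exact lt_of_lt_of_le (hK m h) (le_max_right _ _)
  | not f ih => exact ih
  | imp f g ihf ihg =>
    obtain ⟨N, hN⟩ := ihf
    obtain ⟨K, hK⟩ := ihg
    refine ⟨max N K, ?_⟩
    rintro m (h | h)
    · exact lt_of_lt_of_le (hN m h) (le_max_left _ _)
    · exact lt_of_lt_of_le (hK m h) (le_max_right _ _)
  | all f ih =>
    obtain ⟨N, hN⟩ := ih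
    exact ⟨N, fun m hm => by have := hN (m + 1) hm; omega⟩
  | ex f ih =>
    obtain ⟨N, hN⟩ := ih
    exact ⟨N, fun m hm => by have := hN (m + 1) hm; omega⟩

theorem Tm.sub_noFunc {ρ π} {t : Tm} (h : t.noFunc) : (Tm.sub ρ π t).noFunc := by
  cases t with
  | var n => trivial
  | param a => simp only [Tm.sub]; cases π a <;> trivial
  | func s n a => exact h.elim

theorem Fm.sub_memOnly (f : Fm) : ∀ ρ π, f.memOnly → (Fm.sub ρ π f).memOnly := by
  induction f with
  | rel s n a => intro ρ π h; exact ⟨h.1, h.2.1, fun i => Tm.sub_noFunc (h.2.2 i)⟩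
  | eq t u => intro ρ π h; exact ⟨Tm.sub_noFunc h.1, Tm.sub_noFunc h.2⟩
  | not f ih => intro ρ π h; exact ih _ _ h
  | imp f g ihf ihg => intro ρ π h; exact ⟨ihf _ _ h.1, ihg _ _ h.2⟩
  | all f ih => intro ρ π h; exact ih _ _ h
  | ex f ih => intro ρ π h; exact ih _ _ h

theorem Tm.sub_params {ρ π} (P : Set ZFSet) (hπ : ∀ a, a ∉ P → ∃ k, π a = some k) (t : Tm)
    {Q : Set ZFSet} (hQ : ∀ a ∈ t.paramSet, a ∈ Q) :
    ∀ a ∈ (Tm.sub ρ π t).paramSet, a ∈ P ∧ a ∈ Q := by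
  induction t with
  | var n => intro a h; exact h.elim
  | param b =>
    intro a h
    simp only [Tm.sub] at h
    cases hb : π b with
    | none =>
      rw [hb] at h
      have hab : a = b := h
      subst hab
      refine ⟨?_, hQ a rfl⟩
      by_contra hc
      obtain ⟨k, hk⟩ := hπ a hc
      simp [hk] at hb
    | some k => rw [hb] at h; exact h.elim
  | func s n a ih =>
    rintro b ⟨i, hb⟩
    exact ih i (fun c hc => hQ c ⟨i, hc⟩) b hb

theorem Fm.sub_params (P : Set ZFSet) (f : Fm) : ∀ {ρ : ℕ → ℕ} {π : ZFSet → Option ℕ}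
    {Q : Set ZFSet}, (∀ a, a ∉ P → ∃ k, π a = some k) → (∀ a ∈ f.paramSet, a ∈ Q) →
    ∀ a ∈ (Fm.sub ρ π f).paramSet, a ∈ P ∧ a ∈ Q := by
  have hl : ∀ {π : ZFSet → Option ℕ}, (∀ a, a ∉ P → ∃ k, π a = some k) →
      ∀ a, a ∉ P → ∃ k, liftP π a = some k := by
    intro π h a ha
    obtain ⟨k, hk⟩ := h a ha
    exact ⟨k + 1, by simp [liftP, hk]⟩
  induction f with
  | rel s n a =>
    rintro ρ π Q h hQ b ⟨i, hb⟩
    exact Tm.sub_params P h (a i) (fun c hc => hQ c ⟨i, hc⟩) b hb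
  | eq t u =>
    rintro ρ π Q h hQ b (hb | hb)
    · exact Tm.sub_params P h _ (fun c hc => hQ c (Or.inl hc)) b hb
    · exact Tm.sub_params P h _ (fun c hc => hQ c (Or.inr hc)) b hb
  | not f ih => intro ρ π Q h hQ; exact ih h hQ
  | imp f g ihf ihg =>
    rintro ρ π Q h hQ b (hb | hb)
    · exact ihf h (fun c hc => hQ c (Or.inl hc)) b hb
    · exact ihg h (fun c hc => hQ c (Or.inr hc)) b hb
  | all f ih => intro ρ π Q h hQ; exact ih (hl h) hQ
  | ex f ih => intro ρ π Q h hQ; exact ih (hl h) hQ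

theorem Tm.sub_free {ρ π} (m : ℕ) (h1 : ∀ n, ρ n ≠ m) (h2 : ∀ a, π a ≠ some m) (t : Tm) :
    m ∉ (Tm.sub ρ π t).free := by
  induction t with
  | var n => intro h; exact h1 n (Eq.symm h)
  | param b =>
    simp only [Tm.sub]
    cases hb : π b with
    | none => exact fun h => h
    | some k =>
      intro h
      have : m = k := h
      exact h2 b (by rw [hb, this])
  | func s n a ih => rintro ⟨i, hi⟩; exact ih i hi

theorem Fm.sub_free (f : Fm) : ∀ {ρ : ℕ → ℕ} {π : ZFSet → Option ℕ} (m : ℕ), (∀ n, ρ n ≠ m) →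
    (∀ a, π a ≠ some m) → m ∉ (Fm.sub ρ π f).free := by
  have hl1 : ∀ {ρ : ℕ → ℕ} {m : ℕ}, (∀ n, ρ n ≠ m) → ∀ n, liftR ρ n ≠ m + 1 := by
    intro ρ m h n
    cases n with
    | zero => simp [liftR]
    | succ n => simpa [liftR] using h n
  have hl2 : ∀ {π : ZFSet → Option ℕ} {m : ℕ}, (∀ a, π a ≠ some m) →
      ∀ a, liftP π a ≠ some (m + 1) := by
    intro π m h a
    simpa [liftP] using h a
  induction f with
  | rel s n a => rintro ρ π m h1 h2 ⟨i, hi⟩; exact Tm.sub_free m h1 h2 _ hi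
  | eq t u =>
    rintro ρ π m h1 h2 (h | h)
    · exact Tm.sub_free m h1 h2 _ h
    · exact Tm.sub_free m h1 h2 _ h
  | not f ih => intro ρ π m h1 h2; exact ih m h1 h2
  | imp f g ihf ihg =>
    rintro ρ π m h1 h2 (h | h)
    · exact ihf m h1 h2 h
    · exact ihg m h1 h2 h
  | all f ih => intro ρ π m h1 h2; exact ih (m + 1) (hl1 h1) (hl2 h2)
  | ex f ih => intro ρ π m h1 h2; exact ih (m + 1) (hl1 h1) (hl2 h2)

/-- definable relations over `V`, with parameters -/
class Df (V : ZFSet.{0}) (R : Ctx → Prop) : Prop where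
  out : ∃ φ : Fm, φ.memOnly ∧ (∀ a ∈ φ.paramSet, a ∈ V) ∧
    ∀ v : Ctx, (∀ i, v i ∈ V) → (R v ↔ SatV V φ v)

theorem vcons_mem {V : ZFSet.{0}} {z : ZFSet} {v : Ctx} (hz : z ∈ V) (hv : ∀ i, v i ∈ V) :
    ∀ i, vcons z v i ∈ V := by
  intro i
  cases i with
  | zero => exact hz
  | succ n => exact hv n

section basic
variable {V : ZFSet.{0}}

theorem Df.congr {R R' : Ctx → Prop} (h : Df V R) (e : ∀ v : Ctx, (∀ i, v i ∈ V) → (R' v ↔ R v)) :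
    Df V R' := by
  obtain ⟨φ, h1, h2, h3⟩ := h.out
  exact ⟨φ, h1, h2, fun v hv => (e v hv).trans (h3 v hv)⟩

theorem Df.rename {R : Ctx → Prop} (h : Df V R) (ρ : ℕ → ℕ) :
    Df V (fun w => R (fun i => w (ρ i))) := by
  obtain ⟨φ, h1, h2, h3⟩ := h.out
  refine ⟨Fm.sub ρ (fun _ => none) φ, Fm.sub_memOnly _ _ _ h1, fun a ha =>
    (Fm.sub_params Set.univ φ (fun a ha => (ha trivial).elim) h2 a ha).2, fun v hv => ?_⟩
  rw [h3 _ fun i => hv (ρ i)]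
  exact (sat_sub _ _ _ φ ρ _ _ v (fun n => rfl) (fun a k h => by simp at h)).symm

instance (priority := 900) Df.not {R : Ctx → Prop} [h : Df V R] : Df V (fun v => ¬ R v) := by
  obtain ⟨φ, h1, h2, h3⟩ := h.out
  exact ⟨φ.not, h1, h2, fun v hv => not_congr (h3 v hv)⟩

instance (priority := 800) Df.imp {R S : Ctx → Prop} [h : Df V R] [h' : Df V S] :
    Df V (fun v => R v → S v) := by
  obtain ⟨φ, h1, h2, h3⟩ := h.out
  obtain ⟨φ', h1', h2', h3'⟩ := h'.out
  refine ⟨φ.imp φ', ⟨h1, h1'⟩, ?_, fun v hv => imp_congr (h3 v hv) (h3' v hv)⟩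
  rintro a (ha | ha)
  · exact h2 a ha
  · exact h2' a ha

instance Df.and {R S : Ctx → Prop} [h : Df V R] [h' : Df V S] :
    Df V (fun v => R v ∧ S v) :=
  (inferInstance : Df V (fun v => ¬ (R v → ¬ S v))).congr fun v _ => by tauto

instance Df.or {R S : Ctx → Prop} [h : Df V R] [h' : Df V S] :
    Df V (fun v => R v ∨ S v) :=
  (inferInstance : Df V (fun v => (¬ R v → S v))).congr fun v _ => by tauto

instance Df.iff {R S : Ctx → Prop} [h : Df V R] [h' : Df V S] :
    Df V (fun v => (R v ↔ S v)) :=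
  (inferInstance : Df V (fun v => ((R v → S v) ∧ (S v → R v)))).congr fun v _ => by tauto

instance (priority := 1100) Df.const {p : Prop} : Df V (fun _ => p) := by
  by_cases hp : p
  · refine ⟨eq2 0 0, ⟨trivial, trivial⟩, ?_, fun v _ => ⟨fun _ => rfl, fun _ => hp⟩⟩
    rintro a (ha | ha) <;> exact ha.elim
  · refine ⟨(eq2 0 0).not, ⟨trivial, trivial⟩, ?_, fun v _ => ⟨fun h => (hp h).elim, fun h => (h rfl).elim⟩⟩
    rintro a (ha | ha) <;> exact ha.elim

instance Df.exV {R : ZFSet → Ctx → Prop} [h : Df V (fun w => R (w 0) (fun i => w (i + 1)))] :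
    Df V (fun v => ∃ a ∈ V, R a v) := by
  obtain ⟨φ, h1, h2, h3⟩ := h.out
  exact ⟨φ.ex, h1, h2, fun v hv => exists_congr fun a => and_congr_right fun ha =>
    h3 (vcons a v) (vcons_mem ha hv)⟩

instance Df.allV {R : ZFSet → Ctx → Prop} [h : Df V (fun w => R (w 0) (fun i => w (i + 1)))] :
    Df V (fun v => ∀ a ∈ V, R a v) := by
  obtain ⟨φ, h1, h2, h3⟩ := h.out
  exact ⟨φ.all, h1, h2, fun v hv => forall_congr' fun a => imp_congr_right fun ha =>
    h3 (vcons a v) (vcons_mem ha hv)⟩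

theorem Df.mem2 (i j : ℕ) : Df V (fun v => v i ∈ v j) := by
  refine ⟨SmallExt.mem2 i j, ⟨rfl, rfl, ?_⟩, ?_, fun v hv => ?_⟩
  · intro k; fin_cases k <;> trivial
  · rintro a ⟨k, hk⟩; fin_cases k <;> exact hk.elim
  · simp [SmallExt.mem2, SatV, Sat, memRel, Tm.eval]

theorem Df.eq2 (i j : ℕ) : Df V (fun v => v i = v j) := by
  refine ⟨SmallExt.eq2 i j, ⟨trivial, trivial⟩, ?_, fun v hv => Iff.rfl⟩
  rintro a (ha | ha) <;> exact ha.elim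

theorem Df.eqc (i : ℕ) {c : ZFSet} (hc : c ∈ V) : Df V (fun v => v i = c) := by
  refine ⟨Fm.eq (Tm.var i) (Tm.param c), ⟨trivial, trivial⟩, ?_, fun v hv => Iff.rfl⟩
  rintro a (ha | ha)
  · exact ha.elim
  · have : a = c := ha
    exact this ▸ hc

/-- definable class functions -/
class DfF (V : ZFSet.{0}) (f : Ctx → ZFSet.{0}) : Prop where
  cl : ∀ v : Ctx, (∀ i, v i ∈ V) → f v ∈ V
  gr : Df V (fun w => w 0 = f (fun i => w (i + 1)))

theorem DfF.congr {f f' : Ctx → ZFSet} (h : DfF V f) (e : ∀ v : Ctx, (∀ i, v i ∈ V) → f' v = f v) :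
    DfF V f' :=
  ⟨fun v hv => e v hv ▸ h.cl v hv, h.gr.congr fun v hv => by rw [e _ fun i => hv (i + 1)]⟩

/-- substitution of a definable function -/
theorem Df.bind {f : Ctx → ZFSet} {R : ZFSet → Ctx → Prop} (hf : DfF V f)
    (h : Df V (fun w => R (w 0) (fun i => w (i + 1)))) : Df V (fun v => R (f v) v) := by
  have := hf.gr
  refine (inferInstance : Df V (fun v => ∃ a ∈ V, a = f v ∧ R a v)).congr fun v hv => ?_
  constructor
  · exact fun h => ⟨f v, hf.cl v hv, rfl, h⟩
  · rintro ⟨a, -, rfl, h⟩; exact h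

theorem DfF.rename {f : Ctx → ZFSet} (h : DfF V f) (ρ : ℕ → ℕ) :
    DfF V (fun w => f (fun i => w (ρ i))) :=
  ⟨fun v hv => h.cl _ fun i => hv (ρ i), (h.gr.rename (liftR ρ)).congr fun _ _ => Iff.rfl⟩

theorem DfF.shift {f : Ctx → ZFSet} (h : DfF V f) : DfF V (fun w => f (fun i => w (i + 1))) :=
  h.rename (· + 1)

theorem DfF.bind {f : Ctx → ZFSet} {F : ZFSet → Ctx → ZFSet} (hf : DfF V f)
    (h : DfF V (fun w => F (w 0) (fun i => w (i + 1)))) : DfF V (fun v => F (f v) v) := by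
  refine ⟨fun v hv => h.cl (vcons (f v) v) (vcons_mem (hf.cl v hv) hv), ?_⟩
  refine Df.bind (R := fun a w => w 0 = F a (fun i => w (i + 1))) hf.shift ?_
  refine (h.gr.rename fun i => match i with | 0 => 1 | 1 => 0 | n + 2 => n + 2).congr fun v _ => Iff.rfl

instance (priority := 1100) DfF.var (n : ℕ) : DfF V (fun v => v n) := ⟨fun v hv => hv n, Df.eq2 0 (n + 1)⟩

instance (priority := 1050) DfF.const {c : ZFSet} [h : Fact (c ∈ V)] : DfF V (fun _ => c) :=
  ⟨fun _ _ => h.out, Df.eqc 0 h.out⟩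

theorem DfF.comp1 {F : ZFSet → ZFSet} (h : DfF V (fun v => F (v 0))) {f : Ctx → ZFSet}
    (hf : DfF V f) : DfF V (fun v => F (f v)) :=
  DfF.bind (F := fun a _ => F a) hf (h.rename fun _ => 0)

theorem DfF.comp2 {F : ZFSet → ZFSet → ZFSet} (h : DfF V (fun v => F (v 0) (v 1)))
    {f g : Ctx → ZFSet} (hf : DfF V f) (hg : DfF V g) : DfF V (fun v => F (f v) (g v)) :=
  DfF.bind (F := fun a v => F a (g v)) hf
    (DfF.bind (F := fun b w => F (w 0) b) hg.shift (h.rename fun i => match i with | 0 => 1 | _ => 0))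

theorem DfF.comp3 {F : ZFSet → ZFSet → ZFSet → ZFSet} (h : DfF V (fun v => F (v 0) (v 1) (v 2)))
    {f g k : Ctx → ZFSet} (hf : DfF V f) (hg : DfF V g) (hk : DfF V k) :
    DfF V (fun v => F (f v) (g v) (k v)) :=
  DfF.bind (F := fun a v => F a (g v) (k v)) hf
    (DfF.bind (F := fun b w => F (w 0) b (k (fun i => w (i + 1)))) hg.shift
      (DfF.bind (F := fun c w => F (w 1) (w 0) c) hk.shift.shift
        (h.rename fun i => match i with | 0 => 2 | 1 => 1 | _ => 0)))

theorem Df.comp1 {F : ZFSet → Prop} (h : Df V (fun v => F (v 0))) {f : Ctx → ZFSet}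
    (hf : DfF V f) : Df V (fun v => F (f v)) :=
  Df.bind (R := fun a _ => F a) hf (h.rename fun _ => 0)

theorem Df.comp2 {F : ZFSet → ZFSet → Prop} (h : Df V (fun v => F (v 0) (v 1)))
    {f g : Ctx → ZFSet} (hf : DfF V f) (hg : DfF V g) : Df V (fun v => F (f v) (g v)) :=
  Df.bind (R := fun a v => F a (g v)) hf
    (Df.bind (R := fun b w => F (w 0) b) hg.shift (h.rename fun i => match i with | 0 => 1 | _ => 0))

theorem Df.comp3 {F : ZFSet → ZFSet → ZFSet → Prop} (h : Df V (fun v => F (v 0) (v 1) (v 2)))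
    {f g k : Ctx → ZFSet} (hf : DfF V f) (hg : DfF V g) (hk : DfF V k) :
    Df V (fun v => F (f v) (g v) (k v)) :=
  Df.bind (R := fun a v => F a (g v) (k v)) hf
    (Df.bind (R := fun b w => F (w 0) b (k (fun i => w (i + 1)))) hg.shift
      (Df.bind (R := fun c w => F (w 1) (w 0) c) hk.shift.shift
        (h.rename fun i => match i with | 0 => 2 | 1 => 1 | _ => 0)))

instance Df.mem {f g : Ctx → ZFSet} [hf : DfF V f] [hg : DfF V g] : Df V (fun v => f v ∈ g v) :=
  Df.comp2 (F := fun a b => a ∈ b) (Df.mem2 0 1) hf hg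

instance Df.eq {f g : Ctx → ZFSet} [hf : DfF V f] [hg : DfF V g] : Df V (fun v => f v = g v) :=
  Df.comp2 (Df.eq2 0 1) hf hg

instance Df.ne {f g : Ctx → ZFSet} [hf : DfF V f] [hg : DfF V g] : Df V (fun v => f v ≠ g v) :=
  Df.not

end basic

section trans
variable {V : ZFSet.{0}} [hV : Fact (IsCTM V)]

theorem tr {x y : ZFSet} (hy : y ∈ V) (hx : x ∈ y) : x ∈ V := hV.out.1.1 y hy hx

instance (priority := 950) Df.exB {f : Ctx → ZFSet} {R : ZFSet → Ctx → Prop} [hf : DfF V f]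
    [h : Df V (fun w => R (w 0) (fun i => w (i + 1)))] :
    Df V (fun v => ∃ a ∈ f v, R a v) := by
  have := hf.shift
  refine (inferInstance : Df V (fun v => ∃ a ∈ V, a ∈ f v ∧ R a v)).congr fun v hv => ?_
  exact exists_congr fun a => ⟨fun h => ⟨tr (hf.cl v hv) h.1, h⟩, fun h => h.2⟩

instance (priority := 950) Df.allB {f : Ctx → ZFSet} {R : ZFSet → Ctx → Prop} [hf : DfF V f]
    [h : Df V (fun w => R (w 0) (fun i => w (i + 1)))] :
    Df V (fun v => ∀ a ∈ f v, R a v) := by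
  have := hf.shift
  refine (inferInstance : Df V (fun v => ∀ a ∈ V, a ∈ f v → R a v)).congr fun v hv => ?_
  exact forall_congr' fun a => ⟨fun h _ => h, fun h h' => h (tr (hf.cl v hv) h') h'⟩

instance Df.subset {f g : Ctx → ZFSet} [hf : DfF V f] [hg : DfF V g] :
    Df V (fun v => f v ⊆ g v) := by
  have := hg.shift
  exact (inferInstance : Df V (fun v => ∀ a ∈ f v, a ∈ g v)).congr fun v hv => Iff.rfl



theorem DfF.of_mem {f : Ctx → ZFSet} (cl : ∀ v : Ctx, (∀ i, v i ∈ V) → f v ∈ V)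
    (h : Df V (fun w => w 0 ∈ f (fun i => w (i + 1)))) : DfF V f := by
  refine ⟨cl, ?_⟩
  have : Df V (fun u => u 0 ∈ f (fun i => u (i + 1 + 1))) :=
    (h.rename fun i => match i with | 0 => 0 | n + 1 => n + 2).congr fun v _ => Iff.rfl
  refine (inferInstance : Df V (fun w => ∀ a ∈ V, (a ∈ w 0 ↔ a ∈ f (fun i => w (i + 1))))).congr
    fun v hv => ?_
  constructor
  · intro e a _; rw [e]
  · intro e
    ext a
    constructor
    · intro ha; exact (e a (tr (hv 0) ha)).1 ha
    · intro ha; exact (e a (tr (cl _ fun i => hv (i + 1)) ha)).2 ha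

theorem allClose_elim {dom rI fI} (k : ℕ) : ∀ (f : Fm) (v : Ctx), Sat dom rI fI (allClose k f) v →
    ∀ w : Ctx, (∀ i, dom (w i)) → (∀ i, w (k + i) = v i) → Sat dom rI fI f w := by
  induction k with
  | zero =>
    intro f v h w _ hw
    have : w = v := by funext i; rw [← hw i, Nat.zero_add]
    exact this ▸ h
  | succ k ih =>
    intro f v h w hd hw
    have := ih _ v h (fun i => w (i + 1)) (fun i => hd _) (fun i => by
      rw [← hw i]; congr 1; omega)
    have h2 := this (w 0) (hd 0)
    have e : vcons (w 0) (fun i => w (i + 1)) = w := by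
      funext i; cases i <;> rfl
    rwa [e] at h2

theorem empty_mem' : (∅ : ZFSet.{0}) ∈ V := by
  have h := hV.out.1.2 infAx (by simp [ZFCax])
  obtain ⟨X, hX, _⟩ := h
  have : ∀ y : ZFSet, y ∈ V → ∅ ∈ V := by
    intro y
    induction y using ZFSet.inductionOn with
    | _ y ih =>
      intro hy
      rcases ZFSet.eq_empty_or_nonempty y with h | ⟨z, hz⟩
      · exact h ▸ hy
      · exact ih z hz (tr hy hz)
  exact this X hX

theorem scheme_inst {k : ℕ → ℕ} (f : Fm) (hf : ∀ k, SatV V (allClose k f) (fun _ => ∅)) (w : Ctx)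
    (hw : ∀ i, w i ∈ V) : SatV V f w := by
  obtain ⟨N, hN⟩ := Fm.free_bdd f
  have := allClose_elim N f _ (hf N) (fun i => if i < N then w i else ∅) (fun i => by
    show (if i < N then w i else ∅) ∈ V
    split_ifs
    · exact hw i
    · exact empty_mem') (fun i => by simp)
  exact (sat_agree _ _ _ f _ _ fun n hn => by simp [hN n hn]).1 this

theorem exists_enum (V : ZFSet.{0}) [hV : Fact (IsCTM V)] :
    ∃ e : ℕ → ZFSet, (∀ i, e i ∈ V) ∧ ∀ a ∈ V, ∃ i, e i = a := by
  obtain ⟨e, he⟩ := hV.out.2.exists_eq_range ⟨∅, empty_mem' (V := V)⟩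
  refine ⟨e, fun i => ?_, fun a ha => ?_⟩
  · have : e i ∈ Set.range e := ⟨i, rfl⟩
    rw [← he] at this
    exact this
  · have : a ∈ V.toSet := ha
    rw [he] at this
    exact this

/-- removing parameters -/
theorem Df.deparam {R : Ctx → Prop} (h : Df V R) (ρ : ℕ → ℕ) (κ : ℕ → ℕ) (m : ℕ) (h1 : ∀ n, ρ n ≠ m)
    (h2 : ∀ n, κ n ≠ m) : ∃ (e : ℕ → ZFSet) (φ : Fm), (∀ i, e i ∈ V) ∧ φ.memOnly ∧ φ.paramSet = ∅ ∧
      m ∉ φ.free ∧ ∀ w : Ctx, (∀ i, w i ∈ V) → (∀ i, w (κ i) = e i) →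
        (SatV V φ w ↔ R (fun i => w (ρ i))) := by
  classical
  obtain ⟨φ, p1, p2, p3⟩ := h.out
  obtain ⟨e, he, hs⟩ := exists_enum V
  choose! idx hidx using hs
  let π : ZFSet → Option ℕ := fun a => if a ∈ V then some (κ (idx a)) else none
  refine ⟨e, Fm.sub ρ π φ, he, Fm.sub_memOnly _ _ _ p1, ?_, ?_, ?_⟩
  · refine Set.eq_empty_iff_forall_notMem.2 fun a ha => ?_
    have := Fm.sub_params (ρ := ρ) (π := π) {a | a ∉ V} φ (Q := {a | a ∈ V}) (fun a ha => by
      have : a ∈ V := by simpa using ha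
      exact ⟨_, if_pos this⟩) p2 a ha
    exact this.1 this.2
  · refine Fm.sub_free φ m h1 fun a => ?_
    simp only [π]
    split_ifs
    · simpa using h2 _
    · simp
  · intro w hw hwe
    rw [p3 _ fun i => hw _]
    refine sat_sub _ _ _ φ ρ π _ w (fun n => rfl) fun a k hk => ?_
    simp only [π] at hk
    split_ifs at hk with ha
    simp only [Option.some.injEq] at hk
    rw [← hk, hwe, hidx a ha]

theorem sat_iff_and {dom rI fI} {f g : Fm} {v} : Sat dom rI fI (f.and g) v ↔
    (Sat dom rI fI f v ∧ Sat dom rI fI g v) := by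
  simp [Fm.and, Sat]

theorem sat_iff_iff {dom rI fI} {f g : Fm} {v} : Sat dom rI fI (f.iff g) v ↔
    (Sat dom rI fI f v ↔ Sat dom rI fI g v) := by
  simp only [Fm.iff, sat_iff_and, Sat]; tauto

theorem sat_iff_or {dom rI fI} {f g : Fm} {v} : Sat dom rI fI (f.or g) v ↔
    (Sat dom rI fI f v ∨ Sat dom rI fI g v) := by
  simp only [Fm.or, Sat]; tauto

theorem sat_mem2 {dom fI} {i j : ℕ} {v} : Sat dom memRel fI (SmallExt.mem2 i j) v ↔ v i ∈ v j := by
  simp [SmallExt.mem2, Sat, memRel, Tm.eval]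

theorem sat_eq2 {dom rI fI} {i j : ℕ} {v} : Sat dom rI fI (SmallExt.eq2 i j) v ↔ v i = v j := by
  simp [SmallExt.eq2, Sat, Tm.eval]

/-- interleaving -/
def il (v e : Ctx) : Ctx := fun i => if i % 2 = 0 then v (i / 2) else e (i / 2)

theorem il_even (v e : Ctx) (i : ℕ) : il v e (2 * i) = v i := by
  simp [il]

theorem il_odd (v e : Ctx) (i : ℕ) : il v e (2 * i + 1) = e i := by
  have : (2 * i + 1) / 2 = i := by omega
  simp [il, this]

theorem il_mem {v e : Ctx} (hv : ∀ i, v i ∈ V) (he : ∀ i, e i ∈ V) (i : ℕ) : il v e i ∈ V := by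
  unfold il; split_ifs
  · exact hv _
  · exact he _

theorem sep_mem {R : ZFSet → Ctx → Prop} (h : Df V (fun w => R (w 0) (fun i => w (i + 1))))
    {X : ZFSet} (hX : X ∈ V) (v : Ctx) (hv : ∀ i, v i ∈ V) : ZFSet.sep (fun a => R a v) X ∈ V := by
  obtain ⟨e, φ, he, p1, p2, p3, p4⟩ := h.deparam
    (fun i => match i with | 0 => 0 | n + 1 => 2 * n + 3) (fun n => 2 * n + 1 + 3) 1
    (by rintro (_ | n) <;> simp) (by intro n; omega)
  have hs := scheme_inst (V := V) (k := id) (sepBody φ) (fun k => hV.out.1.2 _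
    (Or.inl (Or.inr ⟨k, φ, p1, p2, p3, rfl⟩))) (il v e) (il_mem hv he)
  obtain ⟨S, hS, hS2⟩ := hs X hX
  have : ZFSet.sep (fun a => R a v) X = S := by
    have hS3 : ∀ z ∈ V, (z ∈ S ↔ z ∈ X ∧ R z v) := by
      intro z hz
      have h0 := sat_iff_iff.1 (hS2 z hz)
      rw [sat_iff_and, sat_mem2, sat_mem2] at h0
      have h1 := p4 (vcons z (vcons S (vcons X (il v e)))) (vcons_mem hz (vcons_mem hS
        (vcons_mem hX (il_mem hv he)))) (fun i => il_odd v e i)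
      refine h0.trans (and_congr_right fun _ => h1.trans ?_)
      have : (fun i => (vcons z (vcons S (vcons X (il v e)))) (2 * i + 3)) = v := by
        funext i; exact il_even v e i
      show R z (fun i => (vcons z (vcons S (vcons X (il v e)))) (2 * i + 3)) ↔ _
      rw [this]
    ext z
    rw [ZFSet.mem_sep]
    constructor
    · intro hz; exact (hS3 z (tr hX hz.1)).2 hz
    · intro hz; exact (hS3 z (tr hS hz)).1 hz
  exact this ▸ hS

theorem collect {R : ZFSet → ZFSet → Ctx → Prop}
    (h : Df V (fun w => R (w 0) (w 1) (fun i => w (i + 2))))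
    {X : ZFSet} (hX : X ∈ V) (v : Ctx) (hv : ∀ i, v i ∈ V) :
    ∃ b ∈ V, ∀ a ∈ X, (∃ y ∈ V, R y a v) → ∃ y ∈ b, R y a v := by
  obtain ⟨e, φ, he, p1, p2, p3, p4⟩ := h.deparam
    (fun i => match i with | 0 => 0 | 1 => 1 | n + 2 => 2 * n + 4) (fun n => 2 * n + 1 + 4) 2
    (by rintro (_ | _ | n) <;> simp) (by intro n; omega)
  have hs := scheme_inst (V := V) (k := id) (repBody φ) (fun k => hV.out.1.2 _
    (Or.inr ⟨k, φ, p1, p2, p3, rfl⟩)) (il v e) (il_mem hv he)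
  obtain ⟨b, hb, hb2⟩ := hs X hX
  refine ⟨b, hb, fun a ha ⟨y, hy, hR⟩ => ?_⟩
  have key : ∀ y ∈ V, (SatV V φ (vcons y (vcons a (vcons b (vcons X (il v e))))) ↔ R y a v) := by
    intro y hy
    refine (p4 _ (vcons_mem hy (vcons_mem (tr hX ha) (vcons_mem hb (vcons_mem hX (il_mem hv he)))))
      (fun i => il_odd v e i)).trans ?_
    have : (fun i => (vcons y (vcons a (vcons b (vcons X (il v e))))) (2 * i + 4)) = v := by
      funext i; exact il_even v e i
    show R y a (fun i => (vcons y (vcons a (vcons b (vcons X (il v e))))) (2 * i + 4)) ↔ _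
    rw [this]
  obtain ⟨z, hz, hz2⟩ := hb2 a (tr hX ha) (sat_mem2.2 ha) ⟨y, hy, (key y hy).2 hR⟩
  rw [sat_iff_and, sat_mem2] at hz2
  exact ⟨z, hz2.1, (key z hz).1 hz2.2⟩

end trans
end SmallExt

namespace SmallExt

/-! ### Part 2: basic closure properties and recursion -/

theorem mem_zimage {f : ZFSet → ZFSet} {x y : ZFSet} : y ∈ zimage f x ↔ ∃ z ∈ x, f z = y := by
  unfold zimage
  rw [@ZFSet.mem_image f (Classical.allZFSetDefinable _)]

theorem opair_inj {a b c d : ZFSet} : opair a b = opair c d ↔ a = c ∧ b = d := ZFSet.pair_inj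

theorem zfst_opair (a b : ZFSet) : zfst (opair a b) = a := by
  ext z
  simp only [zfst, opair, ZFSet.pair, ZFSet.mem_sUnion]
  constructor
  · rintro ⟨y, hy, hz⟩
    have : y ∈ ({a} : ZFSet) := ZFSet.mem_of_mem_sInter hy (by simp)
    simp at this
    exact this ▸ hz
  · intro hz
    refine ⟨a, ?_, hz⟩
    rw [ZFSet.mem_sInter ⟨{a}, by simp⟩]
    intro w hw
    simp at hw
    rcases hw with rfl | rfl <;> simp

theorem zsnd_opair (a b : ZFSet) : zsnd (opair a b) = b := by
  have h1 : ZFSet.sUnion (opair a b) = {a, b} := by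
    ext z; simp [opair, ZFSet.pair]
  have h2 : ZFSet.sInter (opair a b) = {a} := by
    ext z
    rw [ZFSet.mem_sInter ⟨{a}, by simp [opair, ZFSet.pair]⟩]
    simp only [opair, ZFSet.pair]
    constructor
    · intro h; exact h {a} (by simp)
    · intro hz w hw
      simp at hw hz
      rcases hw with rfl | rfl <;> simp [hz]
  unfold zsnd
  rw [h1, h2]
  ext z
  simp only [ZFSet.mem_sUnion, ZFSet.mem_sep]
  by_cases hab : a = b
  · subst hab
    have e : ({a, a} : ZFSet) = {a} := by ext; simp
    constructor
    · rintro ⟨y, ⟨hy, _⟩, hz⟩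
      simp at hy; exact hy ▸ hz
    · intro hz
      exact ⟨a, ⟨by simp, fun h => (h e).elim⟩, hz⟩
  · have hne : ({a, b} : ZFSet) ≠ {a} := by
      intro h
      have : b ∈ ({a} : ZFSet) := h ▸ (by simp)
      simp at this
      exact hab this.symm
    constructor
    · rintro ⟨y, ⟨hy, h⟩, hz⟩
      have := h hne
      simp at hy this
      rcases hy with rfl | rfl
      · exact (this rfl).elim
      · exact hz
    · intro hz
      refine ⟨b, ⟨by simp, fun _ => ?_⟩, hz⟩
      simp
      exact fun h => hab h.symm

attribute [simp] zfst_opair zsnd_opair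

/-- the power set relativized to `V` -/
def pwV (V x : ZFSet) : ZFSet := ZFSet.sep (fun a => a ∈ V) (ZFSet.powerset x)

theorem mem_pwV {V x y : ZFSet} : y ∈ pwV V x ↔ y ∈ V ∧ y ⊆ x := by
  simp [pwV, and_comm]

section trans
variable {V : ZFSet.{0}} [hV : Fact (IsCTM V)]

instance : Fact ((∅ : ZFSet.{0}) ∈ V) := ⟨empty_mem'⟩

theorem pair_mem {a b : ZFSet} (ha : a ∈ V) (hb : b ∈ V) : ({a, b} : ZFSet) ∈ V := by
  have h := hV.out.1.2 pairAx (by simp [ZFCax])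
  obtain ⟨c, hc, h2⟩ := h a ha b hb
  rw [sat_iff_and, sat_mem2, sat_mem2] at h2
  obtain ⟨hac, hbc⟩ : a ∈ c ∧ b ∈ c := h2
  have h3 := sep_mem (V := V) (R := fun z v => z = v 0 ∨ z = v 1) inferInstance hc
    (vcons a (fun _ => b)) (vcons_mem ha (fun _ => hb))
  have : ZFSet.sep (fun z => z = a ∨ z = b) c = {a, b} := by
    ext z
    simp only [ZFSet.mem_sep, ZFSet.mem_pair]
    constructor
    · exact fun h => h.2
    · rintro (rfl | rfl)
      · exact ⟨hac, Or.inl rfl⟩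
      · exact ⟨hbc, Or.inr rfl⟩
  rw [← this]
  exact h3

instance DfF.sep {f : Ctx → ZFSet} {R : ZFSet → Ctx → Prop} [hf : DfF V f]
    [h : Df V (fun w => R (w 0) (fun i => w (i + 1)))] :
    DfF V (fun v => ZFSet.sep (fun a => R a v) (f v)) := by
  have := hf.shift
  refine DfF.of_mem (fun v hv => sep_mem h (hf.cl v hv) v hv) ?_
  exact (inferInstance : Df V (fun w => w 0 ∈ f (fun i => w (i + 1)) ∧
    R (w 0) (fun i => w (i + 1)))).congr fun v _ => by simp

instance DfF.pair {f g : Ctx → ZFSet} [hf : DfF V f] [hg : DfF V g] :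
    DfF V (fun v => ({f v, g v} : ZFSet)) := by
  have := hf.shift
  have := hg.shift
  refine DfF.of_mem (fun v hv => pair_mem (hf.cl v hv) (hg.cl v hv)) ?_
  exact (inferInstance : Df V (fun w => w 0 = f (fun i => w (i + 1)) ∨
    w 0 = g (fun i => w (i + 1)))).congr fun v _ => by simp

instance DfF.singleton {f : Ctx → ZFSet} [hf : DfF V f] :
    DfF V (fun v => ({f v} : ZFSet)) :=
  (inferInstance : DfF V (fun v => ({f v, f v} : ZFSet))).congr fun v _ => by ext; simp

instance DfF.opair {f g : Ctx → ZFSet} [hf : DfF V f] [hg : DfF V g] :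
    DfF V (fun v => opair (f v) (g v)) :=
  (inferInstance : DfF V (fun v => ({{f v}, {f v, g v}} : ZFSet)))

theorem sUnion_mem {x : ZFSet} (hx : x ∈ V) : ZFSet.sUnion x ∈ V := by
  have h := hV.out.1.2 unionAx (by simp [ZFCax])
  obtain ⟨c, hc, h2⟩ := h x hx
  have h3 := sep_mem (V := V) (R := fun z v => ∃ y ∈ v 0, z ∈ y) inferInstance hc
    (fun _ => x) (fun _ => hx)
  have : ZFSet.sep (fun z => ∃ y ∈ x, z ∈ y) c = ZFSet.sUnion x := by
    ext z
    simp only [ZFSet.mem_sep, ZFSet.mem_sUnion, and_iff_right_iff_imp]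
    rintro ⟨y, hy, hz⟩
    have := h2 z (tr (tr hx hy) hz) y (tr hx hy) (sat_iff_and.2 ⟨sat_mem2.2 hz, sat_mem2.2 hy⟩)
    exact sat_mem2.1 this
  rw [← this]
  exact h3

instance DfF.sUnion {f : Ctx → ZFSet} [hf : DfF V f] : DfF V (fun v => ZFSet.sUnion (f v)) := by
  have := hf.shift
  refine DfF.of_mem (fun v hv => sUnion_mem (hf.cl v hv)) ?_
  exact (inferInstance : Df V (fun w => ∃ y ∈ f (fun i => w (i + 1)), w 0 ∈ y)).congr
    fun v _ => by simp

instance DfF.union {f g : Ctx → ZFSet} [hf : DfF V f] [hg : DfF V g] :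
    DfF V (fun v => f v ∪ g v) :=
  (inferInstance : DfF V (fun v => ZFSet.sUnion ({f v, g v} : ZFSet)))

instance DfF.insert {f g : Ctx → ZFSet} [hf : DfF V f] [hg : DfF V g] :
    DfF V (fun v => insert (f v) (g v)) :=
  (inferInstance : DfF V (fun v => ({f v} ∪ g v : ZFSet))).congr fun v _ => ZFSet.insert_eq _ _

instance DfF.inter {f g : Ctx → ZFSet} [hf : DfF V f] [hg : DfF V g] :
    DfF V (fun v => f v ∩ g v) := by
  have := hg.shift
  exact (inferInstance : DfF V (fun v => ZFSet.sep (fun a => a ∈ g v) (f v))).congr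
    fun v _ => by ext; simp

instance DfF.sdiff {f g : Ctx → ZFSet} [hf : DfF V f] [hg : DfF V g] :
    DfF V (fun v => f v \ g v) := by
  have := hg.shift
  exact (inferInstance : DfF V (fun v => ZFSet.sep (fun a => a ∉ g v) (f v))).congr
    fun v _ => by ext; simp

instance DfF.sInter {f : Ctx → ZFSet} [hf : DfF V f] : DfF V (fun v => ZFSet.sInter (f v)) := by
  have := hf.shift
  exact (inferInstance : DfF V (fun v => ZFSet.sep (fun a => ∀ z ∈ f v, a ∈ z) (ZFSet.sUnion (f v))))

instance DfF.zfst {f : Ctx → ZFSet} [hf : DfF V f] : DfF V (fun v => zfst (f v)) :=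
  (inferInstance : DfF V (fun v => ZFSet.sUnion (ZFSet.sInter (f v))))

instance DfF.zsnd {f : Ctx → ZFSet} [hf : DfF V f] : DfF V (fun v => zsnd (f v)) := by
  have := hf.shift
  exact (inferInstance : DfF V (fun v => ZFSet.sUnion (ZFSet.sep
    (fun y => ZFSet.sUnion (f v) ≠ ZFSet.sInter (f v) → y ∉ ZFSet.sInter (f v)) (ZFSet.sUnion (f v)))))

theorem pwV_mem {x : ZFSet} (hx : x ∈ V) : pwV V x ∈ V := by
  have h := hV.out.1.2 powAx (by simp [ZFCax])
  obtain ⟨c, hc, h2⟩ := h x hx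
  have h3 := sep_mem (V := V) (R := fun z v => z ⊆ v 0) inferInstance hc
    (fun _ => x) (fun _ => hx)
  have : ZFSet.sep (fun z => z ⊆ x) c = pwV V x := by
    ext z
    simp only [ZFSet.mem_sep, mem_pwV]
    constructor
    · rintro ⟨h, h'⟩; exact ⟨tr hc h, h'⟩
    · rintro ⟨h, h'⟩
      exact ⟨sat_mem2.1 (h2 z h fun y hy hyz => sat_mem2.2 (h' (sat_mem2.1 hyz))), h'⟩
  rw [← this]
  exact h3

instance DfF.pwV {f : Ctx → ZFSet} [hf : DfF V f] : DfF V (fun v => pwV V (f v)) := by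
  have := hf.shift
  refine DfF.of_mem (fun v hv => pwV_mem (hf.cl v hv)) ?_
  exact (inferInstance : Df V (fun w => w 0 ⊆ f (fun i => w (i + 1)))).congr
    fun v hv => by simp [mem_pwV, hv 0]

instance DfF.zimage {f : Ctx → ZFSet} {F : ZFSet → Ctx → ZFSet} [hf : DfF V f]
    [h : DfF V (fun w => F (w 0) (fun i => w (i + 1)))] :
    DfF V (fun v => zimage (fun a => F a v) (f v)) := by
  have h1 := hf.shift
  have hg : Df V (fun w => w 0 = F (w 1) (fun i => w (i + 2))) := h.gr
  have hg2 : Df V (fun w => w 1 = F (w 0) (fun i => w (i + 1 + 1))) :=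
    (hg.rename (fun i => match i with | 0 => 1 | 1 => 0 | n + 2 => n + 2)).congr fun v _ => Iff.rfl
  refine DfF.of_mem (fun v hv => ?_) ?_
  · obtain ⟨b, hb, hb2⟩ := collect (R := fun y a v => y = F a v) hg (hf.cl v hv) v hv
    have h3 := sep_mem (V := V) (R := fun z v => ∃ a ∈ f v, z = F a v) (by
      exact (inferInstance : Df V (fun w => ∃ a ∈ f (fun i => w (i + 1)), w 0 = F a (fun i => w (i + 1)))))
      hb v hv
    have : ZFSet.sep (fun z => ∃ a ∈ f v, z = F a v) b = SmallExt.zimage (fun a => F a v) (f v) := by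
      ext z
      simp only [ZFSet.mem_sep, mem_zimage]
      constructor
      · rintro ⟨-, a, ha, rfl⟩; exact ⟨a, ha, rfl⟩
      · rintro ⟨a, ha, rfl⟩
        refine ⟨?_, a, ha, rfl⟩
        obtain ⟨y, hy, rfl⟩ := hb2 a ha ⟨F a v, h.cl (vcons a v) (vcons_mem (tr (hf.cl v hv) ha) hv), rfl⟩
        exact hy
    rw [← this]
    exact h3
  · exact (inferInstance : Df V (fun w => ∃ a ∈ f (fun i => w (i + 1)),
      w 0 = F a (fun i => w (i + 1)))).congr fun v _ => by
        rw [mem_zimage]; exact exists_congr fun a => and_congr_right fun _ => eq_comm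

instance DfF.prod {f g : Ctx → ZFSet} [hf : DfF V f] [hg : DfF V g] :
    DfF V (fun v => ZFSet.prod (f v) (g v)) := by
  have := hg.shift
  refine (inferInstance : DfF V (fun v => ZFSet.sUnion (SmallExt.zimage (fun a =>
    SmallExt.zimage (fun b => SmallExt.opair a b) (g v)) (f v)))).congr fun v _ => ?_
  ext z
  simp only [ZFSet.mem_prod, ZFSet.mem_sUnion, mem_zimage]
  constructor
  · rintro ⟨a, ha, b, hb, rfl⟩; exact ⟨_, ⟨a, ha, rfl⟩, mem_zimage.2 ⟨b, hb, rfl⟩⟩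
  · rintro ⟨_, ⟨a, ha, rfl⟩, h⟩
    obtain ⟨b, hb, rfl⟩ := mem_zimage.1 h
    exact ⟨a, ha, b, hb, rfl⟩

theorem opair_mem {a b : ZFSet} (ha : a ∈ V) (hb : b ∈ V) : opair a b ∈ V :=
  pair_mem (pair_mem ha ha |> fun h => by simpa using h) (pair_mem ha hb)

theorem of_opair_mem {a b : ZFSet} (h : opair a b ∈ V) : a ∈ V ∧ b ∈ V := by
  have h1 : ({a, b} : ZFSet) ∈ V := tr h (by simp [opair, ZFSet.pair])
  exact ⟨tr h1 (by simp), tr h1 (by simp)⟩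

/-- `F x` as a closed term from a one-place definable function -/
theorem DfF.ap1 {F : ZFSet → ZFSet} (h : DfF V (fun v => F (v 0))) {x : ZFSet} (hx : x ∈ V) :
    F x ∈ V := h.cl (fun _ => x) (fun _ => hx)

theorem DfF.ap2 {F : ZFSet → ZFSet → ZFSet} (h : DfF V (fun v => F (v 0) (v 1))) {x y : ZFSet}
    (hx : x ∈ V) (hy : y ∈ V) : F x y ∈ V :=
  h.cl (vcons x fun _ => y) (vcons_mem hx fun _ => hy)

/-- the recursion theorem -/
theorem rec1 {α : Type*} [Preorder α] [WellFoundedLT α] {pred : ZFSet → ZFSet}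
    (hp : DfF V (fun v => pred (v 0)))
    {G : ZFSet → ZFSet → ZFSet} (hG : DfF V (fun v => G (v 0) (v 1))) {F : ZFSet → ZFSet}
    (μ : ZFSet → α) (hμ : ∀ x ∈ V, ∀ y ∈ pred x, μ y < μ x)
    (hF : ∀ x ∈ V, F x = G x (zimage (fun y => opair y (F y)) (pred x))) :
    DfF V (fun v => F (v 0)) := by
  let Good : ZFSet → Prop := fun f => ∀ q ∈ f, q = opair (zfst q) (zsnd q) ∧
    (∀ u ∈ pred (zfst q), ∃ r ∈ f, zfst r = u) ∧
    zsnd q = G (zfst q) (ZFSet.sep (fun r => zfst r ∈ pred (zfst q)) f)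
  let GoodF : ZFSet → Prop := fun f => ∀ q ∈ f, q = opair (zfst q) (F (zfst q)) ∧
    ∀ u ∈ pred (zfst q), opair u (F u) ∈ f
  have restr : ∀ f x, (∀ u ∈ pred x, opair u (F u) ∈ f) →
      (∀ q ∈ f, zfst q ∈ pred x → q = opair (zfst q) (F (zfst q))) →
      ZFSet.sep (fun r => zfst r ∈ pred x) f = zimage (fun y => opair y (F y)) (pred x) := by
    intro f x h1 h2
    ext q
    simp only [ZFSet.mem_sep, mem_zimage]
    constructor
    · rintro ⟨hq, hq2⟩; exact ⟨_, hq2, (h2 q hq hq2).symm⟩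
    · rintro ⟨u, hu, rfl⟩; exact ⟨h1 u hu, by simpa using hu⟩
  have toF : ∀ f ∈ V, Good f → GoodF f := by
    intro f hf hg
    have key : ∀ q ∈ f, q = opair (zfst q) (F (zfst q)) := by
      intro q
      induction h : μ (zfst q) using WellFoundedLT.induction generalizing q with
      | ind o ih =>
        intro hq
        obtain ⟨h1, h2, h3⟩ := hg q hq
        have hqV : zfst q ∈ V := (of_opair_mem (h1 ▸ tr hf hq : opair (zfst q) (zsnd q) ∈ V)).1
        have hlt : ∀ r ∈ f, zfst r ∈ pred (zfst q) → r = opair (zfst r) (F (zfst r)) :=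
          fun r hr hr2 => ih _ (h ▸ hμ _ hqV _ hr2) r rfl hr
        rw [restr f (zfst q) (fun u hu => by
          obtain ⟨r, hr, rfl⟩ := h2 u hu
          rw [← hlt r hr hu]; exact hr) hlt, ← hF _ hqV] at h3
        rw [← h3]; exact h1
    intro q hq
    refine ⟨key q hq, fun u hu => ?_⟩
    obtain ⟨r, hr, rfl⟩ := (hg q hq).2.1 u hu
    rw [← key r hr]; exact hr
  have ofF : ∀ f ∈ V, GoodF f → Good f := by
    intro f hf hg q hq
    obtain ⟨h1, h2⟩ := hg q hq
    have hqV : zfst q ∈ V := (of_opair_mem (h1 ▸ tr hf hq : opair (zfst q) (F (zfst q)) ∈ V)).1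
    have h3 : zsnd q = F (zfst q) := by rw [h1, zsnd_opair, zfst_opair]
    refine ⟨h3 ▸ h1, fun u hu => ⟨_, h2 u hu, zfst_opair _ _⟩, ?_⟩
    rw [h3, restr f _ h2 fun r hr _ => (hg r hr).1, ← hF _ hqV]
  have dGood : Df V (fun v => Good (v 0)) := by
    have : ∀ {f : Ctx → ZFSet} [DfF V f], DfF V (fun v => pred (f v)) := fun {f} {hf} => hp.comp1 hf
    have : ∀ {f g : Ctx → ZFSet} [DfF V f] [DfF V g], DfF V (fun v => G (f v) (g v)) :=
      fun {f g} {hf hg} => hG.comp2 hf hg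
    exact (inferInstance : Df V (fun v => ∀ q ∈ v 0, q = opair (zfst q) (zsnd q) ∧
      (∀ u ∈ pred (zfst q), ∃ r ∈ v 0, zfst r = u) ∧
      zsnd q = G (zfst q) (ZFSet.sep (fun r => zfst r ∈ pred (zfst q)) (v 0))))
  have ex : ∀ x ∈ V, ∃ f ∈ V, GoodF f ∧ opair x (F x) ∈ f := by
    intro x
    induction h : μ x using WellFoundedLT.induction generalizing x with
    | ind o ih =>
      intro hx
      have hpx : pred x ∈ V := hp.ap1 hx
      have : ∀ {f : Ctx → ZFSet} [DfF V f], Df V (fun v => Good (f v)) :=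
        fun {f} {hf} => Df.comp1 (F := Good) dGood hf
      obtain ⟨b, hb, hb2⟩ := collect (V := V) (R := fun f u _ => Good f ∧ ∃ r ∈ f, zfst r = u)
        inferInstance hpx (fun _ => ∅) (fun _ => empty_mem')
      have hf0 : ZFSet.sUnion (ZFSet.sep (fun f => Good f) b) ∈ V :=
        sUnion_mem (sep_mem (V := V) (R := fun f _ => Good f) inferInstance hb
          (fun _ => ∅) (fun _ => empty_mem'))
      set f0 := ZFSet.sUnion (ZFSet.sep (fun f => Good f) b) with hf0def
      have gF : GoodF f0 := by
        intro q hq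
        obtain ⟨f, hf, hqf⟩ := ZFSet.mem_sUnion.1 hq
        obtain ⟨hfb, hfg⟩ := ZFSet.mem_sep.1 hf
        obtain ⟨h1, h2⟩ := toF f (tr hb hfb) hfg q hqf
        exact ⟨h1, fun u hu => ZFSet.mem_sUnion.2 ⟨f, hf, h2 u hu⟩⟩
      have hall : ∀ u ∈ pred x, opair u (F u) ∈ f0 := by
        intro u hu
        obtain ⟨f, hf, hf2, hf3⟩ := ih _ (h ▸ hμ x hx u hu) u rfl (tr hpx hu)
        obtain ⟨f', hf', hg', r, hr, rfl⟩ := hb2 u hu ⟨f, hf, ofF f hf hf2, _, hf3, zfst_opair _ _⟩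
        refine ZFSet.mem_sUnion.2 ⟨f', ZFSet.mem_sep.2 ⟨hf', hg'⟩, ?_⟩
        rw [← (toF f' (tr hb hf') hg' r hr).1]; exact hr
      have hFx : F x ∈ V := by
        rw [hF x hx, ← restr f0 x hall fun q hq _ => (gF q hq).1]
        refine hG.ap2 hx ?_
        have : Fact (pred x ∈ V) := ⟨hpx⟩
        exact sep_mem (V := V) (R := fun r _ => zfst r ∈ pred x) inferInstance hf0
          (fun _ => ∅) (fun _ => empty_mem')
      refine ⟨insert (opair x (F x)) f0, ?_, ?_, by simp⟩
      · exact (inferInstance : DfF V (fun v => insert (v 0) (v 1))).ap2 (F := fun a b => insert a b)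
          (opair_mem hx hFx) hf0
      · intro q hq
        rcases ZFSet.mem_insert_iff.1 hq with rfl | hq
        · refine ⟨by simp, fun u hu => ?_⟩
          rw [zfst_opair] at hu
          exact ZFSet.mem_insert_iff.2 (Or.inr (hall u hu))
        · obtain ⟨h1, h2⟩ := gF q hq
          exact ⟨h1, fun u hu => ZFSet.mem_insert_iff.2 (Or.inr (h2 u hu))⟩
  refine ⟨fun v hv => ?_, ?_⟩
  · obtain ⟨f, hf, -, h⟩ := ex (v 0) (hv 0)
    exact (of_opair_mem (tr hf h)).2
  · have : Df V (fun v => Good (v 0)) := dGood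
    refine (inferInstance : Df V (fun w => ∃ f ∈ V, Good f ∧ opair (w 1) (w 0) ∈ f)).congr
      fun v hv => ?_
    constructor
    · intro e
      obtain ⟨f, hf, h1, h2⟩ := ex (v 1) (hv 1)
      exact ⟨f, hf, ofF f hf h1, by rw [e]; exact h2⟩
    · rintro ⟨f, hf, h1, h2⟩
      have := (toF f hf h1 _ h2).1
      rw [zfst_opair, opair_inj] at this
      exact this.2

theorem rec2 {α : Type*} [Preorder α] [WellFoundedLT α] {pred : ZFSet → ZFSet → ZFSet}
    (hp : DfF V (fun v => pred (v 0) (v 1)))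
    {G : ZFSet → ZFSet → ZFSet → ZFSet} (hG : DfF V (fun v => G (v 0) (v 1) (v 2)))
    {F : ZFSet → ZFSet → ZFSet}
    (μ : ZFSet → ZFSet → α) (hμ : ∀ A ∈ V, ∀ x ∈ V, ∀ y ∈ pred A x, μ A y < μ A x)
    (hF : ∀ A ∈ V, ∀ x ∈ V, F A x = G A x (zimage (fun y => opair y (F A y)) (pred A x))) :
    DfF V (fun v => F (v 0) (v 1)) := by
  have zf : ∀ z ∈ V, zfst z ∈ V := fun z hz =>
    (inferInstance : DfF V (fun v => zfst (v 0))).ap1 (F := fun z => zfst z) hz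
  have zs : ∀ z ∈ V, zsnd z ∈ V := fun z hz =>
    (inferInstance : DfF V (fun v => zsnd (v 0))).ap1 (F := fun z => zsnd z) hz
  have : ∀ {f g : Ctx → ZFSet} [DfF V f] [DfF V g], DfF V (fun v => pred (f v) (g v)) :=
    fun {f g} {hf hg} => hp.comp2 hf hg
  have : ∀ {f g k : Ctx → ZFSet} [DfF V f] [DfF V g] [DfF V k], DfF V (fun v => G (f v) (g v) (k v)) :=
    fun {f g k} {hf hg hk} => hG.comp3 hf hg hk
  have key : DfF V (fun v => (fun z => F (zfst z) (zsnd z)) (v 0)) := by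
    refine rec1 (V := V) (F := fun z => F (zfst z) (zsnd z)) (pred := fun z => zimage (fun y => opair (zfst z) y) (pred (zfst z) (zsnd z)))
      (G := fun z r => G (zfst z) (zsnd z) (zimage (fun q => opair (zsnd (zfst q)) (zsnd q)) r))
      inferInstance inferInstance (fun z => μ (zfst z) (zsnd z)) ?_ ?_
    · intro z hz y hy
      obtain ⟨u, hu, rfl⟩ := mem_zimage.1 hy
      simpa using hμ _ (zf z hz) _ (zs z hz) u hu
    · intro z hz
      rw [hF _ (zf z hz) _ (zs z hz)]
      congr 1
      ext q
      simp only [mem_zimage]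
      constructor
      · rintro ⟨u, hu, rfl⟩
        exact ⟨_, ⟨_, ⟨u, hu, rfl⟩, rfl⟩, by simp⟩
      · rintro ⟨_, ⟨_, ⟨u, hu, rfl⟩, rfl⟩, rfl⟩
        exact ⟨u, hu, by simp⟩
  refine (key.comp1 (F := fun z => F (zfst z) (zsnd z)) (f := fun v => opair (v 0) (v 1))
    inferInstance).congr fun v _ => by simp

/-- ∈-recursion -/
theorem rec2E {G : ZFSet → ZFSet → ZFSet → ZFSet} (hG : DfF V (fun v => G (v 0) (v 1) (v 2)))
    {F : ZFSet → ZFSet → ZFSet}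
    (hF : ∀ A x, F A x = G A x (zimage (fun y => opair y (F A y)) x)) :
    DfF V (fun v => F (v 0) (v 1)) :=
  rec2 (V := V) (pred := fun _ x => x) inferInstance hG (fun _ x => x.rank)
    (fun _ _ _ _ _ hy => ZFSet.rank_lt_of_mem hy) (fun A _ x _ => hF A x)

end trans

/-- existence of functions by ∈-recursion -/
theorem exists_epsRec (G : ZFSet.{0} → ZFSet.{0} → ZFSet.{0} → ZFSet.{0}) :
    ∃ F : ZFSet → ZFSet → ZFSet, ∀ A x, F A x = G A x (zimage (fun y => opair y (F A y)) x) := by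
  classical
  refine ⟨fun A => ZFSet.mem_wf.fix fun x rec =>
    G A x (zimage (fun y => if h : y ∈ x then opair y (rec y h) else ∅) x), fun A x => ?_⟩
  show WellFounded.fix _ _ _ = _
  rw [WellFounded.fix_eq]
  congr 1
  ext q
  simp only [mem_zimage]
  refine exists_congr fun y => and_congr_right fun hy => ?_
  rw [dif_pos hy]

def epsRec (G : ZFSet.{0} → ZFSet.{0} → ZFSet.{0} → ZFSet.{0}) : ZFSet.{0} → ZFSet.{0} → ZFSet.{0} := (exists_epsRec G).choose

theorem epsRec_eq (G : ZFSet → ZFSet → ZFSet → ZFSet) (A x : ZFSet) :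
    epsRec G A x = G A x (zimage (fun y => opair y (epsRec G A y)) x) :=
  (exists_epsRec G).choose_spec A x

theorem epsRec_DfF {V : ZFSet} [Fact (IsCTM V)] {G : ZFSet → ZFSet → ZFSet → ZFSet}
    (hG : DfF V (fun v => G (v 0) (v 1) (v 2))) {f g : Ctx → ZFSet} (hf : DfF V f) (hg : DfF V g) :
    DfF V (fun v => epsRec G (f v) (g v)) :=
  (rec2E hG (epsRec_eq G)).comp2 hf hg

end SmallExt

namespace SmallExt

theorem zext {x y : ZFSet.{0}} (h : ∀ z, z ∈ x ↔ z ∈ y) : x = y := ZFSet.ext h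

/-- union recursion -/
def uRec (H : ZFSet.{0} → ZFSet.{0} → ZFSet.{0} → ZFSet.{0}) : ZFSet.{0} → ZFSet.{0} → ZFSet.{0} :=
  epsRec (fun A _ r => ZFSet.sUnion (zimage (fun q => H A (zfst q) (zsnd q)) r))

theorem mem_uRec {H : ZFSet → ZFSet → ZFSet → ZFSet} {A x z : ZFSet} :
    z ∈ uRec H A x ↔ ∃ y ∈ x, z ∈ H A y (uRec H A y) := by
  unfold uRec
  rw [epsRec_eq]
  simp only [ZFSet.mem_sUnion, mem_zimage]
  constructor
  · rintro ⟨_, ⟨_, ⟨y, hy, rfl⟩, rfl⟩, hz⟩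
    exact ⟨y, hy, by simpa using hz⟩
  · rintro ⟨y, hy, hz⟩
    exact ⟨_, ⟨_, ⟨y, hy, rfl⟩, rfl⟩, by simpa using hz⟩

theorem uRec_DfF {V : ZFSet} [Fact (IsCTM V)] {H : ZFSet → ZFSet → ZFSet → ZFSet}
    (hH : DfF V (fun v => H (v 0) (v 1) (v 2))) {f g : Ctx → ZFSet} (hf : DfF V f) (hg : DfF V g) :
    DfF V (fun v => uRec H (f v) (g v)) := by
  have : ∀ {f g k : Ctx → ZFSet} [DfF V f] [DfF V g] [DfF V k], DfF V (fun v => H (f v) (g v) (k v)) :=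
    fun {f g k} {hf hg hk} => hH.comp3 hf hg hk
  exact epsRec_DfF (G := fun A _ r => ZFSet.sUnion (zimage (fun q => H A (zfst q) (zsnd q)) r)) inferInstance hf hg

/-- iteration of an increasing operator -/
theorem uRec_step {H : ZFSet → ZFSet → ZFSet → ZFSet} {A x y : ZFSet} (hy : y ∈ x) :
    H A y (uRec H A y) ⊆ uRec H A x := fun _ hz => mem_uRec.2 ⟨y, hy, hz⟩

theorem uRec_mono {H : ZFSet → ZFSet → ZFSet → ZFSet} {A x y : ZFSet} (h : ∀ y r, r ⊆ H A y r) (hy : y ∈ x) :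
    uRec H A y ⊆ uRec H A x := fun _ hz => mem_uRec.2 ⟨y, hy, h _ _ hz⟩

def omZ : ZFSet.{0} := ZFSet.range natZ

theorem mem_omZ {x : ZFSet} : x ∈ omZ ↔ ∃ n, natZ n = x := by
  simp [omZ]

theorem mem_natZ {n : ℕ} {y : ZFSet} : y ∈ natZ n ↔ ∃ m < n, y = natZ m := by
  induction n with
  | zero => simp [natZ]
  | succ n ih =>
    simp only [natZ, ZFSet.mem_insert_iff, ih]
    constructor
    · rintro (rfl | ⟨m, hm, rfl⟩)
      · exact ⟨n, by omega, rfl⟩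
      · exact ⟨m, by omega, rfl⟩
    · rintro ⟨m, hm, rfl⟩
      rcases Nat.lt_succ_iff_lt_or_eq.1 hm with h | rfl
      · exact Or.inr ⟨m, h, rfl⟩
      · exact Or.inl rfl

theorem natZ_inj {m n : ℕ} : natZ m = natZ n ↔ m = n := by
  refine ⟨fun h => ?_, fun h => by rw [h]⟩
  rcases lt_trichotomy m n with h' | h' | h'
  · exact absurd (by have := mem_natZ.2 ⟨m, h', rfl⟩; rwa [← h] at this : natZ m ∈ natZ m) (ZFSet.mem_irrefl _)
  · exact h'
  · exact absurd (by have := mem_natZ.2 ⟨n, h', rfl⟩; rwa [h] at this : natZ n ∈ natZ n) (ZFSet.mem_irrefl _)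

section trans
variable {V : ZFSet.{0}} [hV : Fact (IsCTM V)]

theorem exists_ind : ∃ I ∈ V, ∅ ∈ I ∧ ∀ y ∈ I, insert y y ∈ I := by
  have h := hV.out.1.2 infAx (by simp [ZFCax])
  simp only [SatV, infAx, Sat, sat_iff_and, sat_iff_iff, sat_iff_or, sat_mem2, sat_eq2, vcons] at h
  obtain ⟨I, hI, ⟨e, heV, heI, he⟩, h2⟩ := h
  have e0 : e = ∅ := by
    apply (ZFSet.eq_empty e).2
    intro y hy
    exact he y (tr heV hy) hy
  refine ⟨I, hI, e0 ▸ heI, fun y hy => ?_⟩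
  obtain ⟨z, hzV, hzI, -, hz⟩ := h2 y (tr hI hy) hy
  have : z = insert y y := by
    apply zext; intro u
    rw [ZFSet.mem_insert_iff]
    constructor
    · intro hu
      exact ((hz u (tr hzV hu)).1 hu).symm
    · rintro (rfl | hu)
      · exact (hz u (tr hI hy)).2 (Or.inr rfl)
      · exact (hz u (tr (tr hI hy) hu)).2 (Or.inl hu)
  exact this ▸ hzI

theorem omZ_mem : omZ ∈ V := by
  obtain ⟨I, hI, h0, hs⟩ := exists_ind (V := V)
  have hD : Df V fun w => ∀ J ∈ V, (∅ ∈ J ∧ ∀ y ∈ J, insert y y ∈ J) → w 0 ∈ J := inferInstance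
  have ho : ZFSet.sep (fun x => ∀ J ∈ V, (∅ ∈ J ∧ ∀ y ∈ J, insert y y ∈ J) → x ∈ J) I ∈ V :=
    sep_mem (V := V) (R := fun x _ => ∀ J ∈ V, (∅ ∈ J ∧ ∀ y ∈ J, insert y y ∈ J) → x ∈ J)
      hD hI (fun _ => ∅) (fun _ => empty_mem')
  set o := ZFSet.sep (fun x => ∀ J ∈ V, (∅ ∈ J ∧ ∀ y ∈ J, insert y y ∈ J) → x ∈ J) I with hod
  have oi : ∅ ∈ o ∧ ∀ y ∈ o, insert y y ∈ o := by
    simp only [hod, ZFSet.mem_sep]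
    exact ⟨⟨h0, fun J _ hJ => hJ.1⟩, fun y hy => ⟨hs _ hy.1, fun J h hJ => hJ.2 _ (hy.2 J h hJ)⟩⟩
  have n1 : ∀ n, natZ n ∈ o := by
    intro n
    induction n with
    | zero => exact oi.1
    | succ n ih => exact oi.2 _ ih
  have n2 : ∀ x, x ∈ o → ∃ n, natZ n = x := by
    intro x
    induction x using ZFSet.inductionOn with
    | _ x ih =>
      intro hx
      by_contra hn
      have hxV := tr ho hx
      have hJ : o \ {x} ∈ V :=
        (inferInstance : DfF V (fun v => v 0 \ {v 1})).ap2 (F := fun a b => a \ {b}) ho hxV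
      have := (ZFSet.mem_sep.1 hx).2 _ hJ ⟨?_, ?_⟩
      · simp at this
      · refine ZFSet.mem_sdiff.2 ⟨oi.1, ?_⟩
        rw [ZFSet.mem_singleton]
        rintro rfl
        exact hn ⟨0, rfl⟩
      · intro y hy
        rw [ZFSet.mem_sdiff, ZFSet.mem_singleton] at hy
        refine ZFSet.mem_sdiff.2 ⟨oi.2 _ hy.1, ?_⟩
        rw [ZFSet.mem_singleton]
        rintro rfl
        obtain ⟨n, rfl⟩ := ih y (by simp) hy.1
        exact hn ⟨n + 1, rfl⟩
  have : omZ = o := by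
    apply zext; intro z
    rw [mem_omZ]
    exact ⟨by rintro ⟨n, rfl⟩; exact n1 n, n2 z⟩
  exact this ▸ ho

instance : Fact (omZ ∈ V) := ⟨omZ_mem⟩
instance (n : ℕ) : Fact (natZ n ∈ V) := ⟨tr omZ_mem (mem_omZ.2 ⟨n, rfl⟩)⟩
theorem natZ_mem (n : ℕ) : natZ n ∈ V := tr omZ_mem (mem_omZ.2 ⟨n, rfl⟩)

end trans

/-! finite subsets -/
def finH (L _y r : ZFSet.{0}) : ZFSet.{0} :=
  insert ∅ (ZFSet.sUnion (zimage (fun a => zimage (fun p => insert a p) r) L))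

theorem mem_finH {L y r z : ZFSet} : z ∈ finH L y r ↔ z = ∅ ∨ ∃ a ∈ L, ∃ p ∈ r, insert a p = z := by
  simp only [finH, ZFSet.mem_insert_iff, ZFSet.mem_sUnion, mem_zimage]
  constructor
  · rintro (h | ⟨_, ⟨a, ha, rfl⟩, h⟩)
    · exact Or.inl h
    · exact Or.inr ⟨a, ha, mem_zimage.1 h⟩
  · rintro (h | ⟨a, ha, h⟩)
    · exact Or.inl h
    · exact Or.inr ⟨_, ⟨a, ha, rfl⟩, mem_zimage.2 h⟩

theorem mem_finSubsets {L p : ZFSet} : p ∈ finSubsets L ↔ p ⊆ L ∧ (p : Set ZFSet).Finite := by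
  simp only [finSubsets, ZFSet.mem_sep, ZFSet.mem_powerset]; rfl

theorem coe_insert' (a p : ZFSet.{0}) : ((insert a p : ZFSet) : Set ZFSet) = insert a (p : Set ZFSet) := by
  ext z; simp [ZFSet.mem_insert_iff]

theorem finSubsets_eq (L : ZFSet.{0}) : finSubsets L = ZFSet.sUnion (zimage (fun n => uRec finH L n) omZ) := by
  apply zext; intro p
  simp only [ZFSet.mem_sUnion, mem_zimage, mem_finSubsets]
  constructor
  · rintro ⟨h1, h2⟩
    suffices H : ∀ s : Set ZFSet, s.Finite → ∀ p : ZFSet, (p : Set ZFSet) = s → p ⊆ L →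
        ∃ n, p ∈ uRec finH L (natZ n) by
      obtain ⟨n, hn⟩ := H _ h2 p rfl h1
      exact ⟨_, ⟨_, mem_omZ.2 ⟨n, rfl⟩, rfl⟩, hn⟩
    intro s hs
    induction s, hs using Set.Finite.induction_on with
    | empty =>
      intro p hp _
      refine ⟨1, mem_uRec.2 ⟨natZ 0, by simp [natZ], mem_finH.2 (Or.inl ?_)⟩⟩
      apply (ZFSet.eq_empty p).2
      intro y hy
      have : y ∈ (p : Set ZFSet) := hy
      rw [hp] at this; exact this
    | @insert a s ha hs ih =>
      intro p hp hpL
      have hap : a ∈ p := by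
        have : a ∈ (p : Set ZFSet) := by rw [hp]; exact Set.mem_insert _ _
        exact this
      obtain ⟨n, hn⟩ := ih (p \ {a}) (by
        ext z
        have : z ∈ p ↔ z ∈ (p : Set ZFSet) := Iff.rfl
        show z ∈ p \ {a} ↔ _
        rw [ZFSet.mem_sdiff, this, hp, ZFSet.mem_singleton]
        constructor
        · rintro ⟨h | h, h'⟩
          · exact absurd h h'
          · exact h
        · intro h
          exact ⟨Or.inr h, fun h' => ha (h' ▸ h)⟩) (fun z hz => hpL (ZFSet.mem_sdiff.1 hz).1)
      refine ⟨n + 1, mem_uRec.2 ⟨natZ n, by simp [natZ], mem_finH.2 (Or.inr ⟨a, hpL hap, _, hn, ?_⟩)⟩⟩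
      apply zext; intro z
      rw [ZFSet.mem_insert_iff, ZFSet.mem_sdiff, ZFSet.mem_singleton]
      constructor
      · rintro (rfl | h)
        · exact hap
        · exact h.1
      · intro h
        by_cases h' : z = a
        · exact Or.inl h'
        · exact Or.inr ⟨h, h'⟩
  · rintro ⟨_, ⟨n, -, rfl⟩, hp⟩
    induction n using ZFSet.inductionOn generalizing p with
    | _ n ih =>
      obtain ⟨y, hy, h⟩ := mem_uRec.1 hp
      rcases mem_finH.1 h with rfl | ⟨a, ha, q, hq, rfl⟩
      · refine ⟨fun z hz => absurd hz (ZFSet.notMem_empty _), ?_⟩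
        have : ((∅ : ZFSet.{0}) : Set ZFSet) = ∅ := by ext; simp
        rw [this]; exact Set.finite_empty
      · obtain ⟨h1, h2⟩ := ih y hy q hq
        refine ⟨fun z hz => ?_, ?_⟩
        · rcases ZFSet.mem_insert_iff.1 hz with rfl | hz
          · exact ha
          · exact h1 hz
        · rw [coe_insert']; exact h2.insert a

instance DfF.finSubsets {V : ZFSet.{0}} [hV : Fact (IsCTM V)] {f : Ctx → ZFSet} [hf : DfF V f] :
    DfF V (fun v => finSubsets (f v)) := by
  have : ∀ {f g : Ctx → ZFSet} [DfF V f] [DfF V g], DfF V (fun v => uRec finH (f v) (g v)) :=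
    fun {f g} {hf hg} => uRec_DfF (by unfold finH; infer_instance) hf hg
  simp only [finSubsets_eq]
  have := hf.shift
  infer_instance

/-! transitive closure -/
def tcl (x : ZFSet.{0}) : ZFSet.{0} := uRec (fun _ y r => insert y r) ∅ x

theorem mem_tcl {x z : ZFSet} : z ∈ tcl x ↔ ∃ y ∈ x, z = y ∨ z ∈ tcl y := by
  unfold tcl; rw [mem_uRec]; simp only [ZFSet.mem_insert_iff]

theorem sub_tcl {x z : ZFSet} (h : z ∈ x) : z ∈ tcl x := mem_tcl.2 ⟨z, h, Or.inl rfl⟩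

theorem tcl_trans {x z y : ZFSet} (h : z ∈ tcl x) (hy : y ∈ z) : y ∈ tcl x := by
  induction x using ZFSet.inductionOn with
  | _ x ih =>
    obtain ⟨u, hu, rfl | h⟩ := mem_tcl.1 h
    · exact mem_tcl.2 ⟨z, hu, Or.inr (sub_tcl hy)⟩
    · exact mem_tcl.2 ⟨u, hu, Or.inr (ih u hu h)⟩

instance DfF.tcl {V : ZFSet.{0}} [hV : Fact (IsCTM V)] {f : Ctx → ZFSet} [hf : DfF V f] :
    DfF V (fun v => tcl (f v)) :=
  uRec_DfF (H := fun _ y r => Insert.insert y r) inferInstance inferInstance hf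

/-! rank -/
def rkZ (x : ZFSet.{0}) : ZFSet.{0} := uRec (fun _ _ r => insert r r) ∅ x

theorem mem_rkZ {x z : ZFSet} : z ∈ rkZ x ↔ ∃ y ∈ x, z = rkZ y ∨ z ∈ rkZ y := by
  unfold rkZ; rw [mem_uRec]; simp only [ZFSet.mem_insert_iff]

instance DfF.rkZ {V : ZFSet.{0}} [hV : Fact (IsCTM V)] {f : Ctx → ZFSet} [hf : DfF V f] :
    DfF V (fun v => rkZ (f v)) :=
  uRec_DfF (H := fun _ _ r => Insert.insert r r) inferInstance inferInstance hf

theorem rkZ_trans {x z y : ZFSet} (h : z ∈ rkZ x) (hy : y ∈ z) : y ∈ rkZ x := by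
  induction x using ZFSet.inductionOn with
  | _ x ih =>
    obtain ⟨u, hu, rfl | h⟩ := mem_rkZ.1 h
    · exact mem_rkZ.2 ⟨u, hu, Or.inr hy⟩
    · exact mem_rkZ.2 ⟨u, hu, Or.inr (ih u hu h)⟩

theorem rkZ_isOrd (x : ZFSet.{0}) : IsOrd (rkZ x) := by
  induction x using ZFSet.inductionOn with
  | _ x ih =>
    refine ⟨fun z hz y hy => rkZ_trans hz hy, fun z hz => ?_⟩
    obtain ⟨u, hu, rfl | h⟩ := mem_rkZ.1 hz
    · exact (ih u hu).1
    · exact (ih u hu).2 z h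

theorem IsOrd.mem {x y : ZFSet} (h : IsOrd x) (hy : y ∈ x) : IsOrd y :=
  ⟨h.2 y hy, fun z hz => h.2 z (h.1 y hy hz)⟩

theorem isOrd_iff {x : ZFSet.{0}} : IsOrd x ↔ x.IsOrdinal :=
  (ZFSet.isOrdinal_iff_forall_mem_isTransitive).symm

theorem rkZ_of_ord {x : ZFSet.{0}} (h : IsOrd x) : rkZ x = x := by
  induction x using ZFSet.inductionOn with
  | _ x ih =>
    apply zext; intro z
    rw [mem_rkZ]
    constructor
    · rintro ⟨y, hy, h'⟩
      rw [ih y hy (h.mem hy)] at h'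
      rcases h' with rfl | h'
      · exact hy
      · exact h.1 y hy h'
    · intro hz
      exact ⟨z, hz, Or.inl (ih z hz (h.mem hz)).symm⟩

theorem ord_tri {x y : ZFSet.{0}} (hx : IsOrd x) (hy : IsOrd y) : x ∈ y ∨ x = y ∨ y ∈ x :=
  (isOrd_iff.1 hx).mem_trichotomous (isOrd_iff.1 hy)

/-- closure under pairs -/
def pcH (A _y r : ZFSet.{0}) : ZFSet.{0} := A ∪ (r ∪ zimage (fun q => {zfst q, zsnd q}) (ZFSet.prod r r))
def pcl (A : ZFSet.{0}) : ZFSet.{0} := ZFSet.sUnion (zimage (fun n => uRec pcH A n) omZ)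

theorem mem_pcH {A y r z : ZFSet} : z ∈ pcH A y r ↔ z ∈ A ∨ z ∈ r ∨ ∃ a ∈ r, ∃ b ∈ r, z = {a, b} := by
  simp only [pcH, ZFSet.mem_union, mem_zimage, ZFSet.mem_prod]
  refine or_congr_right (or_congr_right ⟨?_, ?_⟩)
  · rintro ⟨_, ⟨a, ha, b, hb, rfl⟩, rfl⟩
    exact ⟨a, ha, b, hb, by have := zfst_opair a b; have := zsnd_opair a b; simp_all [SmallExt.opair]⟩
  · rintro ⟨a, ha, b, hb, rfl⟩
    exact ⟨_, ⟨a, ha, b, hb, rfl⟩, by have := zfst_opair a b; have := zsnd_opair a b; simp_all [SmallExt.opair]⟩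

theorem mem_pcl {A z : ZFSet} : z ∈ pcl A ↔ ∃ n, z ∈ uRec pcH A (natZ n) := by
  simp only [pcl, ZFSet.mem_sUnion, mem_zimage, mem_omZ]
  constructor
  · rintro ⟨_, ⟨_, ⟨n, rfl⟩, rfl⟩, h⟩; exact ⟨n, h⟩
  · rintro ⟨n, h⟩; exact ⟨_, ⟨_, ⟨n, rfl⟩, rfl⟩, h⟩

theorem pcl_mono {A : ZFSet} {m n : ℕ} (h : m ≤ n) : uRec pcH A (natZ m) ⊆ uRec pcH A (natZ n) := by
  rcases h.lt_or_eq with h | rfl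
  · exact uRec_mono (fun y r z hz => mem_pcH.2 (Or.inr (Or.inl hz))) (mem_natZ.2 ⟨m, h, rfl⟩)
  · exact fun z hz => hz

theorem sub_pcl {A z : ZFSet} (h : z ∈ A) : z ∈ pcl A :=
  mem_pcl.2 ⟨1, mem_uRec.2 ⟨natZ 0, by simp [natZ], mem_pcH.2 (Or.inl h)⟩⟩

theorem pcl_pair {A a b : ZFSet} (ha : a ∈ pcl A) (hb : b ∈ pcl A) : ({a, b} : ZFSet) ∈ pcl A := by
  obtain ⟨m, hm⟩ := mem_pcl.1 ha
  obtain ⟨n, hn⟩ := mem_pcl.1 hb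
  refine mem_pcl.2 ⟨max m n + 1, mem_uRec.2 ⟨natZ (max m n), by simp [natZ], mem_pcH.2 (Or.inr (Or.inr
    ⟨a, pcl_mono (le_max_left _ _) hm, b, pcl_mono (le_max_right _ _) hn, rfl⟩))⟩⟩

theorem pcl_trans {A z y : ZFSet} (hA : ∀ u ∈ A, ∀ w ∈ u, w ∈ A) (hz : z ∈ pcl A) (hy : y ∈ z) : y ∈ pcl A := by
  obtain ⟨n, hn⟩ := mem_pcl.1 hz
  induction n generalizing z with
  | zero => obtain ⟨u, hu, -⟩ := mem_uRec.1 hn; simp [natZ] at hu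
  | succ n ih =>
    obtain ⟨u, hu, h⟩ := mem_uRec.1 hn
    obtain ⟨m, hm, rfl⟩ := mem_natZ.1 hu
    have hmn : uRec pcH A (natZ m) ⊆ uRec pcH A (natZ n) := pcl_mono (by omega)
    rcases mem_pcH.1 h with h | h | ⟨a, ha, b, hb, rfl⟩
    · exact sub_pcl (hA _ h _ hy)
    · exact ih hz hy (hmn h)
    · rcases ZFSet.mem_pair.1 hy with rfl | rfl
      · exact mem_pcl.2 ⟨_, ha⟩
      · exact mem_pcl.2 ⟨_, hb⟩

instance DfF.pcl {V : ZFSet.{0}} [hV : Fact (IsCTM V)] {f : Ctx → ZFSet} [hf : DfF V f] :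
    DfF V (fun v => pcl (f v)) := by
  have : ∀ {f g : Ctx → ZFSet} [DfF V f] [DfF V g], DfF V (fun v => uRec pcH (f v) (g v)) :=
    fun {f g} {hf hg} => uRec_DfF (by unfold pcH; infer_instance) hf hg
  simp only [SmallExt.pcl]
  have := hf.shift
  infer_instance

/-- stabilization of increasing iterations inside `V` -/
theorem stabilize {V : ZFSet.{0}} [hV : Fact (IsCTM V)] {H : ZFSet → ZFSet → ZFSet → ZFSet}
    (hH : DfF V (fun v => H (v 0) (v 1) (v 2))) {A X : ZFSet} (hA : A ∈ V) (hX : X ∈ V)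
    (hs : ∀ x ∈ V, uRec H A x ⊆ X) (hm : ∀ y r, r ⊆ H A y r) :
    ∃ b ∈ V, IsOrd b ∧ (∀ y, IsOrd y → y ∈ V → uRec H A y ⊆ uRec H A b ∧ H A y (uRec H A y) ⊆ uRec H A b) := by
  have : Fact (A ∈ V) := ⟨hA⟩
  have : ∀ {f g : Ctx → ZFSet} [DfF V f] [DfF V g], DfF V (fun v => uRec H (f v) (g v)) :=
    fun {f g} {hf hg} => uRec_DfF hH hf hg
  obtain ⟨b, hb, h⟩ := collect (V := V) (R := fun y a _ => a ∈ uRec H A (rkZ y)) inferInstance hX (fun _ => ∅)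
    (fun _ => empty_mem')
  have rk : ∀ y ∈ V, rkZ y ∈ V := fun y hy => (inferInstance : DfF V (fun v => rkZ (v 0))).ap1 hy
  have k1 : ∀ y, IsOrd y → y ∈ V → uRec H A y ⊆ uRec H A (rkZ b) := by
    intro y hy hyV a ha
    obtain ⟨z, hz, h'⟩ := h a (hs y hyV ha) ⟨y, hyV, by rw [rkZ_of_ord hy]; exact ha⟩
    exact uRec_mono hm (mem_rkZ.2 ⟨z, hz, Or.inl rfl⟩) h'
  refine ⟨rkZ b, rk b hb, rkZ_isOrd b, fun y hy hyV => ⟨k1 y hy hyV, ?_⟩⟩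
  have hs1 : ({y} : ZFSet) ∈ V := (inferInstance : DfF V (fun v => {v 0})).ap1 (F := fun a => {a}) hyV
  intro a ha
  have : a ∈ uRec H A (rkZ {y}) := by
    have : y ∈ rkZ {y} := mem_rkZ.2 ⟨y, by simp, Or.inl (rkZ_of_ord hy).symm⟩
    exact uRec_step this ha
  exact k1 _ (rkZ_isOrd _) (rk _ hs1) this

end SmallExt

namespace SmallExt

theorem rank_opair_left {a b x : ZFSet.{0}} (h : opair a b ∈ x) : a.rank < x.rank := by
  refine lt_trans ?_ (ZFSet.rank_lt_of_mem h)
  have h1 : ({a} : ZFSet) ∈ opair a b := by simp [opair, ZFSet.pair]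
  exact lt_trans (ZFSet.rank_lt_of_mem (by simp)) (ZFSet.rank_lt_of_mem h1)

theorem exists_rec1 {α : Type*} [Preorder α] [WellFoundedLT α] (pred : ZFSet.{0} → ZFSet.{0})
    (G : ZFSet.{0} → ZFSet.{0} → ZFSet.{0}) (μ : ZFSet.{0} → α) (hμ : ∀ x, ∀ y ∈ pred x, μ y < μ x) :
    ∃ F : ZFSet.{0} → ZFSet.{0}, ∀ x, F x = G x (zimage (fun y => opair y (F y)) (pred x)) := by
  classical
  have wf : WellFounded (fun x y => μ x < μ y) := InvImage.wf μ wellFounded_lt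
  refine ⟨wf.fix fun x rec =>
    G x (zimage (fun y => if h : μ y < μ x then opair y (rec y h) else ∅) (pred x)), fun x => ?_⟩
  rw [WellFounded.fix_eq]
  congr 1
  ext q
  simp only [mem_zimage]
  refine exists_congr fun y => and_congr_right fun hy => ?_
  rw [dif_pos (hμ x y hy)]

/-! evaluation of names -/
theorem exists_val (g : ZFSet.{0}) : ∃ F : ZFSet.{0} → ZFSet.{0}, ∀ x y, y ∈ F x ↔ ∃ s, ∃ p ∈ g, opair s p ∈ x ∧ F s = y := by
  obtain ⟨F, hF⟩ := exists_rec1 (fun x => zimage zfst (ZFSet.sep (fun z => z = opair (zfst z) (zsnd z) ∧ zsnd z ∈ g) x))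
    (fun _ r => zimage zsnd r) ZFSet.rank (by
      intro x y hy
      obtain ⟨z, hz, rfl⟩ := mem_zimage.1 hy
      rw [ZFSet.mem_sep] at hz
      exact rank_opair_left (b := zsnd z) (by rw [← hz.2.1]; exact hz.1))
  refine ⟨F, fun x y => ?_⟩
  rw [hF x]
  simp only [mem_zimage, ZFSet.mem_sep]
  constructor
  · rintro ⟨_, ⟨_, ⟨z, ⟨hz, e, hg⟩, rfl⟩, rfl⟩, rfl⟩
    exact ⟨zfst z, zsnd z, hg, e ▸ hz, by simp⟩
  · rintro ⟨s, p, hp, h, rfl⟩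
    exact ⟨_, ⟨s, ⟨_, ⟨h, by simp, by simpa using hp⟩, by simp⟩, rfl⟩, by simp⟩

def val (g : ZFSet.{0}) : ZFSet.{0} → ZFSet.{0} := (exists_val g).choose
theorem mem_val {g x y : ZFSet} : y ∈ val g x ↔ ∃ s, ∃ p ∈ g, opair s p ∈ x ∧ val g s = y :=
  (exists_val g).choose_spec x y

def IsNm (Q z : ZFSet.{0}) : Prop := z = opair (zfst z) (zsnd z) ∧ zsnd z ∈ Q

instance {V Q : ZFSet.{0}} [Fact (IsCTM V)] [Fact (Q ∈ V)] {f : Ctx → ZFSet} [DfF V f] : Df V (fun v => IsNm Q (f v)) := by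
  unfold IsNm; infer_instance

theorem isNm_opair {Q a b : ZFSet.{0}} (h : b ∈ Q) : IsNm Q (opair a b) := by simp [IsNm, h]

/-! forcing equality -/
def FEcl (Q a b p : ZFSet.{0}) (F : ZFSet.{0} → ZFSet.{0} → ZFSet.{0} → Prop) : Prop :=
  (∀ x ∈ a, IsNm Q x → ∀ p' ∈ Q, p ⊆ p' → zsnd x ⊆ p' → ∃ p'' ∈ Q, p' ⊆ p'' ∧
    ∃ y ∈ b, IsNm Q y ∧ zsnd y ⊆ p'' ∧ F (zfst x) (zfst y) p'') ∧
  (∀ y ∈ b, IsNm Q y → ∀ p' ∈ Q, p ⊆ p' → zsnd y ⊆ p' → ∃ p'' ∈ Q, p' ⊆ p'' ∧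
    ∃ x ∈ a, IsNm Q x ∧ zsnd x ⊆ p'' ∧ F (zfst x) (zfst y) p'')

def FEpred (Q z : ZFSet.{0}) : ZFSet.{0} :=
  zimage (fun u => opair (zfst (zfst u)) (zfst (zsnd u)))
    (ZFSet.sep (fun u => IsNm Q (zfst u) ∧ IsNm Q (zsnd u)) (ZFSet.prod (zfst z) (zsnd z)))

def FEG (Q z r : ZFSet.{0}) : ZFSet.{0} :=
  ZFSet.sep (fun p => FEcl Q (zfst z) (zsnd z) p (fun s t p'' => ∃ y ∈ r, zfst y = opair s t ∧ p'' ∈ zsnd y)) Q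

theorem mem_FEpred {Q z w : ZFSet} : w ∈ FEpred Q z ↔ ∃ x ∈ zfst z, ∃ y ∈ zsnd z, IsNm Q x ∧ IsNm Q y ∧
    w = opair (zfst x) (zfst y) := by
  simp only [FEpred, mem_zimage, ZFSet.mem_sep, ZFSet.mem_prod]
  constructor
  · rintro ⟨_, ⟨⟨x, hx, y, hy, rfl⟩, h1, h2⟩, rfl⟩
    have e1 := zfst_opair x y
    have e2 := zsnd_opair x y
    simp only [SmallExt.opair] at e1 e2
    rw [e1] at h1 ⊢; rw [e2] at h2 ⊢
    exact ⟨x, hx, y, hy, h1, h2, rfl⟩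
  · rintro ⟨x, hx, y, hy, h1, h2, rfl⟩
    have e1 := zfst_opair x y
    have e2 := zsnd_opair x y
    simp only [SmallExt.opair] at e1 e2
    exact ⟨_, ⟨⟨x, hx, y, hy, rfl⟩, by rwa [e1], by rwa [e2]⟩, by rw [e1, e2]⟩

theorem FEpred_rank (Q x : ZFSet.{0}) : ∀ y ∈ FEpred Q x, (zfst y).rank < (zfst x).rank := by
  intro w hw
  obtain ⟨x', hx', y, hy, h1, h2, rfl⟩ := mem_FEpred.1 hw
  rw [zfst_opair]
  exact rank_opair_left (b := zsnd x') (by rw [← h1.1]; exact hx')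

theorem exists_FE (Q : ZFSet.{0}) : ∃ F : ZFSet.{0} → ZFSet.{0},
    ∀ x, F x = FEG Q x (zimage (fun y => opair y (F y)) (FEpred Q x)) :=
  exists_rec1 _ _ _ (FEpred_rank Q)

def FE0 (Q : ZFSet.{0}) : ZFSet.{0} → ZFSet.{0} := (exists_FE Q).choose
def FE (Q a b : ZFSet.{0}) : ZFSet.{0} := FE0 Q (opair a b)

theorem mem_FE {Q a b p : ZFSet} : p ∈ FE Q a b ↔ p ∈ Q ∧ FEcl Q a b p (fun s t p'' => p'' ∈ FE Q s t) := by
  rw [FE, FE0, (exists_FE Q).choose_spec, FEG, ZFSet.mem_sep]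
  refine and_congr_right fun _ => ?_
  have key : ∀ x ∈ a, ∀ y ∈ b, IsNm Q x → IsNm Q y → ∀ p'', ((∃ y_1 ∈ zimage (fun y ↦ opair y ((exists_FE Q).choose y)) (FEpred Q (opair a b)), zfst y_1 = opair (zfst x) (zfst y) ∧ p'' ∈ zsnd y_1) ↔ p'' ∈ FE Q (zfst x) (zfst y)) := by
    intro x hx y hy h1 h2 p''
    constructor
    · rintro ⟨_, hu, e, h⟩
      obtain ⟨w, hw, rfl⟩ := mem_zimage.1 hu
      rw [zfst_opair] at e; rw [zsnd_opair] at h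
      subst e
      exact h
    · intro h
      refine ⟨_, mem_zimage.2 ⟨opair (zfst x) (zfst y), mem_FEpred.2 ⟨x, by simpa using hx, y, by simpa using hy, h1, h2, rfl⟩, rfl⟩, by simp, by rw [zsnd_opair]; exact h⟩
  simp only [zfst_opair, zsnd_opair, FEcl]
  refine and_congr ?_ ?_
  · refine forall_congr' fun x => forall_congr' fun hx => forall_congr' fun h1 => ?_
    refine forall_congr' fun p' => forall_congr' fun _ => forall_congr' fun _ => forall_congr' fun _ => ?_
    refine exists_congr fun p'' => and_congr_right fun _ => and_congr_right fun _ => ?_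
    refine exists_congr fun y => and_congr_right fun hy => and_congr_right fun h2 => and_congr_right fun _ => ?_
    exact key x hx y hy h1 h2 p''
  · refine forall_congr' fun y => forall_congr' fun hy => forall_congr' fun h2 => ?_
    refine forall_congr' fun p' => forall_congr' fun _ => forall_congr' fun _ => forall_congr' fun _ => ?_
    refine exists_congr fun p'' => and_congr_right fun _ => and_congr_right fun _ => ?_
    refine exists_congr fun x => and_congr_right fun hx => and_congr_right fun h1 => and_congr_right fun _ => ?_
    exact key x hx y hy h1 h2 p''

set_option synthInstance.maxHeartbeats 400000 in
set_option synthInstance.maxSize 2000 in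
instance DfF.FE {V Q : ZFSet.{0}} [hV : Fact (IsCTM V)] [hQ : Fact (Q ∈ V)] {f g : Ctx → ZFSet} [hf : DfF V f] [hg : DfF V g] :
    DfF V (fun v => FE Q (f v) (g v)) := by
  have h : DfF V (fun v => FE0 Q (v 0)) := by
    refine rec1 (pred := FEpred Q) (G := FEG Q) ?_ ?_ (fun x => (SmallExt.zfst x).rank) (fun x _ => FEpred_rank Q x)
      (fun x _ => (exists_FE Q).choose_spec x)
    · unfold FEpred; infer_instance
    · simp only [FEG, FEcl]; infer_instance
  unfold SmallExt.FE
  exact h.comp1 inferInstance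

theorem FE_mono {Q a b p q : ZFSet} (h : p ∈ FE Q a b) (hq : q ∈ Q) (hpq : p ⊆ q) : q ∈ FE Q a b := by
  rw [mem_FE] at h ⊢
  refine ⟨hq, fun x hx h1 p' hp' h2 h3 => h.2.1 x hx h1 p' hp' (fun z hz => h2 (hpq hz)) h3,
    fun x hx h1 p' hp' h2 h3 => h.2.2 x hx h1 p' hp' (fun z hz => h2 (hpq hz)) h3⟩

structure Gen (V Q g : ZFSet.{0}) : Prop where
  sub : g ⊆ Q
  ne : ∃ p, p ∈ g
  up : ∀ p ∈ g, ∀ q ∈ Q, q ⊆ p → q ∈ g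
  dir : ∀ p ∈ g, ∀ q ∈ g, ∃ r ∈ g, p ⊆ r ∧ q ⊆ r
  gen : ∀ D ∈ V, D ⊆ Q → (∀ p ∈ Q, ∃ q ∈ D, p ⊆ q) → ∃ q ∈ g, q ∈ D

theorem sub_trans {a b c : ZFSet.{0}} (h : a ⊆ b) (h' : b ⊆ c) : a ⊆ c := fun _ hz => h' (h hz)
theorem sub_refl' (a : ZFSet.{0}) : a ⊆ a := fun _ hz => hz

/-- Rasiowa-Sikorski -/
theorem exists_gen (V : ZFSet.{0}) [hV : Fact (IsCTM V)] {Q p : ZFSet.{0}} (hp : p ∈ Q) :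
    ∃ g, Gen V Q g ∧ p ∈ g := by
  classical
  obtain ⟨e, he⟩ := exists_enum V
  let nxt : ZFSet → ZFSet → ZFSet := fun D q =>
    if h : ∃ r ∈ Q, q ⊆ r ∧ r ∈ D then h.choose else q
  let s : ℕ → ZFSet := fun n => Nat.rec p (fun n q => nxt (e n) q) n
  have hs : ∀ n, s (n + 1) = nxt (e n) (s n) := fun n => rfl
  have nx : ∀ D q, q ∈ Q → nxt D q ∈ Q ∧ q ⊆ nxt D q := by
    intro D q hq
    by_cases h : ∃ r ∈ Q, q ⊆ r ∧ r ∈ D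
    · simp only [nxt, dif_pos h]
      exact ⟨h.choose_spec.1, h.choose_spec.2.1⟩
    · simp only [nxt, dif_neg h]
      exact ⟨hq, sub_refl' q⟩
  have sQ : ∀ n, s n ∈ Q := by
    intro n; induction n with
    | zero => exact hp
    | succ n ih => exact (nx _ _ ih).1
  have mono : ∀ m n, m ≤ n → s m ⊆ s n := by
    intro m n h
    induction n, h using Nat.le_induction with
    | base => exact sub_refl' _
    | succ n _ ih => exact sub_trans ih (nx _ _ (sQ n)).2
  refine ⟨ZFSet.sep (fun q => ∃ n, q ⊆ s n) Q, ⟨fun q hq => (ZFSet.mem_sep.1 hq).1, ⟨p, ?_⟩, ?_, ?_, ?_⟩, ?_⟩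
  · exact ZFSet.mem_sep.2 ⟨hp, 0, sub_refl' _⟩
  · intro q hq r hr hrq
    obtain ⟨_, n, hn⟩ := ZFSet.mem_sep.1 hq
    exact ZFSet.mem_sep.2 ⟨hr, n, sub_trans hrq hn⟩
  · intro q hq r hr
    obtain ⟨_, n, hn⟩ := ZFSet.mem_sep.1 hq
    obtain ⟨_, m, hm⟩ := ZFSet.mem_sep.1 hr
    exact ⟨s (max n m), ZFSet.mem_sep.2 ⟨sQ _, _, sub_refl' _⟩, sub_trans hn (mono _ _ (le_max_left _ _)),
      sub_trans hm (mono _ _ (le_max_right _ _))⟩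
  · intro D hD hDQ hd
    obtain ⟨n, rfl⟩ := he.2 D hD
    have : ∃ r ∈ Q, s n ⊆ r ∧ r ∈ e n := by
      obtain ⟨q, h1, h2⟩ := hd _ (sQ n)
      exact ⟨q, hDQ h1, h2, h1⟩
    refine ⟨s (n + 1), ZFSet.mem_sep.2 ⟨sQ (n + 1), n + 1, sub_refl' (s (n + 1))⟩, ?_⟩
    rw [hs]; simp only [nxt, dif_pos this]
    exact this.choose_spec.2.2
  · exact ZFSet.mem_sep.2 ⟨hp, 0, sub_refl' _⟩

section ext
variable {V Q g : ZFSet.{0}} [hV : Fact (IsCTM V)] [hQ : Fact (Q ∈ V)]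

theorem Gen.below (hg : Gen V Q g) {S : ZFSet → Ctx → Prop}
    (hS : Df V (fun w => S (w 0) (fun i => w (i + 1)))) {v : Ctx} (hv : ∀ i, v i ∈ V) {p0 : ZFSet} (hp0 : p0 ∈ g)
    (h : ∀ p ∈ Q, p0 ⊆ p → ∃ q ∈ Q, p ⊆ q ∧ S q v) : ∃ p ∈ g, p0 ⊆ p ∧ S p v := by
  have hSr : Df V (fun w => S (w 0) (fun i => w (i + 2))) := by
    have := hS.rename (fun i => if i = 0 then 0 else i + 1)
    simpa using this
  have hD : ZFSet.sep (fun a => (p0 ⊆ a ∧ S a v) ∨ ∀ r ∈ Q, ¬ (p0 ⊆ r ∧ a ⊆ r)) Q ∈ V := by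
    have hd : Df V (fun w => (w 1 ⊆ w 0 ∧ S (w 0) (fun i => w (i + 2))) ∨ ∀ r ∈ Q, ¬ (w 1 ⊆ r ∧ w 0 ⊆ r)) := inferInstance
    exact sep_mem (V := V) (R := fun a w => (w 0 ⊆ a ∧ S a (fun i => w (i + 1))) ∨ ∀ r ∈ Q, ¬ (w 0 ⊆ r ∧ a ⊆ r))
      hd hQ.out (vcons p0 v) (vcons_mem (tr hQ.out (hg.sub hp0)) hv)
  obtain ⟨q, hq, hqD⟩ := hg.gen _ hD (fun q hq => (ZFSet.mem_sep.1 hq).1) (by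
    intro p hp
    by_cases hc : ∃ r ∈ Q, p0 ⊆ r ∧ p ⊆ r
    · obtain ⟨r, hr, h1, h2⟩ := hc
      obtain ⟨q, hq, h3, h4⟩ := h r hr h1
      exact ⟨q, ZFSet.mem_sep.2 ⟨hq, Or.inl ⟨sub_trans h1 h3, h4⟩⟩, sub_trans h2 h3⟩
    · push Not at hc
      exact ⟨p, ZFSet.mem_sep.2 ⟨hp, Or.inr fun r hr h => hc r hr h.1 h.2⟩, sub_refl' _⟩)
  rcases (ZFSet.mem_sep.1 hqD).2 with h | h
  · exact ⟨q, hq, h⟩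
  · obtain ⟨r, hr, h1, h2⟩ := hg.dir _ hp0 _ hq
    exact absurd ⟨h1, h2⟩ (h r (hg.sub hr))

theorem Gen.dense (hg : Gen V Q g) {S : ZFSet → Ctx → Prop}
    (hS : Df V (fun w => S (w 0) (fun i => w (i + 1)))) {v : Ctx} (hv : ∀ i, v i ∈ V)
    (h : ∀ p ∈ Q, ∃ q ∈ Q, p ⊆ q ∧ S q v) : ∃ p ∈ g, S p v := by
  obtain ⟨p0, hp0⟩ := hg.ne
  obtain ⟨p, hp, -, h'⟩ := hg.below hS hv hp0 (fun p hp _ => h p hp)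
  exact ⟨p, hp, h'⟩

theorem FE_sound (hg : Gen V Q g) : ∀ a, a ∈ V → ∀ b ∈ V, ∀ p ∈ g, p ∈ FE Q a b → val g a = val g b := by
  intro a
  induction a using (InvImage.wf ZFSet.rank.{0} (wellFounded_lt)).induction with
  | _ a ih =>
  intro ha b hb p hp hf
  have hVa : Fact (a ∈ V) := ⟨ha⟩
  have hVb : Fact (b ∈ V) := ⟨hb⟩
  have cV : ∀ i : ℕ, (fun _ => ∅ : Ctx) i ∈ V := fun _ => empty_mem'
  obtain ⟨_, h1, h2⟩ := mem_FE.1 hf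
  apply zext
  intro z
  rw [mem_val, mem_val]
  constructor
  · rintro ⟨s, q, hq, hs, rfl⟩
    have hsq := tr ha hs
    obtain ⟨hsV, hqV⟩ := of_opair_mem hsq
    have : Fact (s ∈ V) := ⟨hsV⟩
    obtain ⟨r, hr, hpr, hqr⟩ := hg.dir _ hp _ hq
    have hd : Df V (fun w => ∃ y ∈ b, IsNm Q y ∧ zsnd y ⊆ w 0 ∧ w 0 ∈ FE Q s (zfst y)) := inferInstance
    obtain ⟨p2, hp2, -, y, hy, hop, hy2, hf2⟩ := hg.below (S := fun p _ => ∃ y ∈ b, IsNm Q y ∧ zsnd y ⊆ p ∧ p ∈ FE Q s (zfst y)) hd cV hr (by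
      intro p' hp' hrp'
      have := h1 _ hs (isNm_opair (hg.sub hq)) p' hp' (sub_trans hpr hrp') (by rw [zsnd_opair]; exact sub_trans hqr hrp')
      simpa only [zfst_opair] using this)
    have hyV := tr hb hy
    rw [hop.1] at hy hyV
    have hyV := of_opair_mem hyV
    exact ⟨zfst y, zsnd y, hg.up _ hp2 _ hop.2 hy2, hy, (ih s (rank_opair_left hs) hsV _ hyV.1 p2 hp2 hf2).symm⟩
  · rintro ⟨s, q, hq, hs, rfl⟩
    have hsq := tr hb hs
    obtain ⟨hsV, hqV⟩ := of_opair_mem hsq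
    have : Fact (s ∈ V) := ⟨hsV⟩
    obtain ⟨r, hr, hpr, hqr⟩ := hg.dir _ hp _ hq
    have hd : Df V (fun w => ∃ y ∈ a, IsNm Q y ∧ zsnd y ⊆ w 0 ∧ w 0 ∈ FE Q (zfst y) s) := inferInstance
    obtain ⟨p2, hp2, -, y, hy, hop, hy2, hf2⟩ := hg.below (S := fun p _ => ∃ y ∈ a, IsNm Q y ∧ zsnd y ⊆ p ∧ p ∈ FE Q (zfst y) s) hd cV hr (by
      intro p' hp' hrp'
      have := h2 _ hs (isNm_opair (hg.sub hq)) p' hp' (sub_trans hpr hrp') (by rw [zsnd_opair]; exact sub_trans hqr hrp')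
      simpa only [zfst_opair] using this)
    have hyV := tr ha hy
    rw [hop.1] at hy hyV
    have hyV := of_opair_mem hyV
    exact ⟨zfst y, zsnd y, hg.up _ hp2 _ hop.2 hy2, hy, ih _ (rank_opair_left hy) hyV.1 _ hsV p2 hp2 hf2⟩

theorem FE_complete (hg : Gen V Q g) : ∀ a, a ∈ V → ∀ b ∈ V, val g a = val g b → ∃ p ∈ g, p ∈ FE Q a b := by
  intro a
  induction a using (InvImage.wf ZFSet.rank.{0} (wellFounded_lt)).induction with
  | _ a ih =>
  intro ha b hb hval
  have hVa : Fact (a ∈ V) := ⟨ha⟩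
  have hVb : Fact (b ∈ V) := ⟨hb⟩
  have cV : ∀ i : ℕ, (fun _ => ∅ : Ctx) i ∈ V := fun _ => empty_mem'
  let Ne : ZFSet → Prop := fun p =>
    (∃ x ∈ a, IsNm Q x ∧ zsnd x ⊆ p ∧ ∀ p' ∈ Q, p ⊆ p' → ∀ y ∈ b, IsNm Q y → zsnd y ⊆ p' → p' ∉ FE Q (zfst x) (zfst y)) ∨
    (∃ y ∈ b, IsNm Q y ∧ zsnd y ⊆ p ∧ ∀ p' ∈ Q, p ⊆ p' → ∀ x ∈ a, IsNm Q x → zsnd x ⊆ p' → p' ∉ FE Q (zfst x) (zfst y))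
  have hd : Df V (fun w => w 0 ∈ FE Q a b ∨ Ne (w 0)) := by
    simp only [Ne]; infer_instance
  obtain ⟨p, hp, h | h⟩ := hg.dense (S := fun p _ => p ∈ FE Q a b ∨ Ne p) hd cV (by
    intro p hp
    by_cases hf : p ∈ FE Q a b
    · exact ⟨p, hp, sub_refl' _, Or.inl hf⟩
    · have hf' : ¬ FEcl Q a b p (fun s t p'' => p'' ∈ FE Q s t) := fun h => hf (mem_FE.2 ⟨hp, h⟩)
      rw [FEcl, not_and_or] at hf'
      rcases hf' with h | h
      · push Not at h
        obtain ⟨x, hx, h1, p', hp', h2, h3, h4⟩ := h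
        refine ⟨p', hp', h2, Or.inr (Or.inl ⟨x, hx, h1, h3, fun p'' hp'' h5 y hy h6 h7 => ?_⟩)⟩
        exact h4 p'' hp'' h5 y hy h6 h7
      · push Not at h
        obtain ⟨x, hx, h1, p', hp', h2, h3, h4⟩ := h
        refine ⟨p', hp', h2, Or.inr (Or.inr ⟨x, hx, h1, h3, fun p'' hp'' h5 y hy h6 h7 => ?_⟩)⟩
        exact h4 p'' hp'' h5 y hy h6 h7)
  · exact ⟨p, hp, h⟩
  · exfalso
    rcases h with ⟨x, hx, h1, h2, h3⟩ | ⟨x, hx, h1, h2, h3⟩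
    · rw [h1.1] at hx
      have hxV := (of_opair_mem (tr ha hx)).1
      have : val g (zfst x) ∈ val g a := mem_val.2 ⟨_, _, hg.up _ hp _ h1.2 h2, hx, rfl⟩
      rw [hval, mem_val] at this
      obtain ⟨t, r, hr, ht, e⟩ := this
      obtain ⟨p1, hp1, hf⟩ := ih _ (rank_opair_left hx) hxV t (of_opair_mem (tr hb ht)).1 e.symm
      obtain ⟨u, hu, hu1, hu2⟩ := hg.dir _ hp _ hr
      obtain ⟨u', hu', hu1', hu2'⟩ := hg.dir _ hu _ hp1
      refine h3 u' (hg.sub hu') (sub_trans hu1 hu1') _ ht (isNm_opair (hg.sub hr)) ?_ ?_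
      · rw [zsnd_opair]; exact sub_trans hu2 hu1'
      · rw [zfst_opair]; exact FE_mono hf (hg.sub hu') hu2'
    · rw [h1.1] at hx
      have hxV := (of_opair_mem (tr hb hx)).1
      have : val g (zfst x) ∈ val g b := mem_val.2 ⟨_, _, hg.up _ hp _ h1.2 h2, hx, rfl⟩
      rw [← hval, mem_val] at this
      obtain ⟨t, r, hr, ht, e⟩ := this
      obtain ⟨p1, hp1, hf⟩ := ih _ (rank_opair_left ht) (of_opair_mem (tr ha ht)).1 _ hxV e
      obtain ⟨u, hu, hu1, hu2⟩ := hg.dir _ hp _ hr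
      obtain ⟨u', hu', hu1', hu2'⟩ := hg.dir _ hu _ hp1
      refine h3 u' (hg.sub hu') (sub_trans hu1 hu1') _ ht (isNm_opair (hg.sub hr)) ?_ ?_
      · rw [zsnd_opair]; exact sub_trans hu2 hu1'
      · rw [zfst_opair]; exact FE_mono hf (hg.sub hu') hu2'

/-! forceable relations -/
def Fv (V Q g : ZFSet.{0}) (R : Ctx → Prop) : Prop :=
  ∃ Fo : ZFSet → Ctx → Prop, Df V (fun w => Fo (w 0) (fun i => w (i + 1))) ∧
    (∀ v : Ctx, (∀ i, v i ∈ V) → ∀ p ∈ Q, ∀ q ∈ Q, p ⊆ q → Fo p v → Fo q v) ∧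
    ∀ v : Ctx, (∀ i, v i ∈ V) → (R v ↔ ∃ p ∈ g, Fo p v)

def Fc (V Q g : ZFSet.{0}) (R : Ctx → Prop) : Prop := Fv V Q g (fun v => R (fun i => val g (v i)))

theorem Fv.congr {R S : Ctx → Prop} (h : Fv V Q g R) (e : ∀ v : Ctx, (∀ i, v i ∈ V) → (S v ↔ R v)) : Fv V Q g S := by
  obtain ⟨Fo, h1, h2, h3⟩ := h
  exact ⟨Fo, h1, h2, fun v hv => (e v hv).trans (h3 v hv)⟩

theorem Fc.congr {R S : Ctx → Prop} (h : Fc V Q g R) (e : ∀ v : Ctx, (∀ i, v i ∈ V) → (S (fun i => val g (v i)) ↔ R (fun i => val g (v i)))) : Fc V Q g S :=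
  Fv.congr h e

theorem Fv.df (hg : Gen V Q g) {R : Ctx → Prop} (h : Df V R) : Fv V Q g R := by
  have := h.rename (fun i => i + 1)
  refine ⟨fun _ v => R v, this, fun v hv p hp q hq hpq h => h, fun v hv => ?_⟩
  obtain ⟨p, hp⟩ := hg.ne
  exact ⟨fun h => ⟨p, hp, h⟩, fun ⟨_, _, h⟩ => h⟩

theorem Fv.not (hg : Gen V Q g) {R : Ctx → Prop} (h : Fv V Q g R) : Fv V Q g (fun v => ¬ R v) := by
  obtain ⟨Fo, h1, h2, h3⟩ := h
  have h1' : Df V (fun w => Fo (w 0) (fun i => w (i + 2))) := by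
    simpa using h1.rename (fun i => if i = 0 then 0 else i + 1)
  have hd : Df V (fun w => ∀ q ∈ Q, w 0 ⊆ q → ¬ Fo q (fun i => w (i + 1))) := inferInstance
  refine ⟨fun p v => ∀ q ∈ Q, p ⊆ q → ¬ Fo q v, hd, fun v hv p hp q hq hpq h r hr hqr => h r hr (sub_trans hpq hqr), fun v hv => ?_⟩
  show (¬ R v) ↔ ∃ p ∈ g, ∀ q ∈ Q, p ⊆ q → ¬ Fo q v
  rw [h3 v hv]
  constructor
  · intro hn
    have hd2 : Df V (fun w => Fo (w 0) (fun i => w (i + 1)) ∨ ∀ q ∈ Q, w 0 ⊆ q → ¬ Fo q (fun i => w (i + 1))) := inferInstance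
    obtain ⟨p, hp, h⟩ := hg.dense (S := fun p v => Fo p v ∨ ∀ q ∈ Q, p ⊆ q → ¬ Fo q v) hd2 hv (by
      intro p hp
      by_cases hc : ∃ q ∈ Q, p ⊆ q ∧ Fo q v
      · obtain ⟨q, hq, h⟩ := hc
        exact ⟨q, hq, h.1, Or.inl h.2⟩
      · push Not at hc
        exact ⟨p, hp, sub_refl' _, Or.inr hc⟩)
    exact ⟨p, hp, h.resolve_left fun h => hn ⟨p, hp, h⟩⟩
  · rintro ⟨p, hp, h⟩ ⟨q, hq, h'⟩
    obtain ⟨r, hr, hpr, hqr⟩ := hg.dir _ hp _ hq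
    exact h r (hg.sub hr) hpr (h2 v hv q (hg.sub hq) r (hg.sub hr) hqr h')

theorem Fv.and (hg : Gen V Q g) {R S : Ctx → Prop} (h : Fv V Q g R) (h' : Fv V Q g S) : Fv V Q g (fun v => R v ∧ S v) := by
  obtain ⟨Fo, h1, h2, h3⟩ := h
  obtain ⟨Fo', h1', h2', h3'⟩ := h'
  refine ⟨fun p v => Fo p v ∧ Fo' p v, inferInstance, fun v hv p hp q hq hpq h => ⟨h2 v hv p hp q hq hpq h.1, h2' v hv p hp q hq hpq h.2⟩, fun v hv => ?_⟩
  show (R v ∧ S v) ↔ ∃ p ∈ g, Fo p v ∧ Fo' p v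
  rw [h3 v hv, h3' v hv]
  constructor
  · rintro ⟨⟨p, hp, h⟩, q, hq, h'⟩
    obtain ⟨r, hr, hpr, hqr⟩ := hg.dir _ hp _ hq
    exact ⟨r, hr, h2 v hv p (hg.sub hp) r (hg.sub hr) hpr h, h2' v hv q (hg.sub hq) r (hg.sub hr) hqr h'⟩
  · rintro ⟨p, hp, h, h'⟩
    exact ⟨⟨p, hp, h⟩, p, hp, h'⟩

theorem val_vcons (t : ZFSet) (v : Ctx) : (fun i => val g (vcons t v i)) = vcons (val g t) (fun i => val g (v i)) := by
  funext i; cases i <;> rfl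

theorem Fv.ex {R : Ctx → Prop} (h : Fv V Q g R) :
    Fv V Q g (fun v => ∃ t ∈ V, R (vcons t v)) := by
  obtain ⟨Fo, h1, h2, h3⟩ := h
  have h1' : Df V (fun w => Fo (w 1) (vcons (w 0) (fun i => w (i + 2)))) := by
    have := h1.rename (fun i => if i = 0 then 1 else if i = 1 then 0 else i)
    refine this.congr fun v _ => iff_of_eq ?_
    have e : (vcons (v 0) (fun i => v (i + 2))) = (fun i => v (if i + 1 = 0 then 1 else if i + 1 = 1 then 0 else i + 1)) := by
      funext i; cases i <;> simp [vcons]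
    rw [e]; rfl
  have hd : Df V (fun w => ∃ t ∈ V, Fo (w 0) (vcons t (fun i => w (i + 1)))) := inferInstance
  refine ⟨fun p v => ∃ t ∈ V, Fo p (vcons t v), hd, ?_, ?_⟩
  · rintro v hv p hp q hq hpq ⟨t, ht, h⟩
    exact ⟨t, ht, h2 _ (vcons_mem ht hv) p hp q hq hpq h⟩
  · intro v hv
    constructor
    · rintro ⟨t, ht, h⟩
      rw [h3 _ (vcons_mem ht hv)] at h
      obtain ⟨p, hp, h⟩ := h
      exact ⟨p, hp, t, ht, h⟩
    · rintro ⟨p, hp, t, ht, h⟩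
      refine ⟨t, ht, ?_⟩
      rw [h3 _ (vcons_mem ht hv)]
      exact ⟨p, hp, h⟩

theorem Fc.ex {R : Ctx → Prop} (h : Fc V Q g R) :
    Fc V Q g (fun v => ∃ z, z ∈ zimage (val g) V ∧ R (vcons z v)) := by
  refine (Fv.ex h).congr fun v hv => ?_
  constructor
  · rintro ⟨z, hz, h⟩
    obtain ⟨t, ht, rfl⟩ := mem_zimage.1 hz
    rw [← val_vcons] at h
    exact ⟨t, ht, h⟩
  · rintro ⟨t, ht, h⟩
    refine ⟨val g t, mem_zimage.2 ⟨t, ht, rfl⟩, ?_⟩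
    rw [← val_vcons]; exact h

theorem Fv.eq (hg : Gen V Q g) {f h : Ctx → ZFSet} (hf : DfF V f) (hh : DfF V h) : Fv V Q g (fun v => val g (f v) = val g (h v)) := by
  have := hf.shift
  have := hh.shift
  have hd : Df V (fun w => w 0 ∈ FE Q (f (fun i => w (i + 1))) (h (fun i => w (i + 1)))) := inferInstance
  refine ⟨fun p v => p ∈ FE Q (f v) (h v), hd, fun v hv p hp q hq hpq h => FE_mono h hq hpq, fun v hv => ?_⟩
  exact ⟨FE_complete hg _ (hf.cl v hv) _ (hh.cl v hv), fun ⟨p, hp, h⟩ => FE_sound hg _ (hf.cl v hv) _ (hh.cl v hv) p hp h⟩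

theorem Fv.mem (hg : Gen V Q g) {f h : Ctx → ZFSet} (hf : DfF V f) (hh : DfF V h) : Fv V Q g (fun v => val g (f v) ∈ val g (h v)) := by
  have := hf.shift
  have := hf.shift.shift
  have := hh.shift
  have hd : Df V (fun w => ∃ y ∈ h (fun i => w (i + 1)), IsNm Q y ∧ zsnd y ⊆ w 0 ∧ w 0 ∈ FE Q (f (fun i => w (i + 1))) (zfst y)) := inferInstance
  refine ⟨fun p v => ∃ y ∈ h v, IsNm Q y ∧ zsnd y ⊆ p ∧ p ∈ FE Q (f v) (zfst y), hd, ?_, fun v hv => ?_⟩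
  · rintro v hv p hp q hq hpq ⟨y, hy, h1, h2, h3⟩
    exact ⟨y, hy, h1, sub_trans h2 hpq, FE_mono h3 hq hpq⟩
  · show val g (f v) ∈ val g (h v) ↔ ∃ p ∈ g, ∃ y ∈ h v, IsNm Q y ∧ zsnd y ⊆ p ∧ p ∈ FE Q (f v) (zfst y)
    rw [mem_val]
    constructor
    · rintro ⟨s, p, hp, hs, e⟩
      obtain ⟨q, hq, hf⟩ := FE_complete hg _ (hf.cl v hv) s (of_opair_mem (tr (hh.cl v hv) hs)).1 e.symm
      obtain ⟨r, hr, hpr, hqr⟩ := hg.dir _ hp _ hq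
      exact ⟨r, hr, _, hs, isNm_opair (hg.sub hp), by rwa [zsnd_opair], by rw [zfst_opair]; exact FE_mono hf (hg.sub hr) hqr⟩
    · rintro ⟨p, hp, y, hy, h1, h2, h3⟩
      rw [h1.1] at hy
      exact ⟨zfst y, zsnd y, hg.up _ hp _ h1.2 h2, hy, (FE_sound hg _ (hf.cl v hv) _ (of_opair_mem (tr (hh.cl v hv) hy)).1 p hp h3).symm⟩

/-- truth lemma -/
theorem Fc.sat (hg : Gen V Q g) (f : Fm) (h1 : f.memOnly) (h2 : f.paramSet = ∅) :
    Fc V Q g (SatV (zimage (val g) V) f) := by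
  induction f with
  | rel s n a =>
    obtain ⟨rfl, rfl, h⟩ := h1
    have hv : ∀ i, ∃ k, a i = Tm.var k := by
      intro i
      cases hai : a i with
      | var k => exact ⟨k, rfl⟩
      | param b =>
        have : b ∈ (Fm.rel memSym 2 a).paramSet := ⟨i, by rw [hai]; rfl⟩
        rw [h2] at this; exact absurd this (by simp)
      | func _ _ _ => have := h i; rw [hai] at this; exact absurd this id
    obtain ⟨k0, h0⟩ := hv 0
    obtain ⟨k1, h1⟩ := hv 1
    refine (Fv.mem hg (DfF.var k0) (DfF.var k1)).congr fun v _ => ?_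
    simp [SatV, Sat, memRel, h0, h1, Tm.eval]
  | eq t u =>
    obtain ⟨ht, hu⟩ := h1
    cases t with
    | func _ _ _ => exact absurd ht id
    | param b =>
      have : b ∈ (Fm.eq (Tm.param b) u).paramSet := Or.inl rfl
      rw [h2] at this; exact absurd this (by simp)
    | var k =>
      cases u with
      | func _ _ _ => exact absurd hu id
      | param b =>
        have : b ∈ (Fm.eq (Tm.var k) (Tm.param b)).paramSet := Or.inr rfl
        rw [h2] at this; exact absurd this (by simp)
      | var l => exact Fv.eq hg (DfF.var k) (DfF.var l)
  | not f ih => exact Fv.not hg (ih h1 h2)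
  | imp f f' ih ih' =>
    have e := Set.union_empty_iff.1 h2
    refine (Fv.not hg (Fv.and hg (ih h1.1 e.1) (Fv.not hg (ih' h1.2 e.2)))).congr fun v _ => ?_
    simp only [SatV, Sat]; tauto
  | all f ih =>
    refine (Fv.not hg (Fc.ex (R := fun v => ¬ SatV (zimage (val g) V) f v) (Fv.not hg (ih h1 h2)))).congr fun v _ => ?_
    simp only [SatV, Sat]; push Not; rfl
  | ex f ih => exact Fc.ex (ih h1 h2)

end ext
end SmallExt

namespace SmallExt

theorem mem_prod' {a b x y : ZFSet.{0}} : opair a b ∈ ZFSet.prod x y ↔ a ∈ x ∧ b ∈ y := ZFSet.pair_mem_prod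

theorem allClose_intro {dom : ZFSet.{0} → Prop} {rI fI} (k : ℕ) : ∀ (f : Fm), (∀ v : Ctx, (∀ i, dom (v i)) → Sat dom rI fI f v) →
    ∀ v : Ctx, (∀ i, dom (v i)) → Sat dom rI fI (allClose k f) v := by
  induction k with
  | zero => intro f h v hv; exact h v hv
  | succ k ih =>
    intro f h v hv
    refine ih (Fm.all f) ?_ v hv
    intro v hv z hz
    apply h
    rintro (_ | i)
    · exact hz
    · exact hv i

/-- check names -/
def chk (Q x : ZFSet.{0}) : ZFSet.{0} := uRec (fun A _ r => ZFSet.prod {r} A) Q x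

theorem mem_chk {Q x z : ZFSet.{0}} : z ∈ chk Q x ↔ ∃ y ∈ x, z ∈ ZFSet.prod {chk Q y} Q := mem_uRec

instance DfF.chk {V Q : ZFSet.{0}} [hV : Fact (IsCTM V)] [hQ : Fact (Q ∈ V)] {f : Ctx → ZFSet} [hf : DfF V f] :
    DfF V (fun v => chk Q (f v)) := uRec_DfF (V := V) (H := fun A _ r => ZFSet.prod {r} A) inferInstance inferInstance hf

def dom' (x : ZFSet.{0}) : ZFSet.{0} := zimage zfst x
theorem mem_dom' {x s p : ZFSet.{0}} (h : opair s p ∈ x) : s ∈ dom' x := mem_zimage.2 ⟨_, h, by simp⟩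
instance DfF.dom' {V : ZFSet.{0}} [hV : Fact (IsCTM V)] {f : Ctx → ZFSet} [hf : DfF V f] :
    DfF V (fun v => dom' (f v)) := by unfold SmallExt.dom'; infer_instance

section ext
variable {V Q g : ZFSet.{0}} [hV : Fact (IsCTM V)] [hQ : Fact (Q ∈ V)]

theorem val_prod (hg : Gen V Q g) {S z : ZFSet.{0}} : z ∈ val g (ZFSet.prod S Q) ↔ ∃ s ∈ S, val g s = z := by
  rw [mem_val]
  constructor
  · rintro ⟨s, p, hp, h, e⟩
    exact ⟨s, (mem_prod'.1 h).1, e⟩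
  · rintro ⟨s, hs, e⟩
    obtain ⟨p, hp⟩ := hg.ne
    exact ⟨s, p, hp, mem_prod'.2 ⟨hs, hg.sub hp⟩, e⟩

theorem val_chk (hg : Gen V Q g) (x : ZFSet.{0}) : val g (chk Q x) = x := by
  induction x using ZFSet.inductionOn with
  | _ x ih =>
  apply zext; intro z
  rw [mem_val]
  constructor
  · rintro ⟨s, p, hp, h, rfl⟩
    obtain ⟨y, hy, h⟩ := mem_chk.1 h
    have := (mem_prod'.1 h).1
    rw [ZFSet.mem_singleton] at this
    rw [this, ih y hy]; exact hy
  · intro hz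
    obtain ⟨p, hp⟩ := hg.ne
    exact ⟨chk Q z, p, hp, mem_chk.2 ⟨z, hz, mem_prod'.2 ⟨by simp, hg.sub hp⟩⟩, ih z hz⟩

def Ext (V g : ZFSet.{0}) : ZFSet.{0} := zimage (val g) V

theorem mem_Ext {z : ZFSet.{0}} : z ∈ Ext V g ↔ ∃ t ∈ V, val g t = z := mem_zimage
theorem val_Ext {t : ZFSet.{0}} (h : t ∈ V) : val g t ∈ Ext V g := mem_Ext.2 ⟨t, h, rfl⟩

theorem chk_mem {x : ZFSet.{0}} (hx : x ∈ V) : chk Q x ∈ V := by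
  have := DfF.ap1 (V := V) (F := fun x => chk Q x) inferInstance hx
  exact this

theorem sub_Ext (hg : Gen V Q g) {x : ZFSet.{0}} (hx : x ∈ V) : x ∈ Ext V g :=
  mem_Ext.2 ⟨chk Q x, chk_mem hx, val_chk hg x⟩

theorem gen_Ext (hg : Gen V Q g) : g ∈ Ext V g := by
  refine mem_Ext.2 ⟨zimage (fun p => opair (chk Q p) p) Q, ?_, ?_⟩
  · have : DfF V (fun v => zimage (fun p => opair (chk Q p) p) (v 0)) := inferInstance
    exact DfF.ap1 (V := V) (F := fun x => zimage (fun p => opair (chk Q p) p) x) this hQ.out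
  · apply zext; intro z
    rw [mem_val]
    constructor
    · rintro ⟨s, p, hp, h, rfl⟩
      obtain ⟨q, hq, e⟩ := mem_zimage.1 h
      obtain ⟨rfl, rfl⟩ := opair_inj.1 e
      rw [val_chk hg]; exact hp
    · intro hz
      exact ⟨_, z, hz, mem_zimage.2 ⟨z, hg.sub hz, rfl⟩, val_chk hg z⟩

theorem Ext_trans {x y : ZFSet.{0}} (h : x ∈ Ext V g) (hy : y ∈ x) : y ∈ Ext V g := by
  obtain ⟨t, ht, rfl⟩ := mem_Ext.1 h
  obtain ⟨s, p, hp, h, rfl⟩ := mem_val.1 hy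
  exact val_Ext (of_opair_mem (tr ht h)).1

theorem vchoose {v : Ctx} (hv : ∀ i, v i ∈ Ext V g) : ∃ n : Ctx, (∀ i, n i ∈ V) ∧ (fun i => val g (n i)) = v := by
  choose n hn using fun i => mem_Ext.1 (hv i)
  exact ⟨n, fun i => (hn i).1, funext fun i => (hn i).2⟩

/-- separation of names -/
theorem Fv.sep {R : Ctx → Prop} (h : Fv V Q g R) (hg : Gen V Q g) {e : ZFSet.{0} → ZFSet.{0}} (he : DfF V (fun v => e (v 0))) {S : ZFSet} (hS : S ∈ V) {v : Ctx} (hv : ∀ i, v i ∈ V) :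
    ∃ t ∈ V, (∀ z, z ∈ val g t ↔ ∃ s ∈ S, val g (e s) = z ∧ R (vcons s v)) ∧ t ⊆ ZFSet.prod (zimage e S) Q := by
  obtain ⟨Fo, h1, h2, h3⟩ := h
  have e1 : Df V (fun w => Fo (w 2) (vcons (w 0) (fun i => w (i + 3)))) := by
    have := h1.rename (fun i => if i = 0 then 2 else if i = 1 then 0 else i + 1)
    refine this.congr fun v _ => iff_of_eq ?_
    have e : (vcons (v 0) (fun i => v (i + 3))) = (fun i => v (if i + 1 = 0 then 2 else if i + 1 = 1 then 0 else i + 1 + 1)) := by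
      funext i; cases i <;> simp [vcons]
    rw [e]; rfl
  have := he.comp1 (f := fun v => v 0) inferInstance
  have := DfF.zimage (V := V) (f := fun v => v 0) (F := fun z _ => e z) (h := he)
  have e2 : Df V (fun w => Fo (zsnd (w 1)) (vcons (w 0) (fun i => w (i + 3)))) := by
    have e3 : Df V (fun w => Fo (w 0) (vcons (w 1) (fun i => w (i + 4)))) := by
      have := e1.rename (fun i => if i = 0 then 1 else if i = 2 then 0 else i + 1)
      exact this
    exact Df.bind (f := fun w => zsnd (w 1)) (R := fun a w => Fo a (vcons (w 0) (fun i => w (i + 3)))) inferInstance e3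
  have e5 : Df V (fun w => ∃ s ∈ w 1, zfst (w 0) = e s ∧ Fo (zsnd (w 0)) (vcons s (fun i => w (i + 2)))) := inferInstance
  have hP : ZFSet.prod (zimage e S) Q ∈ V := by
    have : DfF V (fun v => ZFSet.prod (zimage e (v 0)) Q) := inferInstance
    exact DfF.ap1 (V := V) (F := fun x => ZFSet.prod (zimage e x) Q) this hS
  have hm := sep_mem (V := V) (R := fun a w => ∃ s ∈ w 0, zfst a = e s ∧ Fo (zsnd a) (vcons s (fun i => w (i + 1)))) e5 hP (vcons S v) (vcons_mem hS hv)
  refine ⟨_, hm, fun z => ?_, fun z hz => (ZFSet.mem_sep.1 hz).1⟩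
  rw [mem_val]
  constructor
  · rintro ⟨s, p, hp, h, rfl⟩
    obtain ⟨h, s', hs', e, hF⟩ := ZFSet.mem_sep.1 h
    rw [zsnd_opair] at hF; rw [zfst_opair] at e
    exact ⟨s', hs', by rw [e], (h3 _ (vcons_mem (tr hS hs') hv)).2 ⟨p, hp, hF⟩⟩
  · rintro ⟨s, hs, rfl, hR⟩
    obtain ⟨p, hp, hF⟩ := (h3 _ (vcons_mem (tr hS hs) hv)).1 hR
    refine ⟨e s, p, hp, ZFSet.mem_sep.2 ⟨mem_prod'.2 ⟨mem_zimage.2 ⟨s, hs, rfl⟩, hg.sub hp⟩, s, hs, by rw [zfst_opair], by rw [zsnd_opair]; exact hF⟩, rfl⟩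

theorem rk_mem {x y : ZFSet.{0}} (h : x ∈ y) : rkZ x ∈ rkZ y := mem_rkZ.2 ⟨x, h, Or.inl rfl⟩

theorem rkZ_val (t : ZFSet.{0}) : rkZ (val g t) ⊆ rkZ t := by
  induction t using (InvImage.wf ZFSet.rank.{0} (wellFounded_lt)).induction with
  | _ t ih =>
  intro z hz
  obtain ⟨y, hy, h⟩ := mem_rkZ.1 hz
  obtain ⟨s, p, hp, hs, rfl⟩ := mem_val.1 hy
  have h1 := ih s (rank_opair_left hs)
  have h2 : rkZ s ∈ rkZ t := by
    refine rkZ_trans (rk_mem hs) (rkZ_trans (z := rkZ {s}) (rk_mem ?_) (rk_mem ?_)) <;> simp [opair, ZFSet.pair]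
  rcases h with rfl | h
  · rcases ord_tri (rkZ_isOrd (val g s)) (rkZ_isOrd s) with h | h | h
    · exact rkZ_trans h2 h
    · rw [h]; exact h2
    · exact absurd (h1 h) (ZFSet.mem_irrefl _)
  · exact rkZ_trans h2 (h1 h)

theorem Ext_ord {y : ZFSet.{0}} (h : y ∈ Ext V g) (ho : IsOrd y) : y ∈ V := by
  obtain ⟨t, ht, rfl⟩ := mem_Ext.1 h
  have h1 := rkZ_val (g := g) t
  rw [rkZ_of_ord ho] at h1
  have h2 : rkZ t ∈ V := DfF.ap1 (V := V) (F := rkZ) inferInstance ht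
  rcases ord_tri ho (rkZ_isOrd t) with h | h | h
  · exact tr h2 h
  · rw [h]; exact h2
  · exact absurd (h1 h) (ZFSet.mem_irrefl _)

end ext
end SmallExt

namespace SmallExt

section
variable {V : ZFSet.{0}} [hV : Fact (IsCTM V)]

theorem choice_fn {t : ZFSet.{0}} (ht : t ∈ V) : ∃ C ∈ V, ∀ u ∈ V, u ⊆ t → (∃ z, z ∈ u) →
    ∃ z ∈ u, opair u z ∈ C ∧ ∀ z' ∈ u, opair u z' ∈ C → z' = z := by
  have h := hV.out.1.2 choiceAx (by simp [ZFCax])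
  simp only [SatV, choiceAx, Sat, sat_iff_and, sat_iff_iff, sat_iff_or, sat_mem2, sat_eq2, vcons] at h
  have hF : zimage (fun u => ZFSet.prod {u} u) (ZFSet.sep (fun u => ∃ z ∈ u, z = z) (pwV V t)) ∈ V := by
    have : DfF V (fun v => zimage (fun u => ZFSet.prod {u} u) (ZFSet.sep (fun u => ∃ z ∈ u, z = z) (pwV V (v 0)))) := inferInstance
    exact DfF.ap1 (V := V) (F := fun t => zimage (fun u => ZFSet.prod {u} u) (ZFSet.sep (fun u => ∃ z ∈ u, z = z) (pwV V t))) this ht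
  have hmem : ∀ m, m ∈ zimage (fun u => ZFSet.prod {u} u) (ZFSet.sep (fun u => ∃ z ∈ u, z = z) (pwV V t)) ↔
      ∃ u ∈ V, u ⊆ t ∧ (∃ z, z ∈ u) ∧ ZFSet.prod {u} u = m := by
    intro m
    rw [mem_zimage]
    simp only [ZFSet.mem_sep, mem_pwV]
    constructor
    · rintro ⟨u, ⟨⟨a, b⟩, z, hz, -⟩, e⟩; exact ⟨u, a, b, ⟨z, hz⟩, e⟩
    · rintro ⟨u, a, b, ⟨z, hz⟩, e⟩; exact ⟨u, ⟨⟨a, b⟩, z, hz, trivial⟩, e⟩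
  have hh := h _ hF ?_
  · obtain ⟨C, hC, h2⟩ := hh
    refine ⟨C, hC, fun u hu hut hne => ?_⟩
    have hm := (hmem _).2 ⟨u, hu, hut, hne, rfl⟩
    obtain ⟨a, haV, ha1, ha2, ha3⟩ := h2 _ (tr hF hm) hm
    obtain ⟨a1, ha1', z, hz, rfl⟩ := ZFSet.mem_prod.1 ha1
    rw [ZFSet.mem_singleton] at ha1'
    subst ha1'
    refine ⟨z, hz, ha2, fun z' hz' h' => ?_⟩
    have := ha3 (opair a1 z') (tr hC h') ⟨mem_prod'.2 ⟨by simp, hz'⟩, h'⟩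
    exact (opair_inj.1 this).2
  · constructor
    · intro m hmV hm
      obtain ⟨u, hu, hut, ⟨z, hz⟩, rfl⟩ := (hmem _).1 hm
      have : opair u z ∈ ZFSet.prod {u} u := mem_prod'.2 ⟨by simp, hz⟩
      exact ⟨_, tr hmV this, this⟩
    · rintro m hmV m' hmV' ⟨hm, hm', a, haV, ha, ha'⟩
      obtain ⟨u, hu, hut, ⟨z, hz⟩, rfl⟩ := (hmem _).1 hm
      obtain ⟨u', hu', hut', ⟨z', hz'⟩, rfl⟩ := (hmem _).1 hm'
      obtain ⟨a1, ha1, b, hb, rfl⟩ := ZFSet.mem_prod.1 ha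
      obtain ⟨a2, ha2, b', hb', e⟩ := ZFSet.mem_prod.1 ha'
      rw [ZFSet.mem_singleton] at ha1 ha2
      have := (ZFSet.pair_inj.1 e).1
      have : u = u' := by rw [← ha1, ← ha2, this]
      rw [this]

/-- every set of `V` is enumerated by an ordinal of `V`, in `V` -/
theorem enum_V {t : ZFSet.{0}} (ht : t ∈ V) : ∃ (e : ZFSet.{0} → ZFSet.{0}) (b : ZFSet), b ∈ V ∧ IsOrd b ∧
    DfF V (fun v => e (v 0)) ∧ ∀ s ∈ t, ∃ x ∈ b, e x = s := by
  obtain ⟨C, hC, hch⟩ := choice_fn ht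
  have : Fact (C ∈ V) := ⟨hC⟩
  have : Fact (t ∈ V) := ⟨ht⟩
  let c : ZFSet → ZFSet := fun u => ZFSet.sUnion (ZFSet.sep (fun z => opair u z ∈ C) u)
  have hc : ∀ {f : Ctx → ZFSet} [DfF V f], DfF V (fun v => c (f v)) := by
    intro f hf; have := hf.shift; simp only [c]; infer_instance
  have hcs : ∀ u ∈ V, u ⊆ t → (∃ z, z ∈ u) → c u ∈ u := by
    intro u hu hut hne
    obtain ⟨z, hz, h1, h2⟩ := hch u hu hut hne
    have : ZFSet.sep (fun z => opair u z ∈ C) u = {z} := by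
      apply zext; intro y
      rw [ZFSet.mem_sep, ZFSet.mem_singleton]
      constructor
      · exact fun h => h2 y h.1 h.2
      · rintro rfl; exact ⟨hz, h1⟩
    show ZFSet.sUnion _ ∈ u
    rw [this, ZFSet.sUnion_singleton]; exact hz
  let H : ZFSet → ZFSet → ZFSet → ZFSet := fun _ _ r => r ∪ ZFSet.sep (fun z => z = c (t \ r)) (t \ r)
  have hH : DfF V (fun v => H (v 0) (v 1) (v 2)) := by simp only [H]; infer_instance
  have hr : ∀ {f : Ctx → ZFSet} [DfF V f], DfF V (fun v => uRec H ∅ (f v)) := fun {f} {hf} => uRec_DfF hH inferInstance hf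
  have hst : ∀ x, uRec H ∅ x ⊆ t := by
    intro x
    induction x using ZFSet.inductionOn with
    | _ x ih =>
    intro z hz
    obtain ⟨y, hy, h⟩ := mem_uRec.1 hz
    rcases ZFSet.mem_union.1 h with h | h
    · exact ih y hy h
    · exact (ZFSet.mem_sdiff.1 (ZFSet.mem_sep.1 h).1).1
  obtain ⟨b, hb, hbo, hbs⟩ := stabilize hH (A := ∅) empty_mem' ht (fun x _ => hst x) (fun y r z hz => ZFSet.mem_union.2 (Or.inl hz))
  refine ⟨fun x => c (t \ uRec H ∅ x), b, hb, hbo, inferInstance, fun s hs => ?_⟩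
  have hsb : s ∈ uRec H ∅ b := by
    by_contra hn
    have hd : t \ uRec H ∅ b ∈ V := DfF.ap1 (V := V) (F := fun b => t \ uRec H ∅ b) inferInstance hb
    have h1 := hcs _ hd (fun z hz => (ZFSet.mem_sdiff.1 hz).1) ⟨s, ZFSet.mem_sdiff.2 ⟨hs, hn⟩⟩
    have h2 := (hbs b hbo hb).2 (ZFSet.mem_union.2 (Or.inr (ZFSet.mem_sep.2 ⟨h1, rfl⟩)))
    exact (ZFSet.mem_sdiff.1 h1).2 h2
  have key : ∀ x, IsOrd x → s ∈ uRec H ∅ x → ∃ y ∈ x, c (t \ uRec H ∅ y) = s := by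
    intro x
    induction x using ZFSet.inductionOn with
    | _ x ih =>
    intro hx h
    obtain ⟨y, hy, h⟩ := mem_uRec.1 h
    rcases ZFSet.mem_union.1 h with h | h
    · obtain ⟨y', hy', e⟩ := ih y hy (hx.mem hy) h
      exact ⟨y', hx.1 y hy hy', e⟩
    · exact ⟨y, hy, (ZFSet.mem_sep.1 h).2.symm⟩
  exact key b hbo hsb

end

section ext
variable {V Q g : ZFSet.{0}} [hV : Fact (IsCTM V)] [hQ : Fact (Q ∈ V)]

theorem Ext_sep (hg : Gen V Q g) (φ : Fm) (h1 : φ.memOnly) (h2 : φ.paramSet = ∅) (h3 : 1 ∉ φ.free)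
    (v : Ctx) (hv : ∀ i, v i ∈ Ext V g) : SatV (Ext V g) (sepBody φ) v := by
  simp only [SatV, sepBody, Sat, sat_iff_and, sat_iff_iff, sat_mem2, vcons]
  intro X hX
  obtain ⟨τ, hτ, rfl⟩ := mem_Ext.1 hX
  obtain ⟨n, hn, rfl⟩ := vchoose hv
  obtain ⟨t, ht, h, -⟩ := (Fv.and hg (Fc.sat hg φ h1 h2) (Fv.mem hg (DfF.var 0) (DfF.var 2))).sep hg (e := fun x => x) inferInstance
    (S := dom' τ) (DfF.ap1 (V := V) (F := dom') inferInstance hτ) (v := vcons ∅ (vcons τ n)) (vcons_mem empty_mem' (vcons_mem hτ hn))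
  refine ⟨val g t, val_Ext ht, fun z hz => ?_⟩
  have ag : ∀ a b, Sat (fun x => x ∈ Ext V g) memRel (fun _ _ => ∅) φ (vcons z (vcons a (vcons (val g τ) fun i => val g (n i)))) →
      Sat (fun x => x ∈ Ext V g) memRel (fun _ _ => ∅) φ (vcons z (vcons b (vcons (val g τ) fun i => val g (n i)))) := by
    intro a b
    refine (sat_agree _ _ _ φ _ _ fun m hm => ?_).1
    rcases m with _ | _ | m
    · rfl
    · exact absurd hm h3
    · rfl
  rw [h]
  constructor
  · rintro ⟨s, hs, rfl, h4, h5⟩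
    refine ⟨h5, ag (val g ∅) _ ?_⟩
    rw [val_vcons, val_vcons, val_vcons] at h4
    exact h4
  · rintro ⟨h5, h4⟩
    obtain ⟨s, p, hp, hs, rfl⟩ := mem_val.1 h5
    refine ⟨s, mem_dom' hs, rfl, ?_, h5⟩
    rw [val_vcons, val_vcons, val_vcons]
    exact ag _ _ h4

theorem Ext_coll (hg : Gen V Q g) (φ : Fm) (h1 : φ.memOnly) (h2 : φ.paramSet = ∅) (h3 : 2 ∉ φ.free)
    (v : Ctx) (hv : ∀ i, v i ∈ Ext V g) : SatV (Ext V g) (repBody φ) v := by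
  simp only [SatV, repBody, Sat, sat_iff_and, sat_iff_iff, sat_mem2, vcons]
  intro X hX
  obtain ⟨τ, hτ, rfl⟩ := mem_Ext.1 hX
  obtain ⟨n, hn, rfl⟩ := vchoose hv
  obtain ⟨Fo, f1, f2, f3⟩ := Fc.sat hg φ h1 h2
  have hS : ZFSet.prod (dom' τ) Q ∈ V := by
    have : DfF V (fun v => ZFSet.prod (dom' (v 0)) Q) := inferInstance
    exact DfF.ap1 (V := V) (F := fun x => ZFSet.prod (dom' x) Q) this hτ
  have e1 : Df V (fun w => Fo (zsnd (w 1)) (vcons (w 0) (vcons (zfst (w 1)) (vcons ∅ (fun i => w (i + 2)))))) := by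
    have a1 : Df V (fun w => Fo (w 2) (vcons (w 3) (vcons (w 1) (vcons (w 0) (fun i => w (i + 5)))))) := by
      have := f1.rename (fun i => match i with | 0 => 2 | 1 => 3 | 2 => 1 | 3 => 0 | n + 4 => n + 5)
      refine this.congr fun w _ => iff_of_eq ?_
      have e : (vcons (w 3) (vcons (w 1) (vcons (w 0) (fun i => w (i + 5))))) = (fun i => w (match i + 1 with | 0 => 2 | 1 => 3 | 2 => 1 | 3 => 0 | n + 4 => n + 5)) := by
        funext i; rcases i with _ | _ | _ | i <;> simp [vcons]
      rw [e]
    have a2 := Df.bind (V := V) (f := fun _ => ∅) (R := fun z w => Fo (w 1) (vcons (w 2) (vcons (w 0) (vcons z (fun i => w (i + 4)))))) inferInstance a1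
    have a3 := Df.bind (V := V) (f := fun w => zfst (w 2)) (R := fun z w => Fo (w 0) (vcons (w 1) (vcons z (vcons ∅ (fun i => w (i + 3)))))) inferInstance a2
    have a4 := Df.bind (V := V) (f := fun w => zsnd (w 1)) (R := fun z w => Fo z (vcons (w 0) (vcons (zfst (w 1)) (vcons ∅ (fun i => w (i + 2)))))) inferInstance a3
    exact a4
  obtain ⟨b, hb, hb2⟩ := collect (V := V) (R := fun y a w => Fo (zsnd a) (vcons y (vcons (zfst a) (vcons ∅ w)))) e1 hS (vcons τ n) (vcons_mem hτ hn)
  have hB : ZFSet.prod b Q ∈ V := DfF.ap1 (V := V) (F := fun x => ZFSet.prod x Q) inferInstance hb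
  refine ⟨val g (ZFSet.prod b Q), val_Ext hB, fun z hz hzX ⟨y, hy, hs⟩ => ?_⟩
  obtain ⟨s, p, hp, hsp, rfl⟩ := mem_val.1 hzX
  obtain ⟨t, ht, rfl⟩ := mem_Ext.1 hy
  have hsV := (of_opair_mem (tr hτ hsp)).1
  have ag : ∀ y a b, Sat (fun x => x ∈ Ext V g) memRel (fun _ _ => ∅) φ (vcons y (vcons (val g s) (vcons a (vcons (val g τ) fun i => val g (n i))))) →
      Sat (fun x => x ∈ Ext V g) memRel (fun _ _ => ∅) φ (vcons y (vcons (val g s) (vcons b (vcons (val g τ) fun i => val g (n i))))) := by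
    intro y a b
    refine (sat_agree _ _ _ φ _ _ fun m hm => ?_).1
    rcases m with _ | _ | _ | m
    · rfl
    · rfl
    · exact absurd hm h3
    · rfl
  replace f3 : ∀ v : Ctx, (∀ i, v i ∈ V) → (SatV (zimage (val g) V) φ (fun i => val g (v i)) ↔ ∃ p ∈ g, Fo p v) := f3
  have hs2 := (f3 (vcons t (vcons s (vcons ∅ (vcons τ n)))) (vcons_mem ht (vcons_mem hsV (vcons_mem empty_mem' (vcons_mem hτ hn))))).1 (by
    rw [val_vcons, val_vcons, val_vcons, val_vcons]; exact ag _ _ _ hs)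
  obtain ⟨q, hq, hF⟩ := hs2
  obtain ⟨t', ht', hF'⟩ := hb2 (opair s q) (mem_prod'.2 ⟨mem_dom' hsp, hg.sub hq⟩) ⟨t, ht, by rw [zfst_opair, zsnd_opair]; exact hF⟩
  rw [zfst_opair, zsnd_opair] at hF'
  have h' := (f3 (vcons t' (vcons s (vcons ∅ (vcons τ n)))) (vcons_mem (tr hb ht') (vcons_mem hsV (vcons_mem empty_mem' (vcons_mem hτ hn))))).2 ⟨q, hq, hF'⟩
  rw [val_vcons, val_vcons, val_vcons, val_vcons] at h'
  exact ⟨val g t', val_Ext (tr hb ht'), (val_prod hg).2 ⟨t', ht', rfl⟩, ag _ _ _ h'⟩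

theorem Ext_choice (hg : Gen V Q g) (v : Ctx) : SatV (Ext V g) choiceAx v := by
  simp only [SatV, choiceAx, Sat, sat_iff_and, sat_iff_iff, sat_iff_or, sat_mem2, sat_eq2, vcons]
  rintro X hX ⟨hne, hdis⟩
  obtain ⟨τ, hτ, rfl⟩ := mem_Ext.1 hX
  have hU : dom' (ZFSet.sUnion (dom' τ)) ∈ V := by
    have : DfF V (fun v => dom' (ZFSet.sUnion (dom' (v 0)))) := inferInstance
    exact DfF.ap1 (V := V) (F := fun x => dom' (ZFSet.sUnion (dom' x))) this hτ
  obtain ⟨e, b, hb, hbo, he, hes⟩ := enum_V hU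
  have := he.comp1 (f := fun v => v 0) inferInstance
  have he1 := he.comp1 (f := fun v => v 1) inferInstance
  have F1 : Fv V Q g (fun v => ∃ x' ∈ V, x' ∈ v 1 ∧ val g (e x') ∈ val g (v 0)) := by
    refine (Fv.ex (Fv.and hg (Fv.df hg (R := fun v => v 0 ∈ v 2) inferInstance) (Fv.mem hg he (DfF.var 1)))).congr fun v hv => ?_
    rfl
  have F2 : Fv V Q g (fun v => ∃ s ∈ V, val g s ∈ val g (v 1) ∧ val g (e (v 0)) ∈ val g s ∧ ¬ ∃ x' ∈ V, x' ∈ v 0 ∧ val g (e x') ∈ val g s) := by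
    refine (Fv.ex (Fv.and hg (Fv.mem hg (DfF.var 0) (DfF.var 2)) (Fv.and hg (Fv.mem hg he1 (DfF.var 0)) (Fv.not hg F1)))).congr fun v hv => ?_
    rfl
  obtain ⟨Z, hZ, hZ2, -⟩ := F2.sep hg he hb (v := fun _ => τ) (fun _ => hτ)
  have hZ3 : ∀ z, z ∈ val g Z ↔ ∃ x ∈ b, val g (e x) = z ∧ ∃ y, y ∈ val g τ ∧ z ∈ y ∧ ∀ x' ∈ x, val g (e x') ∉ y := by
    intro z
    rw [hZ2]
    refine exists_congr fun x => and_congr_right fun hx => and_congr_right fun ez => ?_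
    show (∃ s ∈ V, val g s ∈ val g τ ∧ val g (e x) ∈ val g s ∧ ¬ ∃ x' ∈ V, x' ∈ x ∧ val g (e x') ∈ val g s) ↔ _
    rw [ez]
    constructor
    · rintro ⟨s, hs, h1, h2, h3⟩
      exact ⟨_, h1, h2, fun x' hx' h => h3 ⟨x', tr (tr hb hx) hx', hx', h⟩⟩
    · rintro ⟨y, h1, h2, h3⟩
      obtain ⟨s, hs, rfl⟩ := mem_Ext.1 (Ext_trans hX h1)
      exact ⟨s, hs, h1, h2, fun ⟨x', _, hx', h⟩ => h3 x' hx' h⟩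
  refine ⟨val g Z, val_Ext hZ, fun y hy hyX => ?_⟩
  -- minimal index
  have hex : ∃ x ∈ b, val g (e x) ∈ y := by
    obtain ⟨z, hz, hzy⟩ := hne y hy hyX
    obtain ⟨s, p, hp, hs, rfl⟩ := mem_val.1 hyX
    obtain ⟨r, q, hq, hr, rfl⟩ := mem_val.1 hzy
    obtain ⟨x, hx, ex⟩ := hes r (mem_dom' (p := q) (ZFSet.mem_sUnion.2 ⟨s, mem_dom' hs, hr⟩))
    exact ⟨x, hx, by rw [ex]; exact hzy⟩
  obtain ⟨x, ⟨hx, hxy⟩, hmin⟩ := ZFSet.mem_wf.has_min {x | x ∈ b ∧ val g (e x) ∈ y} hex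
  have hmin' : ∀ x' ∈ x, val g (e x') ∉ y := fun x' hx' h => hmin x' ⟨hbo.1 x hx hx', h⟩ hx'
  refine ⟨val g (e x), Ext_trans hy hxy, hxy, (hZ3 _).2 ⟨x, hx, rfl, y, hyX, hxy, hmin'⟩, ?_⟩
  rintro z hzE ⟨hzy, hzZ⟩
  obtain ⟨x1, hx1, rfl, y', hy', hzy', hm⟩ := (hZ3 _).1 hzZ
  have ey := hdis y hy y' (Ext_trans hX hy') ⟨hyX, hy', _, hzE, hzy, hzy'⟩
  subst ey
  rcases ord_tri (hbo.mem hx) (hbo.mem hx1) with h | h | h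
  · exact absurd hxy (hm x h)
  · rw [h]
  · exact absurd hzy (hmin' x1 h)

theorem Ext_outer (hg : Gen V Q g) : OuterModel V (Ext V g) := by
  refine ⟨hV.out, ⟨⟨fun x hx y hy => Ext_trans hx hy, ?_⟩, ?_⟩, fun x hx => sub_Ext hg hx, fun y hy ho => Ext_ord hy ho⟩
  · have hE : ∀ i : ℕ, (fun _ => ∅ : Ctx) i ∈ Ext V g := fun _ => sub_Ext hg empty_mem'
    rintro f ((h | ⟨k, φ, h1, h2, h3, rfl⟩) | ⟨k, φ, h1, h2, h3, rfl⟩)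
    · simp only [Set.mem_insert_iff, Set.mem_singleton_iff] at h
      rcases h with rfl | rfl | rfl | rfl | rfl | rfl | rfl
      · simp only [SatV, extAx, Sat, sat_iff_and, sat_iff_iff, sat_iff_or, sat_mem2, sat_eq2, vcons]
        intro x hx y hy h
        apply zext; intro z
        exact ⟨fun hz => (h z (Ext_trans hx hz)).1 hz, fun hz => (h z (Ext_trans hy hz)).2 hz⟩
      · simp only [SatV, pairAx, Sat, sat_iff_and, sat_iff_iff, sat_iff_or, sat_mem2, sat_eq2, vcons]
        intro x hx y hy
        obtain ⟨s, hs, rfl⟩ := mem_Ext.1 hx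
        obtain ⟨t, ht, rfl⟩ := mem_Ext.1 hy
        have h : ZFSet.prod {s, t} Q ∈ V := DfF.ap1 (V := V) (F := fun x => ZFSet.prod x Q) inferInstance (pair_mem hs ht)
        exact ⟨_, val_Ext h, (val_prod hg).2 ⟨s, by simp, rfl⟩, (val_prod hg).2 ⟨t, by simp, rfl⟩⟩
      · simp only [SatV, unionAx, Sat, sat_iff_and, sat_iff_iff, sat_iff_or, sat_mem2, sat_eq2, vcons]
        intro x hx
        obtain ⟨τ, hτ, rfl⟩ := mem_Ext.1 hx
        have hU : ZFSet.prod (dom' (ZFSet.sUnion (dom' τ))) Q ∈ V := by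
          have : DfF V (fun v => ZFSet.prod (dom' (ZFSet.sUnion (dom' (v 0)))) Q) := inferInstance
          exact DfF.ap1 (V := V) (F := fun x => ZFSet.prod (dom' (ZFSet.sUnion (dom' x))) Q) this hτ
        refine ⟨_, val_Ext hU, ?_⟩
        rintro z hz y hy ⟨hzy, hyx⟩
        obtain ⟨s, p, hp, hs, rfl⟩ := mem_val.1 hyx
        obtain ⟨r, q, hq, hr, rfl⟩ := mem_val.1 hzy
        exact (val_prod hg).2 ⟨r, mem_dom' (p := q) (ZFSet.mem_sUnion.2 ⟨s, mem_dom' hs, hr⟩), rfl⟩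
      · simp only [SatV, powAx, Sat, sat_iff_and, sat_iff_iff, sat_iff_or, sat_mem2, sat_eq2, vcons]
        intro x hx
        obtain ⟨τ, hτ, rfl⟩ := mem_Ext.1 hx
        have hU : ZFSet.prod (pwV V (ZFSet.prod (dom' τ) Q)) Q ∈ V := by
          have : DfF V (fun v => ZFSet.prod (pwV V (ZFSet.prod (dom' (v 0)) Q)) Q) := inferInstance
          exact DfF.ap1 (V := V) (F := fun x => ZFSet.prod (pwV V (ZFSet.prod (dom' x) Q)) Q) this hτ
        refine ⟨_, val_Ext hU, fun y hy hyx => ?_⟩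
        obtain ⟨σ, hσ, rfl⟩ := mem_Ext.1 hy
        obtain ⟨t, ht, h, hsub⟩ := (Fv.mem (Q := Q) hg (DfF.var 0) (DfF.var 1)).sep hg (e := fun x => x) inferInstance
          (S := dom' τ) (DfF.ap1 (V := V) (F := dom') inferInstance hτ) (v := fun _ => σ) (fun _ => hσ)
        refine (val_prod hg).2 ⟨t, mem_pwV.2 ⟨ht, fun z hz => ?_⟩, ?_⟩
        · have e : zimage (fun x => x) (dom' τ) = dom' τ := by apply zext; intro z; rw [mem_zimage]; simp
          rw [← e]; exact hsub hz
        · apply zext; intro z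
          rw [h]
          constructor
          · rintro ⟨s, hs, rfl, h⟩; exact h
          · intro hz
            obtain ⟨s, p, hp, hs, rfl⟩ := mem_val.1 (hyx z (Ext_trans hy hz) hz)
            exact ⟨s, mem_dom' hs, rfl, hz⟩
      · simp only [SatV, infAx, Sat, sat_iff_and, sat_iff_iff, sat_iff_or, sat_mem2, sat_eq2, vcons]
        refine ⟨omZ, sub_Ext hg omZ_mem, ⟨∅, hE 0, mem_omZ.2 ⟨0, rfl⟩, fun y _ => ZFSet.notMem_empty y⟩, fun y hy hyo => ?_⟩
        obtain ⟨n, rfl⟩ := mem_omZ.1 hyo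
        refine ⟨natZ (n + 1), sub_Ext hg (natZ_mem _), mem_omZ.2 ⟨n + 1, rfl⟩, by simp [natZ], fun z _ => ?_⟩
        rw [natZ, ZFSet.mem_insert_iff]; tauto
      · simp only [SatV, fundAx, Sat, sat_iff_and, sat_iff_iff, sat_iff_or, sat_mem2, sat_eq2, vcons]
        rintro x hx ⟨y, hy, hyx⟩
        obtain ⟨z, hz, hm⟩ := ZFSet.mem_wf.has_min {z | z ∈ x} ⟨y, hyx⟩
        exact ⟨z, Ext_trans hx hz, hz, fun u _ hu hux => hm u hux hu⟩
      · exact Ext_choice hg _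
    · exact allClose_intro k _ (fun v hv => Ext_sep hg φ h1 h2 h3 v hv) _ hE
    · exact allClose_intro k _ (fun v hv => Ext_coll hg φ h1 h2 h3 v hv) _ hE
  · have : ((Ext V g : ZFSet) : Set ZFSet) = (val g) '' (V : Set ZFSet) := by
      ext z
      exact mem_Ext
    have h2 := hV.out.2.image (val g)
    show ((Ext V g : ZFSet) : Set ZFSet).Countable
    rw [this]; exact h2

end ext
end SmallExt

namespace SmallExt

/-- the literal `l` is true of the set of facts `H ⊆ B` -/
def LitP (B H l : ZFSet.{0}) : Prop :=
  (∃ f ∈ H, l = opair (natZ 1) f) ∨ ∃ f ∈ B, f ∉ H ∧ l = opair (natZ 0) f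

def Lit (B : ZFSet.{0}) : ZFSet.{0} :=
  zimage (fun f => opair (natZ 1) f) B ∪ zimage (fun f => opair (natZ 0) f) B

theorem mem_Lit {B l : ZFSet} : l ∈ Lit B ↔ ∃ f ∈ B, opair (natZ 1) f = l ∨ opair (natZ 0) f = l := by
  simp only [Lit, ZFSet.mem_union, mem_zimage]
  constructor
  · rintro (⟨f, hf, e⟩ | ⟨f, hf, e⟩)
    · exact ⟨f, hf, Or.inl e⟩
    · exact ⟨f, hf, Or.inr e⟩
  · rintro ⟨f, hf, e | e⟩
    · exact Or.inl ⟨f, hf, e⟩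
    · exact Or.inr ⟨f, hf, e⟩

theorem LitP.mem {B H l : ZFSet} (hH : H ⊆ B) (h : LitP B H l) : l ∈ Lit B := by
  rcases h with ⟨f, hf, e⟩ | ⟨f, hf, -, e⟩
  · exact mem_Lit.2 ⟨f, hH hf, Or.inl e.symm⟩
  · exact mem_Lit.2 ⟨f, hf, Or.inr e.symm⟩

theorem natZ01 : natZ 1 ≠ natZ 0 := fun h => absurd (natZ_inj.1 h) (by decide)

theorem LitP_one {B H f : ZFSet} : LitP B H (opair (natZ 1) f) ↔ f ∈ H := by
  constructor
  · rintro (⟨f', hf, e⟩ | ⟨f', hf, -, e⟩)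
    · rwa [(opair_inj.1 e).2]
    · exact absurd (opair_inj.1 e).1 natZ01
  · exact fun h => Or.inl ⟨f, h, rfl⟩

theorem LitP_zero {B H f : ZFSet} : LitP B H (opair (natZ 0) f) ↔ f ∈ B ∧ f ∉ H := by
  constructor
  · rintro (⟨f', hf, e⟩ | ⟨f', hf, h, e⟩)
    · exact absurd (opair_inj.1 e).1.symm natZ01
    · rw [(opair_inj.1 e).2]; exact ⟨hf, h⟩
  · exact fun h => Or.inr ⟨f, h.1, h.2, rfl⟩

/-- finite set of true literals -/
def FT (B H q : ZFSet.{0}) : Prop := (q : Set ZFSet).Finite ∧ ∀ l ∈ q, LitP B H l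

theorem FT.sub {B H q q' : ZFSet} (h : FT B H q) (h' : q' ⊆ q) : FT B H q' :=
  ⟨h.1.subset h', fun l hl => h.2 l (h' hl)⟩

theorem FT.union {B H q q' : ZFSet} (h : FT B H q) (h' : FT B H q') : FT B H (q ∪ q') := by
  refine ⟨?_, fun l hl => ?_⟩
  · refine (h.1.union h'.1).subset fun l hl => ?_
    exact ZFSet.mem_union.1 hl
  · rcases ZFSet.mem_union.1 hl with hl | hl
    · exact h.2 l hl
    · exact h'.2 l hl

theorem FT.empty {B H : ZFSet} : FT B H ∅ :=
  ⟨Set.Finite.subset Set.finite_empty fun l hl => absurd hl (ZFSet.notMem_empty l), fun l hl => absurd hl (ZFSet.notMem_empty l)⟩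

theorem FT.single {B H l : ZFSet} (h : LitP B H l) : FT B H {l} :=
  ⟨(Set.finite_singleton l).subset fun z hz => by simpa using hz, fun z hz => by
    rw [ZFSet.mem_singleton] at hz; rwa [hz]⟩

theorem FT.fin {B H q : ZFSet} (hH : H ⊆ B) (h : FT B H q) : q ∈ finSubsets (Lit B) :=
  mem_finSubsets.2 ⟨fun l hl => (h.2 l hl).mem hH, h.1⟩

instance DfF.Lit {V : ZFSet.{0}} [Fact (IsCTM V)] {f : Ctx → ZFSet} [hf : DfF V f] : DfF V (fun v => Lit (f v)) :=
  (inferInstance : DfF V (fun v => SmallExt.zimage (fun a => SmallExt.opair (natZ 1) a) (f v) ∪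
    SmallExt.zimage (fun a => SmallExt.opair (natZ 0) a) (f v)))

/-- open definable relation between contexts and sets of facts -/
class OD (V B : ZFSet.{0}) (Θ : Ctx → ZFSet.{0} → Prop) : Prop where
  out : ∃ ok : ZFSet → Ctx → Prop, Df V (fun w => ok (w 0) (fun i => w (i + 1))) ∧
    ∀ v : Ctx, (∀ i, v i ∈ V) → ∀ H, H ⊆ B → (Θ v H ↔ ∃ q, FT B H q ∧ ok q v)

section
variable {V B : ZFSet.{0}} [hV : Fact (IsCTM V)] [hB : Fact (B ∈ V)]

theorem FT.memV {H q : ZFSet} (hH : H ⊆ B) (h : FT B H q) : q ∈ V :=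
  tr (DfF.ap1 (V := V) (F := fun x => finSubsets (Lit x)) inferInstance hB.out) (h.fin hH)

theorem OD.congr {Θ Θ' : Ctx → ZFSet → Prop} (h : OD V B Θ)
    (e : ∀ v : Ctx, (∀ i, v i ∈ V) → ∀ H, H ⊆ B → (Θ' v H ↔ Θ v H)) : OD V B Θ' := by
  obtain ⟨ok, h1, h2⟩ := h.out
  exact ⟨ok, h1, fun v hv H hH => (e v hv H hH).trans (h2 v hv H hH)⟩

instance (priority := 1100) OD.df {R : Ctx → Prop} [h : Df V R] : OD V B (fun v _ => R v) := by
  refine ⟨fun _ v => R v, h.rename (fun i => i + 1), fun v hv H hH => ?_⟩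
  exact ⟨fun h => ⟨∅, FT.empty, h⟩, fun ⟨_, _, h⟩ => h⟩

instance OD.pos {f : Ctx → ZFSet} [hf : DfF V f] : OD V B (fun v H => f v ∈ H) := by
  have := hf.shift
  refine ⟨fun q v => opair (natZ 1) (f v) ∈ q, inferInstance, fun v hv H hH => ?_⟩
  constructor
  · exact fun h => ⟨{opair (natZ 1) (f v)}, FT.single (LitP_one.2 h), by simp⟩
  · rintro ⟨q, hq, h⟩; exact LitP_one.1 (hq.2 _ h)

instance OD.neg {f : Ctx → ZFSet} [hf : DfF V f] : OD V B (fun v H => ¬ f v ∈ H) := by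
  have := hf.shift
  refine ⟨fun q v => f v ∉ B ∨ opair (natZ 0) (f v) ∈ q, inferInstance, fun v hv H hH => ?_⟩
  constructor
  · intro h
    by_cases hb : f v ∈ B
    · exact ⟨{opair (natZ 0) (f v)}, FT.single (LitP_zero.2 ⟨hb, h⟩), Or.inr (by simp)⟩
    · exact ⟨∅, FT.empty, Or.inl hb⟩
  · rintro ⟨q, hq, h | h⟩
    · exact fun h' => h (hH h')
    · exact (LitP_zero.1 (hq.2 _ h)).2

/-- shift the context under one extra first variable -/
theorem Df.swap {ok : ZFSet → Ctx → Prop} (h : Df V (fun w => ok (w 0) (fun i => w (i + 1)))) :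
    Df V (fun w => ok (w 0) (fun i => w (i + 2))) :=
  (h.rename (fun i => if i = 0 then 0 else i + 1)).congr fun v _ => by simp

theorem Df.swap' {ok : ZFSet → Ctx → Prop} (h : Df V (fun w => ok (w 0) (fun i => w (i + 1)))) :
    Df V (fun w => ok (w 1) (vcons (w 0) (fun i => w (i + 2)))) := by
  refine (h.rename (fun i => if i = 0 then 1 else if i = 1 then 0 else i)).congr fun v _ => ?_
  have : vcons (v 0) (fun i => v (i + 2)) = fun i => v (if i + 1 = 0 then 1 else if i + 1 = 1 then 0 else i + 1) := by
    funext i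
    rcases i with _ | i
    · rfl
    · simp [vcons]
  rw [this]; rfl

theorem Df.swap3 {ok : ZFSet → Ctx → Prop} (h : Df V (fun w => ok (w 0) (fun i => w (i + 1)))) :
    Df V (fun w => ok (w 0) (fun i => w (i + 3))) :=
  (h.rename (fun i => if i = 0 then 0 else i + 2)).congr fun v _ => by simp

theorem Df.swap3' {ok : ZFSet → Ctx → Prop} (h : Df V (fun w => ok (w 0) (fun i => w (i + 1)))) :
    Df V (fun w => ok (w 1) (fun i => w (i + 3))) :=
  (h.rename (fun i => if i = 0 then 1 else i + 2)).congr fun v _ => by simp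

instance OD.and {Θ Θ' : Ctx → ZFSet → Prop} [h : OD V B Θ] [h' : OD V B Θ'] :
    OD V B (fun v H => Θ v H ∧ Θ' v H) := by
  obtain ⟨ok, h1, h2⟩ := h.out
  obtain ⟨ok', h1', h2'⟩ := h'.out
  have i1 := h1.swap3'
  have i2 := h1'.swap3
  refine ⟨fun q v => ∃ q1 ∈ V, ∃ q2 ∈ V, q1 ⊆ q ∧ q2 ⊆ q ∧ ok q1 v ∧ ok' q2 v, inferInstance, fun v hv H hH => ?_⟩
  rw [h2 v hv H hH, h2' v hv H hH]
  constructor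
  · rintro ⟨⟨q, a, b⟩, q', a', b'⟩
    exact ⟨q ∪ q', a.union a', q, a.memV hH, q', a'.memV hH, fun z hz => ZFSet.mem_union.2 (Or.inl hz),
      fun z hz => ZFSet.mem_union.2 (Or.inr hz), b, b'⟩
  · rintro ⟨q, a, q1, -, q2, -, s1, s2, b, b'⟩
    exact ⟨⟨q1, a.sub s1, b⟩, q2, a.sub s2, b'⟩

instance OD.or {Θ Θ' : Ctx → ZFSet → Prop} [h : OD V B Θ] [h' : OD V B Θ'] :
    OD V B (fun v H => Θ v H ∨ Θ' v H) := by
  obtain ⟨ok, h1, h2⟩ := h.out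
  obtain ⟨ok', h1', h2'⟩ := h'.out
  refine ⟨fun q v => ok q v ∨ ok' q v, inferInstance, fun v hv H hH => ?_⟩
  rw [h2 v hv H hH, h2' v hv H hH]
  constructor
  · rintro (⟨q, a, b⟩ | ⟨q, a, b⟩)
    · exact ⟨q, a, Or.inl b⟩
    · exact ⟨q, a, Or.inr b⟩
  · rintro ⟨q, a, b | b⟩
    · exact Or.inl ⟨q, a, b⟩
    · exact Or.inr ⟨q, a, b⟩

instance (priority := 800) OD.imp {Θ Θ' : Ctx → ZFSet → Prop} [h : OD V B (fun v H => ¬ Θ v H)] [h' : OD V B Θ'] :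
    OD V B (fun v H => Θ v H → Θ' v H) :=
  (inferInstance : OD V B (fun v H => ¬ Θ v H ∨ Θ' v H)).congr fun _ _ _ _ => imp_iff_not_or

instance OD.iff {Θ Θ' : Ctx → ZFSet → Prop} [OD V B (fun v H => ¬ Θ v H)] [OD V B Θ']
    [OD V B (fun v H => ¬ Θ' v H)] [OD V B Θ] :
    OD V B (fun v H => (Θ v H ↔ Θ' v H)) :=
  (inferInstance : OD V B (fun v H => (Θ v H → Θ' v H) ∧ (Θ' v H → Θ v H))).congr fun _ _ _ _ => iff_iff_implies_and_implies

instance OD.not_and {Θ Θ' : Ctx → ZFSet → Prop} [h : OD V B (fun v H => ¬ Θ v H)] [h' : OD V B (fun v H => ¬ Θ' v H)] :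
    OD V B (fun v H => ¬ (Θ v H ∧ Θ' v H)) :=
  (inferInstance : OD V B (fun v H => ¬ Θ v H ∨ ¬ Θ' v H)).congr fun _ _ _ _ => not_and_or

instance OD.not_or {Θ Θ' : Ctx → ZFSet → Prop} [h : OD V B (fun v H => ¬ Θ v H)] [h' : OD V B (fun v H => ¬ Θ' v H)] :
    OD V B (fun v H => ¬ (Θ v H ∨ Θ' v H)) :=
  (inferInstance : OD V B (fun v H => ¬ Θ v H ∧ ¬ Θ' v H)).congr fun _ _ _ _ => _root_.not_or

instance (priority := 800) OD.not_imp {Θ Θ' : Ctx → ZFSet → Prop} [h : OD V B Θ] [h' : OD V B (fun v H => ¬ Θ' v H)] :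
    OD V B (fun v H => ¬ (Θ v H → Θ' v H)) :=
  (inferInstance : OD V B (fun v H => Θ v H ∧ ¬ Θ' v H)).congr fun _ _ _ _ => Classical.not_imp

instance OD.not_not {Θ : Ctx → ZFSet → Prop} [h : OD V B Θ] : OD V B (fun v H => ¬ ¬ Θ v H) :=
  h.congr fun _ _ _ _ => Classical.not_not

instance OD.exV {R : ZFSet → Ctx → ZFSet → Prop} [h : OD V B (fun w H => R (w 0) (fun i => w (i + 1)) H)] :
    OD V B (fun v H => ∃ a ∈ V, R a v H) := by
  obtain ⟨ok, h1, h2⟩ := h.out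
  have i1 := h1.swap'
  refine ⟨fun q v => ∃ a ∈ V, ok q (vcons a v), inferInstance, fun v hv H hH => ?_⟩
  have e : ∀ a ∈ V, (R a v H ↔ ∃ q, FT B H q ∧ ok q (vcons a v)) := fun a ha => h2 (vcons a v) (vcons_mem ha hv) H hH
  constructor
  · rintro ⟨a, ha, h⟩
    obtain ⟨q, a1, a2⟩ := (e a ha).1 h
    exact ⟨q, a1, a, ha, a2⟩
  · rintro ⟨q, a1, a, ha, a2⟩
    exact ⟨a, ha, (e a ha).2 ⟨q, a1, a2⟩⟩

instance (priority := 950) OD.exB {f : Ctx → ZFSet} {R : ZFSet → Ctx → ZFSet → Prop} [hf : DfF V f]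
    [h : OD V B (fun w H => R (w 0) (fun i => w (i + 1)) H)] :
    OD V B (fun v H => ∃ a ∈ f v, R a v H) := by
  have := hf.shift
  refine (inferInstance : OD V B (fun v H => ∃ a ∈ V, a ∈ f v ∧ R a v H)).congr fun v hv H hH => ?_
  exact exists_congr fun a => ⟨fun h => ⟨tr (hf.cl v hv) h.1, h⟩, fun h => h.2⟩

theorem OD.bind {f : Ctx → ZFSet} {R : ZFSet → Ctx → ZFSet → Prop} (hf : DfF V f)
    (h : OD V B (fun w H => R (w 0) (fun i => w (i + 1)) H)) : OD V B (fun v H => R (f v) v H) := by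
  have := hf.gr
  refine (inferInstance : OD V B (fun v H => ∃ a ∈ V, a = f v ∧ R a v H)).congr fun v hv H hH => ?_
  constructor
  · exact fun h => ⟨f v, hf.cl v hv, rfl, h⟩
  · rintro ⟨a, -, rfl, h⟩; exact h

theorem OD.rename {Θ : Ctx → ZFSet → Prop} (h : OD V B Θ) (ρ : ℕ → ℕ) : OD V B (fun v H => Θ (fun i => v (ρ i)) H) := by
  obtain ⟨ok, h1, h2⟩ := h.out
  refine ⟨fun q v => ok q (fun i => v (ρ i)), ?_, fun v hv H hH => h2 _ (fun i => hv (ρ i)) H hH⟩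
  exact (h1.rename (fun i => if i = 0 then 0 else ρ (i - 1) + 1)).congr fun v _ => by simp

/-- universally quantified open definable relation -/
class Pi2 (V B : ZFSet.{0}) (Ψ : Ctx → ZFSet.{0} → Prop) : Prop where
  out : ∃ Θ : ZFSet → Ctx → ZFSet → Prop, OD V B (fun w H => Θ (w 0) (fun i => w (i + 1)) H) ∧
    ∀ v : Ctx, (∀ i, v i ∈ V) → ∀ H, H ⊆ B → (Ψ v H ↔ ∀ a ∈ V, Θ a v H)

instance (priority := 500) Pi2.od {Θ : Ctx → ZFSet → Prop} [h : OD V B Θ] : Pi2 V B Θ :=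
  ⟨fun _ v H => Θ v H, h.rename _, fun v hv H hH => ⟨fun h _ _ => h, fun h => h ∅ empty_mem'⟩⟩

instance (priority := 1200) Pi2.and {Ψ Ψ' : Ctx → ZFSet → Prop} [h : Pi2 V B Ψ] [h' : Pi2 V B Ψ'] :
    Pi2 V B (fun v H => Ψ v H ∧ Ψ' v H) := by
  obtain ⟨Θ, h1, h2⟩ := h.out
  obtain ⟨Θ', h1', h2'⟩ := h'.out
  refine ⟨fun a v H => Θ a v H ∧ Θ' a v H, inferInstance, fun v hv H hH => ?_⟩
  rw [h2 v hv H hH, h2' v hv H hH]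
  exact ⟨fun h a ha => ⟨h.1 a ha, h.2 a ha⟩, fun h => ⟨fun a ha => (h a ha).1, fun a ha => (h a ha).2⟩⟩

instance (priority := 800) Pi2.imp {Θ Ψ : Ctx → ZFSet → Prop} [h : OD V B (fun v H => ¬ Θ v H)] [h' : Pi2 V B Ψ] :
    Pi2 V B (fun v H => Θ v H → Ψ v H) := by
  obtain ⟨Θ', h1', h2'⟩ := h'.out
  have := h.rename (fun i => i + 1)
  refine ⟨fun a v H => Θ v H → Θ' a v H, inferInstance, fun v hv H hH => ?_⟩
  rw [h2' v hv H hH]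
  exact ⟨fun h a ha h' => h h' a ha, fun h h' a ha => h a ha h'⟩

instance Pi2.allV {R : ZFSet → Ctx → ZFSet → Prop} [h : Pi2 V B (fun w H => R (w 0) (fun i => w (i + 1)) H)] :
    Pi2 V B (fun v H => ∀ a ∈ V, R a v H) := by
  obtain ⟨Θ, h1, h2⟩ := h.out
  refine ⟨fun c v H => Θ (zsnd c) (vcons (zfst c) v) H, ?_, fun v hv H hH => ?_⟩
  · have e1 : OD V B (fun w H => Θ (w 0) (vcons (w 1) (fun i => w (i + 3))) H) := by
      refine (h1.rename (fun i => if i ≤ 1 then i else i + 1)).congr fun v _ H _ => ?_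
      have : vcons (v 1) (fun i => v (i + 3)) = fun i => v (if i + 1 ≤ 1 then i + 1 else i + 1 + 1) := by
        funext i
        rcases i with _ | i
        · rfl
        · simp [vcons]
      rw [this]; rfl
    have e2 := OD.bind (V := V) (B := B) (f := fun w => zsnd (w 1)) (R := fun a w H => Θ a (vcons (w 0) (fun i => w (i + 2))) H) inferInstance e1
    exact OD.bind (V := V) (B := B) (f := fun w => zfst (w 0)) (R := fun a w H => Θ (zsnd (w 0)) (vcons a (fun i => w (i + 1))) H) inferInstance e2
  · constructor
    · intro h c hc
      have c1 : zfst c ∈ V := DfF.ap1 (V := V) (F := zfst) inferInstance hc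
      exact (h2 (vcons (zfst c) v) (vcons_mem c1 hv) H hH).1 (h _ c1) _ (DfF.ap1 (V := V) (F := zsnd) inferInstance hc)
    · intro h a ha
      refine (h2 (vcons a v) (vcons_mem ha hv) H hH).2 fun b hb => ?_
      have this : Θ (zsnd (opair a b)) (vcons (zfst (opair a b)) v) H := h (opair a b) (opair_mem ha hb)
      rwa [zfst_opair, zsnd_opair] at this

instance (priority := 950) Pi2.allB {f : Ctx → ZFSet} {R : ZFSet → Ctx → ZFSet → Prop} [hf : DfF V f]
    [h : Pi2 V B (fun w H => R (w 0) (fun i => w (i + 1)) H)] :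
    Pi2 V B (fun v H => ∀ a ∈ f v, R a v H) := by
  have := hf.shift
  have i : Pi2 V B (fun v H => ∀ a ∈ V, a ∈ f v → R a v H) := inferInstance
  obtain ⟨Θ, h1, h2⟩ := i.out
  refine ⟨Θ, h1, fun v hv H hH => Iff.trans ?_ (h2 v hv H hH)⟩
  exact forall_congr' fun a => ⟨fun h _ => h, fun h h' => h (tr (hf.cl v hv) h') h'⟩

/-- the main definability lemma -/
theorem lemA {Ψ : Ctx → ZFSet → Prop} (hΨ : Pi2 V B Ψ) : ∃ G : ZFSet → Prop, Df V (fun w => G (w 0)) ∧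
    ∀ u ∈ V, ((∃ H, H ⊆ B ∧ Ψ (fun _ => u) H) → G u) ∧
      (G u → ∃ W H, OuterModel V W ∧ H ∈ W ∧ H ⊆ B ∧ Ψ (fun _ => u) H) := by
  obtain ⟨Θ, h1, h2⟩ := hΨ.out
  obtain ⟨ok, k1, k2⟩ := h1.out
  have k1' := k1.rename (fun i => if i ≤ 2 then i else 2)
  have I : ∀ f g h [DfF V f] [DfF V g] [DfF V h], Df V (fun w => ok (f w) (vcons (g w) (fun _ => h w))) := by
    intro f g h _ _ _
    refine Df.comp3 (F := fun a b c => ok a (vcons b (fun _ => c))) (k1'.congr fun v _ => ?_) ‹_› ‹_› ‹_›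
    have : vcons (v 1) (fun _ => v 2) = fun i => v (if i + 1 ≤ 2 then i + 1 else 2) := by
      funext i
      rcases i with _ | i
      · rfl
      · by_cases h : i = 0 <;> simp [vcons, h]
    rw [this]; rfl
  let Clos : ZFSet → ZFSet → ZFSet → Prop := fun X p u =>
    (∀ f ∈ B, ¬ (opair (natZ 1) f ∈ p ∧ opair (natZ 0) f ∈ p)) ∧
    ∀ a ∈ V, ∃ q ∈ X, p ⊆ q ∧ ∃ q' ∈ V, q' ⊆ q ∧ ok q' (vcons a (fun _ => u))
  have hC : Df V (fun w => Clos (w 0) (w 1) (w 2)) := by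
    show Df V (fun w => (∀ f ∈ B, ¬ (opair (natZ 1) f ∈ w 1 ∧ opair (natZ 0) f ∈ w 1)) ∧
      ∀ a ∈ V, ∃ q ∈ w 0, w 1 ⊆ q ∧ ∃ q' ∈ V, q' ⊆ q ∧ ok q' (vcons a (fun _ => w 2)))
    infer_instance
  have IC : ∀ f g h [DfF V f] [DfF V g] [DfF V h], Df V (fun w => Clos (f w) (g w) (h w)) := by
    intro f g h _ _ _
    exact Df.comp3 (F := Clos) hC ‹_› ‹_› ‹_›
  have hFn : finSubsets (Lit B) ∈ V := DfF.ap1 (V := V) (F := fun x => finSubsets (Lit x)) inferInstance hB.out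
  have hFF : Fact (finSubsets (Lit B) ∈ V) := ⟨hFn⟩
  generalize hFe : finSubsets (Lit B) = Fn at hFn hFF
  have cl1 : ∀ {X p u}, Clos X p u → ∀ f ∈ B, ¬ (opair (natZ 1) f ∈ p ∧ opair (natZ 0) f ∈ p) := fun h => h.1
  have cl2 : ∀ {X p u}, Clos X p u → ∀ a ∈ V, ∃ q ∈ X, p ⊆ q ∧ ∃ q' ∈ V, q' ⊆ q ∧ ok q' (vcons a (fun _ => u)) := fun h => h.2
  have cl3 : ∀ {X p u}, (∀ f ∈ B, ¬ (opair (natZ 1) f ∈ p ∧ opair (natZ 0) f ∈ p)) →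
    (∀ a ∈ V, ∃ q ∈ X, p ⊆ q ∧ ∃ q' ∈ V, q' ⊆ q ∧ ok q' (vcons a (fun _ => u))) → Clos X p u := fun h h' => ⟨h, h'⟩
  clear_value Clos
  have eΘ : ∀ u ∈ V, ∀ a ∈ V, ∀ H, H ⊆ B → (Θ a (fun _ => u) H ↔ ∃ q, FT B H q ∧ ok q (vcons a fun _ => u)) := by
    intro u hu a ha H hH
    exact k2 (vcons a fun _ => u) (vcons_mem ha fun _ => hu) H hH
  refine ⟨fun u => ∃ X ∈ V, X ⊆ Fn ∧ ∅ ∈ X ∧ ∀ p ∈ X, Clos X p u, ?_, fun u hu => ⟨?_, ?_⟩⟩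
  · show Df V (fun w => ∃ X ∈ V, X ⊆ Fn ∧ ∅ ∈ X ∧ ∀ p ∈ X, Clos X p (w 0))
    have e : Fact (∅ ∈ V) := ⟨empty_mem'⟩
    infer_instance
  · rintro ⟨H, hH, hΨH⟩
    have hΘ := (h2 (fun _ => u) (fun _ => hu) H hH).1 hΨH
    let HH : ZFSet → ZFSet → ZFSet → ZFSet := fun u _ r => r ∪ ZFSet.sep (fun p => ¬ Clos (Fn \ r) p u) Fn
    have hHH : DfF V (fun v => HH (v 0) (v 1) (v 2)) := by
      show DfF V (fun v => v 2 ∪ ZFSet.sep (fun p => ¬ Clos (Fn \ v 2) p (v 0)) Fn)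
      infer_instance
    have hsub : ∀ y, uRec HH u y ⊆ Fn ∧ ∀ p ∈ uRec HH u y, ¬ FT B H p := by
      intro y
      induction y using ZFSet.inductionOn with
      | _ y ih =>
        refine ⟨fun p hp => ?_, fun p hp => ?_⟩
        · obtain ⟨z, hz, h⟩ := mem_uRec.1 hp
          rcases ZFSet.mem_union.1 h with h | h
          · exact (ih z hz).1 h
          · exact (ZFSet.mem_sep.1 h).1
        · obtain ⟨z, hz, h⟩ := mem_uRec.1 hp
          rcases ZFSet.mem_union.1 h with h | h
          · exact (ih z hz).2 p h
          · intro hF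
            refine (ZFSet.mem_sep.1 h).2 (cl3 ?_ ?_)
            · rintro f hf ⟨l1, l2⟩
              exact (LitP_zero.1 (hF.2 _ l2)).2 (LitP_one.1 (hF.2 _ l1))
            · intro a ha
              obtain ⟨q', hq', ho⟩ := (eΘ u hu a ha H hH).1 (hΘ a ha)
              have hun := hF.union hq'
              refine ⟨p ∪ q', ZFSet.mem_sdiff.2 ⟨hFe ▸ hun.fin hH, fun hr => (ih z hz).2 _ hr hun⟩,
                fun l hl => ZFSet.mem_union.2 (Or.inl hl), q', hq'.memV hH,
                fun l hl => ZFSet.mem_union.2 (Or.inr hl), ho⟩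
    obtain ⟨b, hb, hbo, hst⟩ := stabilize hHH hu hFn (fun x _ => (hsub x).1)
      (fun y r z hz => ZFSet.mem_union.2 (Or.inl hz))
    refine ⟨Fn \ uRec HH u b, ?_, ?_, ?_, ?_⟩
    · have hr : uRec HH u b ∈ V := tr (pwV_mem hFn) (mem_pwV.2 ⟨(DfF.ap2 (V := V) (F := fun u b => uRec HH u b)
        (uRec_DfF hHH inferInstance inferInstance) hu hb), (hsub b).1⟩)
      exact DfF.ap1 (V := V) (F := fun r => Fn \ r) inferInstance hr
    · exact fun z hz => (ZFSet.mem_sdiff.1 hz).1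
    · exact ZFSet.mem_sdiff.2 ⟨hFe ▸ (FT.empty (B := B) (H := H)).fin hH, fun h => (hsub b).2 _ h FT.empty⟩
    · intro p hp
      by_contra hc
      refine (ZFSet.mem_sdiff.1 hp).2 ((hst b hbo hb).2 (ZFSet.mem_union.2 (Or.inr (ZFSet.mem_sep.2 ⟨(ZFSet.mem_sdiff.1 hp).1, hc⟩))))
  · rintro ⟨X, hX, hXF, h0, hc⟩
    have hXf : Fact (X ∈ V) := ⟨hX⟩
    obtain ⟨g, hg, hg0⟩ := exists_gen V h0
    have hout := Ext_outer hg
    have hW : Fact (IsCTM (Ext V g)) := ⟨hout.2.1⟩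
    have hgW := gen_Ext hg
    have hBW : Fact (B ∈ Ext V g) := ⟨sub_Ext hg hB.out⟩
    let H : ZFSet := ZFSet.sep (fun f => opair (natZ 1) f ∈ ZFSet.sUnion g) B
    have hHW : H ∈ Ext V g := DfF.ap1 (V := Ext V g)
      (F := fun g => ZFSet.sep (fun f => opair (natZ 1) f ∈ ZFSet.sUnion g) B) inferInstance hgW
    have hHB : H ⊆ B := fun z hz => (ZFSet.mem_sep.1 hz).1
    refine ⟨Ext V g, H, hout, hHW, hHB, ?_⟩
    have hlit : ∀ q ∈ g, FT B H q := by
      intro q hq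
      have hqF := hXF (hg.sub hq)
      rw [← hFe, mem_finSubsets] at hqF
      refine ⟨hqF.2, fun l hl => ?_⟩
      obtain ⟨f, hf, rfl | rfl⟩ := mem_Lit.1 (hqF.1 hl)
      · exact LitP_one.2 (ZFSet.mem_sep.2 ⟨hf, ZFSet.mem_sUnion.2 ⟨q, hq, hl⟩⟩)
      · refine LitP_zero.2 ⟨hf, fun h => ?_⟩
        obtain ⟨q2, hq2, hl2⟩ := ZFSet.mem_sUnion.1 (ZFSet.mem_sep.1 h).2
        obtain ⟨r, hr, s1, s2⟩ := hg.dir _ hq _ hq2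
        exact cl1 (hc r (hg.sub hr)) f hf ⟨s2 hl2, s1 hl⟩
    refine (h2 (fun _ => u) (fun _ => hu) H hHB).2 fun a ha => ?_
    obtain ⟨q, hq, q', -, hs, ho⟩ := hg.dense (S := fun q v => ∃ q' ∈ V, q' ⊆ q ∧ ok q' (vcons (v 0) (fun _ => v 1)))
      inferInstance (v := vcons a (fun _ => u)) (vcons_mem ha fun _ => hu) (fun p hp => cl2 (hc p hp) a ha)
    exact (eΘ u hu a ha H hHB).2 ⟨q', (hlit q hq).sub hs, ho⟩

end
end SmallExt

namespace SmallExt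

/-! ### lists, tuples and codes -/

theorem zToNat_natZ (n : ℕ) : zToNat (natZ n) = n := by
  have h : ∃ m, natZ m = natZ n := ⟨n, rfl⟩
  unfold zToNat
  rw [dif_pos h]
  exact natZ_inj.1 h.choose_spec

theorem zToNat_not {a : ZFSet} (h : a ∉ omZ) : zToNat a = 0 := by
  unfold zToNat
  rw [dif_neg]
  exact fun h' => h (mem_omZ.2 h')

theorem natZ_succ (n : ℕ) : natZ (n + 1) = insert (natZ n) (natZ n) := rfl

theorem natZ_zero : natZ 0 = ∅ := rfl

theorem natZ_succ_ne (n : ℕ) : natZ (n + 1) ≠ ∅ := by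
  intro h
  have := natZ_inj.1 (show natZ (n + 1) = natZ 0 from h)
  omega

theorem opair_ne {a b : ZFSet} : opair a b ≠ ∅ := by
  intro h
  have : ({a} : ZFSet) ∈ opair a b := by simp [opair, ZFSet.pair]
  rw [h] at this
  exact ZFSet.notMem_empty _ this

theorem zlist_inj : ∀ {l l' : List ZFSet}, zlist l = zlist l' → l = l'
  | [], [], _ => rfl
  | [], _ :: _, h => absurd h.symm opair_ne
  | _ :: _, [], h => absurd h opair_ne
  | a :: l, b :: l', h => by
    have := opair_inj.1 (h : opair a (zlist l) = opair b (zlist l'))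
    rw [this.1, zlist_inj this.2]

theorem ztuple_cons {a : ZFSet} {l : List ZFSet} (h : l ≠ []) : ztuple (a :: l) = opair a (ztuple l) := by
  cases l with
  | nil => exact absurd rfl h
  | cons b l => rfl

theorem ztuple_inj : ∀ {l l' : List ZFSet}, l.length = l'.length → ztuple l = ztuple l' → l = l'
  | [], [], _, _ => rfl
  | [], _ :: _, h, _ => by simp at h
  | _ :: _, [], h, _ => by simp at h
  | [a], [b], _, h => by rw [show a = b from h]
  | [a], b :: c :: l, h, _ => by simp at h
  | b :: c :: l, [a], h, _ => by simp at h
  | a :: b :: l, a' :: b' :: l', hl, h => by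
    have := opair_inj.1 (h : opair a (ztuple (b :: l)) = opair a' (ztuple (b' :: l')))
    rw [this.1, ztuple_inj (by simpa using hl) this.2]

theorem mem_ZPow {U : ZFSet} : ∀ {n : ℕ} {t : ZFSet},
    t ∈ ZPow U n ↔ ∃ l : List ZFSet, l.length = n ∧ (∀ a ∈ l, a ∈ U) ∧ t = ztuple l
  | 0, t => by
    simp only [ZPow, ZFSet.mem_singleton]
    constructor
    · rintro rfl; exact ⟨[], rfl, by simp, rfl⟩
    · rintro ⟨l, hl, -, rfl⟩
      rw [List.length_eq_zero_iff.1 hl]; rfl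
  | 1, t => by
    simp only [ZPow]
    constructor
    · intro h; exact ⟨[t], rfl, by simpa using h, rfl⟩
    · rintro ⟨l, hl, h, rfl⟩
      obtain ⟨a, rfl⟩ := List.length_eq_one_iff.1 hl
      exact h a (by simp)
  | n + 2, t => by
    simp only [ZPow, ZFSet.mem_prod]
    constructor
    · rintro ⟨a, ha, b, hb, rfl⟩
      obtain ⟨l, hl, h, rfl⟩ := mem_ZPow.1 hb
      refine ⟨a :: l, by simp [hl], ?_, ?_⟩
      · intro c hc
        rcases List.mem_cons.1 hc with rfl | hc
        · exact ha
        · exact h c hc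
      · rw [ztuple_cons (by intro h; simp [h] at hl)]; rfl
    · rintro ⟨l, hl, h, rfl⟩
      match l, hl, h with
      | a :: b :: l, hl, h =>
        exact ⟨a, h a (by simp), ztuple (b :: l), mem_ZPow.2 ⟨b :: l, by simpa using hl, fun c hc => h c (by simp [hc]), rfl⟩, rfl⟩

/-- decode the first `n` entries of a coded list -/
def dl : ℕ → ZFSet.{0} → List ZFSet.{0}
  | 0, _ => []
  | n + 1, w => zfst w :: dl n (zsnd w)

theorem dl_zlist : ∀ (l : List ZFSet), dl l.length (zlist l) = l
  | [] => rfl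
  | a :: l => by
    show zfst (opair a (zlist l)) :: dl l.length (zsnd (opair a (zlist l))) = a :: l
    rw [zfst_opair, zsnd_opair, dl_zlist l]

def tupN (n : ℕ) (w : ZFSet.{0}) : ZFSet.{0} := ztuple (dl n w)
def apN (n : ℕ) (b w : ZFSet.{0}) : ZFSet.{0} := ztuple (dl n w ++ [b])
def rawN (n : ℕ) (t : ZFSet.{0}) : ZFSet.{0} := zlist (decodeTuple n t)
def parN (n : ℕ) (t : ZFSet.{0}) : ZFSet.{0} := zlist ((decodeTuple n t).map (opair (natZ 1)))
def frN (n : ℕ) (t : ZFSet.{0}) : ZFSet.{0} := zlist (((decodeTuple (n + 1) t).take n).map (opair (natZ 1)))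
def lastN (n : ℕ) (t : ZFSet.{0}) : ZFSet.{0} := (decodeTuple (n + 1) t).getD n ∅

theorem tupN_zlist {n : ℕ} {l : List ZFSet} (h : l.length = n) : tupN n (zlist l) = ztuple l := by
  subst h; rw [tupN, dl_zlist]

theorem apN_zlist {n : ℕ} {b : ZFSet} {l : List ZFSet} (h : l.length = n) : apN n b (zlist l) = ztuple (l ++ [b]) := by
  subst h; rw [apN, dl_zlist]

theorem length_decode : ∀ (n : ℕ) (t : ZFSet), (decodeTuple n t).length = n
  | 0, _ => rfl
  | 1, _ => rfl
  | n + 2, t => by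
    show (zfst t :: decodeTuple (n + 1) (zsnd t)).length = n + 2
    rw [List.length_cons, length_decode (n + 1)]

theorem decode_ztuple : ∀ (l : List ZFSet), decodeTuple l.length (ztuple l) = l
  | [] => rfl
  | [a] => rfl
  | a :: b :: l => by
    show zfst (opair a (ztuple (b :: l))) :: decodeTuple (l.length + 1) (zsnd (opair a (ztuple (b :: l)))) = a :: b :: l
    rw [zfst_opair, zsnd_opair]
    congr 1
    exact decode_ztuple (b :: l)

instance DfF.ite {V : ZFSet.{0}} {c : Ctx → Prop} {d : ∀ v, Decidable (c v)} {f g : Ctx → ZFSet}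
    [hc : Df V c] [hf : DfF V f] [hg : DfF V g] : DfF V (fun v => @_root_.ite _ (c v) (d v) (f v) (g v)) := by
  refine ⟨fun v hv => ?_, ?_⟩
  · split
    · exact hf.cl v hv
    · exact hg.cl v hv
  · have h1 := hf.gr
    have h2 := hg.gr
    have h3 := hc.rename (fun i => i + 1)
    have : Df V (fun w : Ctx => (c (fun i => w (i + 1)) ∧ w 0 = f (fun i => w (i + 1))) ∨
      (¬ c (fun i => w (i + 1)) ∧ w 0 = g (fun i => w (i + 1)))) := inferInstance
    refine this.congr fun w hw => ?_
    by_cases h : c (fun i => w (i + 1)) <;> simp [h]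

section
variable {V : ZFSet.{0}} [hV : Fact (IsCTM V)]

theorem omZ_cases {a : ZFSet} (h : a ∈ omZ) : ∃ n, a = natZ n := by
  obtain ⟨n, rfl⟩ := mem_omZ.1 h
  exact ⟨n, rfl⟩

/-- recursion on a natural number, with the argument changing along `zsnd` -/
theorem natRec_DfF {F : ℕ → ZFSet → ZFSet → ZFSet} {G : ZFSet → ZFSet → ZFSet}
    {K : ZFSet → ZFSet → ZFSet → ZFSet → ZFSet}
    (h0 : ∀ A t, F 0 A t = G A t) (hs : ∀ n A t, F (n + 1) A t = K (natZ n) A t (F n A (zsnd t)))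
    (hG : DfF V (fun v => G (v 0) (v 1))) (hK : DfF V (fun v => K (v 0) (v 1) (v 2) (v 3)))
    {a b c : Ctx → ZFSet} (ha : DfF V a) (hb : DfF V b) (hc : DfF V c) :
    DfF V (fun v => F (zToNat (a v)) (b v) (c v)) := by
  have IK : ∀ i j k l, DfF V (fun w => K (w i) (w j) (w k) (w l)) := fun i j k l =>
    (hK.rename (fun n => if n = 0 then i else if n = 1 then j else if n = 2 then k else l)).congr fun v _ => by simp
  have IG : ∀ i j, DfF V (fun w => G (w i) (w j)) := fun i j =>
    (hG.rename (fun n => if n = 0 then i else j)).congr fun v _ => by simp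
  have zs : ∀ {t}, t ∈ V → zsnd t ∈ V := fun ht => DfF.ap1 (V := V) (F := zsnd) inferInstance ht
  have cG : ∀ {A t}, A ∈ V → t ∈ V → G A t ∈ V := fun hA ht => DfF.ap2 (V := V) (F := G) hG hA ht
  have cK : ∀ {n A t r}, n ∈ V → A ∈ V → t ∈ V → r ∈ V → K n A t r ∈ V := fun {n A t r} h1 h2 h3 h4 =>
    hK.cl (vcons n (vcons A (vcons t (fun _ => r)))) (vcons_mem h1 (vcons_mem h2 (vcons_mem h3 fun _ => h4)))
  have cF : ∀ n {A t}, A ∈ V → t ∈ V → F n A t ∈ V := by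
    intro n
    induction n with
    | zero => intro A t hA ht; rw [h0]; exact cG hA ht
    | succ n ih => intro A t hA ht; rw [hs]; exact cK (natZ_mem n) hA ht (ih hA (zs ht))
  let J : ZFSet → ZFSet → Prop := fun A Y => ∀ b ∈ Y, (∃ t ∈ V, b = opair ∅ (opair t (G A t))) ∨
    ∃ n ∈ V, ∃ t ∈ V, ∃ r ∈ V, b = opair (insert n n) (opair t (K n A t r)) ∧ opair n (opair (zsnd t) r) ∈ Y
  have he : Fact (∅ ∈ V) := ⟨empty_mem'⟩
  have dJ : Df V (fun w => J (w 0) (w 1)) := by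
    show Df V (fun w => ∀ b ∈ w 1, (∃ t ∈ V, b = opair ∅ (opair t (G (w 0) t))) ∨
      ∃ n ∈ V, ∃ t ∈ V, ∃ r ∈ V, b = opair (insert n n) (opair t (K n (w 0) t r)) ∧ opair n (opair (zsnd t) r) ∈ w 1)
    infer_instance
  have IJ : ∀ f g [DfF V f] [DfF V g], Df V (fun w => J (f w) (g w)) := fun f g _ _ => Df.comp2 (F := J) dJ ‹_› ‹_›
  have sound : ∀ {A Y}, J A Y → ∀ n t y, opair (natZ n) (opair t y) ∈ Y → y = F n A t := by
    intro A Y hJ n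
    induction n with
    | zero =>
      intro t y h
      rcases hJ _ h with ⟨t', -, e⟩ | ⟨n, -, t', -, r, -, e, -⟩
      · obtain ⟨-, e⟩ := opair_inj.1 e
        obtain ⟨rfl, rfl⟩ := opair_inj.1 e
        rw [h0]
      · have := (opair_inj.1 e).1
        rw [natZ_zero] at this
        exact absurd (this ▸ ZFSet.mem_insert n n : n ∈ (∅ : ZFSet)) (ZFSet.notMem_empty n)
    | succ n ih =>
      intro t y h
      rcases hJ _ h with ⟨t', -, e⟩ | ⟨m, hm, t', -, r, -, e, hr⟩
      · exact absurd (opair_inj.1 e).1 (natZ_succ_ne n)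
      · obtain ⟨e1, e2⟩ := opair_inj.1 e
        obtain ⟨rfl, rfl⟩ := opair_inj.1 e2
        have hmn : m ∈ natZ (n + 1) := by rw [e1]; exact ZFSet.mem_insert m m
        obtain ⟨k, hk, rfl⟩ := mem_natZ.1 hmn
        have : n = k := by
          have := natZ_inj.1 (e1.trans (natZ_succ k).symm)
          omega
        subst this
        rw [hs, ← ih _ _ hr]
  have complete : ∀ n {A t}, A ∈ V → t ∈ V → ∃ Y ∈ V, J A Y ∧ opair (natZ n) (opair t (F n A t)) ∈ Y := by
    intro n
    induction n with
    | zero =>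
      intro A t hA ht
      have hm : opair (natZ 0) (opair t (F 0 A t)) ∈ V := opair_mem (natZ_mem 0) (opair_mem ht (cF 0 hA ht))
      refine ⟨{opair (natZ 0) (opair t (F 0 A t))}, DfF.ap1 (V := V) (F := fun x => {x}) inferInstance hm, ?_, by simp⟩
      intro b hb
      rw [ZFSet.mem_singleton] at hb
      exact Or.inl ⟨t, ht, by rw [hb, h0]; rfl⟩
    | succ n ih =>
      intro A t hA ht
      obtain ⟨Y, hY, hJ, hm⟩ := ih hA (zs ht)
      have hm' : opair (natZ (n + 1)) (opair t (F (n + 1) A t)) ∈ V := opair_mem (natZ_mem _) (opair_mem ht (cF _ hA ht))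
      refine ⟨Insert.insert (opair (natZ (n + 1)) (opair t (F (n + 1) A t))) Y,
        DfF.ap2 (V := V) (F := fun x y => Insert.insert x y) inferInstance hm' hY, ?_, ZFSet.mem_insert _ _⟩
      intro b hb
      rcases ZFSet.mem_insert_iff.1 hb with rfl | hb
      · exact Or.inr ⟨natZ n, natZ_mem n, t, ht, F n A (zsnd t), cF n hA (zs ht), by rw [hs]; rfl, ZFSet.mem_insert_of_mem _ hm⟩
      · rcases hJ b hb with h | ⟨n, hn, t, ht, r, hr, e, h⟩
        · exact Or.inl h
        · exact Or.inr ⟨n, hn, t, ht, r, hr, e, ZFSet.mem_insert_of_mem _ h⟩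
  refine DfF.comp3 (F := fun n A t => F (zToNat n) A t) ⟨fun v hv => cF _ (hv 1) (hv 2), ?_⟩ ha hb hc
  have : Df V (fun w => (w 1 ∈ omZ ∧ ∃ Y ∈ V, J (w 2) Y ∧ opair (w 1) (opair (w 3) (w 0)) ∈ Y) ∨ (w 1 ∉ omZ ∧ w 0 = G (w 2) (w 3))) := inferInstance
  refine this.congr fun w hw => ?_
  show w 0 = F (zToNat (w 1)) (w 2) (w 3) ↔ _
  by_cases h : w 1 ∈ omZ
  · obtain ⟨n, hn⟩ := omZ_cases h
    simp only [h, true_and, not_true_eq_false, false_and, or_false]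
    rw [hn, zToNat_natZ]
    constructor
    · intro e
      obtain ⟨Y, hY, hJ, hm⟩ := complete n (hw 2) (hw 3)
      exact ⟨Y, hY, hJ, by rw [e]; exact hm⟩
    · rintro ⟨Y, hY, hJ, hm⟩
      exact sound hJ n _ _ hm
  · rw [zToNat_not h, h0]
    simp [h]

instance DfF.tupN {a c : Ctx → ZFSet} [ha : DfF V a] [hc : DfF V c] : DfF V (fun v => tupN (zToNat (a v)) (c v)) := by
  have he : Fact (∅ ∈ V) := ⟨empty_mem'⟩
  classical
  refine natRec_DfF (F := fun n _ t => SmallExt.tupN n t) (G := fun _ _ => ∅)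
    (K := fun n _ w r => if n = ∅ then SmallExt.zfst w else SmallExt.opair (SmallExt.zfst w) r)
    (fun A t => rfl) (fun n A t => ?_) inferInstance inferInstance ha hc hc
  cases n with
  | zero => simp [SmallExt.tupN, dl, natZ_zero, ztuple]
  | succ n => simp only [natZ_succ_ne, if_false]; rfl

instance DfF.apN {a b c : Ctx → ZFSet} [ha : DfF V a] [hb : DfF V b] [hc : DfF V c] :
    DfF V (fun v => apN (zToNat (a v)) (b v) (c v)) := by
  refine natRec_DfF (F := fun n b t => SmallExt.apN n b t) (G := fun b _ => b)
    (K := fun n _ w r => SmallExt.opair (SmallExt.zfst w) r)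
    (fun A t => rfl) (fun n A t => ?_) inferInstance inferInstance ha hb hc
  exact ztuple_cons (by simp)

instance DfF.rawN {a c : Ctx → ZFSet} [ha : DfF V a] [hc : DfF V c] : DfF V (fun v => rawN (zToNat (a v)) (c v)) := by
  have he : Fact (∅ ∈ V) := ⟨empty_mem'⟩
  classical
  refine natRec_DfF (F := fun n _ t => SmallExt.rawN n t) (G := fun _ _ => ∅)
    (K := fun n _ w r => if n = ∅ then SmallExt.opair w ∅ else SmallExt.opair (SmallExt.zfst w) r)
    (fun A t => rfl) (fun n A t => ?_) inferInstance inferInstance ha hc hc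
  cases n with
  | zero => simp [SmallExt.rawN, decodeTuple, natZ_zero, zlist]
  | succ n => simp only [natZ_succ_ne, if_false]; rfl

instance DfF.parN {a c : Ctx → ZFSet} [ha : DfF V a] [hc : DfF V c] : DfF V (fun v => parN (zToNat (a v)) (c v)) := by
  have he : Fact (∅ ∈ V) := ⟨empty_mem'⟩
  classical
  refine natRec_DfF (F := fun n _ t => SmallExt.parN n t) (G := fun _ _ => ∅)
    (K := fun n _ w r => if n = ∅ then SmallExt.opair (SmallExt.opair (natZ 1) w) ∅ else
      SmallExt.opair (SmallExt.opair (natZ 1) (SmallExt.zfst w)) r)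
    (fun A t => rfl) (fun n A t => ?_) inferInstance inferInstance ha hc hc
  cases n with
  | zero => simp [SmallExt.parN, decodeTuple, natZ_zero, zlist]
  | succ n => simp only [natZ_succ_ne, if_false]; rfl

instance DfF.frN {a c : Ctx → ZFSet} [ha : DfF V a] [hc : DfF V c] : DfF V (fun v => frN (zToNat (a v)) (c v)) := by
  have he : Fact (∅ ∈ V) := ⟨empty_mem'⟩
  refine natRec_DfF (F := fun n _ t => SmallExt.frN n t) (G := fun _ _ => ∅)
    (K := fun n _ w r => SmallExt.opair (SmallExt.opair (natZ 1) (SmallExt.zfst w)) r)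
    (fun A t => rfl) (fun n A t => rfl) inferInstance inferInstance ha hc hc

instance DfF.lastN {a c : Ctx → ZFSet} [ha : DfF V a] [hc : DfF V c] : DfF V (fun v => lastN (zToNat (a v)) (c v)) := by
  refine natRec_DfF (F := fun n _ t => SmallExt.lastN n t) (G := fun _ t => t)
    (K := fun n _ w r => r)
    (fun A t => rfl) (fun n A t => rfl) inferInstance inferInstance ha hc hc

instance DfF.arity {a : Ctx → ZFSet} [ha : DfF V a] : DfF V (fun v => symArity (a v)) :=
  (inferInstance : DfF V (fun v => SmallExt.zfst (SmallExt.zsnd (a v))))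

instance DfF.kind {a : Ctx → ZFSet} [ha : DfF V a] : DfF V (fun v => symKind (a v)) :=
  (inferInstance : DfF V (fun v => SmallExt.zfst (a v)))

end

/-! ### injectivity of codes -/

theorem natZ_ne {m n : ℕ} (h : m ≠ n) : natZ m ≠ natZ n := fun e => h (natZ_inj.1 e)

theorem zlist_ofFn {α : Type*} {n : ℕ} (f : α → ZFSet) (a : Fin n → α) :
    (List.ofFn fun i => f (a i)) = (List.ofFn a).map f := by
  rw [List.map_ofFn]; rfl

theorem TmCode_inj : ∀ {t u : Tm}, TmCode t = TmCode u → t = u := by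
  intro t
  induction t with
  | var n =>
    intro u h
    cases u with
    | var m => rw [natZ_inj.1 (opair_inj.1 h).2]
    | param b => exact absurd (opair_inj.1 h).1 (natZ_ne (by decide))
    | func s m b => exact absurd (opair_inj.1 h).1 (natZ_ne (by decide))
  | param a =>
    intro u h
    cases u with
    | var m => exact absurd (opair_inj.1 h).1 (natZ_ne (by decide))
    | param b => rw [(opair_inj.1 h).2]
    | func s m b => exact absurd (opair_inj.1 h).1 (natZ_ne (by decide))
  | func s n a ih =>
    intro u h
    cases u with
    | var m => exact absurd (opair_inj.1 h).1 (natZ_ne (by decide))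
    | param b => exact absurd (opair_inj.1 h).1 (natZ_ne (by decide))
    | func s' m b =>
      obtain ⟨rfl, h2⟩ := opair_inj.1 (opair_inj.1 h).2
      have h3 := zlist_inj h2
      have hn : n = m := by simpa using congrArg List.length h3
      subst hn
      have h4 := List.ofFn_injective h3
      have : a = b := funext fun i => ih i (congrFun h4 i)
      rw [this]

theorem ofFn_TmCode {n m : ℕ} {a : Fin n → Tm} {b : Fin m → Tm}
    (h : zlist (List.ofFn fun i => TmCode (a i)) = zlist (List.ofFn fun i => TmCode (b i))) :
    List.ofFn a = List.ofFn b := by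
  have h3 := zlist_inj h
  have hn : n = m := by simpa using congrArg List.length h3
  subst hn
  have h4 := List.ofFn_injective h3
  have : a = b := funext fun i => TmCode_inj (congrFun h4 i)
  rw [this]

theorem FmCode_inj : ∀ {f g : Fm}, FmCode f = FmCode g → f = g := by
  intro f
  induction f with
  | rel s n a =>
    intro g h
    cases g with
    | rel s' m b =>
      obtain ⟨rfl, h2⟩ := opair_inj.1 (opair_inj.1 h).2
      have h3 := zlist_inj h2
      have hn : n = m := by simpa using congrArg List.length h3
      subst hn
      have h4 := List.ofFn_injective h3
      have : a = b := funext fun i => TmCode_inj (congrFun h4 i)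
      rw [this]
    | _ => exact absurd (opair_inj.1 h).1 (natZ_ne (by decide))
  | eq t u =>
    intro g h
    cases g with
    | eq t' u' =>
      obtain ⟨h1, h2⟩ := opair_inj.1 (opair_inj.1 h).2
      rw [TmCode_inj h1, TmCode_inj h2]
    | _ => exact absurd (opair_inj.1 h).1 (natZ_ne (by decide))
  | not f ih =>
    intro g h
    cases g with
    | not f' => rw [ih (opair_inj.1 h).2]
    | _ => exact absurd (opair_inj.1 h).1 (natZ_ne (by decide))
  | imp f f1 ih ih1 =>
    intro g h
    cases g with
    | imp f' f1' =>
      obtain ⟨h1, h2⟩ := opair_inj.1 (opair_inj.1 h).2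
      rw [ih h1, ih1 h2]
    | _ => exact absurd (opair_inj.1 h).1 (natZ_ne (by decide))
  | all f ih =>
    intro g h
    cases g with
    | all f' => rw [ih (opair_inj.1 h).2]
    | _ => exact absurd (opair_inj.1 h).1 (natZ_ne (by decide))
  | ex f ih =>
    intro g h
    cases g with
    | ex f' => rw [ih (opair_inj.1 h).2]
    | _ => exact absurd (opair_inj.1 h).1 (natZ_ne (by decide))

end SmallExt

namespace SmallExt

/-! ### TCIs: values of the constraint map, good structures, codes -/

def thv (x s : ZFSet.{0}) : ZFSet.{0} := ZFSet.sUnion (zimage zsnd (ZFSet.sep (fun q => zfst q = s) (tciTheta x)))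
def yv (x s : ZFSet.{0}) : ZFSet.{0} := zfst (thv x s)
def iv (x s : ZFSet.{0}) : ZFSet.{0} := zsnd (thv x s)

theorem iapp_eq {f d s v : ZFSet} (h : IsZFunc f d) (hs : s ∈ d) (hv : opair s v ∈ f) : iapp f s = v := by
  have h1 : opair s (iapp f s) ∈ f := Classical.epsilon_spec (p := fun v => opair s v ∈ f) ⟨v, hv⟩
  obtain ⟨u, -, hu⟩ := h.2 s hs
  rw [hu _ h1, hu _ hv]

theorem iapp_spec {f d s : ZFSet} (h : IsZFunc f d) (hs : s ∈ d) : opair s (iapp f s) ∈ f := by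
  obtain ⟨v, hv, -⟩ := h.2 s hs
  exact Classical.epsilon_spec (p := fun v => opair s v ∈ f) ⟨v, hv⟩

theorem thv_eq {x s : ZFSet} (hx : IsTCI x) (hs : s ∈ insert (tciUdot x) (tciSig x)) : thv x s = iapp (tciTheta x) s := by
  have hf := hx.2.2.2.2.2.2.1
  have hm := iapp_spec hf hs
  apply zext; intro z
  simp only [thv, ZFSet.mem_sUnion, mem_zimage, ZFSet.mem_sep]
  constructor
  · rintro ⟨_, ⟨q, ⟨hq, hqs⟩, rfl⟩, hz⟩
    obtain ⟨s', v, rfl, -⟩ := hf.1 q hq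
    rw [zfst_opair] at hqs
    subst hqs
    rw [zsnd_opair] at hz
    rwa [iapp_eq hf hs hq]
  · intro hz
    exact ⟨_, ⟨_, ⟨hm, zfst_opair _ _⟩, rfl⟩, by rwa [zsnd_opair]⟩

theorem thv_pair {x s : ZFSet} (hx : IsTCI x) (hs : s ∈ insert (tciUdot x) (tciSig x)) :
    iapp (tciTheta x) s = opair (yv x s) (iv x s) ∧ (iv x s = natZ 0 ∨ iv x s = natZ 1) := by
  obtain ⟨y, i, h1, h2, -⟩ := hx.2.2.2.2.2.2.2.1 s hs
  rw [yv, iv, thv_eq hx hs, h1, zfst_opair, zsnd_opair]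
  exact ⟨rfl, h2⟩

/-- structures obeying the constraints of a TCI -/
structure Good (x U : ZFSet.{0}) (X : ZFSet.{0} → ZFSet.{0}) : Prop where
  uy : ∀ a ∈ U, a ∈ yv x (tciUdot x)
  u1 : iv x (tciUdot x) = natZ 1 → ∀ a ∈ yv x (tciUdot x), a ∈ U
  rel : ∀ s ∈ tciSig x, symKind s = natZ 0 → ∀ t ∈ X s, t ∈ yv x s ∧
    ∃ l : List ZFSet, l.length = arityOf s ∧ (∀ a ∈ l, a ∈ U) ∧ t = ztuple l
  rel1 : ∀ s ∈ tciSig x, symKind s = natZ 0 → iv x s = natZ 1 → ∀ l : List ZFSet, l.length = arityOf s →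
    (∀ a ∈ l, a ∈ U) → ztuple l ∈ yv x s → ztuple l ∈ X s
  fn : ∀ s ∈ tciSig x, symKind s = natZ 1 → ∀ t ∈ X s, t ∈ yv x s ∧
    ∃ l : List ZFSet, ∃ b, l.length = arityOf s ∧ (∀ a ∈ l, a ∈ U) ∧ b ∈ U ∧ t = ztuple (l ++ [b])
  fn1 : ∀ s ∈ tciSig x, symKind s = natZ 1 → iv x s = natZ 1 → ∀ (l : List ZFSet) (b : ZFSet), l.length = arityOf s →
    (∀ a ∈ l, a ∈ U) → b ∈ U → ztuple (l ++ [b]) ∈ yv x s → ztuple (l ++ [b]) ∈ X s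
  tot : ∀ s ∈ tciSig x, symKind s = natZ 1 → ∀ l : List ZFSet, l.length = arityOf s → (∀ a ∈ l, a ∈ U) →
    ∃ b ∈ U, ztuple (l ++ [b]) ∈ X s
  uniq : ∀ s ∈ tciSig x, symKind s = natZ 1 → ∀ (l : List ZFSet) (b b' : ZFSet), l.length = arityOf s → (∀ a ∈ l, a ∈ U) →
    ztuple (l ++ [b]) ∈ X s → ztuple (l ++ [b']) ∈ X s → b = b'
  cst : ∀ s ∈ tciSig x, symKind s = natZ 2 → X s ∈ yv x s ∧ X s ∈ U

theorem snoc_split {U : ZFSet} {n : ℕ} {l : List ZFSet} (hl : l.length = n + 1) (h : ∀ a ∈ l, a ∈ U) :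
    ∃ l' b, l = l' ++ [b] ∧ l'.length = n ∧ (∀ a ∈ l', a ∈ U) ∧ b ∈ U := by
  have hne : l ≠ [] := by intro e; simp [e] at hl
  refine ⟨l.dropLast, l.getLast hne, (List.dropLast_append_getLast hne).symm, by simp [hl], fun a ha => h a (List.mem_of_mem_dropLast ha),
    h _ (List.getLast_mem hne)⟩

theorem snoc_inj {n : ℕ} {l l' : List ZFSet} {b b' : ZFSet} (hl : l.length = n) (hl' : l'.length = n)
    (e : ztuple (l ++ [b]) = ztuple (l' ++ [b'])) : l = l' ∧ b = b' := by
  have := ztuple_inj (by simp [hl, hl']) e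
  have h2 := List.append_inj this (by rw [hl, hl'])
  exact ⟨h2.1, by simpa using h2.2⟩

theorem models_iff {x M : ZFSet} (hx : IsTCI x) : ModelsTCI M x ↔
    M = opair (zfst M) (zsnd M) ∧ IsZFunc (zsnd M) (tciSig x) ∧ Good x (zfst M) (iapp (zsnd M)) ∧
    ∀ c ∈ tciT x, ∀ f : Fm, FmCode f = c → SatStr M f := by
  have hσ : ∀ s ∈ tciSig x, s ∈ insert (tciUdot x) (tciSig x) := fun s hs => ZFSet.mem_insert_of_mem _ hs
  have hU0 := thv_pair hx (ZFSet.mem_insert (tciUdot x) (tciSig x))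
  constructor
  · rintro ⟨-, h1, h2, h3, h4, h5⟩
    refine ⟨h1, h2, ?_, h5⟩
    have hU := h3 _ _ hU0.1
    have h4' : ∀ s (hs : s ∈ tciSig x), _ := fun s hs => h4 s hs _ _ (thv_pair hx (hσ s hs)).1
    have hr : ∀ s ∈ tciSig x, symKind s = natZ 0 → ∀ t ∈ iapp (zsnd M) s, t ∈ yv x s ∩ ZPow (zfst M) (arityOf s) := by
      intro s hs hk t ht
      rcases (thv_pair hx (hσ s hs)).2 with hi | hi
      · exact ((h4' s hs).1 hk).1 hi ht
      · rw [← ((h4' s hs).1 hk).2 hi]; exact ht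
    have hf : ∀ s ∈ tciSig x, symKind s = natZ 1 → ∀ t ∈ iapp (zsnd M) s, t ∈ yv x s ∩ ZPow (zfst M) (arityOf s + 1) := by
      intro s hs hk t ht
      rcases (thv_pair hx (hσ s hs)).2 with hi | hi
      · exact ((h4' s hs).2.1 hk).2.1 hi ht
      · rw [← ((h4' s hs).2.1 hk).2.2 hi]; exact ht
    constructor
    · intro a ha
      rcases hU0.2 with hi | hi
      · exact hU.1 hi ha
      · rw [← hU.2 hi]; exact ha
    · intro hi a ha
      rw [hU.2 hi]; exact ha
    · intro s hs hk t ht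
      have := ZFSet.mem_inter.1 (hr s hs hk t ht)
      exact ⟨this.1, mem_ZPow.1 this.2⟩
    · intro s hs hk hi l hl hlU hly
      rw [((h4' s hs).1 hk).2 hi]
      exact ZFSet.mem_inter.2 ⟨hly, mem_ZPow.2 ⟨l, hl, hlU, rfl⟩⟩
    · intro s hs hk t ht
      have := ZFSet.mem_inter.1 (hf s hs hk t ht)
      obtain ⟨l, hl, hlU, e⟩ := mem_ZPow.1 this.2
      obtain ⟨l', b, rfl, h1, h2, h3⟩ := snoc_split hl hlU
      exact ⟨this.1, l', b, h1, h2, h3, e⟩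
    · intro s hs hk hi l b hl hlU hb hly
      rw [((h4' s hs).2.1 hk).2.2 hi]
      refine ZFSet.mem_inter.2 ⟨hly, mem_ZPow.2 ⟨l ++ [b], by simp [hl], fun a ha => ?_, rfl⟩⟩
      rcases List.mem_append.1 ha with ha | ha
      · exact hlU a ha
      · rw [List.mem_singleton.1 ha]; exact hb
    · intro s hs hk l hl hlU
      obtain ⟨b, hb, -⟩ := ((h4' s hs).2.1 hk).1 l hl hlU
      exact ⟨b, hb⟩
    · intro s hs hk l b b' hl hlU hb hb'
      obtain ⟨c, -, hc⟩ := ((h4' s hs).2.1 hk).1 l hl hlU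
      have hbU : ∀ b, ztuple (l ++ [b]) ∈ iapp (zsnd M) s → b ∈ zfst M := by
        intro b hb
        obtain ⟨l1, h1, h2, e⟩ := mem_ZPow.1 (ZFSet.mem_inter.1 (hf s hs hk _ hb)).2
        have := ztuple_inj (by simp [hl, h1]) e
        exact h2 b (by simp [← this])
      rw [hc b ⟨hbU b hb, hb⟩, hc b' ⟨hbU b' hb', hb'⟩]
    · intro s hs hk
      exact (h4' s hs).2.2 hk
  · rintro ⟨h1, h2, hG, h5⟩
    refine ⟨hx, h1, h2, ?_, ?_, h5⟩
    · intro y i e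
      obtain ⟨rfl, rfl⟩ := opair_inj.1 (hU0.1.symm.trans e)
      refine ⟨fun _ a ha => hG.uy a ha, fun hi => ?_⟩
      apply zext; intro a
      exact ⟨fun ha => hG.uy a ha, fun ha => hG.u1 hi a ha⟩
    · intro s hs y i e
      obtain ⟨rfl, rfl⟩ := opair_inj.1 ((thv_pair hx (hσ s hs)).1.symm.trans e)
      have hr : symKind s = natZ 0 → ∀ t ∈ iapp (zsnd M) s, t ∈ yv x s ∩ ZPow (zfst M) (arityOf s) := by
        intro hk t ht
        obtain ⟨a, l, b, c, d⟩ := hG.rel s hs hk t ht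
        exact ZFSet.mem_inter.2 ⟨a, mem_ZPow.2 ⟨l, b, c, d⟩⟩
      have hf : symKind s = natZ 1 → ∀ t ∈ iapp (zsnd M) s, t ∈ yv x s ∩ ZPow (zfst M) (arityOf s + 1) := by
        intro hk t ht
        obtain ⟨a, l, b, c, d, f, e⟩ := hG.fn s hs hk t ht
        refine ZFSet.mem_inter.2 ⟨a, mem_ZPow.2 ⟨l ++ [b], by simp [c], fun a ha => ?_, e⟩⟩
        rcases List.mem_append.1 ha with ha | ha
        · exact d a ha
        · rw [List.mem_singleton.1 ha]; exact f
      refine ⟨fun hk => ⟨fun _ => hr hk, fun hi => ?_⟩, fun hk => ⟨?_, fun _ => hf hk, fun hi => ?_⟩, fun hk => hG.cst s hs hk⟩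
      · apply zext; intro t
        refine ⟨fun ht => hr hk t ht, fun ht => ?_⟩
        obtain ⟨a, b⟩ := ZFSet.mem_inter.1 ht
        obtain ⟨l, h1, h2, rfl⟩ := mem_ZPow.1 b
        exact hG.rel1 s hs hk hi l h1 h2 a
      · intro l hl hlU
        obtain ⟨b, hb, hb'⟩ := hG.tot s hs hk l hl hlU
        exact ⟨b, ⟨hb, hb'⟩, fun c hc => hG.uniq s hs hk l c b hl hlU hc.2 hb'⟩
      · apply zext; intro t
        refine ⟨fun ht => hf hk t ht, fun ht => ?_⟩
        obtain ⟨a, b⟩ := ZFSet.mem_inter.1 ht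
        obtain ⟨l, h1, h2, rfl⟩ := mem_ZPow.1 b
        obtain ⟨l', b', rfl, h3, h4, h5⟩ := snoc_split h1 h2
        exact hG.fn1 s hs hk hi l' b' h3 h4 h5 a

/-! codes -/

open Classical in
def codeF (s t : ZFSet.{0}) : ZFSet.{0} :=
  if symKind s = natZ 0 then opair (natZ 0) (opair s (parN (zToNat (symArity s)) t))
  else if symKind s = natZ 1 then
    opair (natZ 1) (opair (opair (natZ 2) (opair s (frN (zToNat (symArity s)) t))) (opair (natZ 1) (lastN (zToNat (symArity s)) t)))
  else opair (natZ 1) (opair (opair (natZ 2) (opair s ∅)) (opair (natZ 1) t))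

theorem ofFn_getD (l : List ZFSet) (f : ZFSet → ZFSet) (d : ZFSet) (n : ℕ) (h : n ≤ l.length) :
    (List.ofFn fun i : Fin n => f (l.getD i d)) = (l.take n).map f := by
  apply List.ext_getElem
  · simp [h]
  · intro i h1 h2
    have hi : i < l.length := by simp at h2; omega
    simp [hi]

open Classical in
def fmF (s t : ZFSet.{0}) : Fm :=
  if symKind s = natZ 0 then Fm.rel s (arityOf s) fun i => Tm.param ((decodeTuple (arityOf s) t).getD i ∅)
  else if symKind s = natZ 1 then Fm.eq
      (Tm.func s (arityOf s) fun i => Tm.param ((decodeTuple (arityOf s + 1) t).getD i ∅))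
      (Tm.param ((decodeTuple (arityOf s + 1) t).getD (arityOf s) ∅))
  else Fm.eq (Tm.func s 0 Fin.elim0) (Tm.param t)

theorem code_fmF (s t : ZFSet) : FmCode (fmF s t) = codeF s t := by
  unfold fmF codeF
  split_ifs with h1 h2
  · simp only [FmCode, TmCode]
    rw [ofFn_getD (decodeTuple (arityOf s) t) (opair (natZ 1)) ∅ _ (by rw [length_decode]), List.take_of_length_le (by rw [length_decode])]
    rfl
  · simp only [FmCode, TmCode]
    rw [ofFn_getD (decodeTuple (arityOf s + 1) t) (opair (natZ 1)) ∅ _ (by rw [length_decode]; omega)]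
    rfl
  · simp only [FmCode, TmCode]
    rfl

theorem codesFor_eq {x s : ZFSet} (hx : IsTCI x) (hs : s ∈ insert (tciUdot x) (tciSig x)) :
    codesFor x s = zimage (codeF s) (yv x s) := by
  have e : zfst (iapp (tciTheta x) s) = yv x s := by rw [(thv_pair hx hs).1, zfst_opair]
  unfold codesFor
  have h := fun t => code_fmF s t
  split_ifs with h1 h2 <;> rw [e] <;> congr 1 <;> funext t <;> rw [← h t] <;> simp [fmF, h1] <;> simp [h2]

theorem mem_LLbase {x c : ZFSet} (hx : IsTCI x) : c ∈ LLbase x ↔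
    ∃ s ∈ insert (tciUdot x) (tciSig x), ∃ t ∈ yv x s, codeF s t = c := by
  simp only [LLbase, ZFSet.mem_sUnion, mem_zimage]
  constructor
  · rintro ⟨_, ⟨s, hs, rfl⟩, h⟩
    rw [codesFor_eq hx hs, mem_zimage] at h
    exact ⟨s, hs, h⟩
  · rintro ⟨s, hs, h⟩
    exact ⟨_, ⟨s, hs, rfl⟩, by rw [codesFor_eq hx hs, mem_zimage]; exact h⟩

theorem mem_LL {x c : ZFSet} (hx : IsTCI x) : c ∈ LL x ↔
    ∃ s ∈ insert (tciUdot x) (tciSig x), ∃ t ∈ yv x s, c = codeF s t ∨ c = opair (natZ 2) (codeF s t) := by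
  simp only [LL, ZFSet.mem_union, mem_zimage, mem_LLbase hx]
  constructor
  · rintro (⟨s, hs, t, ht, e⟩ | ⟨_, ⟨s, hs, t, ht, rfl⟩, e⟩)
    · exact ⟨s, hs, t, ht, Or.inl e.symm⟩
    · exact ⟨s, hs, t, ht, Or.inr e.symm⟩
  · rintro ⟨s, hs, t, ht, e | e⟩
    · exact Or.inl ⟨s, hs, t, ht, e.symm⟩
    · exact Or.inr ⟨_, ⟨s, hs, t, ht, rfl⟩, e.symm⟩

section
variable {V x : ZFSet.{0}} [hV : Fact (IsCTM V)] [hxV : Fact (x ∈ V)]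

instance : Fact (tciT x ∈ V) := ⟨DfF.ap1 (V := V) (F := fun x => zfst x) inferInstance hxV.out⟩
instance : Fact (tciSig x ∈ V) := ⟨DfF.ap1 (V := V) (F := fun x => zfst (zsnd x)) inferInstance hxV.out⟩
instance : Fact (tciUdot x ∈ V) := ⟨DfF.ap1 (V := V) (F := fun x => zfst (zsnd (zsnd x))) inferInstance hxV.out⟩
instance : Fact (tciTheta x ∈ V) := ⟨DfF.ap1 (V := V) (F := fun x => zsnd (zsnd (zsnd x))) inferInstance hxV.out⟩

instance DfF.thv {f : Ctx → ZFSet} [hf : DfF V f] : DfF V (fun v => thv x (f v)) := by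
  have := hf.shift
  exact (inferInstance : DfF V (fun v => ZFSet.sUnion (SmallExt.zimage (fun q => SmallExt.zsnd q)
    (ZFSet.sep (fun q => SmallExt.zfst q = f v) (tciTheta x)))))

instance DfF.yv {f : Ctx → ZFSet} [hf : DfF V f] : DfF V (fun v => yv x (f v)) :=
  (inferInstance : DfF V (fun v => SmallExt.zfst (SmallExt.thv x (f v))))

instance DfF.iv {f : Ctx → ZFSet} [hf : DfF V f] : DfF V (fun v => iv x (f v)) :=
  (inferInstance : DfF V (fun v => SmallExt.zsnd (SmallExt.thv x (f v))))

instance DfF.codeF {f g : Ctx → ZFSet} [hf : DfF V f] [hg : DfF V g] : DfF V (fun v => codeF (f v) (g v)) := by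
  have he : Fact (∅ ∈ V) := ⟨empty_mem'⟩
  unfold SmallExt.codeF
  infer_instance

theorem LL_mem (hx : IsTCI x) : LL x ∈ V := by
  have h : DfF V (fun v => ZFSet.sUnion (zimage (fun s => zimage (fun t => codeF s t) (yv x s)) (insert (v 0) (tciSig x)))) := inferInstance
  have hb : LLbase x ∈ V := by
    have := DfF.ap1 (V := V) (F := fun u => ZFSet.sUnion (zimage (fun s => zimage (fun t => codeF s t) (yv x s)) (insert u (tciSig x)))) h (Fact.out : tciUdot x ∈ V)
    convert this using 1
    apply zext; intro c
    rw [mem_LLbase hx]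
    simp only [ZFSet.mem_sUnion, mem_zimage]
    constructor
    · rintro ⟨s, hs, h⟩
      exact ⟨_, ⟨s, hs, rfl⟩, by rw [mem_zimage]; exact h⟩
    · rintro ⟨_, ⟨s, hs, rfl⟩, h⟩
      rw [mem_zimage] at h
      exact ⟨s, hs, h⟩
  exact DfF.ap1 (V := V) (F := fun u => u ∪ zimage (fun t => opair (natZ 2) t) u) inferInstance hb

end

end SmallExt

namespace SmallExt

/-! ### Facts and rules describing a model of a TCI -/

abbrev fU (a : ZFSet.{0}) : ZFSet.{0} := opair (natZ 0) a
abbrev fI (s t : ZFSet.{0}) : ZFSet.{0} := opair (natZ 1) (opair s t)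
abbrev fV (c v b : ZFSet.{0}) : ZFSet.{0} := opair (natZ 2) (opair c (opair v b))
abbrev fL (c v b : ZFSet.{0}) : ZFSet.{0} := opair (natZ 3) (opair c (opair v b))
abbrev fS (c v : ZFSet.{0}) : ZFSet.{0} := opair (natZ 4) (opair c v)
abbrev fF (c : ZFSet.{0}) : ZFSet.{0} := opair (natZ 5) c
abbrev fT (c : ZFSet.{0}) : ZFSet.{0} := opair (natZ 6) c
abbrev fTL (c : ZFSet.{0}) : ZFSet.{0} := opair (natZ 7) c
abbrev fN (n w : ZFSet.{0}) : ZFSet.{0} := opair (natZ 8) (opair n w)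
/-- codes of variables, function terms -/
abbrev cv (n : ZFSet.{0}) : ZFSet.{0} := opair (natZ 0) n
abbrev cf (s L : ZFSet.{0}) : ZFSet.{0} := opair (natZ 2) (opair s L)
abbrev tpA (s w : ZFSet.{0}) : ZFSet.{0} := tupN (zToNat (symArity s)) w
abbrev apA (s b w : ZFSet.{0}) : ZFSet.{0} := apN (zToNat (symArity s)) b w

def R1 (x B H : ZFSet.{0}) : Prop :=
  (∀ a ∈ B, fU a ∈ H → a ∈ yv x (tciUdot x)) ∧
  (iv x (tciUdot x) = natZ 1 → ∀ a ∈ yv x (tciUdot x), fU a ∈ H)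

def R2 (B H : ZFSet.{0}) : Prop :=
  (∀ w ∈ B, fN (natZ 0) w ∈ H ↔ w = ∅) ∧
  (∀ n ∈ omZ, ∀ a ∈ B, ∀ w ∈ B, fN (insert n n) (opair a w) ∈ H ↔ fU a ∈ H ∧ fN n w ∈ H) ∧
  (∀ n ∈ omZ, ∀ w ∈ B, fN (insert n n) w ∈ H → ∃ a ∈ B, ∃ w' ∈ B, w = opair a w')

def R3 (x B H : ZFSet.{0}) : Prop := ∀ s ∈ tciSig x, symKind s = natZ 0 →
  (∀ t ∈ B, fI s t ∈ H → t ∈ yv x s ∧ ∃ w ∈ B, fN (symArity s) w ∈ H ∧ t = tpA s w) ∧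
  (iv x s = natZ 1 → ∀ w ∈ B, fN (symArity s) w ∈ H → tpA s w ∈ yv x s → fI s (tpA s w) ∈ H)

def R4 (x B H : ZFSet.{0}) : Prop := ∀ s ∈ tciSig x, symKind s = natZ 1 →
  (∀ t ∈ B, fI s t ∈ H → t ∈ yv x s ∧ ∃ w ∈ B, ∃ b ∈ B, fN (symArity s) w ∈ H ∧ fU b ∈ H ∧ t = apA s b w) ∧
  (iv x s = natZ 1 → ∀ w ∈ B, ∀ b ∈ B, fN (symArity s) w ∈ H → fU b ∈ H → apA s b w ∈ yv x s → fI s (apA s b w) ∈ H) ∧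
  (∀ w ∈ B, fN (symArity s) w ∈ H → ∃ b ∈ B, fU b ∈ H ∧ fI s (apA s b w) ∈ H) ∧
  (∀ w ∈ B, ∀ b ∈ B, ∀ b' ∈ B, fN (symArity s) w ∈ H → fI s (apA s b w) ∈ H → fI s (apA s b' w) ∈ H → b = b')

def R5 (x B H : ZFSet.{0}) : Prop := ∀ s ∈ tciSig x, symKind s = natZ 2 →
  (∃ t ∈ B, fI s t ∈ H) ∧ (∀ t ∈ B, ∀ t' ∈ B, fI s t ∈ H → fI s t' ∈ H → t = t') ∧
  (∀ t ∈ B, fI s t ∈ H → t ∈ yv x s ∧ fU t ∈ H)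

def R6 (B H : ZFSet.{0}) : Prop := (∀ n ∈ omZ, ∀ b ∈ B, fV (cv n) ∅ b ∈ H ↔ b = ∅) ∧
  (∀ m ∈ omZ, ∀ v ∈ B, ∀ a ∈ B, fN m v ∈ H → fU a ∈ H →
    (∀ b ∈ B, fV (cv ∅) (opair a v) b ∈ H ↔ b = a) ∧
    (∀ n ∈ omZ, ∀ b ∈ B, fV (cv (insert n n)) (opair a v) b ∈ H ↔ fV (cv n) v b ∈ H))

def R7 (B H : ZFSet.{0}) : Prop := (∀ s ∈ B, ∀ L ∈ B, fT (cf s L) ∈ H → fTL L ∈ H) ∧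
  (∀ c ∈ B, ∀ L ∈ B, fTL (opair c L) ∈ H → fT c ∈ H ∧ fTL L ∈ H)

def R8 (B H : ZFSet.{0}) : Prop := ∀ m ∈ omZ, ∀ v ∈ B, fN m v ∈ H →
  (∀ w ∈ B, fL ∅ v w ∈ H ↔ w = ∅) ∧
  (∀ c ∈ B, ∀ L ∈ B, fTL (opair c L) ∈ H →
    (∀ w ∈ B, fL (opair c L) v w ∈ H → ∃ b ∈ B, ∃ w' ∈ B, w = opair b w' ∧ fV c v b ∈ H ∧ fL L v w' ∈ H) ∧
    (∀ b ∈ B, ∀ w ∈ B, fV c v b ∈ H → fL L v w ∈ H → fL (opair c L) v (opair b w) ∈ H))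

def R9a (x B H : ZFSet.{0}) : Prop := ∀ m ∈ omZ, ∀ v ∈ B, fN m v ∈ H → ∀ s ∈ tciSig x, fT (cf s ∅) ∈ H →
  (symKind s = natZ 2 → ∀ b ∈ B, fV (cf s ∅) v b ∈ H ↔ fI s b ∈ H) ∧
  (symKind s = natZ 1 → (∀ b ∈ B, fV (cf s ∅) v b ∈ H → ∃ b' ∈ B, b = {b'} ∧ fI s b' ∈ H) ∧
    (∀ b ∈ B, fI s b ∈ H → fV (cf s ∅) v {b} ∈ H))

def R9b (x B E H : ZFSet.{0}) : Prop := ∀ m ∈ omZ, ∀ v ∈ B, fN m v ∈ H → ∀ s ∈ tciSig x, ∀ L ∈ B, L ≠ ∅ → fT (cf s L) ∈ H →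
  (∀ w ∈ B, fL L v w ∈ H →
    (∀ b ∈ B, fV (cf s L) v b ∈ H → fI s (apA s b w) ∈ H ∨ b ∈ E) ∧
    (∀ b ∈ B, ∀ b' ∈ B, fV (cf s L) v b ∈ H → fI s (apA s b' w) ∈ H → b = b') ∧
    (∀ b ∈ B, fI s (apA s b w) ∈ H → fV (cf s L) v b ∈ H) ∧
    (∀ e ∈ E, fV (cf s L) v e ∈ H ∨ ∃ b' ∈ B, fI s (apA s b' w) ∈ H)) ∧
  (∀ b ∈ B, fV (cf s L) v b ∈ H → ∃ w ∈ B, fL L v w ∈ H)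

def R10a (x B H : ZFSet.{0}) : Prop := ∀ s ∈ tciSig x, ∀ L ∈ B, fF (opair (natZ 0) (opair s L)) ∈ H →
  fTL L ∈ H ∧ ∀ m ∈ omZ, ∀ v ∈ B, fN m v ∈ H →
    (fS (opair (natZ 0) (opair s L)) v ∈ H → ∃ w ∈ B, fL L v w ∈ H ∧ fI s (tpA s w) ∈ H) ∧
    (∀ w ∈ B, fL L v w ∈ H → fI s (tpA s w) ∈ H → fS (opair (natZ 0) (opair s L)) v ∈ H)

def R10b (B H : ZFSet.{0}) : Prop := ∀ t ∈ B, ∀ u ∈ B, fF (opair (natZ 1) (opair t u)) ∈ H →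
  fT t ∈ H ∧ fT u ∈ H ∧ ∀ m ∈ omZ, ∀ v ∈ B, fN m v ∈ H →
    (fS (opair (natZ 1) (opair t u)) v ∈ H → ∀ b ∈ B, fV t v b ∈ H ↔ fV u v b ∈ H) ∧
    (∀ b ∈ B, fV t v b ∈ H → fV u v b ∈ H → fS (opair (natZ 1) (opair t u)) v ∈ H) ∧
    (fS (opair (natZ 1) (opair t u)) v ∈ H ∨ (∃ b ∈ B, fV t v b ∈ H) ∨ ∃ b ∈ B, fV u v b ∈ H)

def R10c (B H : ZFSet.{0}) : Prop := (∀ c ∈ B, fF (opair (natZ 2) c) ∈ H → fF c ∈ H ∧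
    ∀ m ∈ omZ, ∀ v ∈ B, fN m v ∈ H → (fS (opair (natZ 2) c) v ∈ H ↔ ¬ fS c v ∈ H)) ∧
  (∀ c ∈ B, ∀ d ∈ B, fF (opair (natZ 3) (opair c d)) ∈ H → fF c ∈ H ∧ fF d ∈ H ∧
    ∀ m ∈ omZ, ∀ v ∈ B, fN m v ∈ H → (fS (opair (natZ 3) (opair c d)) v ∈ H ↔ (fS c v ∈ H → fS d v ∈ H)))

def R10d (B H : ZFSet.{0}) : Prop := (∀ c ∈ B, fF (opair (natZ 4) c) ∈ H → fF c ∈ H ∧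
    ∀ m ∈ omZ, ∀ v ∈ B, fN m v ∈ H → (∀ a ∈ B, fU a ∈ H → fS (opair (natZ 4) c) v ∈ H → fS c (opair a v) ∈ H) ∧
      (fS (opair (natZ 4) c) v ∈ H ∨ ∃ a ∈ B, fU a ∈ H ∧ ¬ fS c (opair a v) ∈ H)) ∧
  (∀ c ∈ B, fF (opair (natZ 5) c) ∈ H → fF c ∈ H ∧
    ∀ m ∈ omZ, ∀ v ∈ B, fN m v ∈ H → (∀ a ∈ B, fU a ∈ H → fS c (opair a v) ∈ H → fS (opair (natZ 5) c) v ∈ H) ∧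
      (fS (opair (natZ 5) c) v ∈ H → ∃ a ∈ B, fU a ∈ H ∧ fS c (opair a v) ∈ H))

def R11 (x H : ZFSet.{0}) : Prop := ∀ c ∈ tciT x, fF c ∈ H ∧ fS c ∅ ∈ H

def Tru (x H s t : ZFSet.{0}) : Prop :=
  (s = tciUdot x ∧ fU t ∈ H) ∨
  (s ≠ tciUdot x ∧ symKind s = natZ 0 ∧ fI s (tpA s (rawN (zToNat (symArity s)) t)) ∈ H) ∨
  (s ≠ tciUdot x ∧ symKind s = natZ 1 ∧ symArity s ≠ ∅ ∧
    fI s (tupN (zToNat (insert (symArity s) (symArity s))) (rawN (zToNat (insert (symArity s) (symArity s))) t)) ∈ H) ∨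
  (s ≠ tciUdot x ∧ symKind s = natZ 1 ∧ symArity s = ∅ ∧ fU t ∈ H ∧ t = {ZFSet.sUnion t} ∧ fI s (ZFSet.sUnion t) ∈ H) ∨
  (s ≠ tciUdot x ∧ symKind s = natZ 2 ∧ fI s t ∈ H)

def Fls (x H s t : ZFSet.{0}) : Prop :=
  (s = tciUdot x ∧ ¬ fU t ∈ H) ∨
  (s ≠ tciUdot x ∧ ¬ Tru x H s t ∧
    ((symKind s = natZ 0 ∧ fN (symArity s) (rawN (zToNat (symArity s)) t) ∈ H) ∨
     (symKind s = natZ 1 ∧ fN (insert (symArity s) (symArity s)) (rawN (zToNat (insert (symArity s) (symArity s))) t) ∈ H) ∨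
     (symKind s = natZ 2 ∧ fU t ∈ H)))

def R12 (x H A p : ZFSet.{0}) : Prop :=
  (∀ c ∈ p, ∃ s ∈ insert (tciUdot x) (tciSig x), ∃ t ∈ yv x s,
    (c = codeF s t ∧ Tru x H s t) ∨ (c = opair (natZ 2) (codeF s t) ∧ Fls x H s t)) ∧
  (∀ a ∈ A, ∃ c ∈ a, ∃ s ∈ insert (tciUdot x) (tciSig x), ∃ t ∈ yv x s,
    (c = codeF s t ∧ ¬ Tru x H s t) ∨ (c = opair (natZ 2) (codeF s t) ∧ ¬ Fls x H s t))

structure Rules (x B E H : ZFSet.{0}) : Prop where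
  r1 : R1 x B H
  r2 : R2 B H
  r3 : R3 x B H
  r4 : R4 x B H
  r5 : R5 x B H
  r6 : R6 B H
  r7 : R7 B H
  r8 : R8 B H
  r9a : R9a x B H
  r9b : R9b x B E H
  r10a : R10a x B H
  r10b : R10b B H
  r10c : R10c B H
  r10d : R10d B H
  r11 : R11 x H

section
variable {V B x E : ZFSet.{0}} [hV : Fact (IsCTM V)] [hB : Fact (B ∈ V)] [hx : Fact (x ∈ V)] [hE : Fact (E ∈ V)]

theorem fempty : Fact (∅ ∈ V) := ⟨empty_mem'⟩

set_option synthInstance.maxHeartbeats 400000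
set_option synthInstance.maxSize 2000

theorem p1 : Pi2 V B (fun _ H => R1 x B H) := by unfold R1; infer_instance
theorem p2 : Pi2 V B (fun _ H => R2 B H) := by
  have := fempty (V := V)
  unfold R2; infer_instance
theorem p3 : Pi2 V B (fun _ H => R3 x B H) := by unfold R3; infer_instance
theorem p4 : Pi2 V B (fun _ H => R4 x B H) := by unfold R4; infer_instance
theorem p5 : Pi2 V B (fun _ H => R5 x B H) := by unfold R5; infer_instance
theorem p6 : Pi2 V B (fun _ H => R6 B H) := by
  have := fempty (V := V)
  unfold R6; infer_instance
theorem p7 : Pi2 V B (fun _ H => R7 B H) := by unfold R7; infer_instance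
theorem p8 : Pi2 V B (fun _ H => R8 B H) := by
  have := fempty (V := V)
  unfold R8; infer_instance
theorem p9a : Pi2 V B (fun _ H => R9a x B H) := by
  have := fempty (V := V)
  unfold R9a; infer_instance
theorem p9b : Pi2 V B (fun _ H => R9b x B E H) := by
  have := fempty (V := V)
  unfold R9b; infer_instance
theorem p10a : Pi2 V B (fun _ H => R10a x B H) := by unfold R10a; infer_instance
theorem p10b : Pi2 V B (fun _ H => R10b B H) := by unfold R10b; infer_instance
theorem p10c : Pi2 V B (fun _ H => R10c B H) := by unfold R10c; infer_instance
theorem p10d : Pi2 V B (fun _ H => R10d B H) := by unfold R10d; infer_instance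
theorem p11 : Pi2 V B (fun _ H => R11 x H) := by
  have := fempty (V := V)
  unfold R11; infer_instance

instance odTru {f g : Ctx → ZFSet} [DfF V f] [DfF V g] : OD V B (fun v H => Tru x H (f v) (g v)) := by
  have := fempty (V := V)
  unfold Tru; infer_instance
instance odNTru {f g : Ctx → ZFSet} [DfF V f] [DfF V g] : OD V B (fun v H => ¬ Tru x H (f v) (g v)) := by
  have := fempty (V := V)
  unfold Tru; infer_instance
instance odFls {f g : Ctx → ZFSet} [DfF V f] [DfF V g] : OD V B (fun v H => Fls x H (f v) (g v)) := by
  unfold Fls; infer_instance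
instance odNFls {f g : Ctx → ZFSet} [DfF V f] [DfF V g] : OD V B (fun v H => ¬ Fls x H (f v) (g v)) := by
  unfold Fls; infer_instance
theorem p12 : Pi2 V B (fun v H => R12 x H (zfst (v 0)) (zsnd (v 0))) := by
  unfold R12; infer_instance

theorem pRules : Pi2 V B (fun v H => Rules x B E H ∧ R12 x H (zfst (v 0)) (zsnd (v 0))) := by
  have i1 := p1 (V := V) (B := B) (x := x)
  have i2 := p2 (V := V) (B := B)
  have i3 := p3 (V := V) (B := B) (x := x)
  have i4 := p4 (V := V) (B := B) (x := x)
  have i5 := p5 (V := V) (B := B) (x := x)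
  have i6 := p6 (V := V) (B := B)
  have i7 := p7 (V := V) (B := B)
  have i8 := p8 (V := V) (B := B)
  have i9 := p9a (V := V) (B := B) (x := x)
  have i10 := p9b (V := V) (B := B) (x := x) (E := E)
  have i11 := p10a (V := V) (B := B) (x := x)
  have i12 := p10b (V := V) (B := B)
  have i13 := p10c (V := V) (B := B)
  have i14 := p10d (V := V) (B := B)
  have i15 := p11 (V := V) (B := B) (x := x)
  have i16 := p12 (V := V) (B := B) (x := x)
  have e : (fun (v : Ctx) H => Rules x B E H ∧ R12 x H (zfst (v 0)) (zsnd (v 0))) =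
    (fun v H => R1 x B H ∧ R2 B H ∧ R3 x B H ∧ R4 x B H ∧ R5 x B H ∧ R6 B H ∧ R7 B H ∧ R8 B H ∧ R9a x B H ∧
      R9b x B E H ∧ R10a x B H ∧ R10b B H ∧ R10c B H ∧ R10d B H ∧ R11 x H ∧ R12 x H (zfst (v 0)) (zsnd (v 0))) := by
    funext v H
    apply propext
    constructor
    · rintro ⟨⟨h1, h2, h3, h4, h5, h6, h7, h8, h9, h10, h11, h12, h13, h14, h15⟩, h16⟩
      exact ⟨h1, h2, h3, h4, h5, h6, h7, h8, h9, h10, h11, h12, h13, h14, h15, h16⟩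
    · rintro ⟨h1, h2, h3, h4, h5, h6, h7, h8, h9, h10, h11, h12, h13, h14, h15, h16⟩
      exact ⟨⟨h1, h2, h3, h4, h5, h6, h7, h8, h9, h10, h11, h12, h13, h14, h15⟩, h16⟩
  rw [e]
  infer_instance
end

end SmallExt

namespace SmallExt

/-! ### semantics -/

def relI (X : ZFSet.{0} → ZFSet.{0}) (s : ZFSet.{0}) (args : List ZFSet.{0}) : Prop := ztuple args ∈ X s
open Classical in
def fnI (X : ZFSet.{0} → ZFSet.{0}) (s : ZFSet.{0}) (args : List ZFSet.{0}) : ZFSet.{0} :=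
  if args = [] then X s else Classical.epsilon fun b => ztuple (args ++ [b]) ∈ X s
def ev (X : ZFSet.{0} → ZFSet.{0}) (l : List ZFSet.{0}) (t : Tm) : ZFSet.{0} := Tm.eval (fnI X) (fun n => l.getD n ∅) t
def sf (U : ZFSet.{0}) (X : ZFSet.{0} → ZFSet.{0}) (l : List ZFSet.{0}) (f : Fm) : Prop :=
  Sat (· ∈ U) (relI X) (fnI X) f (fun n => l.getD n ∅)
def e0 : ZFSet.{0} := Classical.epsilon fun _ => False

theorem eps_none {P : ZFSet → Prop} (h : ¬ ∃ b, P b) : Classical.epsilon P = e0 := by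
  have : P = fun _ => False := by funext b; exact propext ⟨fun hb => h ⟨b, hb⟩, False.elim⟩
  rw [this]; rfl

theorem satStr_iff {M : ZFSet} {f : Fm} : SatStr M f ↔ sf (zfst M) (iapp (zsnd M)) [] f := by
  have : (fun n => ([] : List ZFSet).getD n ∅) = fun _ => ∅ := by funext n; simp
  unfold sf
  rw [this]
  unfold SatStr
  have e : (fun s (args : List ZFSet) => if args = [] then iapp (zsnd M) s
      else Classical.epsilon fun b => ztuple (args ++ [b]) ∈ iapp (zsnd M) s) = fnI (iapp (zsnd M)) := by
    funext s args
    unfold fnI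
    split_ifs <;> rfl
  exact Iff.of_eq (by rw [← e]; rfl)

theorem vcons_getD (a : ZFSet) (l : List ZFSet) : vcons a (fun n => l.getD n ∅) = fun n => (a :: l).getD n ∅ := by
  funext n
  rcases n with _ | n
  · simp [vcons]
  · simp [vcons]

section
variable {U : ZFSet.{0}} {X : ZFSet.{0} → ZFSet.{0}} {l : List ZFSet.{0}}

theorem ev_var {n : ℕ} : ev X l (Tm.var n) = l.getD n ∅ := rfl
theorem ev_param {a : ZFSet} : ev X l (Tm.param a) = a := rfl
theorem ev_func {s : ZFSet} {n : ℕ} {a : Fin n → Tm} : ev X l (Tm.func s n a) = fnI X s ((List.ofFn a).map (ev X l)) := by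
  show fnI X s _ = _
  congr 1
  rw [List.map_ofFn]; rfl
theorem sf_rel {s : ZFSet} {n : ℕ} {a : Fin n → Tm} : sf U X l (Fm.rel s n a) ↔ ztuple ((List.ofFn a).map (ev X l)) ∈ X s := by
  show ztuple _ ∈ _ ↔ _
  rw [List.map_ofFn]; rfl
theorem sf_eq {t u : Tm} : sf U X l (Fm.eq t u) ↔ ev X l t = ev X l u := Iff.rfl
theorem sf_not {f : Fm} : sf U X l (Fm.not f) ↔ ¬ sf U X l f := Iff.rfl
theorem sf_imp {f g : Fm} : sf U X l (Fm.imp f g) ↔ (sf U X l f → sf U X l g) := Iff.rfl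
theorem sf_all {f : Fm} : sf U X l (Fm.all f) ↔ ∀ a ∈ U, sf U X (a :: l) f := by
  unfold sf; rw [Sat]; simp only [vcons_getD]
theorem sf_ex {f : Fm} : sf U X l (Fm.ex f) ↔ ∃ a ∈ U, sf U X (a :: l) f := by
  unfold sf; rw [Sat]; simp only [vcons_getD]
theorem fnI_nil {s : ZFSet} : fnI X s [] = X s := by simp [fnI]
theorem fnI_ne {s : ZFSet} {as : List ZFSet} (h : as ≠ []) : fnI X s as = Classical.epsilon fun b => ztuple (as ++ [b]) ∈ X s := by
  simp [fnI, h]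
end

/-- closure properties of the ambient set -/
structure BOK (x B : ZFSet.{0}) : Prop where
  trs : ∀ u ∈ B, ∀ w ∈ u, w ∈ B
  pr : ∀ a ∈ B, ∀ b ∈ B, ({a, b} : ZFSet) ∈ B
  x : x ∈ B
  om : omZ ∈ B

section
variable {x B : ZFSet.{0}}

theorem BOK.nat (hB : BOK x B) (n : ℕ) : natZ n ∈ B := hB.trs _ hB.om _ (mem_omZ.2 ⟨n, rfl⟩)
theorem BOK.emp (hB : BOK x B) : (∅ : ZFSet) ∈ B := hB.nat 0
theorem BOK.sing (hB : BOK x B) {a : ZFSet} (h : a ∈ B) : ({a} : ZFSet) ∈ B := by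
  have := hB.pr a h a h
  have e : ({a, a} : ZFSet) = {a} := by ext; simp
  rwa [e] at this
theorem BOK.op (hB : BOK x B) {a b : ZFSet} : opair a b ∈ B ↔ a ∈ B ∧ b ∈ B := by
  have e : opair a b = {{a}, {a, b}} := rfl
  constructor
  · intro h
    have h1 : ({a, b} : ZFSet) ∈ B := hB.trs _ h _ (by rw [e]; simp)
    exact ⟨hB.trs _ h1 _ (by simp), hB.trs _ h1 _ (by simp)⟩
  · rintro ⟨ha, hb⟩
    rw [e]
    exact hB.pr _ (hB.sing ha) _ (hB.pr _ ha _ hb)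
theorem BOK.zl (hB : BOK x B) {l : List ZFSet} : zlist l ∈ B ↔ ∀ a ∈ l, a ∈ B := by
  induction l with
  | nil => simp [zlist, hB.emp]
  | cons a l ih => simp [zlist, hB.op, ih]
theorem BOK.zt (hB : BOK x B) : ∀ {l : List ZFSet}, ztuple l ∈ B ↔ ∀ a ∈ l, a ∈ B
  | [] => by simp [ztuple, hB.emp]
  | [a] => by simp [ztuple]
  | a :: b :: l => by
    rw [ztuple, hB.op, BOK.zt hB (l := b :: l)]
    simp
theorem BOK.four (hB : BOK x B) (hx : IsTCI x) : tciT x ∈ B ∧ tciSig x ∈ B ∧ tciUdot x ∈ B ∧ tciTheta x ∈ B := by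
  have h := hB.x
  rw [hx.1, hB.op, hB.op, hB.op] at h
  exact h
theorem BOK.sig (hB : BOK x B) (hx : IsTCI x) {s : ZFSet} (hs : s ∈ insert (tciUdot x) (tciSig x)) : s ∈ B := by
  rcases ZFSet.mem_insert_iff.1 hs with rfl | hs
  · exact (hB.four hx).2.2.1
  · exact hB.trs _ (hB.four hx).2.1 _ hs
theorem BOK.yv (hB : BOK x B) (hx : IsTCI x) {s t : ZFSet} (hs : s ∈ insert (tciUdot x) (tciSig x)) (ht : t ∈ yv x s) : t ∈ B := by
  have h1 := iapp_spec hx.2.2.2.2.2.2.1 hs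
  rw [(thv_pair hx hs).1] at h1
  have h2 := hB.trs _ (hB.four hx).2.2.2 _ h1
  rw [hB.op, hB.op] at h2
  exact hB.trs _ h2.2.1 _ ht
end

theorem exists_BOK {V x : ZFSet.{0}} [Fact (IsCTM V)] (hx : x ∈ V) : ∃ B ∈ V, BOK x B := by
  have h : DfF V (fun v => pcl (tcl {v 0, omZ})) := inferInstance
  refine ⟨pcl (tcl {x, omZ}), DfF.ap1 (V := V) (F := fun y => pcl (tcl {y, omZ})) h hx, ?_⟩
  have ht : ∀ u ∈ tcl {x, omZ}, ∀ w ∈ u, w ∈ tcl {x, omZ} := fun u hu w hw => tcl_trans hu hw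
  refine ⟨fun u hu w hw => pcl_trans ht hu hw, fun a ha b hb => pcl_pair ha hb, sub_pcl (sub_tcl (by simp)), sub_pcl (sub_tcl (by simp))⟩

theorem sym_spec {x s : ZFSet} (hx : IsTCI x) (hs : s ∈ tciSig x) :
    (symKind s = natZ 0 ∨ symKind s = natZ 1 ∨ symKind s = natZ 2) ∧ symArity s = natZ (arityOf s) := by
  obtain ⟨k, a, nm, rfl, hk, n, rfl⟩ := hx.2.1 s hs
  simp only [symKind, arityOf, symArity, zfst_opair, zsnd_opair, zToNat_natZ]
  exact ⟨hk, trivial⟩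

section
variable {x B U : ZFSet.{0}} {X : ZFSet.{0} → ZFSet.{0}}

theorem Good.UB (hx : IsTCI x) (hB : BOK x B) (hG : Good x U X) {a : ZFSet} (h : a ∈ U) : a ∈ B :=
  hB.yv hx (ZFSet.mem_insert _ _) (hG.uy a h)

theorem Good.XB (hx : IsTCI x) (hB : BOK x B) (hG : Good x U X) {s t : ZFSet} (hs : s ∈ tciSig x) (hk : symKind s ≠ natZ 2)
    (h : t ∈ X s) : t ∈ B := by
  rcases (sym_spec hx hs).1 with k | k | k
  · exact hB.yv hx (ZFSet.mem_insert_of_mem _ hs) (hG.rel s hs k t h).1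
  · exact hB.yv hx (ZFSet.mem_insert_of_mem _ hs) (hG.fn s hs k t h).1
  · exact absurd k hk

theorem Good.fnU (hG : Good x U X) {s : ZFSet} {l : List ZFSet} {b : ZFSet} (hs : s ∈ tciSig x) (hk : symKind s = natZ 1)
    (hl : l.length = arityOf s) (h : ztuple (l ++ [b]) ∈ X s) : (∀ a ∈ l, a ∈ U) ∧ b ∈ U := by
  obtain ⟨-, l', b', h1, h2, h3, e⟩ := hG.fn s hs hk _ h
  obtain ⟨rfl, rfl⟩ := snoc_inj hl h1 e
  exact ⟨h2, h3⟩

theorem Good.relU (hG : Good x U X) {s : ZFSet} {l : List ZFSet} (hs : s ∈ tciSig x) (hk : symKind s = natZ 0)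
    (hl : l.length = arityOf s) (h : ztuple l ∈ X s) : ∀ a ∈ l, a ∈ U := by
  obtain ⟨-, l', h1, h2, e⟩ := hG.rel s hs hk _ h
  have := ztuple_inj (hl.trans h1.symm) e
  subst this; exact h2

/-- a nullary function symbol is interpreted by a singleton -/
theorem Good.null (hG : Good x U X) {s : ZFSet} (hs : s ∈ tciSig x) (hk : symKind s = natZ 1) (ha : arityOf s = 0) :
    ∃ b ∈ U, X s = {b} := by
  obtain ⟨b, hb, hb'⟩ := hG.tot s hs hk [] (by simp [ha]) (by simp)
  refine ⟨b, hb, ?_⟩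
  apply zext; intro z
  rw [ZFSet.mem_singleton]
  constructor
  · intro hz
    obtain ⟨-, l', b', h1, h2, h3, e⟩ := hG.fn s hs hk _ hz
    rw [ha] at h1
    obtain rfl := List.length_eq_zero_iff.1 h1
    have e' : z = b' := e
    subst e'
    exact hG.uniq s hs hk [] z b (by simp [ha]) (by simp) hz hb'
  · rintro rfl; exact hb'

/-- values of terms are in the ambient set, or the junk value -/
theorem ev_B (hx : IsTCI x) (hB : BOK x B) (hG : Good x U X) {l : List ZFSet} (hl : ∀ a ∈ l, a ∈ U) :
    ∀ (t : Tm), t.usesSig (tciSig x) → ev X l t ∈ B ∨ ev X l t = e0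
  | Tm.var n, _ => by
    left
    rw [ev_var]
    by_cases hn : n < l.length
    · rw [List.getD_eq_getElem _ _ hn]; exact hG.UB hx hB (hl _ (List.getElem_mem hn))
    · rw [List.getD_eq_default _ _ (by omega)]; exact hB.emp
  | Tm.param a, h => h.elim
  | Tm.func s n a, h => by
    obtain ⟨hs, hk, h'⟩ := h
    rw [ev_func]
    rcases hk with ⟨hk, hn⟩ | ⟨hk, rfl⟩
    · have han : arityOf s = n := by rw [arityOf, hn, zToNat_natZ]
      by_cases h0 : n = 0
      · subst h0
        rw [List.ofFn_zero, List.map_nil, fnI_nil]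
        obtain ⟨b, hb, e⟩ := hG.null hs hk han
        rw [e]
        exact Or.inl (hB.sing (hG.UB hx hB hb))
      · have hne : (List.ofFn a).map (ev X l) ≠ [] := by
          intro e; apply h0; simpa using congrArg List.length e
        rw [fnI_ne hne]
        by_cases hex : ∃ b, ztuple ((List.ofFn a).map (ev X l) ++ [b]) ∈ X s
        · have := Classical.epsilon_spec hex
          exact Or.inl (hG.UB hx hB (hG.fnU hs hk (by simp [han]) this).2)
        · exact Or.inr (eps_none hex)
    · rw [List.ofFn_zero, List.map_nil, fnI_nil]
      exact Or.inl (hG.UB hx hB (hG.cst s hs hk).2)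
end

/-- the facts in `H` about universe and interpretation are those of a structure -/
structure Rep (x H U : ZFSet.{0}) (X : ZFSet.{0} → ZFSet.{0}) : Prop where
  u : ∀ a, fU a ∈ H ↔ a ∈ U
  i : ∀ s ∈ tciSig x, symKind s ≠ natZ 2 → ∀ t, fI s t ∈ H ↔ t ∈ X s
  c : ∀ s ∈ tciSig x, symKind s = natZ 2 → ∀ t, fI s t ∈ H ↔ t = X s
  n : ∀ (n : ℕ) w, fN (natZ n) w ∈ H ↔ ∃ l : List ZFSet, l.length = n ∧ (∀ a ∈ l, a ∈ U) ∧ w = zlist l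

section
variable {x M H : ZFSet.{0}}

theorem fmF_U (hx : IsTCI x) (t : ZFSet) : fmF (tciUdot x) t = Fm.rel (tciUdot x) 1 (fun _ => Tm.param t) := by
  apply FmCode_inj
  have ha : arityOf (tciUdot x) = 1 := by rw [arityOf, hx.2.2.2.2.1, zToNat_natZ]
  unfold fmF
  rw [if_pos hx.2.2.2.1, ha]
  simp [FmCode, TmCode, decodeTuple]

theorem fmF_ne {s s' t t' : ZFSet} : fmF s t ≠ Fm.not (fmF s' t') := by
  unfold fmF
  split_ifs <;> simp

theorem fmF_atom {s t : ZFSet} : (fmF s t).isAtom := by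
  unfold fmF
  split_ifs <;> simp [Fm.isAtom]

theorem fmF_sig (hx : IsTCI x) {s t : ZFSet} (hs : s ∈ tciSig x) : (fmF s t).usesSigP (tciSig x) := by
  obtain ⟨hk, ha⟩ := sym_spec hx hs
  unfold fmF
  split_ifs with h1 h2
  · exact ⟨hs, h1, ha, fun _ => trivial⟩
  · exact ⟨⟨hs, Or.inl ⟨h2, ha⟩, fun _ => trivial⟩, trivial⟩
  · exact ⟨⟨hs, Or.inr ⟨by tauto, rfl⟩, fun i => i.elim0⟩, trivial⟩

/-- the parameters of the literal lie in the universe, and it holds -/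
def PU (U : ZFSet.{0}) (s t : ZFSet.{0}) : Prop := ∀ a ∈ (fmF s t).paramSet, a ∈ U

theorem lit_pos (hx : IsTCI x) {s t : ZFSet} (hs : s ∈ tciSig x) :
    LitTrue x M (fmF s t) ↔ PU (zfst M) s t ∧ SatStr M (fmF s t) := by
  have hsU : s ≠ tciUdot x := fun e => hx.2.2.2.2.2.1 (e ▸ hs)
  have hU : ∀ a, fmF s t ≠ Fm.rel (tciUdot x) 1 (fun _ => Tm.param a) := by
    intro a e
    unfold fmF at e
    split_ifs at e
    injection e with e1
    exact hsU e1
  have hn : ∀ g, fmF s t ≠ Fm.not g := by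
    intro g; unfold fmF; split_ifs <;> simp
  constructor
  · rintro (⟨a, e, -⟩ | ⟨a, e, -⟩ | ⟨g, e, h1, h2, h3, h4, h5⟩)
    · exact (hU a e).elim
    · exact (hn _ e).elim
    · rcases e with e | e
      · subst e; exact ⟨h3, h4 rfl⟩
      · exact (hn _ e).elim
  · rintro ⟨h1, h2⟩
    exact Or.inr (Or.inr ⟨fmF s t, Or.inl rfl, fmF_atom, fmF_sig hx hs, h1, fun _ => h2, fun e => (hn _ e).elim⟩)

theorem lit_neg (hx : IsTCI x) {s t : ZFSet} (hs : s ∈ tciSig x) :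
    LitTrue x M (Fm.not (fmF s t)) ↔ PU (zfst M) s t ∧ ¬ SatStr M (fmF s t) := by
  have hsU : s ≠ tciUdot x := fun e => hx.2.2.2.2.2.1 (e ▸ hs)
  have hU : ∀ a, fmF s t ≠ Fm.rel (tciUdot x) 1 (fun _ => Tm.param a) := by
    intro a e
    unfold fmF at e
    split_ifs at e
    injection e with e1
    exact hsU e1
  have hnn : ∀ g : Fm, g ≠ Fm.not g := by
    intro g e
    have := congrArg sizeOf e
    simp at this
  constructor
  · rintro (⟨a, e, -⟩ | ⟨a, e, -⟩ | ⟨g, e, h1, h2, h3, h4, h5⟩)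
    · cases e
    · injection e with e; exact (hU a e).elim
    · rcases e with e | e
      · subst e; exact h1.elim
      · injection e with e; subst e; exact ⟨h3, h5 rfl⟩
  · rintro ⟨h1, h2⟩
    exact Or.inr (Or.inr ⟨fmF s t, Or.inr rfl, fmF_atom, fmF_sig hx hs, h1, fun e => (hnn _ e.symm).elim, fun _ => h2⟩)

theorem lit_Upos (hx : IsTCI x) {t : ZFSet} : LitTrue x M (fmF (tciUdot x) t) ↔ t ∈ zfst M := by
  rw [fmF_U hx]
  constructor
  · rintro (⟨a, e, h⟩ | ⟨a, e, -⟩ | ⟨g, e, h1, h2, h3, h4, h5⟩)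
    · injection e with e1 e2 e3
      have := congrFun (e3) 0
      injection this with this
      rw [this]; exact h
    · cases e
    · rcases e with e | e
      · subst e; exact (hx.2.2.2.2.2.1 h2.1).elim
      · cases e
  · exact fun h => Or.inl ⟨t, rfl, h⟩

theorem lit_Uneg (hx : IsTCI x) {t : ZFSet} : LitTrue x M (Fm.not (fmF (tciUdot x) t)) ↔ t ∉ zfst M := by
  rw [fmF_U hx]
  constructor
  · rintro (⟨a, e, h⟩ | ⟨a, e, h⟩ | ⟨g, e, h1, h2, h3, h4, h5⟩)
    · cases e
    · injection e with e
      injection e with e1 e2 e3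
      have := congrFun (e3) 0
      injection this with this
      rw [this]; exact h
    · rcases e with e | e
      · subst e; exact h1.elim
      · injection e with e; subst e; exact (hx.2.2.2.2.2.1 h2.1).elim
  · exact fun h => Or.inr (Or.inl ⟨t, rfl, h⟩)

theorem mem_Sigma_pos (hx : IsTCI x) {s t : ZFSet} (hs : s ∈ insert (tciUdot x) (tciSig x)) (ht : t ∈ yv x s) :
    codeF s t ∈ SigmaSet x M ↔ LitTrue x M (fmF s t) := by
  rw [SigmaSet, ZFSet.mem_sep, mem_LL hx]
  constructor
  · rintro ⟨-, f, hf, h⟩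
    rw [← code_fmF] at hf
    rwa [← FmCode_inj hf]
  · intro h
    exact ⟨⟨s, hs, t, ht, Or.inl rfl⟩, _, code_fmF s t, h⟩

theorem mem_Sigma_neg (hx : IsTCI x) {s t : ZFSet} (hs : s ∈ insert (tciUdot x) (tciSig x)) (ht : t ∈ yv x s) :
    opair (natZ 2) (codeF s t) ∈ SigmaSet x M ↔ LitTrue x M (Fm.not (fmF s t)) := by
  have e : FmCode (Fm.not (fmF s t)) = opair (natZ 2) (codeF s t) := by rw [FmCode, code_fmF]
  rw [SigmaSet, ZFSet.mem_sep, mem_LL hx]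
  constructor
  · rintro ⟨-, f, hf, h⟩
    rw [← e] at hf
    rwa [← FmCode_inj hf]
  · intro h
    exact ⟨⟨s, hs, t, ht, Or.inr rfl⟩, _, e, h⟩

end

end SmallExt

namespace SmallExt

/-! ### the diagram in terms of facts -/

theorem ev_params {X : ZFSet → ZFSet} {L : List ZFSet} {n : ℕ} (h : n ≤ L.length) :
    (List.ofFn fun i : Fin n => Tm.param (L.getD i ∅)).map (ev X []) = L.take n := by
  rw [List.map_ofFn]
  have := ofFn_getD L id ∅ n h
  rw [List.map_id] at this
  exact this

theorem params_U {U : ZFSet} {L : List ZFSet} {n : ℕ} (h : n ≤ L.length) :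
    (∀ a, (∃ i : Fin n, a ∈ Tm.paramSet (Tm.param (L.getD i ∅))) → a ∈ U) ↔ ∀ a ∈ L.take n, a ∈ U := by
  constructor
  · intro H a ha
    obtain ⟨i, hi, rfl⟩ := List.mem_iff_getElem.1 ha
    have hi' : i < n := by simp at hi; omega
    have hl : i < L.length := by omega
    apply H
    refine ⟨⟨i, hi'⟩, ?_⟩
    simp [Tm.paramSet, hl]
  · rintro H a ⟨⟨i, hi⟩, ha⟩
    have hl : i < L.length := by omega
    simp only [Tm.paramSet, Set.mem_singleton_iff] at ha
    rw [ha, List.getD_eq_getElem _ _ hl]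
    apply H
    rw [List.mem_iff_getElem]
    exact ⟨i, by simp; omega, by simp⟩

section
variable {x H U : ZFSet.{0}} {X : ZFSet.{0} → ZFSet.{0}} {s t : ZFSet.{0}}

theorem tup_raw {n : ℕ} : tupN n (rawN n t) = ztuple (decodeTuple n t) := by
  unfold rawN
  rw [tupN_zlist (length_decode n t)]

theorem k0 (h0 : symKind s = natZ 0) : (PU U s t ↔ ∀ a ∈ decodeTuple (arityOf s) t, a ∈ U) ∧
    (sf U X [] (fmF s t) ↔ ztuple (decodeTuple (arityOf s) t) ∈ X s) := by
  have hl := length_decode (arityOf s) t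
  have e : fmF s t = Fm.rel s (arityOf s) fun i => Tm.param ((decodeTuple (arityOf s) t).getD i ∅) := by
    unfold fmF; rw [if_pos h0]
  constructor
  · unfold PU
    rw [e]
    have := params_U (U := U) (L := decodeTuple (arityOf s) t) (n := arityOf s) (by omega)
    rw [List.take_of_length_le (by omega)] at this
    exact this
  · rw [e, sf_rel, ev_params (by omega), List.take_of_length_le (by omega)]

theorem k1e (h1 : symKind s = natZ 1) : fmF s t = Fm.eq
      (Tm.func s (arityOf s) fun i => Tm.param ((decodeTuple (arityOf s + 1) t).getD i ∅))
      (Tm.param ((decodeTuple (arityOf s + 1) t).getD (arityOf s) ∅)) := by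
  unfold fmF; rw [if_neg (by rw [h1]; exact natZ_ne (by decide)), if_pos h1]

theorem split_last {L : List ZFSet} {n : ℕ} (h : L.length = n + 1) : L = L.take n ++ [L.getD n ∅] := by
  have h2 : L.drop n = [L.getD n ∅] := by
    rw [List.getD_eq_getElem _ _ (by omega)]
    rw [List.drop_eq_getElem_cons (by omega), List.drop_of_length_le (by omega)]
  rw [← h2, List.take_append_drop]

theorem k1 (h1 : symKind s = natZ 1) : (PU U s t ↔ ∀ a ∈ decodeTuple (arityOf s + 1) t, a ∈ U) ∧
    (sf U X [] (fmF s t) ↔ fnI X s ((decodeTuple (arityOf s + 1) t).take (arityOf s)) = (decodeTuple (arityOf s + 1) t).getD (arityOf s) ∅) := by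
  have hl := length_decode (arityOf s + 1) t
  generalize hL : decodeTuple (arityOf s + 1) t = L at *
  constructor
  · unfold PU
    rw [k1e h1, hL]
    have := params_U (U := U) (L := L) (n := arityOf s) (by omega)
    have e2 := split_last hl
    have e3 : (∀ a ∈ L, a ∈ U) ↔ (∀ a ∈ L.take (arityOf s), a ∈ U) ∧ L.getD (arityOf s) ∅ ∈ U := by
      conv_lhs => rw [e2]
      constructor
      · exact fun h => ⟨fun a ha => h a (List.mem_append.2 (Or.inl ha)), h _ (List.mem_append.2 (Or.inr (by simp)))⟩
      · rintro ⟨h1, h2⟩ a ha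
        rcases List.mem_append.1 ha with ha | ha
        · exact h1 a ha
        · rw [List.mem_singleton.1 ha]; exact h2
    rw [e3, ← this]
    constructor
    · intro h
      exact ⟨fun a ha => h a (Or.inl ha), h _ (Or.inr rfl)⟩
    · rintro ⟨h1, h2⟩ a (ha | ha)
      · exact h1 a ha
      · rw [show a = _ from ha]; exact h2
  · rw [k1e h1, hL, sf_eq, ev_func, ev_params (by omega), ev_param]

theorem k2 (h2 : symKind s = natZ 2) : (PU U s t ↔ t ∈ U) ∧ (sf U X [] (fmF s t) ↔ X s = t) := by
  have e : fmF s t = Fm.eq (Tm.func s 0 Fin.elim0) (Tm.param t) := by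
    unfold fmF; rw [if_neg (by rw [h2]; exact natZ_ne (by decide)), if_neg (by rw [h2]; exact natZ_ne (by decide))]
  constructor
  · unfold PU
    rw [e]
    constructor
    · exact fun h => h t (Or.inr rfl)
    · rintro h a (⟨i, -⟩ | ha)
      · exact i.elim0
      · rw [show a = t from ha]; exact h
  · rw [e, sf_eq, ev_func, ev_param, List.ofFn_zero, List.map_nil, fnI_nil]

theorem Tru_iff (hx : IsTCI x) (hG : Good x U X) (hR : Rep x H U X) (hs : s ∈ tciSig x) :
    Tru x H s t ↔ PU U s t ∧ sf U X [] (fmF s t) := by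
  have hsU : s ≠ tciUdot x := fun e => hx.2.2.2.2.2.1 (e ▸ hs)
  obtain ⟨hk, ha⟩ := sym_spec hx hs
  have n01 : ((natZ 0 : ZFSet.{0}) = natZ 1) = False := eq_false <| natZ_ne (by decide)
  have n02 : ((natZ 0 : ZFSet.{0}) = natZ 2) = False := eq_false <| natZ_ne (by decide)
  have n12 : ((natZ 1 : ZFSet.{0}) = natZ 2) = False := eq_false <| natZ_ne (by decide)
  have n10 : ((natZ 1 : ZFSet.{0}) = natZ 0) = False := eq_false <| natZ_ne (by decide)
  have n20 : ((natZ 2 : ZFSet.{0}) = natZ 0) = False := eq_false <| natZ_ne (by decide)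
  have n21 : ((natZ 2 : ZFSet.{0}) = natZ 1) = False := eq_false <| natZ_ne (by decide)
  have hz : zToNat (symArity s) = arityOf s := rfl
  have hz1 : zToNat (insert (symArity s) (symArity s)) = arityOf s + 1 := by rw [ha, ← natZ_succ, zToNat_natZ]
  unfold Tru tpA
  rw [hz1, hz, tup_raw, tup_raw]
  rcases hk with k | k | k
  · simp only [hsU, k, n01, n02, ne_eq, not_false_eq_true, true_and, false_and, or_false, false_or]
    rw [hR.i s hs (by rw [k]; exact natZ_ne (by decide)), (k0 (U := U) (X := X) k).1, (k0 (U := U) (X := X) k).2]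
    exact ⟨fun h => ⟨hG.relU hs k (length_decode _ _) h, h⟩, fun h => h.2⟩
  · simp only [hsU, k, n10, n12, ne_eq, not_false_eq_true, true_and, false_and, or_false, false_or]
    rw [hR.i s hs (by rw [k]; exact natZ_ne (by decide)), hR.i s hs (by rw [k]; exact natZ_ne (by decide)), hR.u, (k1 (U := U) (X := X) k).1, (k1 (U := U) (X := X) k).2]
    have hl := length_decode (arityOf s + 1) t
    by_cases h0 : arityOf s = 0
    · have : symArity s = ∅ := by rw [ha, h0]; rfl
      simp only [this, not_true_eq_false, false_and, false_or, true_and]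
      rw [h0]
      simp only [decodeTuple, List.take_zero, List.getD_cons_zero, fnI_nil]
      obtain ⟨b, hb, e⟩ := hG.null hs k h0
      rw [e]
      simp only [ZFSet.mem_singleton, List.mem_singleton, forall_eq]
      constructor
      · rintro ⟨h1, h2, h3⟩
        exact ⟨h1, by rw [← h3, ← h2]⟩
      · rintro ⟨h1, rfl⟩
        exact ⟨h1, by simp, by simp⟩
    · have : symArity s ≠ ∅ := by
        rw [ha]
        obtain ⟨m, hm⟩ := Nat.exists_eq_succ_of_ne_zero h0
        rw [hm]; exact natZ_succ_ne m
      simp only [this, not_false_eq_true, true_and, false_and, or_false]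
      generalize decodeTuple (arityOf s + 1) t = L at *
      have e2 := split_last hl
      have hlt : (L.take (arityOf s)).length = arityOf s := by simp [hl]
      have hne : L.take (arityOf s) ≠ [] := by intro e; rw [e] at hlt; exact h0 hlt.symm
      rw [fnI_ne hne]
      constructor
      · intro h
        rw [e2] at h
        have h3 := hG.fnU hs k hlt h
        refine ⟨?_, ?_⟩
        · intro a ha
          rw [e2] at ha
          rcases List.mem_append.1 ha with ha | ha
          · exact h3.1 a ha
          · rw [List.mem_singleton.1 ha]; exact h3.2
        · have h4 := Classical.epsilon_spec (p := fun b => ztuple (L.take (arityOf s) ++ [b]) ∈ X s) ⟨_, h⟩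
          exact hG.uniq s hs k _ _ _ hlt h3.1 h4 h
      · rintro ⟨h1, h2⟩
        obtain ⟨b, hb, hb'⟩ := hG.tot s hs k _ hlt (fun a ha => h1 a (List.mem_of_mem_take ha))
        have h4 := Classical.epsilon_spec (p := fun b => ztuple (L.take (arityOf s) ++ [b]) ∈ X s) ⟨_, hb'⟩
        rw [h2] at h4
        rw [e2]; exact h4
  · simp only [hsU, k, n20, n21, ne_eq, not_false_eq_true, true_and, false_and, or_false, false_or]
    rw [hR.c s hs k, (k2 (U := U) (X := X) k).1, (k2 (U := U) (X := X) k).2]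
    exact ⟨fun h => ⟨by rw [h]; exact (hG.cst s hs k).2, h.symm⟩, fun h => h.2.symm⟩

theorem Fls_iff (hx : IsTCI x) (hG : Good x U X) (hR : Rep x H U X) (hs : s ∈ tciSig x) :
    Fls x H s t ↔ PU U s t ∧ ¬ sf U X [] (fmF s t) := by
  have hsU : s ≠ tciUdot x := fun e => hx.2.2.2.2.2.1 (e ▸ hs)
  obtain ⟨hk, ha⟩ := sym_spec hx hs
  have n01 : ((natZ 0 : ZFSet.{0}) = natZ 1) = False := eq_false <| natZ_ne (by decide)
  have n02 : ((natZ 0 : ZFSet.{0}) = natZ 2) = False := eq_false <| natZ_ne (by decide)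
  have n12 : ((natZ 1 : ZFSet.{0}) = natZ 2) = False := eq_false <| natZ_ne (by decide)
  have n10 : ((natZ 1 : ZFSet.{0}) = natZ 0) = False := eq_false <| natZ_ne (by decide)
  have n20 : ((natZ 2 : ZFSet.{0}) = natZ 0) = False := eq_false <| natZ_ne (by decide)
  have n21 : ((natZ 2 : ZFSet.{0}) = natZ 1) = False := eq_false <| natZ_ne (by decide)
  have hz : zToNat (symArity s) = arityOf s := rfl
  have hz1 : zToNat (insert (symArity s) (symArity s)) = arityOf s + 1 := by rw [ha, ← natZ_succ, zToNat_natZ]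
  have hraw : ∀ n, (∃ l : List ZFSet, l.length = n ∧ (∀ a ∈ l, a ∈ U) ∧ rawN n t = zlist l) ↔ ∀ a ∈ decodeTuple n t, a ∈ U := by
    intro n
    constructor
    · rintro ⟨l, h1, h2, e⟩
      rw [zlist_inj e]; exact h2
    · exact fun h => ⟨_, length_decode n t, h, rfl⟩
  unfold Fls
  rw [Tru_iff hx hG hR hs, hz1, hz]
  have hN : (symKind s = natZ 0 ∧ fN (symArity s) (rawN (arityOf s) t) ∈ H ∨
     symKind s = natZ 1 ∧ fN (insert (symArity s) (symArity s)) (rawN (arityOf s + 1) t) ∈ H ∨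
     symKind s = natZ 2 ∧ fU t ∈ H) ↔ PU U s t := by
    rw [ha, ← natZ_succ, hR.n, hR.n, hraw, hraw, hR.u]
    rcases hk with k | k | k
    · simp only [k, n01, n02, true_and, false_and, or_false, (k0 (U := U) (X := X) k).1]
    · simp only [k, n10, n12, true_and, false_and, or_false, false_or, (k1 (U := U) (X := X) k).1]
    · simp only [k, n20, n21, true_and, false_and, or_false, false_or, (k2 (U := U) (X := X) k).1]
  rw [hN]
  simp only [hsU]
  tauto

theorem sigma_pos {M : ZFSet} (hx : IsTCI x) (hG : Good x (zfst M) (iapp (zsnd M))) (hR : Rep x H (zfst M) (iapp (zsnd M)))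
    (hs : s ∈ insert (tciUdot x) (tciSig x)) (ht : t ∈ yv x s) : codeF s t ∈ SigmaSet x M ↔ Tru x H s t := by
  rw [mem_Sigma_pos hx hs ht]
  rcases ZFSet.mem_insert_iff.1 hs with rfl | hs
  · rw [lit_Upos hx]
    simp [Tru, hR.u]
  · rw [lit_pos hx hs, Tru_iff hx hG hR hs, satStr_iff]

theorem sigma_neg {M : ZFSet} (hx : IsTCI x) (hG : Good x (zfst M) (iapp (zsnd M))) (hR : Rep x H (zfst M) (iapp (zsnd M)))
    (hs : s ∈ insert (tciUdot x) (tciSig x)) (ht : t ∈ yv x s) : opair (natZ 2) (codeF s t) ∈ SigmaSet x M ↔ Fls x H s t := by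
  rw [mem_Sigma_neg hx hs ht]
  rcases ZFSet.mem_insert_iff.1 hs with rfl | hs
  · rw [lit_Uneg hx]
    simp [Fls, hR.u]
  · rw [lit_neg hx hs, Fls_iff hx hG hR hs, satStr_iff]

/-- rule 12 expresses that the condition `p` holds and those in `A` fail -/
theorem R12_iff {M A p : ZFSet} (hx : IsTCI x) (hG : Good x (zfst M) (iapp (zsnd M))) (hR : Rep x H (zfst M) (iapp (zsnd M)))
    (hp : p ⊆ LL x) (hA : ∀ a ∈ A, a ⊆ LL x) :
    R12 x H A p ↔ p ⊆ SigmaSet x M ∧ ∀ a ∈ A, ¬ a ⊆ SigmaSet x M := by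
  have key : ∀ c ∈ LL x, (c ∈ SigmaSet x M ↔ ∃ s ∈ insert (tciUdot x) (tciSig x), ∃ t ∈ yv x s,
    (c = codeF s t ∧ Tru x H s t) ∨ (c = opair (natZ 2) (codeF s t) ∧ Fls x H s t)) := by
    intro c hc
    constructor
    · intro h
      obtain ⟨s, hs, t, ht, e | e⟩ := (mem_LL hx).1 hc
      · exact ⟨s, hs, t, ht, Or.inl ⟨e, (sigma_pos hx hG hR hs ht).1 (e ▸ h)⟩⟩
      · exact ⟨s, hs, t, ht, Or.inr ⟨e, (sigma_neg hx hG hR hs ht).1 (e ▸ h)⟩⟩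
    · rintro ⟨s, hs, t, ht, ⟨rfl, h⟩ | ⟨rfl, h⟩⟩
      · exact (sigma_pos hx hG hR hs ht).2 h
      · exact (sigma_neg hx hG hR hs ht).2 h
  have key' : ∀ c ∈ LL x, (c ∉ SigmaSet x M ↔ ∃ s ∈ insert (tciUdot x) (tciSig x), ∃ t ∈ yv x s,
    (c = codeF s t ∧ ¬ Tru x H s t) ∨ (c = opair (natZ 2) (codeF s t) ∧ ¬ Fls x H s t)) := by
    intro c hc
    constructor
    · intro h
      obtain ⟨s, hs, t, ht, e | e⟩ := (mem_LL hx).1 hc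
      · exact ⟨s, hs, t, ht, Or.inl ⟨e, fun h' => h (e ▸ (sigma_pos hx hG hR hs ht).2 h')⟩⟩
      · exact ⟨s, hs, t, ht, Or.inr ⟨e, fun h' => h (e ▸ (sigma_neg hx hG hR hs ht).2 h')⟩⟩
    · rintro ⟨s, hs, t, ht, ⟨rfl, h⟩ | ⟨rfl, h⟩⟩
      · exact fun h' => h ((sigma_pos hx hG hR hs ht).1 h')
      · exact fun h' => h ((sigma_neg hx hG hR hs ht).1 h')
  unfold R12
  constructor
  · rintro ⟨h1, h2⟩
    refine ⟨fun c hc => (key c (hp hc)).2 (h1 c hc), fun a ha hs => ?_⟩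
    obtain ⟨c, hc, h⟩ := h2 a ha
    exact (key' c (hA a ha hc)).2 h (hs hc)
  · rintro ⟨h1, h2⟩
    refine ⟨fun c hc => (key c (hp hc)).1 (h1 hc), fun a ha => ?_⟩
    by_contra hcon
    refine h2 a ha fun c hc => ?_
    by_contra hc'
    exact hcon ⟨c, hc, (key' c (hA a ha hc)).1 hc'⟩
end

end SmallExt

namespace SmallExt

/-! ### the facts of an actual model satisfy the rules -/

/-- `H` is the set of all true facts about the structure (U, X) -/
structure Full (x B H U : ZFSet.{0}) (X : ZFSet.{0} → ZFSet.{0}) : Prop where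
  rep : Rep x H U X
  T : ∀ c, fT c ∈ H ↔ c ∈ B ∧ ∃ t : Tm, t.usesSig (tciSig x) ∧ TmCode t = c
  TL : ∀ c, fTL c ∈ H ↔ c ∈ B ∧ ∃ ts : List Tm, (∀ t ∈ ts, t.usesSig (tciSig x)) ∧ zlist (ts.map TmCode) = c
  F : ∀ c, fF c ∈ H ↔ c ∈ B ∧ ∃ f : Fm, f.usesSig (tciSig x) ∧ FmCode f = c
  V : ∀ (t : Tm) (l : List ZFSet) b, t.usesSig (tciSig x) → (∀ a ∈ l, a ∈ U) → TmCode t ∈ B →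
    (fV (TmCode t) (zlist l) b ∈ H ↔ b ∈ B ∧ b = ev X l t)
  L : ∀ (ts : List Tm) (l : List ZFSet) w, (∀ t ∈ ts, t.usesSig (tciSig x)) → (∀ a ∈ l, a ∈ U) → zlist (ts.map TmCode) ∈ B →
    (fL (zlist (ts.map TmCode)) (zlist l) w ∈ H ↔ w ∈ B ∧ w = zlist (ts.map (ev X l)))
  S : ∀ (f : Fm) (l : List ZFSet), f.usesSig (tciSig x) → (∀ a ∈ l, a ∈ U) → FmCode f ∈ B →
    (fS (FmCode f) (zlist l) ∈ H ↔ sf U X l f)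

section
variable {x B U : ZFSet.{0}} {X : ZFSet.{0} → ZFSet.{0}}

def TF (x U : ZFSet.{0}) (X : ZFSet.{0} → ZFSet.{0}) : ℕ → ZFSet.{0} → Prop
  | 0, a => a ∈ U
  | 1, z => zfst z ∈ tciSig x ∧ ((symKind (zfst z) ≠ natZ 2 ∧ zsnd z ∈ X (zfst z)) ∨ (symKind (zfst z) = natZ 2 ∧ zsnd z = X (zfst z)))
  | 2, z => ∃ (t : Tm) (l : List ZFSet), t.usesSig (tciSig x) ∧ (∀ a ∈ l, a ∈ U) ∧ zfst z = TmCode t ∧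
      zfst (zsnd z) = zlist l ∧ zsnd (zsnd z) = ev X l t
  | 3, z => ∃ (ts : List Tm) (l : List ZFSet), (∀ t ∈ ts, t.usesSig (tciSig x)) ∧ (∀ a ∈ l, a ∈ U) ∧ zfst z = zlist (ts.map TmCode) ∧
      zfst (zsnd z) = zlist l ∧ zsnd (zsnd z) = zlist (ts.map (ev X l))
  | 4, z => ∃ (f : Fm) (l : List ZFSet), f.usesSig (tciSig x) ∧ (∀ a ∈ l, a ∈ U) ∧ zfst z = FmCode f ∧ zsnd z = zlist l ∧ sf U X l f
  | 5, c => ∃ f : Fm, f.usesSig (tciSig x) ∧ FmCode f = c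
  | 6, c => ∃ t : Tm, t.usesSig (tciSig x) ∧ TmCode t = c
  | 7, c => ∃ ts : List Tm, (∀ t ∈ ts, t.usesSig (tciSig x)) ∧ zlist (ts.map TmCode) = c
  | 8, z => ∃ l : List ZFSet, zfst z = natZ l.length ∧ (∀ a ∈ l, a ∈ U) ∧ zsnd z = zlist l
  | _, _ => False

def HM (x B U : ZFSet.{0}) (X : ZFSet.{0} → ZFSet.{0}) : ZFSet.{0} :=
  ZFSet.sep (fun y => TF x U X (zToNat (zfst y)) (zsnd y)) B

theorem mem_HM (hB : BOK x B) {k : ℕ} {z : ZFSet} : opair (natZ k) z ∈ HM x B U X ↔ z ∈ B ∧ TF x U X k z := by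
  rw [HM, ZFSet.mem_sep, hB.op, zfst_opair, zsnd_opair, zToNat_natZ]
  simp [hB.nat k]

theorem TmCodes_inj {ts us : List Tm} (h : zlist (ts.map TmCode) = zlist (us.map TmCode)) : ts = us :=
  List.map_injective_iff.2 (fun _ _ => TmCode_inj) (zlist_inj h)

theorem HM_full (hx : IsTCI x) (hB : BOK x B) (hG : Good x U X) : Full x B (HM x B U X) U X := by
  have lB : ∀ l : List ZFSet, (∀ a ∈ l, a ∈ U) → zlist l ∈ B := fun l hl => hB.zl.2 fun a ha => hG.UB hx hB (hl a ha)
  refine ⟨⟨?_, ?_, ?_, ?_⟩, ?_, ?_, ?_, ?_, ?_, ?_⟩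
  · intro a
    rw [mem_HM hB]
    exact ⟨fun h => h.2, fun h => ⟨hG.UB hx hB h, h⟩⟩
  · intro s hs hk t
    rw [mem_HM hB]
    simp only [TF, zfst_opair, zsnd_opair]
    constructor
    · rintro ⟨-, -, ⟨-, h⟩ | ⟨h, -⟩⟩
      · exact h
      · exact absurd h hk
    · exact fun h => ⟨hB.op.2 ⟨hB.sig hx (ZFSet.mem_insert_of_mem _ hs), hG.XB hx hB hs hk h⟩, hs, Or.inl ⟨hk, h⟩⟩
  · intro s hs hk t
    rw [mem_HM hB]
    simp only [TF, zfst_opair, zsnd_opair]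
    constructor
    · rintro ⟨-, -, ⟨h, -⟩ | ⟨-, h⟩⟩
      · exact absurd hk h
      · exact h
    · rintro rfl
      exact ⟨hB.op.2 ⟨hB.sig hx (ZFSet.mem_insert_of_mem _ hs), hG.UB hx hB (hG.cst s hs hk).2⟩, hs, Or.inr ⟨hk, rfl⟩⟩
  · intro n w
    rw [mem_HM hB]
    simp only [TF, zfst_opair, zsnd_opair]
    constructor
    · rintro ⟨-, l, h1, h2, h3⟩
      exact ⟨l, (natZ_inj.1 h1).symm, h2, h3⟩
    · rintro ⟨l, rfl, h2, rfl⟩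
      exact ⟨hB.op.2 ⟨hB.nat _, lB l h2⟩, l, rfl, h2, rfl⟩
  · intro c; exact mem_HM hB
  · intro c; exact mem_HM hB
  · intro c; exact mem_HM hB
  · intro t l b ht hl hc
    rw [mem_HM hB, hB.op, hB.op]
    simp only [TF, zfst_opair, zsnd_opair]
    constructor
    · rintro ⟨⟨-, -, hb⟩, t', l', -, -, h1, h2, h3⟩
      obtain rfl := TmCode_inj h1
      obtain rfl := zlist_inj h2
      exact ⟨hb, h3⟩
    · rintro ⟨hb, e⟩
      exact ⟨⟨hc, lB l hl, hb⟩, t, l, ht, hl, rfl, rfl, e⟩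
  · intro t l b ht hl hc
    rw [mem_HM hB, hB.op, hB.op]
    simp only [TF, zfst_opair, zsnd_opair]
    constructor
    · rintro ⟨⟨-, -, hb⟩, t', l', -, -, h1, h2, h3⟩
      obtain rfl := TmCodes_inj h1
      obtain rfl := zlist_inj h2
      exact ⟨hb, h3⟩
    · rintro ⟨hb, e⟩
      exact ⟨⟨hc, lB l hl, hb⟩, t, l, ht, hl, rfl, rfl, e⟩
  · intro f l hf hl hc
    rw [mem_HM hB, hB.op]
    simp only [TF, zfst_opair, zsnd_opair]
    constructor
    · rintro ⟨-, f', l', -, -, h1, h2, h3⟩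
      obtain rfl := FmCode_inj h1
      obtain rfl := zlist_inj h2
      exact h3
    · intro e
      exact ⟨⟨hc, lB l hl⟩, f, l, hf, hl, rfl, rfl, e⟩
end

theorem TmCode_func {s : ZFSet} {n : ℕ} {a : Fin n → Tm} : TmCode (Tm.func s n a) = cf s (zlist ((List.ofFn a).map TmCode)) := by
  rw [TmCode, zlist_ofFn]
theorem TmCode_var {n : ℕ} : TmCode (Tm.var n) = cv (natZ n) := rfl
theorem FmCode_rel {s : ZFSet} {n : ℕ} {a : Fin n → Tm} : FmCode (Fm.rel s n a) = opair (natZ 0) (opair s (zlist ((List.ofFn a).map TmCode))) := by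
  rw [FmCode, zlist_ofFn]

theorem cf_inv {σ s L : ZFSet} {t : Tm} (ht : t.usesSig σ) (e : TmCode t = cf s L) :
    ∃ n a, t = Tm.func s n a ∧ L = zlist ((List.ofFn a).map TmCode) := by
  cases t with
  | var n => exact absurd (opair_inj.1 e).1 (natZ_ne (by decide))
  | param a => exact ht.elim
  | func s' n a =>
    rw [TmCode_func] at e
    obtain ⟨-, e⟩ := opair_inj.1 e
    obtain ⟨rfl, rfl⟩ := opair_inj.1 e
    exact ⟨n, a, rfl, rfl⟩

section
variable {x B E H U : ZFSet.{0}} {X : ZFSet.{0} → ZFSet.{0}}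

theorem tpA_zlist {s : ZFSet} {l : List ZFSet} (h : l.length = arityOf s) : tpA s (zlist l) = ztuple l := tupN_zlist h
theorem apA_zlist {s b : ZFSet} {l : List ZFSet} (h : l.length = arityOf s) : apA s b (zlist l) = ztuple (l ++ [b]) := apN_zlist h

theorem Rep.ar (hx : IsTCI x) (hR : Rep x H U X) {s w : ZFSet} (hs : s ∈ tciSig x) :
    fN (symArity s) w ∈ H ↔ ∃ l : List ZFSet, l.length = arityOf s ∧ (∀ a ∈ l, a ∈ U) ∧ w = zlist l := by
  rw [(sym_spec hx hs).2, hR.n]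

theorem Full.fst (hx : IsTCI x) (hB : BOK x B) (hG : Good x U X) (hR : Rep x H U X) :
    R1 x B H ∧ R2 B H ∧ R3 x B H ∧ R4 x B H ∧ R5 x B H := by
  have lB : ∀ l : List ZFSet, (∀ a ∈ l, a ∈ U) → zlist l ∈ B := fun l hl => hB.zl.2 fun a ha => hG.UB hx hB (hl a ha)
  refine ⟨⟨?_, ?_⟩, ⟨?_, ?_, ?_⟩, ?_, ?_, ?_⟩
  · exact fun a _ h => hG.uy a ((hR.u a).1 h)
  · exact fun h a ha => (hR.u a).2 (hG.u1 h a ha)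
  · intro w _
    rw [hR.n]
    constructor
    · rintro ⟨l, h1, -, rfl⟩
      rw [List.length_eq_zero_iff.1 h1]; rfl
    · rintro rfl
      exact ⟨[], rfl, by simp, rfl⟩
  · intro n hn a _ w _
    obtain ⟨n, rfl⟩ := mem_omZ.1 hn
    rw [← natZ_succ, hR.n, hR.n, hR.u]
    constructor
    · rintro ⟨l, h1, h2, h3⟩
      cases l with
      | nil => simp at h1
      | cons b l =>
        obtain ⟨rfl, rfl⟩ := opair_inj.1 h3
        exact ⟨h2 _ (by simp), l, by simpa using h1, fun a ha => h2 a (by simp [ha]), rfl⟩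
    · rintro ⟨h1, l, h2, h3, rfl⟩
      refine ⟨a :: l, by simp [h2], ?_, rfl⟩
      intro b hb
      rcases List.mem_cons.1 hb with rfl | hb
      · exact h1
      · exact h3 b hb
  · intro n hn w _ h
    obtain ⟨n, rfl⟩ := mem_omZ.1 hn
    rw [← natZ_succ, hR.n] at h
    obtain ⟨l, h1, h2, rfl⟩ := h
    cases l with
    | nil => simp at h1
    | cons b l =>
      exact ⟨b, hG.UB hx hB (h2 _ (by simp)), zlist l, lB l fun a ha => h2 a (by simp [ha]), rfl⟩
  · intro s hs k
    have k2 : symKind s ≠ natZ 2 := by rw [k]; exact natZ_ne (by decide)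
    refine ⟨?_, ?_⟩
    · intro t _ h
      rw [hR.i s hs k2] at h
      obtain ⟨h1, l, h2, h3, rfl⟩ := hG.rel s hs k t h
      refine ⟨h1, zlist l, lB l h3, (hR.ar hx hs).2 ⟨l, h2, h3, rfl⟩, (tpA_zlist h2).symm⟩
    · intro hi w _ hw ht
      obtain ⟨l, h2, h3, rfl⟩ := (hR.ar hx hs).1 hw
      rw [tpA_zlist h2] at ht ⊢
      exact (hR.i s hs k2 _).2 (hG.rel1 s hs k hi l h2 h3 ht)
  · intro s hs k
    have k2 : symKind s ≠ natZ 2 := by rw [k]; exact natZ_ne (by decide)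
    refine ⟨?_, ?_, ?_, ?_⟩
    · intro t _ h
      rw [hR.i s hs k2] at h
      obtain ⟨h1, l, b, h2, h3, h4, rfl⟩ := hG.fn s hs k t h
      refine ⟨h1, zlist l, lB l h3, b, hG.UB hx hB h4, (hR.ar hx hs).2 ⟨l, h2, h3, rfl⟩, (hR.u b).2 h4, (apA_zlist h2).symm⟩
    · intro hi w _ b _ hw hb ht
      obtain ⟨l, h2, h3, rfl⟩ := (hR.ar hx hs).1 hw
      rw [apA_zlist h2] at ht ⊢
      exact (hR.i s hs k2 _).2 (hG.fn1 s hs k hi l b h2 h3 ((hR.u b).1 hb) ht)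
    · intro w _ hw
      obtain ⟨l, h2, h3, rfl⟩ := (hR.ar hx hs).1 hw
      obtain ⟨b, hb, h⟩ := hG.tot s hs k l h2 h3
      refine ⟨b, hG.UB hx hB hb, (hR.u b).2 hb, ?_⟩
      rw [apA_zlist h2]
      exact (hR.i s hs k2 _).2 h
    · intro w _ b _ b' _ hw hb hb'
      obtain ⟨l, h2, h3, rfl⟩ := (hR.ar hx hs).1 hw
      rw [apA_zlist h2, hR.i s hs k2] at hb hb'
      exact hG.uniq s hs k l b b' h2 h3 hb hb'
  · intro s hs k
    refine ⟨⟨X s, hG.UB hx hB (hG.cst s hs k).2, (hR.c s hs k _).2 rfl⟩, ?_, ?_⟩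
    · intro t _ t' _ h h'
      rw [hR.c s hs k] at h h'
      rw [h, h']
    · intro t _ h
      rw [hR.c s hs k] at h
      subst h
      exact ⟨(hG.cst s hs k).1, (hR.u _).2 (hG.cst s hs k).2⟩

theorem Full.snd (hx : IsTCI x) (hB : BOK x B) (hG : Good x U X) (hF : Full x B H U X) :
    R6 B H ∧ R7 B H ∧ R8 B H := by
  have hR := hF.rep
  refine ⟨⟨?_, ?_⟩, ⟨?_, ?_⟩, ?_⟩
  · intro n hn b hb
    obtain ⟨n, rfl⟩ := mem_omZ.1 hn
    have := hF.V (Tm.var n) [] b trivial (by simp) (hB.op.2 ⟨hB.nat 0, hB.nat n⟩)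
    rw [ev_var] at this
    refine this.trans ?_
    simp [hb]
  · intro m hm v hv a ha hN hu
    obtain ⟨m, rfl⟩ := mem_omZ.1 hm
    obtain ⟨l, h1, h2, rfl⟩ := (hR.n _ _).1 hN
    rw [hR.u] at hu
    have h3 : ∀ b ∈ a :: l, b ∈ U := by
      intro b hb
      rcases List.mem_cons.1 hb with rfl | hb
      · exact hu
      · exact h2 b hb
    refine ⟨?_, ?_⟩
    · intro b hb
      have := hF.V (Tm.var 0) (a :: l) b trivial h3 (hB.op.2 ⟨hB.nat 0, hB.nat 0⟩)
      rw [ev_var] at this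
      refine this.trans ?_
      simp [hb]
    · intro n hn b hb
      obtain ⟨n, rfl⟩ := mem_omZ.1 hn
      have e1 := hF.V (Tm.var (n + 1)) (a :: l) b trivial h3 (hB.op.2 ⟨hB.nat 0, hB.nat _⟩)
      have e2 := hF.V (Tm.var n) l b trivial h2 (hB.op.2 ⟨hB.nat 0, hB.nat n⟩)
      rw [ev_var] at e1 e2
      refine (e1.trans ?_).trans e2.symm
      simp
  · intro s _ L hL h
    obtain ⟨-, t, ht, e⟩ := (hF.T _).1 h
    obtain ⟨n, a, rfl, rfl⟩ := cf_inv ht e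
    refine (hF.TL _).2 ⟨hL, _, ?_, rfl⟩
    intro t ht'
    obtain ⟨i, rfl⟩ := (List.mem_ofFn' _ _).1 ht'
    exact ht.2.2 i
  · intro c hc L hL h
    obtain ⟨-, ts, ht, e⟩ := (hF.TL _).1 h
    cases ts with
    | nil => exact absurd e.symm opair_ne
    | cons t ts =>
      obtain ⟨rfl, rfl⟩ := opair_inj.1 e
      exact ⟨(hF.T _).2 ⟨hc, t, ht t (by simp), rfl⟩, (hF.TL _).2 ⟨hL, ts, fun u hu => ht u (by simp [hu]), rfl⟩⟩
  · intro m hm v hv hN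
    obtain ⟨m, rfl⟩ := mem_omZ.1 hm
    obtain ⟨l, h1, h2, rfl⟩ := (hR.n _ _).1 hN
    refine ⟨?_, ?_⟩
    · intro w hw
      have := hF.L [] l w (by simp) h2 hB.emp
      refine this.trans ?_
      simp [hw, zlist]
    · intro c hc L hL h
      obtain ⟨hcB, ts, ht, e⟩ := (hF.TL _).1 h
      cases ts with
      | nil => exact absurd e.symm opair_ne
      | cons t ts =>
        obtain ⟨rfl, rfl⟩ := opair_inj.1 e
        have e1 := fun w => hF.L (t :: ts) l w ht h2 hcB
        have e2 := fun w => hF.L ts l w (fun u hu => ht u (by simp [hu])) h2 hL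
        have e3 := fun b => hF.V t l b (ht t (by simp)) h2 hc
        refine ⟨?_, ?_⟩
        · intro w hw h
          obtain ⟨-, e⟩ := (e1 w).1 h
          have e' : w = opair (ev X l t) (zlist (ts.map (ev X l))) := e
          rw [e', hB.op] at hw
          exact ⟨_, hw.1, _, hw.2, e', (e3 _).2 ⟨hw.1, rfl⟩, (e2 _).2 ⟨hw.2, rfl⟩⟩
        · intro b hb w hw hb' hw'
          refine (e1 _).2 ⟨hB.op.2 ⟨hb, hw⟩, ?_⟩
          rw [((e3 b).1 hb').2, ((e2 w).1 hw').2]; rfl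

theorem Full.thd (hx : IsTCI x) (hB : BOK x B) (hE : ∀ b, b ∈ E ↔ b ∈ B ∧ b = e0) (hG : Good x U X) (hF : Full x B H U X) :
    R9a x B H ∧ R9b x B E H := by
  have hR := hF.rep
  refine ⟨?_, ?_⟩
  · intro m hm v hv hN s hs h
    obtain ⟨m, rfl⟩ := mem_omZ.1 hm
    obtain ⟨l, h1, h2, rfl⟩ := (hR.n _ _).1 hN
    obtain ⟨hc, t, ht, e⟩ := (hF.T _).1 h
    obtain ⟨n, a, rfl, e'⟩ := cf_inv ht e
    have h0 : n = 0 := by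
      have := zlist_inj (l := []) e'
      simpa using (congrArg List.length this).symm
    subst h0
    rw [← e] at hc ⊢
    have eV := fun b => hF.V _ l b ht h2 hc
    rw [ev_func, List.ofFn_zero, List.map_nil, fnI_nil] at eV
    refine ⟨?_, ?_⟩
    · intro k b hb
      rw [eV, hR.c s hs k]
      simp [hb]
    · intro k
      have k2 : symKind s ≠ natZ 2 := by rw [k]; exact natZ_ne (by decide)
      have ha : arityOf s = 0 := by
        rcases ht.2.1 with ⟨-, h⟩ | ⟨h, -⟩
        · rw [arityOf, h, zToNat_natZ]
        · exact absurd h k2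
      obtain ⟨b0, hb0, e0'⟩ := hG.null hs k ha
      simp only [eV, hR.i s hs k2, e0', ZFSet.mem_singleton]
      refine ⟨?_, ?_⟩
      · rintro b - ⟨-, rfl⟩
        exact ⟨b0, hG.UB hx hB hb0, rfl, rfl⟩
      · rintro b hb rfl
        exact ⟨hB.sing hb, rfl⟩
  · intro m hm v hv hN s hs L hL hL0 h
    obtain ⟨m, rfl⟩ := mem_omZ.1 hm
    obtain ⟨l, h1, h2, rfl⟩ := (hR.n _ _).1 hN
    obtain ⟨hc, t, ht, e⟩ := (hF.T _).1 h
    obtain ⟨n, a, rfl, rfl⟩ := cf_inv ht e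
    have h0 : n ≠ 0 := by
      rintro rfl
      exact hL0 (by simp [zlist])
    obtain ⟨k, ha⟩ : symKind s = natZ 1 ∧ arityOf s = n := by
      rcases ht.2.1 with ⟨h, h'⟩ | ⟨-, h'⟩
      · exact ⟨h, by rw [arityOf, h', zToNat_natZ]⟩
      · exact absurd h' h0
    have k2 : symKind s ≠ natZ 2 := by rw [k]; exact natZ_ne (by decide)
    have hts : ∀ t ∈ List.ofFn a, t.usesSig (tciSig x) := by
      intro t ht'
      obtain ⟨i, rfl⟩ := (List.mem_ofFn' _ _).1 ht'
      exact ht.2.2 i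
    rw [← e] at hc ⊢
    have eV := fun b => hF.V _ l b ht h2 hc
    have eL := fun w => hF.L (List.ofFn a) l w hts h2 hL
    have hlen : ((List.ofFn a).map (ev X l)).length = arityOf s := by simp [ha]
    have hne : (List.ofFn a).map (ev X l) ≠ [] := by
      intro e; rw [e] at hlen; exact h0 (ha ▸ hlen.symm)
    rw [ev_func, fnI_ne hne] at eV
    have hargs : ∀ t ∈ (List.ofFn a).map (ev X l), t ∈ B ∨ t = e0 := by
      intro t ht'
      obtain ⟨u, hu, rfl⟩ := List.mem_map.1 ht'
      exact ev_B hx hB hG h2 u (hts u hu)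
    generalize (List.ofFn a).map (ev X l) = as at *
    refine ⟨?_, ?_⟩
    · intro w hw hw'
      obtain ⟨-, rfl⟩ := (eL w).1 hw'
      simp only [apA_zlist hlen, hR.i s hs k2, eV, hE]
      have uq : ∀ b b', ztuple (as ++ [b]) ∈ X s → ztuple (as ++ [b']) ∈ X s → b = b' :=
        fun b b' h h' => hG.uniq s hs k as b b' hlen (hG.fnU hs k hlen h).1 h h'
      refine ⟨?_, ?_, ?_, ?_⟩
      · rintro b hb ⟨-, rfl⟩
        by_cases hex : ∃ b, ztuple (as ++ [b]) ∈ X s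
        · exact Or.inl (Classical.epsilon_spec hex)
        · exact Or.inr ⟨hb, eps_none hex⟩
      · rintro b hb b' - ⟨-, rfl⟩ h
        exact uq _ _ (Classical.epsilon_spec (p := fun b => ztuple (as ++ [b]) ∈ X s) ⟨_, h⟩) h
      · intro b hb h
        exact ⟨hb, uq _ _ h (Classical.epsilon_spec (p := fun b => ztuple (as ++ [b]) ∈ X s) ⟨_, h⟩)⟩
      · rintro e ⟨he, rfl⟩
        by_cases hex : ∃ b, ztuple (as ++ [b]) ∈ X s
        · obtain ⟨b, hb⟩ := hex
          exact Or.inr ⟨b, hG.UB hx hB (hG.fnU hs k hlen hb).2, hb⟩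
        · exact Or.inl ⟨he, (eps_none hex).symm⟩
    · intro b hb h
      obtain ⟨-, rfl⟩ := (eV b).1 h
      have : ∀ c ∈ as, c ∈ B := by
        by_cases hex : ∃ b, ztuple (as ++ [b]) ∈ X s
        · obtain ⟨b, hb⟩ := hex
          exact fun c hc => hG.UB hx hB ((hG.fnU hs k hlen hb).1 c hc)
        · rw [eps_none hex] at hb
          intro c hc
          rcases hargs c hc with h | rfl
          · exact h
          · exact hb
      exact ⟨zlist as, hB.zl.2 this, (eL _).2 ⟨hB.zl.2 this, rfl⟩⟩

theorem Full.fth (hx : IsTCI x) (hB : BOK x B) (hG : Good x U X) (hF : Full x B H U X) :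
    R10a x B H ∧ R10b B H ∧ R10c B H ∧ R10d B H := by
  have hR := hF.rep
  have hcons : ∀ a (l : List ZFSet), a ∈ U → (∀ b ∈ l, b ∈ U) → ∀ b ∈ a :: l, b ∈ U := by
    intro a l h1 h2 b hb
    rcases List.mem_cons.1 hb with rfl | hb
    · exact h1
    · exact h2 b hb
  refine ⟨?_, ?_, ⟨?_, ?_⟩, ⟨?_, ?_⟩⟩
  · intro s hs L hL h
    obtain ⟨hc, f, hf, e⟩ := (hF.F _).1 h
    cases f with
    | rel s' n a =>
      have e1 := e
      rw [FmCode_rel] at e1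
      obtain ⟨-, e2⟩ := opair_inj.1 e1
      obtain ⟨rfl, rfl⟩ := opair_inj.1 e2
      obtain ⟨-, k, ha, hu⟩ := hf
      have hts : ∀ t ∈ List.ofFn a, t.usesSig (tciSig x) := by
        intro t ht'
        obtain ⟨i, rfl⟩ := (List.mem_ofFn' _ _).1 ht'
        exact hu i
      have k2 : symKind s' ≠ natZ 2 := by rw [k]; exact natZ_ne (by decide)
      refine ⟨(hF.TL _).2 ⟨hL, _, hts, rfl⟩, ?_⟩
      intro m hm v hv hN
      obtain ⟨m, rfl⟩ := mem_omZ.1 hm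
      obtain ⟨l, h1, h2, rfl⟩ := (hR.n _ _).1 hN
      rw [← e] at hc ⊢
      have eS := hF.S (Fm.rel s' n a) l ⟨hs, k, ha, hu⟩ h2 hc
      have eL := fun w => hF.L (List.ofFn a) l w hts h2 hL
      rw [sf_rel] at eS
      have hlen : ((List.ofFn a).map (ev X l)).length = arityOf s' := by simp [arityOf, ha, zToNat_natZ]
      refine ⟨?_, ?_⟩
      · intro h
        rw [eS] at h
        have hB' : zlist ((List.ofFn a).map (ev X l)) ∈ B := hB.zl.2 fun c hc => hG.UB hx hB (hG.relU hs k hlen h c hc)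
        refine ⟨_, hB', (eL _).2 ⟨hB', rfl⟩, ?_⟩
        rw [tpA_zlist hlen, hR.i _ hs k2]; exact h
      · intro w hw hw' h
        obtain ⟨-, rfl⟩ := (eL w).1 hw'
        rw [tpA_zlist hlen, hR.i _ hs k2] at h
        exact eS.2 h
    | _ => exact absurd (opair_inj.1 e).1 (natZ_ne (by decide))
  · intro t ht u hu h
    obtain ⟨hc, f, hf, e⟩ := (hF.F _).1 h
    cases f with
    | eq t' u' =>
      obtain ⟨-, e2⟩ := opair_inj.1 e
      obtain ⟨rfl, rfl⟩ := opair_inj.1 e2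
      refine ⟨(hF.T _).2 ⟨ht, t', hf.1, rfl⟩, (hF.T _).2 ⟨hu, u', hf.2, rfl⟩, ?_⟩
      intro m hm v hv hN
      obtain ⟨m, rfl⟩ := mem_omZ.1 hm
      obtain ⟨l, h1, h2, rfl⟩ := (hR.n _ _).1 hN
      have eS := hF.S _ l hf h2 hc
      rw [sf_eq] at eS
      have e1 := fun b => hF.V t' l b hf.1 h2 ht
      have e2 := fun b => hF.V u' l b hf.2 h2 hu
      refine ⟨?_, ?_, ?_⟩
      · intro h b hb
        rw [e1, e2, eS.1 h]
      · intro b hb h h'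
        exact eS.2 (((e1 b).1 h).2.symm.trans ((e2 b).1 h').2)
      · rcases ev_B hx hB hG h2 t' hf.1 with h | h
        · exact Or.inr (Or.inl ⟨_, h, (e1 _).2 ⟨h, rfl⟩⟩)
        · rcases ev_B hx hB hG h2 u' hf.2 with h' | h'
          · exact Or.inr (Or.inr ⟨_, h', (e2 _).2 ⟨h', rfl⟩⟩)
          · exact Or.inl (eS.2 (h.trans h'.symm))
    | _ => exact absurd (opair_inj.1 e).1 (natZ_ne (by decide))
  · intro c hcB h
    obtain ⟨hc, f, hf, e⟩ := (hF.F _).1 h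
    cases f with
    | not f =>
      obtain ⟨-, rfl⟩ := opair_inj.1 e
      refine ⟨(hF.F _).2 ⟨hcB, f, hf, rfl⟩, ?_⟩
      intro m hm v hv hN
      obtain ⟨m, rfl⟩ := mem_omZ.1 hm
      obtain ⟨l, h1, h2, rfl⟩ := (hR.n _ _).1 hN
      have eS := hF.S _ l hf h2 hc
      rw [sf_not, ← hF.S f l hf h2 hcB] at eS
      exact eS
    | _ => exact absurd (opair_inj.1 e).1 (natZ_ne (by decide))
  · intro c hcB d hdB h
    obtain ⟨hc, f, hf, e⟩ := (hF.F _).1 h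
    cases f with
    | imp f g =>
      obtain ⟨-, e⟩ := opair_inj.1 e
      obtain ⟨rfl, rfl⟩ := opair_inj.1 e
      refine ⟨(hF.F _).2 ⟨hcB, f, hf.1, rfl⟩, (hF.F _).2 ⟨hdB, g, hf.2, rfl⟩, ?_⟩
      intro m hm v hv hN
      obtain ⟨m, rfl⟩ := mem_omZ.1 hm
      obtain ⟨l, h1, h2, rfl⟩ := (hR.n _ _).1 hN
      have eS := hF.S _ l hf h2 hc
      rw [sf_imp, ← hF.S f l hf.1 h2 hcB, ← hF.S g l hf.2 h2 hdB] at eS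
      exact eS
    | _ => exact absurd (opair_inj.1 e).1 (natZ_ne (by decide))
  · intro c hcB h
    obtain ⟨hc, f, hf, e⟩ := (hF.F _).1 h
    cases f with
    | all f =>
      obtain ⟨-, rfl⟩ := opair_inj.1 e
      refine ⟨(hF.F _).2 ⟨hcB, f, hf, rfl⟩, ?_⟩
      intro m hm v hv hN
      obtain ⟨m, rfl⟩ := mem_omZ.1 hm
      obtain ⟨l, h1, h2, rfl⟩ := (hR.n _ _).1 hN
      have eS := hF.S _ l hf h2 hc
      rw [sf_all] at eS
      have eA := fun a ha => hF.S f (a :: l) hf (hcons a l ha h2) hcB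
      refine ⟨?_, ?_⟩
      · intro a _ ha h
        rw [hR.u] at ha
        exact (eA a ha).2 (eS.1 h a ha)
      · by_cases h : ∀ a ∈ U, sf U X (a :: l) f
        · exact Or.inl (eS.2 h)
        · push Not at h
          obtain ⟨a, ha, h⟩ := h
          exact Or.inr ⟨a, hG.UB hx hB ha, (hR.u a).2 ha, fun h' => h ((eA a ha).1 h')⟩
    | _ => exact absurd (opair_inj.1 e).1 (natZ_ne (by decide))
  · intro c hcB h
    obtain ⟨hc, f, hf, e⟩ := (hF.F _).1 h
    cases f with
    | ex f =>
      obtain ⟨-, rfl⟩ := opair_inj.1 e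
      refine ⟨(hF.F _).2 ⟨hcB, f, hf, rfl⟩, ?_⟩
      intro m hm v hv hN
      obtain ⟨m, rfl⟩ := mem_omZ.1 hm
      obtain ⟨l, h1, h2, rfl⟩ := (hR.n _ _).1 hN
      have eS := hF.S _ l hf h2 hc
      rw [sf_ex] at eS
      have eA := fun a ha => hF.S f (a :: l) hf (hcons a l ha h2) hcB
      refine ⟨?_, ?_⟩
      · intro a _ ha h
        rw [hR.u] at ha
        exact eS.2 ⟨a, ha, (eA a ha).1 h⟩
      · intro h
        obtain ⟨a, ha, h⟩ := eS.1 h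
        exact ⟨a, hG.UB hx hB ha, (hR.u a).2 ha, (eA a ha).2 h⟩
    | _ => exact absurd (opair_inj.1 e).1 (natZ_ne (by decide))

theorem Full.rules (hx : IsTCI x) (hB : BOK x B) (hE : ∀ b, b ∈ E ↔ b ∈ B ∧ b = e0) (hG : Good x U X) (hF : Full x B H U X)
    (hT : ∀ c ∈ tciT x, ∀ f : Fm, FmCode f = c → sf U X [] f) : Rules x B E H := by
  obtain ⟨h1, h2, h3, h4, h5⟩ := Full.fst hx hB hG hF.rep
  obtain ⟨h6, h7, h8⟩ := Full.snd hx hB hG hF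
  obtain ⟨h9, h10⟩ := Full.thd hx hB hE hG hF
  obtain ⟨h11, h12, h13, h14⟩ := Full.fth hx hB hG hF
  refine ⟨h1, h2, h3, h4, h5, h6, h7, h8, h9, h10, h11, h12, h13, h14, ?_⟩
  intro c hc
  have hcB : c ∈ B := hB.trs _ (hB.four hx).1 _ hc
  obtain ⟨f, rfl, -, hf⟩ := hx.2.2.2.2.2.2.2.2.2.2 c hc
  exact ⟨(hF.F _).2 ⟨hcB, f, hf, rfl⟩, (hF.S f [] hf (by simp) hcB).2 (hT _ hc f rfl)⟩

/-- Lemma B -/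
theorem lemB {M A p : ZFSet} (hx : IsTCI x) (hB : BOK x B) (hE : ∀ b, b ∈ E ↔ b ∈ B ∧ b = e0) (hM : ModelsTCI M x)
    (hp : p ⊆ LL x) (hA : ∀ a ∈ A, a ⊆ LL x) (h1 : p ⊆ SigmaSet x M) (h2 : ∀ a ∈ A, ¬ a ⊆ SigmaSet x M) :
    ∃ H, H ⊆ B ∧ Rules x B E H ∧ R12 x H A p := by
  obtain ⟨-, -, hG, hT⟩ := (models_iff hx).1 hM
  have hF := HM_full hx hB hG
  refine ⟨_, ?_, hF.rules hx hB hE hG fun c hc f e => satStr_iff.1 (hT c hc f e), (R12_iff hx hG hF.rep hp hA).2 ⟨h1, h2⟩⟩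
  intro y hy
  exact (ZFSet.mem_sep.1 hy).1
end

end SmallExt

namespace SmallExt

/-! ### a set of facts satisfying the rules describes a model -/
section
variable {x B E H U : ZFSet.{0}} {X : ZFSet.{0} → ZFSet.{0}}

theorem Rules.rep (hB : BOK x B) (hH : H ⊆ B) (h : Rules x B E H) (hu : ∀ a, fU a ∈ H ↔ a ∈ U)
    (hi : ∀ s ∈ tciSig x, symKind s ≠ natZ 2 → ∀ t, fI s t ∈ H ↔ t ∈ X s)
    (hc : ∀ s ∈ tciSig x, symKind s = natZ 2 → ∀ t, fI s t ∈ H ↔ t = X s) : Rep x H U X := by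
  refine ⟨hu, hi, hc, ?_⟩
  have hwB : ∀ n w, fN n w ∈ H → w ∈ B := fun n w h => (hB.op.1 (hB.op.1 (hH h)).2).2
  intro n
  induction n with
  | zero =>
    intro w
    constructor
    · intro h'
      exact ⟨[], rfl, by simp, (h.r2.1 w (hwB _ _ h')).1 h'⟩
    · rintro ⟨l, h1, -, rfl⟩
      obtain rfl := List.length_eq_zero_iff.1 h1
      exact (h.r2.1 _ hB.emp).2 rfl
  | succ n ih =>
    intro w
    rw [natZ_succ]
    have hn : natZ n ∈ omZ := mem_omZ.2 ⟨n, rfl⟩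
    constructor
    · intro h'
      obtain ⟨a, ha, w', hw', rfl⟩ := h.r2.2.2 _ hn w (hwB _ _ h') h'
      obtain ⟨h1, h2⟩ := (h.r2.2.1 _ hn a ha w' hw').1 h'
      obtain ⟨l, e1, e2, rfl⟩ := (ih w').1 h2
      refine ⟨a :: l, by simp [e1], ?_, rfl⟩
      intro b hb
      rcases List.mem_cons.1 hb with rfl | hb
      · exact (hu _).1 h1
      · exact e2 b hb
    · rintro ⟨l, h1, h2, rfl⟩
      cases l with
      | nil => simp at h1
      | cons a l =>
        have ha : fU a ∈ H := (hu a).2 (h2 a (by simp))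
        have hl : fN (natZ n) (zlist l) ∈ H := (ih _).2 ⟨l, by simpa using h1, fun b hb => h2 b (by simp [hb]), rfl⟩
        exact (h.r2.2.1 _ hn a (hB.op.1 (hH ha)).2 _ (hwB _ _ hl)).2 ⟨ha, hl⟩

theorem Rules.good (hx : IsTCI x) (hB : BOK x B) (hH : H ⊆ B) (h : Rules x B E H) (hR : Rep x H U X) : Good x U X := by
  have hwB : ∀ n w, fN n w ∈ H → w ∈ B := fun n w h => (hB.op.1 (hB.op.1 (hH h)).2).2
  have hIB : ∀ n w, fI n w ∈ H → w ∈ B := fun n w h => (hB.op.1 (hB.op.1 (hH h)).2).2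
  have hUB : ∀ a, fU a ∈ H → a ∈ B := fun a h => (hB.op.1 (hH h)).2
  have k0 : ∀ {s}, symKind s = natZ 0 → symKind s ≠ natZ 2 := fun k => by rw [k]; exact natZ_ne (by decide)
  have k1 : ∀ {s}, symKind s = natZ 1 → symKind s ≠ natZ 2 := fun k => by rw [k]; exact natZ_ne (by decide)
  refine ⟨?_, ?_, ?_, ?_, ?_, ?_, ?_, ?_, ?_⟩
  · intro a ha
    rw [← hR.u] at ha
    exact h.r1.1 a (hUB a ha) ha
  · intro hi a ha
    exact (hR.u a).1 (h.r1.2 hi a ha)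
  · intro s hs k t ht
    rw [← hR.i s hs (k0 k)] at ht
    obtain ⟨h1, w, hw, hw', rfl⟩ := (h.r3 s hs k).1 t (hIB _ _ ht) ht
    obtain ⟨l, h2, h3, rfl⟩ := (hR.ar hx hs).1 hw'
    exact ⟨h1, l, h2, h3, tpA_zlist h2⟩
  · intro s hs k hi l h2 h3 ht
    have hw := (hR.ar hx hs).2 ⟨l, h2, h3, rfl⟩
    have := (h.r3 s hs k).2 hi _ (hwB _ _ hw) hw
    rw [tpA_zlist h2] at this
    exact (hR.i s hs (k0 k) _).1 (this ht)
  · intro s hs k t ht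
    rw [← hR.i s hs (k1 k)] at ht
    obtain ⟨h1, w, hw, b, hb, hw', hb', rfl⟩ := (h.r4 s hs k).1 t (hIB _ _ ht) ht
    obtain ⟨l, h2, h3, rfl⟩ := (hR.ar hx hs).1 hw'
    exact ⟨h1, l, b, h2, h3, (hR.u b).1 hb', apA_zlist h2⟩
  · intro s hs k hi l b h2 h3 hb ht
    have hw := (hR.ar hx hs).2 ⟨l, h2, h3, rfl⟩
    have hb' := (hR.u b).2 hb
    have := (h.r4 s hs k).2.1 hi _ (hwB _ _ hw) b (hUB b hb') hw hb'
    rw [apA_zlist h2] at this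
    exact (hR.i s hs (k1 k) _).1 (this ht)
  · intro s hs k l h2 h3
    have hw := (hR.ar hx hs).2 ⟨l, h2, h3, rfl⟩
    obtain ⟨b, hb, hb', h4⟩ := (h.r4 s hs k).2.2.1 _ (hwB _ _ hw) hw
    rw [apA_zlist h2] at h4
    exact ⟨b, (hR.u b).1 hb', (hR.i s hs (k1 k) _).1 h4⟩
  · intro s hs k l b b' h2 h3 hb hb'
    have hw := (hR.ar hx hs).2 ⟨l, h2, h3, rfl⟩
    rw [← hR.i s hs (k1 k)] at hb hb'
    have hbB : b ∈ B := hB.zt.1 (hIB _ _ hb) b (by simp)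
    have hbB' : b' ∈ B := hB.zt.1 (hIB _ _ hb') b' (by simp)
    refine (h.r4 s hs k).2.2.2 _ (hwB _ _ hw) b hbB b' hbB' hw ?_ ?_
    · rw [apA_zlist h2]; exact hb
    · rw [apA_zlist h2]; exact hb'
  · intro s hs k
    have := (hR.c s hs k (X s)).2 rfl
    obtain ⟨h1, h2⟩ := (h.r5 s hs k).2.2 _ (hIB _ _ this) this
    exact ⟨h1, (hR.u _).1 h2⟩

theorem Rules.evL (hB : BOK x B) (hH : H ⊆ B) (h : Rules x B E H) (hR : Rep x H U X) {l : List ZFSet} (hl : ∀ a ∈ l, a ∈ U) :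
    ∀ (ts : List Tm), (∀ t ∈ ts, fT (TmCode t) ∈ H → ∀ b, fV (TmCode t) (zlist l) b ∈ H ↔ b ∈ B ∧ b = ev X l t) →
      fTL (zlist (ts.map TmCode)) ∈ H → ∀ w, fL (zlist (ts.map TmCode)) (zlist l) w ∈ H ↔ w ∈ B ∧ w = zlist (ts.map (ev X l)) := by
  have hLB : ∀ c v w, fL c v w ∈ H → w ∈ B := fun c v w h => (hB.op.1 (hB.op.1 (hB.op.1 (hH h)).2).2).2
  have hN : fN (natZ l.length) (zlist l) ∈ H := (hR.n _ _).2 ⟨l, rfl, hl, rfl⟩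
  have hm : natZ l.length ∈ omZ := mem_omZ.2 ⟨_, rfl⟩
  have hlB : zlist l ∈ B := (hB.op.1 (hB.op.1 (hH hN)).2).2
  have h8 := h.r8 _ hm _ hlB hN
  intro ts
  induction ts with
  | nil =>
    intro _ _ w
    constructor
    · intro hw
      exact ⟨hLB _ _ _ hw, (h8.1 w (hLB _ _ _ hw)).1 hw⟩
    · rintro ⟨hw, e⟩
      exact (h8.1 w hw).2 e
  | cons t ts ih =>
    intro h1 h2 w
    have hcB := hB.op.1 (hB.op.1 (hH h2)).2
    obtain ⟨h3, h4⟩ := h.r7.2 _ hcB.1 _ hcB.2 h2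
    have ih' := ih (fun u hu => h1 u (by simp [hu])) h4
    have ht := h1 t (by simp) h3
    obtain ⟨e1, e2⟩ := h8.2 _ hcB.1 _ hcB.2 h2
    constructor
    · intro hw
      obtain ⟨b, hb, w', hw', rfl, h5, h6⟩ := e1 w (hLB _ _ _ hw) hw
      refine ⟨hLB _ _ _ hw, ?_⟩
      rw [((ht b).1 h5).2, ((ih' w').1 h6).2]; rfl
    · rintro ⟨hw, rfl⟩
      have hw' := hB.op.1 hw
      exact e2 _ hw'.1 _ hw'.2 ((ht _).2 ⟨hw'.1, rfl⟩) ((ih' _).2 ⟨hw'.2, rfl⟩)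

theorem Rules.evT (hx : IsTCI x) (hB : BOK x B) (hE : ∀ b, b ∈ E ↔ b ∈ B ∧ b = e0) (hH : H ⊆ B) (h : Rules x B E H) (hR : Rep x H U X) (t : Tm) :
    t.usesSig (tciSig x) → fT (TmCode t) ∈ H → ∀ {l : List ZFSet}, (∀ a ∈ l, a ∈ U) →
      ∀ b, fV (TmCode t) (zlist l) b ∈ H ↔ b ∈ B ∧ b = ev X l t := by
  have hG := h.good hx hB hH hR
  have hLB : ∀ c v w, fL c v w ∈ H → w ∈ B := fun c v w h => (hB.op.1 (hB.op.1 (hB.op.1 (hH h)).2).2).2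
  have hVB : ∀ c v w, fV c v w ∈ H → w ∈ B := fun c v w h => (hB.op.1 (hB.op.1 (hB.op.1 (hH h)).2).2).2
  have hIB : ∀ n w, fI n w ∈ H → w ∈ B := fun n w h => (hB.op.1 (hB.op.1 (hH h)).2).2
  have hN : ∀ l : List ZFSet, (∀ a ∈ l, a ∈ U) → fN (natZ l.length) (zlist l) ∈ H := fun l hl => (hR.n _ _).2 ⟨l, rfl, hl, rfl⟩
  have hm : ∀ n, natZ n ∈ omZ := fun n => mem_omZ.2 ⟨n, rfl⟩
  have hlB : ∀ l : List ZFSet, (∀ a ∈ l, a ∈ U) → zlist l ∈ B := fun l hl => (hB.op.1 (hB.op.1 (hH (hN l hl))).2).2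
  induction t with
  | var n =>
    intro _ _
    have key : ∀ (l : List ZFSet), (∀ a ∈ l, a ∈ U) → ∀ (n : ℕ), ∀ b ∈ B, fV (cv (natZ n)) (zlist l) b ∈ H ↔ b = l.getD n ∅ := by
      intro l
      induction l with
      | nil =>
        intro _ n b hb
        rw [List.getD_nil]
        exact h.r6.1 _ (hm n) b hb
      | cons a l ih =>
        intro hl n b hb
        have hl' : ∀ a ∈ l, a ∈ U := fun c hc => hl c (by simp [hc])
        have ha : a ∈ U := hl a (by simp)
        obtain ⟨e1, e2⟩ := h.r6.2 _ (hm l.length) _ (hlB l hl') a (hG.UB hx hB ha) (hN l hl') ((hR.u a).2 ha)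
        cases n with
        | zero => exact e1 b hb
        | succ n =>
          rw [List.getD_cons_succ, ← ih hl' n b hb]
          exact e2 _ (hm n) b hb
    intro l hl b
    constructor
    · intro hb
      exact ⟨hVB _ _ _ hb, (key l hl n b (hVB _ _ _ hb)).1 hb⟩
    · rintro ⟨hb, e⟩
      exact (key l hl n b hb).2 e
  | param a => exact fun h => h.elim
  | func s n a ih =>
    intro hu hT l hl
    obtain ⟨hs, hk, hua⟩ := hu
    have hsB := hB.sig hx (ZFSet.mem_insert_of_mem _ hs)
    rw [TmCode_func] at hT ⊢
    have hts : ∀ t ∈ List.ofFn a, fT (TmCode t) ∈ H → ∀ b, fV (TmCode t) (zlist l) b ∈ H ↔ b ∈ B ∧ b = ev X l t := by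
      intro t ht
      obtain ⟨i, rfl⟩ := (List.mem_ofFn' _ _).1 ht
      exact fun h => ih i (hua i) h hl
    have hargs : ∀ t ∈ (List.ofFn a).map (ev X l), t ∈ B ∨ t = e0 := by
      intro t ht'
      obtain ⟨u, hu, rfl⟩ := List.mem_map.1 ht'
      obtain ⟨i, rfl⟩ := (List.mem_ofFn' _ _).1 hu
      exact ev_B hx hB hG hl _ (hua i)
    have hLB' := hB.op.1 (hB.op.1 (hH hT)).2
    have hTL := h.r7.1 _ hsB _ (hB.op.1 hLB'.2).2 hT
    have eL := h.evL hB hH hR hl _ hts hTL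
    rw [ev_func]
    by_cases h0 : n = 0
    · subst h0
      have := h.r9a _ (hm _) _ (hlB l hl) (hN l hl) s hs hT
      obtain ⟨q1, q2⟩ := this
      simp only [List.ofFn_zero, List.map_nil, fnI_nil]
      intro b
      rcases hk with ⟨k, ha⟩ | ⟨k, -⟩
      · have k2 : symKind s ≠ natZ 2 := by rw [k]; exact natZ_ne (by decide)
        have ha : arityOf s = 0 := by rw [arityOf, ha, zToNat_natZ]
        obtain ⟨b0, hb0, e0'⟩ := hG.null hs k ha
        obtain ⟨q3, q4⟩ := q2 k
        simp only [hR.i s hs k2, e0', ZFSet.mem_singleton] at q3 q4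
        rw [e0']
        constructor
        · intro hb
          obtain ⟨b', -, rfl, rfl⟩ := q3 b (hVB _ _ _ hb) hb
          exact ⟨hVB _ _ _ hb, rfl⟩
        · rintro ⟨hb, rfl⟩
          exact q4 b0 (hG.UB hx hB hb0) rfl
      · constructor
        · intro hb
          exact ⟨hVB _ _ _ hb, (hR.c s hs k b).1 ((q1 k b (hVB _ _ _ hb)).1 hb)⟩
        · rintro ⟨hb, e⟩
          exact (q1 k b hb).2 ((hR.c s hs k b).2 e)
    · obtain ⟨k, ha⟩ : symKind s = natZ 1 ∧ arityOf s = n := by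
        rcases hk with ⟨h, h'⟩ | ⟨-, h'⟩
        · exact ⟨h, by rw [arityOf, h', zToNat_natZ]⟩
        · exact absurd h' h0
      have k2 : symKind s ≠ natZ 2 := by rw [k]; exact natZ_ne (by decide)
      have hlen : ((List.ofFn a).map (ev X l)).length = arityOf s := by simp [ha]
      have hne : (List.ofFn a).map (ev X l) ≠ [] := by
        intro e; rw [e] at hlen; exact h0 (ha ▸ hlen.symm)
      have hL0 : zlist ((List.ofFn a).map TmCode) ≠ ∅ := by
        intro e
        have := zlist_inj (l' := []) e
        apply h0
        simpa using congrArg List.length this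
      obtain ⟨q1, q2⟩ := h.r9b _ (hm _) _ (hlB l hl) (hN l hl) s hs _ (hB.op.1 hLB'.2).2 hL0 hT
      rw [fnI_ne hne]
      generalize (List.ofFn a).map (ev X l) = as at *
      have uq : ∀ b b', ztuple (as ++ [b]) ∈ X s → ztuple (as ++ [b']) ∈ X s → b = b' :=
        fun b b' h h' => hG.uniq s hs k as b b' hlen (hG.fnU hs k hlen h).1 h h'
      have hepsB : ∀ b, ztuple (as ++ [b]) ∈ X s → b ∈ B := fun b hb => hG.UB hx hB (hG.fnU hs k hlen hb).2
      simp only [hE] at q1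
      intro b
      constructor
      · intro hb
        have hbB := hVB _ _ _ hb
        refine ⟨hbB, ?_⟩
        obtain ⟨w, hw, hw'⟩ := q2 b hbB hb
        obtain ⟨-, rfl⟩ := (eL w).1 hw'
        obtain ⟨c1, c2, -, -⟩ := q1 _ hw hw'
        simp only [apA_zlist hlen, hR.i s hs k2] at c1 c2
        by_cases hex : ∃ b, ztuple (as ++ [b]) ∈ X s
        · have := Classical.epsilon_spec hex
          exact c2 b hbB _ (hepsB _ this) hb this
        · rcases c1 b hbB hb with h' | ⟨-, h'⟩
          · exact (hex ⟨b, h'⟩).elim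
          · rw [eps_none hex]; exact h'
      · rintro ⟨hbB, rfl⟩
        by_cases hex : ∃ b, ztuple (as ++ [b]) ∈ X s
        · have := Classical.epsilon_spec hex
          have hasB : zlist as ∈ B := hlB as (hG.fnU hs k hlen this).1
          obtain ⟨-, -, c3, -⟩ := q1 _ hasB ((eL _).2 ⟨hasB, rfl⟩)
          simp only [apA_zlist hlen, hR.i s hs k2] at c3
          exact c3 _ hbB this
        · rw [eps_none hex] at hbB ⊢
          have hasB : zlist as ∈ B := by
            refine hB.zl.2 fun c hc => ?_
            rcases hargs c hc with h' | rfl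
            · exact h'
            · exact hbB
          obtain ⟨-, -, -, c4⟩ := q1 _ hasB ((eL _).2 ⟨hasB, rfl⟩)
          simp only [apA_zlist hlen, hR.i s hs k2] at c4
          rcases c4 _ ⟨hbB, rfl⟩ with h' | ⟨b', -, h'⟩
          · exact h'
          · exact (hex ⟨b', h'⟩).elim

theorem Rules.evF (hx : IsTCI x) (hB : BOK x B) (hE : ∀ b, b ∈ E ↔ b ∈ B ∧ b = e0) (hH : H ⊆ B) (h : Rules x B E H) (hR : Rep x H U X) (f : Fm) :
    f.usesSig (tciSig x) → fF (FmCode f) ∈ H → ∀ {l : List ZFSet}, (∀ a ∈ l, a ∈ U) →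
      (fS (FmCode f) (zlist l) ∈ H ↔ sf U X l f) := by
  have hG := h.good hx hB hH hR
  have hN : ∀ l : List ZFSet, (∀ a ∈ l, a ∈ U) → fN (natZ l.length) (zlist l) ∈ H := fun l hl => (hR.n _ _).2 ⟨l, rfl, hl, rfl⟩
  have hm : ∀ n, natZ n ∈ omZ := fun n => mem_omZ.2 ⟨n, rfl⟩
  have hlB : ∀ l : List ZFSet, (∀ a ∈ l, a ∈ U) → zlist l ∈ B := fun l hl => (hB.op.1 (hB.op.1 (hH (hN l hl))).2).2
  have hcons : ∀ a (l : List ZFSet), a ∈ U → (∀ b ∈ l, b ∈ U) → ∀ b ∈ a :: l, b ∈ U := by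
    intro a l h1 h2 b hb
    rcases List.mem_cons.1 hb with rfl | hb
    · exact h1
    · exact h2 b hb
  have hFB : ∀ k c, fF (opair k c) ∈ H → c ∈ B := fun k c h => (hB.op.1 (hB.op.1 (hH h)).2).2
  induction f with
  | rel s n a =>
    intro hu hF l hl
    obtain ⟨hs, k, ha, hua⟩ := hu
    have k2 : symKind s ≠ natZ 2 := by rw [k]; exact natZ_ne (by decide)
    rw [FmCode_rel] at hF ⊢
    have hLB := (hB.op.1 (hFB _ _ hF)).2
    obtain ⟨hTL, q⟩ := h.r10a s hs _ hLB hF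
    obtain ⟨q1, q2⟩ := q _ (hm _) _ (hlB l hl) (hN l hl)
    have hts : ∀ t ∈ List.ofFn a, fT (TmCode t) ∈ H → ∀ b, fV (TmCode t) (zlist l) b ∈ H ↔ b ∈ B ∧ b = ev X l t := by
      intro t ht
      obtain ⟨i, rfl⟩ := (List.mem_ofFn' _ _).1 ht
      exact fun h' => h.evT hx hB hE hH hR _ (hua i) h' hl
    have eL := h.evL hB hH hR hl _ hts hTL
    have hlen : ((List.ofFn a).map (ev X l)).length = arityOf s := by simp [arityOf, ha, zToNat_natZ]
    rw [sf_rel]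
    constructor
    · intro h'
      obtain ⟨w, hw, hw', h''⟩ := q1 h'
      obtain ⟨-, rfl⟩ := (eL w).1 hw'
      rw [tpA_zlist hlen, hR.i s hs k2] at h''
      exact h''
    · intro h'
      have hB' : zlist ((List.ofFn a).map (ev X l)) ∈ B := hB.zl.2 fun c hc => hG.UB hx hB (hG.relU hs k hlen h' c hc)
      refine q2 _ hB' ((eL _).2 ⟨hB', rfl⟩) ?_
      rw [tpA_zlist hlen, hR.i s hs k2]
      exact h'
  | eq t u =>
    intro hu hF l hl
    rw [FmCode] at hF ⊢
    obtain ⟨htB, huB⟩ := hB.op.1 (hFB _ _ hF)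
    obtain ⟨hT1, hT2, q⟩ := h.r10b _ htB _ huB hF
    obtain ⟨q1, q2, q3⟩ := q _ (hm _) _ (hlB l hl) (hN l hl)
    have e1 := h.evT hx hB hE hH hR t hu.1 hT1 hl
    have e2 := h.evT hx hB hE hH hR u hu.2 hT2 hl
    rw [sf_eq]
    constructor
    · intro h'
      have q4 := q1 h'
      rcases ev_B hx hB hG hl t hu.1 with h1 | h1
      · exact ((e2 _).1 ((q4 _ h1).1 ((e1 _).2 ⟨h1, rfl⟩))).2
      · rcases ev_B hx hB hG hl u hu.2 with h2 | h2
        · exact ((e1 _).1 ((q4 _ h2).2 ((e2 _).2 ⟨h2, rfl⟩))).2.symm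
        · exact h1.trans h2.symm
    · intro e
      rcases q3 with h' | ⟨b, hb, h'⟩ | ⟨b, hb, h'⟩
      · exact h'
      · refine q2 b hb h' ((e2 b).2 ?_)
        rw [← e]; exact (e1 b).1 h'
      · refine q2 b hb ((e1 b).2 ?_) h'
        rw [e]; exact (e2 b).1 h'
  | not f ih =>
    intro hu hF l hl
    rw [FmCode] at hF ⊢
    obtain ⟨h1, q⟩ := h.r10c.1 _ (hFB _ _ hF) hF
    rw [sf_not, ← ih hu h1 hl]
    exact q _ (hm _) _ (hlB l hl) (hN l hl)
  | imp f g ihf ihg =>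
    intro hu hF l hl
    rw [FmCode] at hF ⊢
    have hcB := hB.op.1 (hFB _ _ hF)
    obtain ⟨h1, h2, q⟩ := h.r10c.2 _ hcB.1 _ hcB.2 hF
    rw [sf_imp, ← ihf hu.1 h1 hl, ← ihg hu.2 h2 hl]
    exact q _ (hm _) _ (hlB l hl) (hN l hl)
  | all f ih =>
    intro hu hF l hl
    rw [FmCode] at hF ⊢
    obtain ⟨h1, q⟩ := h.r10d.1 _ (hFB _ _ hF) hF
    obtain ⟨q1, q2⟩ := q _ (hm _) _ (hlB l hl) (hN l hl)
    rw [sf_all]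
    constructor
    · intro h' a ha
      exact (ih hu h1 (hcons a l ha hl)).1 (q1 a (hG.UB hx hB ha) ((hR.u a).2 ha) h')
    · intro h'
      rcases q2 with h2 | ⟨a, -, ha, h2⟩
      · exact h2
      · rw [hR.u] at ha
        exact (h2 ((ih hu h1 (hcons a l ha hl)).2 (h' a ha))).elim
  | ex f ih =>
    intro hu hF l hl
    rw [FmCode] at hF ⊢
    obtain ⟨h1, q⟩ := h.r10d.2 _ (hFB _ _ hF) hF
    obtain ⟨q1, q2⟩ := q _ (hm _) _ (hlB l hl) (hN l hl)
    rw [sf_ex]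
    constructor
    · intro h'
      obtain ⟨a, -, ha, h2⟩ := q2 h'
      rw [hR.u] at ha
      exact ⟨a, ha, (ih hu h1 (hcons a l ha hl)).1 h2⟩
    · rintro ⟨a, ha, h'⟩
      exact q1 a (hG.UB hx hB ha) ((hR.u a).2 ha) ((ih hu h1 (hcons a l ha hl)).2 h')
end

open Classical in
/-- interpretation read off from the facts -/
def XH (B H s : ZFSet.{0}) : ZFSet.{0} :=
  if symKind s = natZ 2 then ZFSet.sUnion (ZFSet.sep (fun t => fI s t ∈ H) B) else ZFSet.sep (fun t => fI s t ∈ H) B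
def MH (x B H : ZFSet.{0}) : ZFSet.{0} :=
  opair (ZFSet.sep (fun a => fU a ∈ H) B) (zimage (fun s => opair s (XH B H s)) (tciSig x))

theorem MH_mem {W x B H : ZFSet.{0}} [Fact (IsCTM W)] (hx : x ∈ W) (hB : B ∈ W) (hH : H ∈ W) : MH x B H ∈ W := by
  have : Fact (x ∈ W) := ⟨hx⟩
  have : Fact (B ∈ W) := ⟨hB⟩
  have : Fact (H ∈ W) := ⟨hH⟩
  have h : DfF W (fun _ => MH x B H) := by
    unfold MH XH
    infer_instance
  exact h.cl (fun _ => H) (fun _ => hH)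

theorem lemC {W x B E H A p : ZFSet.{0}} [Fact (IsCTM W)] (hxW : x ∈ W) (hBW : B ∈ W) (hHW : H ∈ W)
    (hx : IsTCI x) (hB : BOK x B) (hE : ∀ b, b ∈ E ↔ b ∈ B ∧ b = e0) (hH : H ⊆ B) (h : Rules x B E H)
    (h12 : R12 x H A p) (hp : p ⊆ LL x) (hA : ∀ a ∈ A, a ⊆ LL x) :
    ∃ M ∈ W, ModelsTCI M x ∧ p ⊆ SigmaSet x M ∧ ∀ a ∈ A, ¬ a ⊆ SigmaSet x M := by
  have hIB : ∀ n w, fI n w ∈ H → w ∈ B := fun n w h => (hB.op.1 (hB.op.1 (hH h)).2).2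
  have hfun : IsZFunc (zsnd (MH x B H)) (tciSig x) := by
    rw [MH, zsnd_opair]
    refine ⟨?_, ?_⟩
    · intro z hz
      obtain ⟨s, hs, rfl⟩ := mem_zimage.1 hz
      exact ⟨s, _, rfl, hs⟩
    · intro s hs
      refine ⟨XH B H s, mem_zimage.2 ⟨s, hs, rfl⟩, ?_⟩
      intro y hy
      obtain ⟨s', hs', e⟩ := mem_zimage.1 hy
      obtain ⟨rfl, rfl⟩ := opair_inj.1 e
      rfl
  have hX : ∀ s ∈ tciSig x, iapp (zsnd (MH x B H)) s = XH B H s := by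
    intro s hs
    refine iapp_eq hfun hs ?_
    rw [MH, zsnd_opair]
    exact mem_zimage.2 ⟨s, hs, rfl⟩
  have hR : Rep x H (zfst (MH x B H)) (iapp (zsnd (MH x B H))) := by
    refine h.rep hB hH ?_ ?_ ?_
    · intro a
      rw [MH, zfst_opair, ZFSet.mem_sep]
      exact ⟨fun h => ⟨(hB.op.1 (hH h)).2, h⟩, fun h => h.2⟩
    · intro s hs k t
      rw [hX s hs, XH, if_neg k, ZFSet.mem_sep]
      exact ⟨fun h => ⟨hIB _ _ h, h⟩, fun h => h.2⟩
    · intro s hs k t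
      rw [hX s hs, XH, if_pos k]
      obtain ⟨⟨t0, ht0, h0⟩, h1, -⟩ := h.r5 s hs k
      have e : ZFSet.sUnion (ZFSet.sep (fun t => fI s t ∈ H) B) = t0 := by
        have : ZFSet.sep (fun t => fI s t ∈ H) B = {t0} := by
          apply zext; intro z
          rw [ZFSet.mem_sep, ZFSet.mem_singleton]
          exact ⟨fun hz => h1 z hz.1 t0 ht0 hz.2 h0, fun hz => by rw [hz]; exact ⟨ht0, h0⟩⟩
        rw [this]; simp
      rw [e]
      exact ⟨fun h' => h1 t (hIB _ _ h') t0 ht0 h' h0, fun h' => by rw [h']; exact h0⟩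
  have hG := h.good hx hB hH hR
  refine ⟨MH x B H, MH_mem hxW hBW hHW, (models_iff hx).2 ⟨by simp [MH, zfst_opair, zsnd_opair], hfun, hG, ?_⟩, (R12_iff hx hG hR hp hA).1 h12⟩
  intro c hc f e
  obtain ⟨g, hg, -, hu⟩ := hx.2.2.2.2.2.2.2.2.2.2 c hc
  obtain rfl := FmCode_inj (e.trans hg.symm)
  subst e
  obtain ⟨h1, h2⟩ := h.r11 _ hc
  exact satStr_iff.2 ((h.evF hx hB hE hH hR f hu h1 (l := []) (by simp)).1 h2)

/-- the condition `p` is realized by some model in an outer model avoiding all of `A` -/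
def Rlz (V x A p : ZFSet.{0}) : Prop :=
  ∃ W M, OuterModel V W ∧ M ∈ W ∧ ModelsTCI M x ∧ p ⊆ SigmaSet x M ∧ ∀ a ∈ A, ¬ a ⊆ SigmaSet x M

theorem Rlz_def {V x : ZFSet.{0}} [hV : Fact (IsCTM V)] (hxV : x ∈ V) (hx : IsTCI x) :
    ∃ G : ZFSet → Prop, Df V (fun w => G (w 0)) ∧ ∀ A ∈ V, ∀ p ∈ V, p ⊆ LL x → (∀ a ∈ A, a ⊆ LL x) →
      (Rlz V x A p ↔ G (opair A p)) := by
  obtain ⟨B, hBV, hB⟩ := exists_BOK hxV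
  have : Fact (B ∈ V) := ⟨hBV⟩
  have : Fact (x ∈ V) := ⟨hxV⟩
  obtain ⟨E, hEV, hE⟩ : ∃ E ∈ V, ∀ b, b ∈ E ↔ b ∈ B ∧ b = e0 := by
    by_cases h : e0 ∈ B
    · refine ⟨{e0}, ?_, ?_⟩
      · have := pair_mem (tr hBV h) (tr hBV h)
        have e : ({e0, e0} : ZFSet) = {e0} := by ext; simp
        rwa [e] at this
      · intro b
        rw [ZFSet.mem_singleton]
        exact ⟨fun e => ⟨e ▸ h, e⟩, fun e => e.2⟩
    · refine ⟨∅, empty_mem', ?_⟩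
      intro b
      constructor
      · exact fun h' => (ZFSet.notMem_empty _ h').elim
      · rintro ⟨h1, rfl⟩
        exact (h h1).elim
  have : Fact (E ∈ V) := ⟨hEV⟩
  obtain ⟨G, hG, h⟩ := lemA (pRules (V := V) (B := B) (x := x) (E := E))
  refine ⟨G, hG, fun A hA p hp hpL hAL => ?_⟩
  have := h _ (opair_mem hA hp)
  simp only [zfst_opair, zsnd_opair] at this
  constructor
  · rintro ⟨W, M, -, -, hM, h1, h2⟩
    obtain ⟨H, hH, h3⟩ := lemB hx hB hE hM hpL hAL h1 h2
    exact this.1 ⟨H, hH, h3⟩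
  · intro hg
    obtain ⟨W, H, hW, hHW, hHB, h3, h4⟩ := this.2 hg
    have : Fact (IsCTM W) := ⟨hW.2.1⟩
    obtain ⟨M, hM, h5, h6⟩ := lemC (hW.2.2.1 hxV) (hW.2.2.1 hBV) hHW hx hB hE hHB h3 h4 hpL hAL
    exact ⟨W, M, hW, hM, h5, h6⟩

end SmallExt

namespace SmallExt

/-- the atoms of the derivative stages before `α` -/
def AtB (V x : ZFSet.{0}) (α : Ordinal.{1}) : ZFSet.{0} :=
  ZFSet.sep (fun q => ∃ β < α, SupAtomIn (PTa V x β) q) (finSubsets (LL x))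

theorem PTa_sub {V x : ZFSet.{0}} {α : Ordinal.{1}} {p : ZFSet} (h : p ∈ PTa V x α) : p ∈ finSubsets (LL x) := by
  rw [PTa, WellFounded.fix_eq] at h
  exact (ZFSet.mem_sep.1 h).1

theorem mem_AtB {V x : ZFSet.{0}} {α : Ordinal.{1}} {q : ZFSet} :
    q ∈ AtB V x α ↔ ∃ β < α, SupAtomIn (PTa V x β) q := by
  rw [AtB, ZFSet.mem_sep]
  exact ⟨fun h => h.2, fun h => ⟨by obtain ⟨β, -, h⟩ := h; exact PTa_sub h.1, h⟩⟩

theorem mem_PTa {V x : ZFSet.{0}} {α : Ordinal.{1}} {p : ZFSet} :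
    p ∈ PTa V x α ↔ p ∈ finSubsets (LL x) ∧ Rlz V x (AtB V x α) p := by
  rw [PTa, WellFounded.fix_eq, ZFSet.mem_sep]
  refine and_congr Iff.rfl ?_
  refine exists_congr fun W => exists_congr fun M => and_congr Iff.rfl (and_congr Iff.rfl (and_congr Iff.rfl (and_congr Iff.rfl ?_)))
  constructor
  · intro h a ha
    obtain ⟨β, hβ, h'⟩ := mem_AtB.1 ha
    exact h β hβ a h'
  · intro h β hβ q hq
    exact h q (mem_AtB.2 ⟨β, hβ, hq⟩)

theorem PTa_eq {V x : ZFSet.{0}} {α β : Ordinal.{1}} (h : AtB V x α = AtB V x β) : PTa V x α = PTa V x β := by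
  apply zext; intro p
  rw [mem_PTa, mem_PTa, h]

theorem notMem_AtB {V x : ZFSet.{0}} {α : Ordinal.{1}} {p : ZFSet} (h : p ∈ PTa V x α) : p ∉ AtB V x α := by
  intro h'
  obtain ⟨-, W, M, -, -, -, h1, h2⟩ := mem_PTa.1 h
  exact h2 p h' h1

theorem AtB_succ {V x : ZFSet.{0}} {α : Ordinal.{1}} {q : ZFSet} :
    q ∈ AtB V x (Order.succ α) ↔ q ∈ AtB V x α ∨ SupAtomIn (PTa V x α) q := by
  rw [mem_AtB, mem_AtB]
  constructor
  · rintro ⟨β, hβ, h⟩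
    rcases (Order.lt_succ_iff.1 hβ).lt_or_eq with h' | rfl
    · exact Or.inl ⟨β, h', h⟩
    · exact Or.inr h
  · rintro (⟨β, hβ, h⟩ | h)
    · exact ⟨β, hβ.trans (Order.lt_succ α), h⟩
    · exact ⟨α, Order.lt_succ α, h⟩

/-- a stage is a fixed point exactly when it has no atoms -/
theorem fixed_iff {V x : ZFSet.{0}} {α : Ordinal.{1}} :
    PTa V x α = PTa V x (Order.succ α) ↔ ∀ q, ¬ SupAtomIn (PTa V x α) q := by
  constructor
  · intro h q hq
    have h1 : q ∈ PTa V x (Order.succ α) := h ▸ hq.1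
    exact notMem_AtB h1 (AtB_succ.2 (Or.inr hq))
  · intro h
    apply PTa_eq
    apply zext; intro q
    rw [AtB_succ]
    exact ⟨Or.inl, fun h' => h'.resolve_right (h q)⟩

theorem AtB_const {V x : ZFSet.{0}} {α : Ordinal.{1}} (h : ∀ q, ¬ SupAtomIn (PTa V x α) q) :
    ∀ γ, α ≤ γ → AtB V x γ = AtB V x α := by
  intro γ
  induction γ using WellFoundedLT.induction with
  | ind γ ih =>
    intro hγ
    apply zext; intro q
    rw [mem_AtB, mem_AtB]
    constructor
    · rintro ⟨β, hβ, hq⟩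
      by_cases hb : β < α
      · exact ⟨β, hb, hq⟩
      · have := PTa_eq (ih β hβ (not_lt.1 hb))
        rw [this] at hq
        exact (h q hq).elim
    · rintro ⟨β, hβ, hq⟩
      exact ⟨β, hβ.trans_le hγ, hq⟩

theorem lt_cardBound {V x : ZFSet.{0}} {α : Ordinal.{1}}
    (h : ∀ β < α, ∃ q, SupAtomIn (PTa V x β) q) : α < cardBound x := by
  rw [cardBound, Cardinal.lt_ord, Order.lt_succ_iff]
  have hc : ∀ β : Set.Iio α, ∃ q, SupAtomIn (PTa V x β.1) q := fun β => h β.1 β.2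
  choose f hf using hc
  have hlt : ∀ β γ : Set.Iio α, β.1 < γ.1 → f β ≠ f γ := by
    intro β γ hlt e
    refine notMem_AtB (hf γ).1 (mem_AtB.2 ⟨β.1, hlt, ?_⟩)
    rw [← e]; exact hf β
  have hinj : Function.Injective (fun β : Set.Iio α => (⟨f β, PTa_sub (hf β).1⟩ : (finSubsets (LL x)).toSet)) := by
    intro β γ e
    have e' : f β = f γ := congrArg Subtype.val e
    rcases lt_trichotomy β.1 γ.1 with h' | h' | h'
    · exact (hlt _ _ h' e').elim
    · exact Subtype.ext h'
    · exact (hlt _ _ h' e'.symm).elim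
  have := Cardinal.lift_mk_le'.2 ⟨⟨_, hinj⟩⟩
  rw [Cardinal.mk_Iio_ordinal] at this
  rw [Cardinal.lift_lift] at this
  exact Cardinal.lift_le.{2}.1 this

theorem Rlz.mono {V x A p q : ZFSet.{0}} (h : Rlz V x A p) (hq : q ⊆ p) : Rlz V x A q := by
  obtain ⟨W, M, h1, h2, h3, h4, h5⟩ := h
  exact ⟨W, M, h1, h2, h3, fun z hz => h4 (hq hz), h5⟩

theorem fin_union {L p q : ZFSet.{0}} (hp : p ∈ finSubsets L) (hq : q ∈ finSubsets L) : p ∪ q ∈ finSubsets L := by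
  rw [mem_finSubsets] at *
  refine ⟨fun z hz => (ZFSet.mem_union.1 hz).elim (fun h => hp.1 h) (fun h => hq.1 h), ?_⟩
  refine (hp.2.union hq.2).subset ?_
  intro z hz
  exact ZFSet.mem_union.1 hz

theorem mem_PT {V x p : ZFSet.{0}} : p ∈ PT V x ↔ p ∈ finSubsets (LL x) ∧ Rlz V x ∅ p := by
  rw [PT, ZFSet.mem_sep]
  refine and_congr Iff.rfl ?_
  refine exists_congr fun W => exists_congr fun M => and_congr Iff.rfl (and_congr Iff.rfl (and_congr Iff.rfl ?_))
  exact ⟨fun h => ⟨h, fun a ha => (ZFSet.notMem_empty _ ha).elim⟩, fun h => h.1⟩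

/-- a condition not realizable avoiding `A` extends some element of `A` -/
theorem hit {V x A q : ZFSet.{0}} (hA : A ⊆ finSubsets (LL x)) (hq : q ∈ PT V x) (hn : ¬ Rlz V x A q) :
    ∃ a ∈ A, q ∪ a ∈ PT V x := by
  obtain ⟨hf, W, M, h1, h2, h3, h4, -⟩ := mem_PT.1 hq
  by_contra hc
  push Not at hc
  refine hn ⟨W, M, h1, h2, h3, h4, fun a ha hs => hc a ha (mem_PT.2 ⟨fin_union hf (hA ha), W, M, h1, h2, h3, ?_, ?_⟩)⟩
  · exact fun z hz => (ZFSet.mem_union.1 hz).elim (fun h => h4 h) (fun h => hs h)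
  · exact fun a ha => (ZFSet.notMem_empty _ ha).elim

theorem ple_sup {P a b : ZFSet.{0}} : ple (opair P (supsetOrder P)) a b ↔ a ∈ P ∧ b ∈ P ∧ b ⊆ a := by
  rw [ple, zsnd_opair, supsetOrder, ZFSet.mem_sep]
  constructor
  · rintro ⟨-, a', ha, b', hb, e, h⟩
    obtain ⟨rfl, rfl⟩ := opair_inj.1 e
    exact ⟨ha, hb, h⟩
  · rintro ⟨ha, hb, h⟩
    exact ⟨ZFSet.mem_prod.2 ⟨a, ha, b, hb, rfl⟩, a, ha, b, hb, rfl, h⟩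

/-- the fixed point is reached inside `V` -/
theorem top_in {V x : ZFSet.{0}} [hV : Fact (IsCTM V)] (hxV : x ∈ V) (hx : IsTCI x) :
    PT V x ∈ V ∧ ∃ α, AtB V x α ∈ V ∧ PTa V x α ∈ V ∧ ∀ q, ¬ SupAtomIn (PTa V x α) q := by
  have : Fact (x ∈ V) := ⟨hxV⟩
  have hL : LL x ∈ V := LL_mem hx
  have : Fact (LL x ∈ V) := ⟨hL⟩
  obtain ⟨G, hG, h⟩ := Rlz_def hxV hx
  have hF : finSubsets (LL x) ∈ V := DfF.ap1 (V := V) (F := fun y => finSubsets y) inferInstance hL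
  have : Fact (finSubsets (LL x) ∈ V) := ⟨hF⟩
  have I : ∀ (f : Ctx → ZFSet) [DfF V f], Df V (fun w => G (f w)) := fun f hf => hG.comp1 (F := G) hf
  let PP : ZFSet → ZFSet := fun A => ZFSet.sep (fun p => G (opair A p)) (finSubsets (LL x))
  have hPPd : DfF V (fun v => PP (v 0)) := by
    show DfF V (fun v => ZFSet.sep (fun p => G (opair (v 0) p)) (finSubsets (LL x)))
    infer_instance
  have hPP : ∀ A ∈ V, A ⊆ finSubsets (LL x) → ∀ p, p ∈ PP A ↔ p ∈ finSubsets (LL x) ∧ Rlz V x A p := by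
    intro A hA hs p
    show p ∈ ZFSet.sep _ _ ↔ _
    rw [ZFSet.mem_sep]
    refine and_congr_right fun hp => ?_
    exact (h A hA p (tr hF hp) (mem_finSubsets.1 hp).1 (fun a ha => (mem_finSubsets.1 (hs ha)).1)).symm
  have hPPm : ∀ A ∈ V, PP A ∈ V := fun A hA => DfF.ap1 (V := V) (F := PP) hPPd hA
  refine ⟨?_, ?_⟩
  · have : PT V x = PP ∅ := by
      apply zext; intro p
      rw [mem_PT, hPP _ empty_mem' (fun z hz => (ZFSet.notMem_empty _ hz).elim)]
    rw [this]
    exact hPPm _ empty_mem'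
  let H : ZFSet → ZFSet → ZFSet → ZFSet := fun _ _ r => r ∪ ZFSet.sep (fun q => SupAtomIn (PP r) q) (finSubsets (LL x))
  have hH : DfF V (fun v => H (v 0) (v 1) (v 2)) := by
    have J : ∀ (f : Ctx → ZFSet) [DfF V f], DfF V (fun w => PP (f w)) := fun f hf => hPPd.comp1 (F := PP) hf
    show DfF V (fun v => v 2 ∪ ZFSet.sep (fun q => q ∈ PP (v 2) ∧ ∀ q₁ ∈ PP (v 2), ∀ q₂ ∈ PP (v 2),
      q ⊆ q₁ → q ⊆ q₂ → ∃ r ∈ PP (v 2), q₁ ⊆ r ∧ q₂ ⊆ r) (finSubsets (LL x)))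
    infer_instance
  have hsub : ∀ y, uRec H ∅ y ⊆ finSubsets (LL x) := by
    intro y
    induction y using ZFSet.inductionOn with
    | _ y ih =>
      intro z hz
      obtain ⟨w, hw, hz⟩ := mem_uRec.1 hz
      rcases ZFSet.mem_union.1 hz with h | h
      · exact ih w hw h
      · exact (ZFSet.mem_sep.1 h).1
  have hE : ∀ y ∈ V, uRec H ∅ y ∈ V := fun y hy => DfF.ap2 (V := V) (F := fun u b => uRec H u b)
        (uRec_DfF hH inferInstance inferInstance) empty_mem' hy
  have hEA : ∀ y ∈ V, ∃ α, uRec H ∅ y = AtB V x α := by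
    intro y
    induction y using ZFSet.inductionOn with
    | _ y ih =>
      intro hy
      have hc : ∀ z : {z // z ∈ y}, ∃ α, uRec H ∅ z.1 = AtB V x α := fun z => ih z.1 z.2 (tr hy z.2)
      choose f hf using hc
      have hP : ∀ z : {z // z ∈ y}, PP (uRec H ∅ z.1) = PTa V x (f z) := by
        intro z
        apply zext; intro p
        rw [hPP _ (hE _ (tr hy z.2)) (hsub _), mem_PTa, hf]
      refine ⟨⨆ z, Order.succ (f z), ?_⟩
      apply zext; intro q
      rw [mem_uRec, mem_AtB]
      have key : ∀ z : {z // z ∈ y}, q ∈ H ∅ z.1 (uRec H ∅ z.1) ↔ q ∈ AtB V x (Order.succ (f z)) := by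
        intro z
        show q ∈ _ ∪ ZFSet.sep _ _ ↔ _
        rw [AtB_succ, ZFSet.mem_union, ZFSet.mem_sep, hP z, hf z]
        exact or_congr Iff.rfl ⟨fun h => h.2, fun h => ⟨PTa_sub h.1, h⟩⟩
      constructor
      · rintro ⟨z, hz, hq⟩
        obtain ⟨β, hβ, h'⟩ := mem_AtB.1 ((key ⟨z, hz⟩).1 hq)
        exact ⟨β, Ordinal.lt_iSup_iff.2 ⟨⟨z, hz⟩, hβ⟩, h'⟩
      · rintro ⟨β, hβ, h'⟩
        obtain ⟨z, hz⟩ := Ordinal.lt_iSup_iff.1 hβ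
        exact ⟨z.1, z.2, (key z).2 (mem_AtB.2 ⟨β, hz, h'⟩)⟩
  obtain ⟨b, hb, hbo, hst⟩ := stabilize hH (A := ∅) empty_mem' hF (fun y _ => hsub y)
    (fun y r z hz => ZFSet.mem_union.2 (Or.inl hz))
  obtain ⟨α, hα⟩ := hEA b hb
  have hP : PP (uRec H ∅ b) = PTa V x α := by
    apply zext; intro p
    rw [hPP _ (hE _ hb) (hsub _), mem_PTa, hα]
  refine ⟨α, hα ▸ hE b hb, hP ▸ hPPm _ (hE b hb), fun q hq => notMem_AtB hq.1 ?_⟩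
  rw [← hα]
  refine (hst b hbo hb).2 (ZFSet.mem_union.2 (Or.inr (ZFSet.mem_sep.2 ⟨PTa_sub hq.1, ?_⟩)))
  rw [hP]; exact hq

theorem main_dichotomy (V x M : ZFSet.{0}) (hV : IsCTM V) (hxV : x ∈ V)
    (hx : IsTCI x) (hM : ModelsTCI M x)
    (hgen : ∃ g : ZFSet, GenericFilterOver V (Pforcing V x) g ∧
      SigmaSet x M = ZFSet.sUnion g ∩ LL x) :
    AlmostFinDet V x M ∨
      ∃ g : ZFSet, GenericFilterOver V (PtopForcing V x) g ∧
        SigmaSet x M = ZFSet.sUnion g ∩ LL x := by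
  have : Fact (IsCTM V) := ⟨hV⟩
  obtain ⟨g, ⟨⟨g1, g2, g3⟩, g4⟩, hS⟩ := hgen
  obtain ⟨hPV, α, hAV, hTV, hno⟩ := top_in hxV hx
  by_cases hafd : AlmostFinDet V x M
  · exact Or.inl hafd
  refine Or.inr ⟨g, ?_, hS⟩
  have hmem : α ∈ {α : Ordinal.{1} | PTa V x α = PTa V x (Order.succ α)} := fixed_iff.2 hno
  have h0 := csInf_mem (⟨α, hmem⟩ : Set.Nonempty _)
  have hle : sInf {α : Ordinal.{1} | PTa V x α = PTa V x (Order.succ α)} ≤ α := csInf_le' hmem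
  have hlt : ∀ β < sInf {α : Ordinal.{1} | PTa V x α = PTa V x (Order.succ α)},
      ∃ q, SupAtomIn (PTa V x β) q := by
    intro β hβ
    by_contra hc
    push Not at hc
    exact notMem_of_lt_csInf' hβ (fixed_iff.2 hc)
  have hT0 : PTtopSet V x = PTa V x (sInf {α : Ordinal.{1} | PTa V x α = PTa V x (Order.succ α)}) := rfl
  rw [PtopForcing]
  rw [Pforcing] at g1 g2 g3 g4
  generalize sInf {α : Ordinal.{1} | PTa V x α = PTa V x (Order.succ α)} = α0 at *
  have hA : AtB V x α = AtB V x α0 := AtB_const (fixed_iff.1 h0) α hle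
  have hT : PTtopSet V x = PTa V x α := hT0.trans (PTa_eq hA).symm
  rw [hT]
  clear hT hT0
  have hAS : ∀ a ∈ AtB V x α, ¬ a ⊆ SigmaSet x M := by
    intro a ha hs
    rw [hA] at ha
    obtain ⟨β, hβ, h⟩ := mem_AtB.1 ha
    exact hafd ⟨hM, β, lt_cardBound (fun γ hγ => hlt γ (hγ.trans hβ)), a, h, hs⟩
  have hAF : AtB V x α ⊆ finSubsets (LL x) := fun a ha => (ZFSet.mem_sep.1 ha).1
  have hTP : ∀ p, p ∈ PTa V x α ↔ p ∈ finSubsets (LL x) ∧ Rlz V x (AtB V x α) p := fun p => mem_PTa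
  generalize AtB V x α = A at *
  generalize PTa V x α = T at *
  rw [zfst_opair] at g1
  simp only [zfst_opair, ple_sup] at g2 g3
  have hTsub : ∀ p ∈ T, p ∈ PT V x := by
    intro p hp
    obtain ⟨h1, W, N, h2, h3, h4, h5, -⟩ := (hTP p).1 hp
    exact mem_PT.2 ⟨h1, W, N, h2, h3, h4, h5, fun a ha => (ZFSet.notMem_empty _ ha).elim⟩
  have hgS : ∀ p ∈ g, p ⊆ SigmaSet x M := by
    intro p hp z hz
    rw [hS, ZFSet.mem_inter, ZFSet.mem_sUnion]
    exact ⟨⟨p, hp, hz⟩, (mem_finSubsets.1 (mem_PT.1 (g1 hp)).1).1 hz⟩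
  have hga : ∀ p ∈ g, ∀ a ∈ A, ¬ a ⊆ p := fun p hp a ha h => hAS a ha (fun z hz => hgS p hp (h hz))
  have : Fact (A ∈ V) := ⟨hAV⟩
  have : Fact (T ∈ V) := ⟨hTV⟩
  have : Fact (PT V x ∈ V) := ⟨hPV⟩
  have hul : ∀ {p q : ZFSet.{0}}, p ⊆ p ∪ q := fun {p q} z hz => ZFSet.mem_union.2 (Or.inl hz)
  have hur : ∀ {p q : ZFSet.{0}}, q ⊆ p ∪ q := fun {p q} z hz => ZFSet.mem_union.2 (Or.inr hz)
  have hss : ∀ p : ZFSet.{0}, p ⊆ p := fun p z hz => hz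
  have hfd : ∀ p q : ZFSet.{0}, q ∈ PT V x → p ⊆ q → p ∈ finSubsets (LL x) := by
    intro p q hq hpq
    have := mem_finSubsets.1 (mem_PT.1 hq).1
    exact mem_finSubsets.2 ⟨fun z hz => this.1 (hpq hz), this.2.subset hpq⟩
  have hgT : ∀ p ∈ g, p ∈ T := by
    intro p hp
    have : Fact (p ∈ V) := ⟨tr hPV (g1 hp)⟩
    have hD : ZFSet.sep (fun q => (∃ a ∈ A, a ⊆ q) ∨ q ∪ p ∈ T ∨ ¬ q ∪ p ∈ PT V x) (PT V x) ∈ V :=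
      DfF.ap1 (V := V) (F := fun P => ZFSet.sep (fun q => (∃ a ∈ A, a ⊆ q) ∨ q ∪ p ∈ T ∨ ¬ q ∪ p ∈ PT V x) P)
        inferInstance hPV
    obtain ⟨q, hq, hqD⟩ := g4 _ hD ⟨by rw [zfst_opair]; exact fun z hz => (ZFSet.mem_sep.1 hz).1, by
      intro q hq
      rw [zfst_opair] at hq
      simp only [ple_sup, ZFSet.mem_sep]
      by_cases h1 : q ∪ p ∈ PT V x
      · by_cases h2 : q ∪ p ∈ T
        · exact ⟨q, ⟨hq, Or.inr (Or.inl h2)⟩, hq, hq, hss q⟩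
        · obtain ⟨a, ha, h3⟩ := hit hAF h1 (fun h => h2 ((hTP _).2 ⟨(mem_PT.1 h1).1, h⟩))
          exact ⟨_, ⟨h3, Or.inl ⟨a, ha, hur⟩⟩, h3, hq, fun z hz => hul (hul hz)⟩
      · exact ⟨q, ⟨hq, Or.inr (Or.inr h1)⟩, hq, hq, hss q⟩⟩
    obtain ⟨hqP, ⟨a, ha, h⟩ | h | h⟩ := ZFSet.mem_sep.1 hqD
    · exact (hga q hq a ha h).elim
    · exact (hTP p).2 ⟨(mem_PT.1 (g1 hp)).1, ((hTP _).1 h).2.mono hur⟩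
    · obtain ⟨r, hr, ⟨h1, -, h2⟩, -, -, h3⟩ := g3 p hp q hq
      have hs : q ∪ p ⊆ r := fun z hz => (ZFSet.mem_union.1 hz).elim (fun h => h3 h) (fun h => h2 h)
      exact (h (mem_PT.2 ⟨hfd _ _ h1 hs, (mem_PT.1 h1).2.mono hs⟩)).elim
  refine ⟨⟨?_, ?_, ?_⟩, ?_⟩
  · rw [zfst_opair]; exact fun p hp => hgT p hp
  · simp only [zfst_opair, ple_sup]
    exact fun p hp q hq h => g2 p hp q (hTsub q hq) ⟨g1 hp, hTsub q hq, h.2.2⟩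
  · simp only [ple_sup]
    intro p hp q hq
    obtain ⟨r, hr, h1, h2⟩ := g3 p hp q hq
    exact ⟨r, hr, ⟨hgT r hr, hgT p hp, h1.2.2⟩, ⟨hgT r hr, hgT q hq, h2.2.2⟩⟩
  · intro D hDV hD
    have : Fact (D ∈ V) := ⟨hDV⟩
    obtain ⟨hD1, hD2⟩ := hD
    rw [zfst_opair] at hD1
    simp only [zfst_opair, ple_sup] at hD2
    have hD' : ZFSet.sep (fun q => (∃ a ∈ A, a ⊆ q) ∨ q ∈ D) (PT V x) ∈ V :=
      DfF.ap1 (V := V) (F := fun P => ZFSet.sep (fun q => (∃ a ∈ A, a ⊆ q) ∨ q ∈ D) P) inferInstance hPV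
    obtain ⟨q, hq, hqD⟩ := g4 _ hD' ⟨by rw [zfst_opair]; exact fun z hz => (ZFSet.mem_sep.1 hz).1, by
      intro q hq
      rw [zfst_opair] at hq
      simp only [ple_sup, ZFSet.mem_sep]
      by_cases h2 : q ∈ T
      · obtain ⟨r, hr, h3, -, h4⟩ := hD2 q h2
        exact ⟨r, ⟨hTsub r h3, Or.inr hr⟩, hTsub r h3, hq, h4⟩
      · obtain ⟨a, ha, h3⟩ := hit hAF hq (fun h => h2 ((hTP _).2 ⟨(mem_PT.1 hq).1, h⟩))
        exact ⟨_, ⟨h3, Or.inl ⟨a, ha, hur⟩⟩, h3, hq, hul⟩⟩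
    obtain ⟨-, ⟨a, ha, h⟩ | h⟩ := ZFSet.mem_sep.1 hqD
    · exact (hga q hq a ha h).elim
    · exact ⟨q, hq, h⟩

end SmallExt

open SmallExt in
/-- If `M` is a `(ℙ(𝔗), V)`-generic model of a `Π₂` TCI
`𝔗 ∈ V`, then either `M` is almost finitely determined, or `M` is a
`(ℙ(𝔗)^⊤, V)`-generic model of `𝔗`. -/
theorem generic_model_dichotomy (V x M : ZFSet) (hV : IsCTM V) (hxV : x ∈ V)
    (hPi : IsPiTCI 2 x) (hM : ModelsTCI M x)
    (hgen : ∃ g : ZFSet, GenericFilterOver V (Pforcing V x) g ∧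
      SigmaSet x M = ZFSet.sUnion g ∩ LL x) :
    AlmostFinDet V x M ∨
      ∃ g : ZFSet, GenericFilterOver V (PtopForcing V x) g ∧
        SigmaSet x M = ZFSet.sUnion g ∩ LL x := by
  exact main_dichotomy V x M hV hxV hPi.1 hM hgen
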